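/- (Moreira, 2018) For every t ∈ ℝ one has dimH(L ∩ (−∞, t)) = dimH(M ∩ (−∞, t)) = min(1, 2·D(t)), where D(t) := dimH({α ∈ ℝ∖ℚ : ℓ(α) < t}). Moreover, the function t ↦ dimH(M ∩ (−∞, t)) is continuous on ℝ, it is strictly positive for every t > 3, and it equals 1 at t = √12. -/

import Mathlib

open scoped ENNReal

/-- The distance from a real number to the nearest integer. -/
noncomputable def distNearestInt (x : ℝ) : ℝ := |x - round x|

/-- The best constant of Diophantine approximation of `α`,
`ℓ(α) = limsup_{q → ∞} 1 / (q ⬝ ‖q α‖) ∈ [0, ∞]`. -/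
noncomputable def lagrangeVal (α : ℝ) : ℝ≥0∞ :=
  Filter.limsup (fun q : ℕ => ENNReal.ofReal (1 / (q * distNearestInt (q * α)))) Filter.atTop

/-- The Lagrange spectrum: the set of finite values `ℓ(α)` over irrational `α`. -/
def LagrangeSpectrum : Set ℝ :=
  {t | ∃ α : ℝ, Irrational α ∧ lagrangeVal α ≠ ⊤ ∧ (lagrangeVal α).toReal = t}

/-- The best constant of Diophantine approximation of the binary quadratic form
`h(x,y) = a x² + b x y + c y²`, namely `m(h) = sup_{(p,q) ≠ (0,0)} √Δ(h) / |h(p,q)| ∈ (0, ∞]`. -/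
noncomputable def markovVal (a b c : ℝ) : ℝ≥0∞ :=
  ⨆ (pq : ℤ × ℤ) (_ : pq ≠ (0, 0)),
    ENNReal.ofReal (Real.sqrt (b ^ 2 - 4 * a * c)) /
      ENNReal.ofReal |a * (pq.1 : ℝ) ^ 2 + b * pq.1 * pq.2 + c * (pq.2 : ℝ) ^ 2|

/-- The Markov spectrum: the set of finite values `m(h)` over real indefinite binary
quadratic forms `h` with positive discriminant. -/
def MarkovSpectrum : Set ℝ :=
  {t | ∃ a b c : ℝ, 0 < b ^ 2 - 4 * a * c ∧ markovVal a b c ≠ ⊤ ∧ (markovVal a b c).toReal = t}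

/-- `D(t)`: the Hausdorff dimension of the set of irrationals `α` with `ℓ(α) < t`. -/
noncomputable def lagrangeDim (t : ℝ) : ℝ≥0∞ :=
  dimH {α : ℝ | Irrational α ∧ lagrangeVal α < ENNReal.ofReal t}

open scoped NNReal
open Filter Topology Set MeasureTheory

/-- The elementary matrix of the partial quotient `a + 1`. -/
noncomputable def cmat (a : ℕ) : Matrix (Fin 2) (Fin 2) ℝ := !![0, 1; 1, (a : ℝ) + 1]

/-- The continued fraction matrix of a word, the letter `a` standing for the
partial quotient `a + 1`. -/
noncomputable def wmat (w : List ℕ) : Matrix (Fin 2) (Fin 2) ℝ := (w.map cmat).prod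

/-- Denominator of the continued fraction of a word. -/
noncomputable def qd (w : List ℕ) : ℝ := wmat w 1 1
/-- Denominator of the penultimate convergent. -/
noncomputable def qe (w : List ℕ) : ℝ := wmat w 1 0
/-- Numerator of the continued fraction of a word. -/
noncomputable def pd (w : List ℕ) : ℝ := wmat w 0 1
/-- Numerator of the penultimate convergent. -/
noncomputable def pe (w : List ℕ) : ℝ := wmat w 0 0

/-- The inverse branch of the Gauss map attached to a word. -/
noncomputable def phi : List ℕ → ℝ → ℝ
  | [], x => x
  | a :: w, x => 1 / ((a : ℝ) + 1 + phi w x)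

lemma wmat_nil : wmat [] = 1 := by simp [wmat]
lemma wmat_cons (a : ℕ) (w : List ℕ) : wmat (a :: w) = cmat a * wmat w := by simp [wmat]
lemma wmat_append (u v : List ℕ) : wmat (u ++ v) = wmat u * wmat v := by simp [wmat]

lemma cmat_transpose (a : ℕ) : (cmat a).transpose = cmat a := by
  ext i j; fin_cases i <;> fin_cases j <;> simp [cmat]

lemma wmat_reverse (w : List ℕ) : wmat w.reverse = (wmat w).transpose := by
  induction w with
  | nil => simp [wmat_nil]
  | cons a w ih =>
    rw [List.reverse_cons, wmat_append, ih, wmat_cons a w, Matrix.transpose_mul, cmat_transpose,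
      wmat_cons, wmat_nil, mul_one]

lemma qd_reverse (w : List ℕ) : qd w.reverse = qd w := by simp [qd, wmat_reverse]
lemma qe_reverse (w : List ℕ) : qe w.reverse = pd w := by simp [qe, pd, wmat_reverse]
lemma pd_reverse (w : List ℕ) : pd w.reverse = qe w := by simp [qe, pd, wmat_reverse]
lemma pe_reverse (w : List ℕ) : pe w.reverse = pe w := by simp [pe, wmat_reverse]

@[simp] lemma qd_nil : qd [] = 1 := by simp [qd, wmat_nil]
@[simp] lemma qe_nil : qe [] = 0 := by simp [qe, wmat_nil]
@[simp] lemma pd_nil : pd [] = 0 := by simp [pd, wmat_nil]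
@[simp] lemma pe_nil : pe [] = 1 := by simp [pe, wmat_nil]

lemma qd_append (u v : List ℕ) : qd (u ++ v) = qe u * pd v + qd u * qd v := by
  simp [qd, qe, pd, wmat_append, Matrix.mul_apply, Fin.sum_univ_two]
lemma qe_append (u v : List ℕ) : qe (u ++ v) = qe u * pe v + qd u * qe v := by
  simp [qd, qe, pe, wmat_append, Matrix.mul_apply, Fin.sum_univ_two]
lemma pd_append (u v : List ℕ) : pd (u ++ v) = pe u * pd v + pd u * qd v := by
  simp [qd, pe, pd, wmat_append, Matrix.mul_apply, Fin.sum_univ_two]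
lemma pe_append (u v : List ℕ) : pe (u ++ v) = pe u * pe v + pd u * qe v := by
  simp [pe, qe, pd, wmat_append, Matrix.mul_apply, Fin.sum_univ_two]

lemma qd_cons (a : ℕ) (w : List ℕ) : qd (a :: w) = pd w + (a + 1) * qd w := by
  simp [qd, pd, wmat_cons, cmat, Matrix.mul_apply, Fin.sum_univ_two]
lemma qe_cons (a : ℕ) (w : List ℕ) : qe (a :: w) = pe w + (a + 1) * qe w := by
  simp [qe, pe, wmat_cons, cmat, Matrix.mul_apply, Fin.sum_univ_two]
lemma pd_cons (a : ℕ) (w : List ℕ) : pd (a :: w) = qd w := by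
  simp [qd, pd, wmat_cons, cmat, Matrix.mul_apply, Fin.sum_univ_two]
lemma pe_cons (a : ℕ) (w : List ℕ) : pe (a :: w) = qe w := by
  simp [qe, pe, wmat_cons, cmat, Matrix.mul_apply, Fin.sum_univ_two]

lemma wmat_det (w : List ℕ) : pe w * qd w - pd w * qe w = (-1) ^ w.length := by
  induction w with
  | nil => simp
  | cons a w ih =>
    rw [qd_cons, qe_cons, pd_cons, pe_cons, List.length_cons, pow_succ, ← ih]; ring

lemma wmat_nonneg (w : List ℕ) : 0 ≤ pe w ∧ 0 ≤ pd w ∧ 0 ≤ qe w ∧ 1 ≤ qd w ∧ pd w ≤ qd w := by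
  induction w with
  | nil => simp
  | cons a w ih =>
    obtain ⟨h1, h2, h3, h4, h5⟩ := ih
    rw [qd_cons, qe_cons, pd_cons, pe_cons]
    have ha : (0 : ℝ) ≤ a := a.cast_nonneg
    refine ⟨h3, by linarith, by positivity, by nlinarith, by nlinarith⟩

lemma qd_ge_one (w : List ℕ) : 1 ≤ qd w := (wmat_nonneg w).2.2.2.1
lemma qd_pos (w : List ℕ) : 0 < qd w := by linarith [qd_ge_one w]
lemma qe_nonneg (w : List ℕ) : 0 ≤ qe w := (wmat_nonneg w).2.2.1
lemma pd_nonneg (w : List ℕ) : 0 ≤ pd w := (wmat_nonneg w).2.1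
lemma pe_nonneg (w : List ℕ) : 0 ≤ pe w := (wmat_nonneg w).1
lemma pd_le_qd (w : List ℕ) : pd w ≤ qd w := (wmat_nonneg w).2.2.2.2
lemma qe_le_qd (w : List ℕ) : qe w ≤ qd w := by
  rw [← qd_reverse, ← pd_reverse]; exact pd_le_qd _

lemma qd_mul_le (u v : List ℕ) : qd u * qd v ≤ qd (u ++ v) := by
  rw [qd_append]; nlinarith [mul_nonneg (qe_nonneg u) (pd_nonneg v)]
lemma qd_append_le (u v : List ℕ) : qd (u ++ v) ≤ 2 * (qd u * qd v) := by
  rw [qd_append]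
  nlinarith [mul_le_mul (qe_le_qd u) (pd_le_qd v) (pd_nonneg v) (qd_pos u).le]
lemma qd_le_append_left (u v : List ℕ) : qd u ≤ qd (u ++ v) := by
  nlinarith [qd_mul_le u v, qd_ge_one v, qd_pos u]
lemma qd_le_append_right (u v : List ℕ) : qd v ≤ qd (u ++ v) := by
  nlinarith [qd_mul_le u v, qd_ge_one u, qd_pos v]

lemma two_pow_le_qd : ∀ w : List ℕ, (2 : ℝ) ^ (w.length / 2) ≤ qd w
  | [] => by simp
  | [a] => by simpa using qd_ge_one [a]
  | a :: b :: w => by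
    have h := two_pow_le_qd w
    have h2 : (a :: b :: w).length / 2 = w.length / 2 + 1 := by simp; omega
    rw [h2, pow_succ, qd_cons, qd_cons, pd_cons]
    have ha : (0 : ℝ) ≤ a := a.cast_nonneg
    have hb : (0 : ℝ) ≤ b := b.cast_nonneg
    have := pd_nonneg w
    have := qd_pos w
    nlinarith [mul_nonneg ha hb, mul_nonneg (mul_nonneg ha hb) (qd_pos w).le,
      mul_nonneg ha (qd_pos w).le, mul_nonneg hb (qd_pos w).le, mul_nonneg ha (pd_nonneg w)]

lemma qd_le_pow {T : ℕ} : ∀ w : List ℕ, (∀ a ∈ w, a < T) → qd w ≤ ((T : ℝ) + 1) ^ w.length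
  | [], _ => by simp
  | a :: w, h => by
    have ih := qd_le_pow w fun b hb => h b (by simp [hb])
    have ha : (a : ℝ) + 1 ≤ T := by exact_mod_cast h a (by simp)
    rw [qd_cons, List.length_cons, pow_succ]
    have := pd_le_qd w
    have := qd_pos w
    nlinarith

/-- The pieces of the denominators are integers. -/
lemma exists_nat_wmat (w : List ℕ) :
    ∃ a b c d : ℕ, pe w = a ∧ pd w = b ∧ qe w = c ∧ qd w = d := by
  induction w with
  | nil => exact ⟨1, 0, 0, 1, by simp⟩
  | cons x w ih =>
    obtain ⟨a, b, c, d, h1, h2, h3, h4⟩ := ih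
    refine ⟨c, d, a + (x + 1) * c, b + (x + 1) * d, ?_⟩
    rw [qd_cons, qe_cons, pd_cons, pe_cons, h1, h2, h3, h4]
    push_cast
    exact ⟨rfl, rfl, rfl, rfl⟩

lemma phi_nonneg (w : List ℕ) {x : ℝ} (hx : 0 ≤ x) : 0 ≤ phi w x := by
  induction w with
  | nil => simpa [phi]
  | cons a w ih => simp only [phi]; positivity

lemma den_pos (w : List ℕ) {x : ℝ} (hx : 0 ≤ x) : 0 < qe w * x + qd w := by
  nlinarith [mul_nonneg (qe_nonneg w) hx, qd_pos w]

lemma den_ge (w : List ℕ) {x : ℝ} (hx : 0 ≤ x) : qd w ≤ qe w * x + qd w := by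
  nlinarith [mul_nonneg (qe_nonneg w) hx]

lemma den_le (w : List ℕ) {x : ℝ} (hx1 : x ≤ 1) : qe w * x + qd w ≤ 2 * qd w := by
  nlinarith [qe_le_qd w, qe_nonneg w]

lemma phi_eq (w : List ℕ) {x : ℝ} (hx : 0 ≤ x) :
    phi w x = (pe w * x + pd w) / (qe w * x + qd w) := by
  induction w with
  | nil => simp [phi]
  | cons a w ih =>
    have h1 := den_pos w hx
    have h2 := den_pos (a :: w) hx
    simp only [phi]
    rw [ih, pe_cons, pd_cons]
    have h3 : (a : ℝ) + 1 + (pe w * x + pd w) / (qe w * x + qd w)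
        = (qe (a :: w) * x + qd (a :: w)) / (qe w * x + qd w) := by
      rw [qe_cons, qd_cons, eq_div_iff h1.ne', add_mul, div_mul_cancel₀ _ h1.ne']; ring
    rw [h3, one_div_div]

lemma phi_append (u v : List ℕ) (x : ℝ) : phi (u ++ v) x = phi u (phi v x) := by
  induction u with
  | nil => simp [phi]
  | cons a u ih => simp [phi, ih]

lemma phi_mem (w : List ℕ) {x : ℝ} (hx : x ∈ Icc (0 : ℝ) 1) : phi w x ∈ Icc (0 : ℝ) 1 := by
  refine ⟨phi_nonneg w hx.1, ?_⟩
  cases w with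
  | nil => simpa [phi] using hx.2
  | cons a w =>
    simp only [phi]
    have := phi_nonneg w hx.1
    rw [div_le_one (by positivity)]
    have : (0 : ℝ) ≤ a := a.cast_nonneg
    linarith

lemma phi_sub (w : List ℕ) {x y : ℝ} (hx : 0 ≤ x) (hy : 0 ≤ y) :
    phi w x - phi w y
      = (-1) ^ w.length * (x - y) / ((qe w * x + qd w) * (qe w * y + qd w)) := by
  have h1 := den_pos w hx
  have h2 := den_pos w hy
  rw [phi_eq w hx, phi_eq w hy, ← wmat_det, div_sub_div _ _ h1.ne' h2.ne']
  congr 1; ring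

lemma abs_phi_sub (w : List ℕ) {x y : ℝ} (hx : 0 ≤ x) (hy : 0 ≤ y) :
    |phi w x - phi w y| = |x - y| / ((qe w * x + qd w) * (qe w * y + qd w)) := by
  rw [phi_sub w hx hy, abs_div, abs_mul, abs_pow, abs_neg, abs_one, one_pow, one_mul,
    abs_of_pos (mul_pos (den_pos w hx) (den_pos w hy))]

lemma abs_phi_sub_le (w : List ℕ) {x y : ℝ} (hx : 0 ≤ x) (hy : 0 ≤ y) :
    |phi w x - phi w y| ≤ |x - y| / qd w ^ 2 := by
  rw [abs_phi_sub w hx hy, sq]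
  have := qd_pos w
  have := den_ge w hx
  have := den_ge w hy
  have := den_pos w hx
  gcongr

lemma le_abs_phi_sub (w : List ℕ) {x y : ℝ} (hx : x ∈ Icc (0 : ℝ) 1) (hy : y ∈ Icc (0 : ℝ) 1) :
    |x - y| / (4 * qd w ^ 2) ≤ |phi w x - phi w y| := by
  rw [abs_phi_sub w hx.1 hy.1]
  have h1 := den_pos w hx.1
  have h2 := den_pos w hy.1
  have : (qe w * x + qd w) * (qe w * y + qd w) ≤ 4 * qd w ^ 2 := by
    have := mul_le_mul (den_le w hx.2) (den_le w hy.2) h2.le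
      (by linarith [qd_pos w])
    linarith
  gcongr

/-- The word formed by the first `n` letters of a stream. -/
def pre (f : ℕ → ℕ) (n : ℕ) : List ℕ := (List.range n).map f

/-- The stream without its first `n` letters. -/
def shf (n : ℕ) (f : ℕ → ℕ) : ℕ → ℕ := fun j => f (n + j)

@[simp] lemma pre_length (f : ℕ → ℕ) (n : ℕ) : (pre f n).length = n := by simp [pre]
lemma pre_zero (f : ℕ → ℕ) : pre f 0 = [] := by simp [pre]
lemma pre_succ (f : ℕ → ℕ) (n : ℕ) : pre f (n + 1) = pre f n ++ [f n] := by
  simp [pre, List.range_succ]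
lemma pre_succ' (f : ℕ → ℕ) (n : ℕ) : pre f (n + 1) = f 0 :: pre (shf 1 f) n := by
  simp [pre, shf, List.range_succ_eq_map, Nat.add_comm 1, Function.comp_def]
lemma pre_add (f : ℕ → ℕ) (m n : ℕ) : pre f (m + n) = pre f m ++ pre (shf m f) n := by
  simp [pre, shf, List.range_add, Function.comp_def]
lemma shf_shf (m n : ℕ) (f : ℕ → ℕ) : shf m (shf n f) = shf (n + m) f := by
  funext j; simp [shf, Nat.add_assoc]
@[simp] lemma shf_zero (f : ℕ → ℕ) : shf 0 f = f := by funext j; simp [shf]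
lemma mem_pre {f : ℕ → ℕ} {n a : ℕ} : a ∈ pre f n ↔ ∃ j < n, f j = a := by
  simp [pre]
lemma pre_congr {f g : ℕ → ℕ} {n : ℕ} (h : ∀ j < n, f j = g j) : pre f n = pre g n := by
  simp only [pre]
  exact List.map_congr_left fun j hj => h j (List.mem_range.1 hj)

lemma phi_pre_cauchy (f : ℕ → ℕ) : CauchySeq fun n => phi (pre f n) 0 := by
  have key : ∀ n m, n ≤ m → |phi (pre f n) 0 - phi (pre f m) 0| ≤ 1 / ((2 : ℝ) ^ (n / 2)) ^ 2 := by
    intro n m h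
    obtain ⟨k, rfl⟩ := Nat.exists_eq_add_of_le h
    rw [pre_add, phi_append]
    have h1 : phi (pre (shf n f) k) 0 ∈ Icc (0 : ℝ) 1 := phi_mem _ (by simp)
    refine (abs_phi_sub_le _ le_rfl h1.1).trans ?_
    have h2 := two_pow_le_qd (pre f n)
    rw [pre_length] at h2
    gcongr
    rw [zero_sub, abs_neg, abs_of_nonneg h1.1]; exact h1.2
  refine cauchySeq_of_le_tendsto_0 (fun n => 2 * (1 / ((2 : ℝ) ^ (n / 2)) ^ 2)) ?_ ?_
  · intro n m N hn hm
    rw [Real.dist_eq]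
    have h1 := key N n hn
    have h2 := key N m hm
    rw [abs_sub_comm] at h1
    have := abs_sub_le (phi (pre f n) 0) (phi (pre f N) 0) (phi (pre f m) 0)
    linarith
  · have : Tendsto (fun n : ℕ => ((2 : ℝ) ^ (n / 2))) atTop atTop :=
      (tendsto_pow_atTop_atTop_of_one_lt one_lt_two).comp
        (Nat.tendsto_div_const_atTop two_ne_zero)
    have := ((tendsto_pow_atTop two_ne_zero).comp this).inv_tendsto_atTop.const_mul 2
    simpa [Function.comp_def] using this

/-- The value of the infinite continued fraction `[0; f 0 + 1, f 1 + 1, …]`. -/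
noncomputable def cf (f : ℕ → ℕ) : ℝ := limUnder atTop fun n => phi (pre f n) 0

lemma cf_tendsto (f : ℕ → ℕ) : Tendsto (fun n => phi (pre f n) 0) atTop (𝓝 (cf f)) :=
  (phi_pre_cauchy f).tendsto_limUnder

lemma cf_mem (f : ℕ → ℕ) : cf f ∈ Icc (0 : ℝ) 1 :=
  isClosed_Icc.mem_of_tendsto (cf_tendsto f) (Eventually.of_forall fun _ => phi_mem _ (by simp))

lemma cf_cons (f : ℕ → ℕ) : cf f = 1 / ((f 0 : ℝ) + 1 + cf (shf 1 f)) := by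
  have h1 := (cf_tendsto f).comp (tendsto_add_atTop_nat 1)
  have h2 : Tendsto (fun n => 1 / ((f 0 : ℝ) + 1 + phi (pre (shf 1 f) n) 0)) atTop
      (𝓝 (1 / ((f 0 : ℝ) + 1 + cf (shf 1 f)))) := by
    refine tendsto_const_nhds.div (tendsto_const_nhds.add (cf_tendsto _)) ?_
    have := (cf_mem (shf 1 f)).1
    positivity
  refine tendsto_nhds_unique h1 (h2.congr fun n => ?_)
  simp [Function.comp, pre_succ', phi]

lemma cf_eq_phi (f : ℕ → ℕ) (n : ℕ) : cf f = phi (pre f n) (cf (shf n f)) := by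
  induction n generalizing f with
  | zero => simp [pre_zero, phi]
  | succ n ih =>
    rw [pre_succ', phi, cf_cons, ih (shf 1 f), shf_shf, Nat.add_comm 1 n]

lemma cf_pos (f : ℕ → ℕ) : 0 < cf f := by
  rw [cf_cons]; have := (cf_mem (shf 1 f)).1; positivity

lemma cf_lt_one (f : ℕ → ℕ) : cf f < 1 := by
  rw [cf_cons]; have := cf_pos (shf 1 f)
  rw [div_lt_one (by positivity)]
  have : (0 : ℝ) ≤ f 0 := (f 0).cast_nonneg
  linarith

lemma le_cf {f : ℕ → ℕ} {T : ℕ} (h : f 0 < T) : 1 / ((T : ℝ) + 1) ≤ cf f := by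
  rw [cf_cons]
  have h1 := cf_mem (shf 1 f)
  have h2 : (f 0 : ℝ) + 1 ≤ T := by exact_mod_cast h
  have := h1.1
  gcongr
  linarith [h1.2]

lemma cf_le {f : ℕ → ℕ} {T : ℕ} (h : f 1 < T) : cf f ≤ 1 - 1 / ((T : ℝ) + 2) := by
  rw [cf_cons]
  have h1 : 1 / ((T : ℝ) + 1) ≤ cf (shf 1 f) := le_cf (by simpa [shf] using h)
  have h2 : (0 : ℝ) ≤ f 0 := (f 0).cast_nonneg
  have h3 : 1 / ((f 0 : ℝ) + 1 + cf (shf 1 f)) ≤ 1 / (1 + 1 / ((T : ℝ) + 1)) := by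
    gcongr; linarith
  refine h3.trans (le_of_eq ?_)
  field_simp; ring

lemma abs_cf_sub_le {f g : ℕ → ℕ} {n : ℕ} (h : pre f n = pre g n) :
    |cf f - cf g| ≤ 1 / qd (pre f n) ^ 2 := by
  rw [cf_eq_phi f n, cf_eq_phi g n, ← h]
  refine (abs_phi_sub_le _ (cf_mem _).1 (cf_mem _).1).trans ?_
  have := qd_pos (pre f n)
  gcongr
  rw [abs_le]
  constructor <;> linarith [(cf_mem (shf n f)).1, (cf_mem (shf n f)).2, (cf_mem (shf n g)).1,
    (cf_mem (shf n g)).2]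

lemma abs_cf_sub_le_pow {f g : ℕ → ℕ} {n : ℕ} (h : ∀ j < n, f j = g j) :
    |cf f - cf g| ≤ 1 / 4 ^ (n / 2) := by
  refine (abs_cf_sub_le (pre_congr h)).trans ?_
  have h2 := two_pow_le_qd (pre f n)
  rw [pre_length] at h2
  have : (4 : ℝ) ^ (n / 2) = (2 ^ (n / 2)) ^ 2 := by rw [← pow_mul, mul_comm, pow_mul]; norm_num
  rw [this]; gcongr

lemma continuous_cf : Continuous cf := by
  rw [continuous_iff_continuousAt]
  intro f
  rw [ContinuousAt, Metric.tendsto_nhds]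
  intro ε hε
  have h1 : Tendsto (fun n : ℕ => 1 / (4 : ℝ) ^ (n / 2)) atTop (𝓝 0) := by
    have : Tendsto (fun n : ℕ => ((4 : ℝ) ^ (n / 2))) atTop atTop :=
      (tendsto_pow_atTop_atTop_of_one_lt (by norm_num)).comp
        (Nat.tendsto_div_const_atTop two_ne_zero)
    simpa [Pi.inv_def] using this.inv_tendsto_atTop
  obtain ⟨n, hn⟩ := (h1.eventually (gt_mem_nhds hε)).exists
  have h2 : ∀ j ∈ Finset.range n, ∀ᶠ g : ℕ → ℕ in 𝓝 f, g j = f j := fun j _ =>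
    (continuous_apply (A := fun _ : ℕ => ℕ) j).continuousAt.eventually_mem
      (s := {f j}) ((isOpen_discrete _).mem_nhds rfl)
  filter_upwards [(Finset.eventually_all _).2 h2] with g hg
  rw [Real.dist_eq]
  exact (abs_cf_sub_le_pow fun j hj => hg j (Finset.mem_range.2 hj)).trans_lt hn

/-- The range of tails of continued fractions whose letters are smaller than `T`. -/
noncomputable def tailIcc (T : ℕ) : Set ℝ := Icc (1 / ((T : ℝ) + 1)) (1 - 1 / ((T : ℝ) + 2))

/-- The separation constant of words over letters smaller than `T`. -/
noncomputable def sepC (T : ℕ) : ℝ := 1 / (4 * ((T : ℝ) + 1) ^ 3)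

lemma sepC_pos (T : ℕ) : 0 < sepC T := by unfold sepC; positivity

lemma tailIcc_subset (T : ℕ) : tailIcc T ⊆ Icc 0 1 := by
  intro x hx
  have h1 : 0 < 1 / ((T : ℝ) + 1) := by positivity
  have h2 : 0 < 1 / ((T : ℝ) + 2) := by positivity
  exact ⟨h1.le.trans hx.1, by linarith [hx.2]⟩

lemma half_mem_tailIcc {T : ℕ} (hT : 0 < T) : (1 / 2 : ℝ) ∈ tailIcc T := by
  have : (1 : ℝ) ≤ T := by exact_mod_cast hT
  constructor
  · exact one_div_le_one_div_of_le two_pos (by linarith)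
  · have : 1 / ((T : ℝ) + 2) ≤ 1 / 2 := one_div_le_one_div_of_le two_pos (by linarith)
    linarith

lemma cf_mem_tailIcc {f : ℕ → ℕ} {T : ℕ} (h : ∀ j, f j < T) : cf f ∈ tailIcc T :=
  ⟨le_cf (h 0), cf_le (h 1)⟩

lemma phi_mem_tailIcc {T : ℕ} {w : List ℕ} (hw : ∀ a ∈ w, a < T) {x : ℝ} (hx : x ∈ tailIcc T) :
    phi w x ∈ tailIcc T := by
  induction w with
  | nil => simpa [phi]
  | cons a w ih =>
    have h := ih fun b hb => hw b (by simp [hb])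
    have h01 := tailIcc_subset T h
    have ha : (a : ℝ) + 1 ≤ T := by exact_mod_cast hw a (by simp)
    have ha0 : (0 : ℝ) ≤ a := a.cast_nonneg
    simp only [phi]
    constructor
    · have := h01.1
      gcongr
      linarith [h01.2]
    · have h3 : 1 / ((a : ℝ) + 1 + phi w x) ≤ 1 / (1 + 1 / ((T : ℝ) + 1)) := by
        gcongr
        · linarith
        · exact h.1
      refine h3.trans (le_of_eq ?_)
      field_simp; ring

lemma exists_common_split : ∀ {u v : List ℕ}, u.length = v.length → u ≠ v →
    ∃ c a b u' v', u = c ++ a :: u' ∧ v = c ++ b :: v' ∧ a ≠ b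
  | [], [], _, h => (h rfl).elim
  | [], _ :: _, h, _ => by simp at h
  | _ :: _, [], h, _ => by simp at h
  | a :: u, b :: v, h, hne => by
    by_cases hab : a = b
    · subst hab
      obtain ⟨c, a', b', u', v', h1, h2, h3⟩ :=
        exists_common_split (u := u) (v := v) (by simpa using h) (by simpa using hne)
      exact ⟨a :: c, a', b', u', v', by simp [h1], by simp [h2], h3⟩
    · exact ⟨[], a, b, u, v, by simp, by simp, hab⟩

lemma first_letter_sep {T a b : ℕ} (hb : b < T) (hab : a < b) {x y : ℝ} (hx : x ∈ tailIcc T)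
    (hy : y ∈ tailIcc T) :
    1 / ((T : ℝ) + 1) ^ 3 ≤ 1 / ((a : ℝ) + 1 + x) - 1 / ((b : ℝ) + 1 + y) := by
  have h1 : (a : ℝ) + 1 ≤ b := by exact_mod_cast hab
  have h2 : (b : ℝ) + 1 ≤ T := by exact_mod_cast hb
  have h3 : (0 : ℝ) ≤ a := a.cast_nonneg
  have hx0 := tailIcc_subset T hx
  have hy0 := tailIcc_subset T hy
  have h4 : 0 < 1 / ((T : ℝ) + 2) := by positivity
  have e1 : 0 < (a : ℝ) + 1 + x := by linarith [hx0.1]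
  have e2 : 0 < (b : ℝ) + 1 + y := by linarith [hy0.1]
  rw [div_sub_div _ _ e1.ne' e2.ne']
  have h5 : 1 / ((T : ℝ) + 1) ^ 3 = 1 / ((T : ℝ) + 1) / (((T : ℝ) + 1) * ((T : ℝ) + 1)) := by
    field_simp
  rw [h5]
  have hx2 := hx.2
  have hy1 := hy.1
  have h6 : 0 < 1 / ((T : ℝ) + 1) := by positivity
  have h7 : ((a : ℝ) + 1 + x) * ((b : ℝ) + 1 + y) ≤ ((T : ℝ) + 1) * ((T : ℝ) + 1) :=
    mul_le_mul (by linarith [hx0.2]) (by linarith [hy0.2]) e2.le (by linarith)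
  exact div_le_div₀ (by linarith) (by linarith) (mul_pos e1 e2) h7

lemma word_sep_aux {T : ℕ} {c u v : List ℕ} {a b : ℕ} (hu : ∀ z ∈ c ++ a :: u, z < T)
    (hv : ∀ z ∈ c ++ b :: v, z < T) (hab : a < b) {x y : ℝ} (hx : x ∈ tailIcc T)
    (hy : y ∈ tailIcc T) :
    1 / (4 * ((T : ℝ) + 1) ^ 3) / qd c ^ 2 ≤
      (-1) ^ c.length * (phi (c ++ a :: u) x - phi (c ++ b :: v) y) := by
  have hx' : phi u x ∈ tailIcc T := phi_mem_tailIcc (fun z hz => hu z (by simp [hz])) hx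
  have hy' : phi v y ∈ tailIcc T := phi_mem_tailIcc (fun z hz => hv z (by simp [hz])) hy
  have h := first_letter_sep (hv b (by simp)) hab hx' hy'
  have hX : phi (a :: u) x ∈ tailIcc T :=
    phi_mem_tailIcc (fun z hz => hu z (List.mem_append_right _ hz)) hx
  have hY : phi (b :: v) y ∈ tailIcc T :=
    phi_mem_tailIcc (fun z hz => hv z (List.mem_append_right _ hz)) hy
  change _ ≤ phi (a :: u) x - phi (b :: v) y at h
  have hX1 := tailIcc_subset T hX
  have hY1 := tailIcc_subset T hY
  rw [phi_append, phi_append, phi_sub c hX1.1 hY1.1, mul_div_assoc, ← mul_assoc, ← mul_pow]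
  simp only [neg_mul_neg, one_mul, one_pow]
  have e1 := den_pos c hX1.1
  have e2 := den_pos c hY1.1
  have e3 := qd_pos c
  have h4 : (qe c * phi (a :: u) x + qd c) * (qe c * phi (b :: v) y + qd c) ≤ 4 * qd c ^ 2 := by
    have := mul_le_mul (den_le c hX1.2) (den_le c hY1.2) e2.le (by linarith)
    linarith
  calc 1 / (4 * ((T : ℝ) + 1) ^ 3) / qd c ^ 2
      = 1 / ((T : ℝ) + 1) ^ 3 / (4 * qd c ^ 2) := by field_simp
    _ ≤ _ := div_le_div₀ (h.trans' (by positivity)) h (mul_pos e1 e2) h4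

/-- Distinct words of the same length have uniformly separated images, in an order that does
not depend on the tails. -/
lemma word_sep {T : ℕ} {u v : List ℕ} (hl : u.length = v.length) (hne : u ≠ v)
    (hu : ∀ z ∈ u, z < T) (hv : ∀ z ∈ v, z < T) :
    (∀ x ∈ tailIcc T, ∀ y ∈ tailIcc T, phi u x + sepC T / qd u ^ 2 ≤ phi v y) ∨
    (∀ x ∈ tailIcc T, ∀ y ∈ tailIcc T, phi v y + sepC T / qd u ^ 2 ≤ phi u x) := by
  obtain ⟨c, a, b, u', v', rfl, rfl, hab⟩ := exists_common_split hl hne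
  have hq : sepC T / qd (c ++ a :: u') ^ 2 ≤ 1 / (4 * ((T : ℝ) + 1) ^ 3) / qd c ^ 2 := by
    have e3 := qd_pos c
    have := qd_le_append_left c (a :: u')
    unfold sepC
    gcongr
  rcases lt_or_gt_of_ne hab with h | h <;> rcases neg_one_pow_eq_or ℝ c.length with e | e
  · right; intro x hx y hy
    have := word_sep_aux hu hv h hx hy
    rw [e] at this; linarith
  · left; intro x hx y hy
    have := word_sep_aux hu hv h hx hy
    rw [e] at this; linarith
  · left; intro x hx y hy
    have := word_sep_aux hv hu h hy hx
    rw [e] at this; linarith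
  · right; intro x hx y hy
    have := word_sep_aux hv hu h hy hx
    rw [e] at this; linarith

/-- The key used to order words of a given length. -/
noncomputable def wkey (u : List ℕ) : ℝ := phi u (1 / 2)

lemma word_sep_of_key_lt {T : ℕ} {u v : List ℕ} (hl : u.length = v.length)
    (hu : ∀ z ∈ u, z < T) (hv : ∀ z ∈ v, z < T) (h : wkey u < wkey v) {x y : ℝ}
    (hx : x ∈ tailIcc T) (hy : y ∈ tailIcc T) : phi u x + sepC T / qd u ^ 2 ≤ phi v y := by
  have hT : 0 < T := by
    rcases u with _ | ⟨a, u⟩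
    · obtain rfl : v = [] := by simpa using hl.symm
      exact (lt_irrefl _ h).elim
    · exact (Nat.zero_le a).trans_lt (hu a (by simp))
  rcases word_sep hl (fun e => by simp [e] at h) hu hv with H | H
  · exact H x hx y hy
  · have := H _ (half_mem_tailIcc hT) _ (half_mem_tailIcc hT)
    have h1 : 0 < sepC T / qd u ^ 2 := div_pos (sepC_pos T) (pow_pos (qd_pos u) 2)
    unfold wkey at h
    linarith

lemma wkey_injOn {T n : ℕ} {u v : List ℕ} (hl : u.length = n) (hl' : v.length = n)
    (hu : ∀ z ∈ u, z < T) (hv : ∀ z ∈ v, z < T) (h : wkey u = wkey v) : u = v := by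
  by_contra hne
  have hT : 0 < T := by
    rcases u with _ | ⟨a, u⟩
    · obtain rfl : v = [] := by subst hl; simpa using hl'
      exact (hne rfl).elim
    · exact (Nat.zero_le a).trans_lt (hu a (by simp))
  have h1 : 0 < sepC T / qd u ^ 2 := div_pos (sepC_pos T) (pow_pos (qd_pos u) 2)
  have hm := half_mem_tailIcc hT
  unfold wkey at h
  rcases word_sep (hl.trans hl'.symm) hne hu hv with H | H <;> linarith [H _ hm _ hm]

/-- The ray of `θ` to the right, starting at `i`. -/
def rt (θ : ℤ → ℕ) (i : ℤ) : ℕ → ℕ := fun j => θ (i + j)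
/-- The ray of `θ` to the left, starting just before `i`. -/
def lf (θ : ℤ → ℕ) (i : ℤ) : ℕ → ℕ := fun j => θ (i - 1 - j)
/-- The word of length `n` read from position `i`. -/
def block (θ : ℤ → ℕ) (i : ℤ) (n : ℕ) : List ℕ := pre (rt θ i) n

/-- The Perron value of a bi-infinite sequence at a position. -/
noncomputable def lam (θ : ℤ → ℕ) (i : ℤ) : ℝ := θ i + 1 + cf (rt θ (i + 1)) + cf (lf θ i)

/-- Translate of a bi-infinite sequence. -/
def tr (k : ℤ) (θ : ℤ → ℕ) : ℤ → ℕ := fun i => θ (i + k)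

lemma shf_rt (θ : ℤ → ℕ) (i : ℤ) (n : ℕ) : shf n (rt θ i) = rt θ (i + n) := by
  funext j; simp [shf, rt, add_assoc]
lemma shf_lf (θ : ℤ → ℕ) (i : ℤ) (n : ℕ) : shf n (lf θ i) = lf θ (i - n) := by
  funext j; simp only [shf, lf]; congr 1; push_cast; ring
lemma rt_tr (k : ℤ) (θ : ℤ → ℕ) (i : ℤ) : rt (tr k θ) i = rt θ (i + k) := by
  funext j; simp only [rt, tr]; congr 1; ring
lemma lf_tr (k : ℤ) (θ : ℤ → ℕ) (i : ℤ) : lf (tr k θ) i = lf θ (i + k) := by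
  funext j; simp only [lf, tr]; congr 1; ring
lemma lam_tr (k : ℤ) (θ : ℤ → ℕ) (i : ℤ) : lam (tr k θ) i = lam θ (i + k) := by
  simp only [lam, rt_tr, lf_tr, tr]
  rw [show i + 1 + k = i + k + 1 by ring]

@[simp] lemma block_length (θ : ℤ → ℕ) (i : ℤ) (n : ℕ) : (block θ i n).length = n := by
  simp [block]
lemma block_add (θ : ℤ → ℕ) (i : ℤ) (m n : ℕ) :
    block θ i (m + n) = block θ i m ++ block θ (i + m) n := by
  simp only [block, pre_add, shf_rt]
lemma mem_block {θ : ℤ → ℕ} {i : ℤ} {n a : ℕ} : a ∈ block θ i n ↔ ∃ j < n, θ (i + j) = a := by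
  simp [block, mem_pre, rt]
lemma block_getElem (θ : ℤ → ℕ) (i : ℤ) (n j : ℕ) (h : j < (block θ i n).length) :
    (block θ i n)[j] = θ (i + j) := by
  simp [block, pre, rt]
lemma block_eq_iff {θ θ' : ℤ → ℕ} {i i' : ℤ} {n : ℕ} :
    block θ i n = block θ' i' n ↔ ∀ j < n, θ (i + j) = θ' (i' + j) := by
  constructor
  · intro h j hj
    have h1 := block_getElem θ i n j (by simpa using hj)
    have h2 := block_getElem θ' i' n j (by simpa using hj)
    rw [← h1, ← h2]; simp [h]
  · intro h; exact pre_congr fun j hj => h j hj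

lemma pre_lf (θ : ℤ → ℕ) (i : ℤ) (n : ℕ) : pre (lf θ i) n = (block θ (i - n) n).reverse := by
  induction n generalizing i with
  | zero => simp [pre_zero, block]
  | succ n ih =>
    rw [pre_succ', show shf 1 (lf θ i) = lf θ (i - 1) by simpa using shf_lf θ i 1, ih,
      show i - ((n + 1 : ℕ) : ℤ) = i - 1 - n by push_cast; ring, block_add]
    simp [block, pre_succ, pre_zero, rt, lf]

/-- Sequences agreeing in a window around `i` have close values there. -/
lemma abs_lam_sub_le {θ θ' : ℤ → ℕ} {i i' : ℤ} {n : ℕ}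
    (h : ∀ j : ℤ, |j| ≤ n → θ (i + j) = θ' (i' + j)) :
    |lam θ i - lam θ' i'| ≤ 2 / 4 ^ (n / 2) := by
  have h0 : θ i = θ' i' := by simpa using h 0 (by simp)
  have h1 : |cf (rt θ (i + 1)) - cf (rt θ' (i' + 1))| ≤ 1 / 4 ^ (n / 2) :=
    abs_cf_sub_le_pow fun j hj => by
      have := h (1 + j) (by rw [abs_le]; constructor <;> omega)
      simpa [rt, add_assoc] using this
  have h2 : |cf (lf θ i) - cf (lf θ' i')| ≤ 1 / 4 ^ (n / 2) :=
    abs_cf_sub_le_pow fun j hj => by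
      have := h (-1 - j) (by rw [abs_le]; constructor <;> omega)
      simpa [lf, sub_eq_add_neg, add_assoc] using this
  have : lam θ i - lam θ' i' = (cf (rt θ (i + 1)) - cf (rt θ' (i' + 1)))
      + (cf (lf θ i) - cf (lf θ' i')) := by simp only [lam, h0]; ring
  rw [this]
  refine (abs_add_le _ _).trans ?_
  have e : (2 : ℝ) / 4 ^ (n / 2) = 1 / 4 ^ (n / 2) + 1 / 4 ^ (n / 2) := by ring
  linarith

lemma lt_lam (θ : ℤ → ℕ) (i : ℤ) : (θ i : ℝ) + 1 < lam θ i := by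
  have := cf_pos (rt θ (i + 1)); have := cf_pos (lf θ i)
  unfold lam; linarith

lemma lam_lt (θ : ℤ → ℕ) (i : ℤ) : lam θ i < θ i + 3 := by
  have := cf_lt_one (rt θ (i + 1)); have := cf_lt_one (lf θ i)
  unfold lam; linarith

lemma continuous_lam (i : ℤ) : Continuous fun θ : ℤ → ℕ => lam θ i := by
  unfold lam
  have h1 : Continuous fun θ : ℤ → ℕ => rt θ (i + 1) :=
    continuous_pi fun j => continuous_apply _
  have h2 : Continuous fun θ : ℤ → ℕ => lf θ i := continuous_pi fun j => continuous_apply _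
  have h3 : Continuous fun θ : ℤ → ℕ => (θ i : ℝ) :=
    continuous_of_discreteTopology.comp (continuous_apply i)
  exact ((h3.add continuous_const).add (continuous_cf.comp h1)).add (continuous_cf.comp h2)

/-- The subshift of sequences all of whose Perron values are at most `t`. -/
def Sig (t : ℝ) : Set (ℤ → ℕ) := {θ | ∀ i, lam θ i ≤ t}

lemma Sig_mono {t t' : ℝ} (h : t ≤ t') : Sig t ⊆ Sig t' := fun _ hθ i => (hθ i).trans h

lemma tr_mem_Sig {t : ℝ} {θ : ℤ → ℕ} (h : θ ∈ Sig t) (k : ℤ) : tr k θ ∈ Sig t :=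
  fun i => by rw [lam_tr]; exact h _

lemma lt_ceil_of_lam_le {t : ℝ} {θ : ℤ → ℕ} {i : ℤ} (h : lam θ i ≤ t) : θ i < ⌈t⌉₊ := by
  have h1 : (θ i : ℝ) < t := by linarith [lt_lam θ i]
  exact_mod_cast h1.trans_le (Nat.le_ceil t)

lemma isCompact_digits (T : ℕ) : IsCompact {θ : ℤ → ℕ | ∀ i, θ i < T} := by
  have h := isCompact_univ_pi (X := fun _ : ℤ => ℕ) (s := fun _ => Iio T)
    fun _ => (Set.finite_Iio T).isCompact
  convert h using 1
  ext θ; simp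

lemma isClosed_Sig (t : ℝ) : IsClosed (Sig t) := by
  have : Sig t = ⋂ i, {θ | lam θ i ≤ t} := by ext; simp [Sig]
  rw [this]
  exact isClosed_iInter fun i => isClosed_le (continuous_lam i) continuous_const

lemma isCompact_Sig (t : ℝ) : IsCompact (Sig t) :=
  (isCompact_digits ⌈t⌉₊).of_isClosed_subset (isClosed_Sig t)
    fun _ hθ i => lt_ceil_of_lam_le (hθ i)

lemma finite_words (T n : ℕ) : {w : List ℕ | w.length = n ∧ ∀ a ∈ w, a < T}.Finite := by
  refine (Set.finite_range fun g : Fin n → Fin T => List.ofFn fun i => (g i : ℕ)).subset ?_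
  rintro w ⟨rfl, h⟩
  refine ⟨fun i => ⟨w[i], h _ (List.getElem_mem _)⟩, ?_⟩
  simp

/-- The words of length `n` allowed in `Sig t`. -/
def Lang (t : ℝ) (n : ℕ) : Set (List ℕ) := {w | ∃ θ ∈ Sig t, ∃ i, block θ i n = w}

lemma Lang_finite (t : ℝ) (n : ℕ) : (Lang t n).Finite := by
  refine (finite_words ⌈t⌉₊ n).subset ?_
  rintro w ⟨θ, hθ, i, rfl⟩
  refine ⟨by simp, fun a ha => ?_⟩
  obtain ⟨j, -, rfl⟩ := mem_block.1 ha
  exact lt_ceil_of_lam_le (hθ _)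

/-- The words of length `n` allowed in `Sig t`, as a finite set. -/
noncomputable def LangF (t : ℝ) (n : ℕ) : Finset (List ℕ) := (Lang_finite t n).toFinset

lemma mem_LangF {t : ℝ} {n : ℕ} {w : List ℕ} :
    w ∈ LangF t n ↔ ∃ θ ∈ Sig t, ∃ i, block θ i n = w := by simp [LangF, Lang]

lemma LangF_length {t : ℝ} {n : ℕ} {w : List ℕ} (h : w ∈ LangF t n) : w.length = n := by
  obtain ⟨θ, -, i, rfl⟩ := mem_LangF.1 h; simp

lemma LangF_lt {t : ℝ} {n : ℕ} {w : List ℕ} (h : w ∈ LangF t n) : ∀ a ∈ w, a < ⌈t⌉₊ := by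
  obtain ⟨θ, hθ, i, rfl⟩ := mem_LangF.1 h
  intro a ha
  obtain ⟨j, -, rfl⟩ := mem_block.1 ha
  exact lt_ceil_of_lam_le (hθ _)

lemma LangF_mono {t t' : ℝ} (h : t ≤ t') (n : ℕ) : LangF t n ⊆ LangF t' n := fun w hw => by
  obtain ⟨θ, hθ, i, rfl⟩ := mem_LangF.1 hw
  exact mem_LangF.2 ⟨θ, Sig_mono h hθ, i, rfl⟩

/-- The weighted count of allowed words. -/
noncomputable def Zs (t : ℝ) (n : ℕ) (s : ℝ) : ℝ := ∑ w ∈ LangF t n, qd w ^ (-2 * s)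

lemma Zs_nonneg (t : ℝ) (n : ℕ) (s : ℝ) : 0 ≤ Zs t n s :=
  Finset.sum_nonneg fun w _ => (Real.rpow_pos_of_pos (qd_pos w) _).le

/-- Subcriticality of the exponent `s` for the subshift `Sig t`. -/
def Subcrit (t s : ℝ) : Prop := ∃ n, 1 ≤ n ∧ Zs t n s < 1

lemma Subcrit.mono_right {t s s' : ℝ} (h : Subcrit t s) (hs : s ≤ s') : Subcrit t s' := by
  obtain ⟨n, hn, h⟩ := h
  refine ⟨n, hn, lt_of_le_of_lt ?_ h⟩
  exact Finset.sum_le_sum fun w _ => Real.rpow_le_rpow_of_exponent_le (qd_ge_one w) (by linarith)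

/-- The language is upper semicontinuous in `t`. -/
lemma exists_LangF_eq (t : ℝ) (n : ℕ) : ∃ t' > t, LangF t' n = LangF t n := by
  set u : ℕ → ℝ := fun k => t + 1 / ((k : ℝ) + 1) with hu
  have hanti : Antitone u := fun a b hab => by
    simp only [hu]; gcongr
  have hgt : ∀ k, t < u k := fun k => by
    have : 0 < 1 / ((k : ℝ) + 1) := by positivity
    simp only [hu]; linarith
  have hlim : Tendsto u atTop (𝓝 t) := by
    simpa [hu] using (tendsto_const_nhds (x := t)).add
      (tendsto_one_div_add_atTop_nhds_zero_nat (𝕜 := ℝ))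
  have key : ∀ w, (∀ k, w ∈ LangF (u k) n) → w ∈ LangF t n := by
    intro w hw
    let C : ℕ → Set (ℤ → ℕ) := fun k => Sig (u k) ∩ {θ | ∀ j : Fin n, θ j = w.getD j 0}
    have hclosed : IsClosed {θ : ℤ → ℕ | ∀ j : Fin n, θ j = w.getD j 0} := by
      simp only [ofPred_forall]
      exact isClosed_iInter fun j => isClosed_eq (continuous_apply _) continuous_const
    have hne : (⋂ k, C k).Nonempty := by
      refine IsCompact.nonempty_iInter_of_sequence_nonempty_isCompact_isClosed C ?_ ?_ ?_ ?_
      · exact fun k => inter_subset_inter_left _ (Sig_mono (hanti (Nat.le_succ k)))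
      · intro k
        obtain ⟨θ, hθ, i, rfl⟩ := mem_LangF.1 (hw k)
        refine ⟨tr i θ, tr_mem_Sig hθ i, fun j => ?_⟩
        rw [List.getD_eq_getElem _ _ (by simp), block_getElem, tr, add_comm]
      · exact (isCompact_Sig _).inter_right hclosed
      · exact fun k => (isClosed_Sig _).inter hclosed
    obtain ⟨θ, hθ⟩ := hne
    rw [mem_iInter] at hθ
    refine mem_LangF.2 ⟨θ, fun i => ge_of_tendsto' hlim fun k => (hθ k).1 i, 0, ?_⟩
    have hlen : w.length = n := LangF_length (hw 0)
    refine List.ext_getElem (by simp [hlen]) fun j h1 h2 => ?_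
    have := (hθ 0).2 ⟨j, by simpa using h1⟩
    rw [block_getElem, zero_add]
    rw [List.getD_eq_getElem _ _ h2] at this
    exact this
  have : ∀ w ∈ LangF (u 0) n, ∃ k, w ∈ LangF t n ∨ w ∉ LangF (u k) n := by
    intro w _
    by_contra! h
    exact (h 0).1 (key w fun k => (h k).2)
  choose! k hk using this
  refine ⟨u ((LangF (u 0) n).sup k), hgt _, Finset.Subset.antisymm (fun w hw => ?_)
    (LangF_mono (hgt _).le n)⟩
  have hw0 : w ∈ LangF (u 0) n := LangF_mono (hanti (Nat.zero_le _)) n hw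
  refine (hk w hw0).resolve_right fun h => h (LangF_mono (hanti ?_) n hw)
  exact Finset.le_sup hw0

lemma Subcrit.exists_gt {t s : ℝ} (h : Subcrit t s) : ∃ t' > t, Subcrit t' s := by
  obtain ⟨n, hn, h⟩ := h
  obtain ⟨t', ht', he⟩ := exists_LangF_eq t n
  exact ⟨t', ht', n, hn, by simpa [Zs, he] using h⟩

/-- A one-sided sequence whose Perron values are eventually at most `t` eventually consists of
allowed words. -/
lemma eventually_block_mem {t : ℝ} {T : ℕ} {θ : ℤ → ℕ} (hT : ∀ i, θ i < T)
    (h : ∀ᶠ n : ℕ in atTop, lam θ n ≤ t) (k : ℕ) :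
    ∀ᶠ n : ℕ in atTop, block θ n k ∈ LangF t k := by
  by_contra hcon
  rw [not_eventually] at hcon
  obtain ⟨g, hg, hgn⟩ := extraction_of_frequently_atTop hcon
  have hmem : ∀ j, tr (g j : ℤ) θ ∈ {θ : ℤ → ℕ | ∀ i, θ i < T} := fun j i => hT _
  obtain ⟨η, -, ψ, hψ, hlim⟩ := (isCompact_digits T).tendsto_subseq hmem
  have hη : η ∈ Sig t := by
    intro i
    refine le_of_tendsto ((continuous_lam i).continuousAt.tendsto.comp hlim) ?_
    have h1 : Tendsto (fun j => g (ψ j)) atTop atTop := (hg.comp hψ).tendsto_atTop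
    obtain ⟨N, hN⟩ := eventually_atTop.1 h
    filter_upwards [h1.eventually_ge_atTop (N + i.natAbs)] with j hj
    simp only [Function.comp, lam_tr]
    have h2 := hN (i + g (ψ j)).toNat (by omega)
    rwa [Int.toNat_of_nonneg (by omega)] at h2
  have hev : ∀ᶠ j in atTop, ∀ m ∈ Finset.range k, tr (g (ψ j) : ℤ) θ m = η m := by
    rw [Finset.eventually_all]
    intro m _
    have := ((continuous_apply (A := fun _ : ℤ => ℕ) (m : ℤ)).tendsto η).comp hlim
    exact this.eventually_mem (s := {η m}) ((isOpen_discrete _).mem_nhds rfl)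
  obtain ⟨j, hj⟩ := hev.exists
  refine hgn (ψ j) (mem_LangF.2 ⟨η, hη, 0, block_eq_iff.2 fun m hm => ?_⟩)
  rw [zero_add, ← hj m (Finset.mem_range.2 hm), tr, add_comm]

/-- The `d`-dimensional Hausdorff content on the real line. -/
noncomputable def hcont (d : ℝ) (hd : 0 < d) : OuterMeasure ℝ :=
  OuterMeasure.ofFunction (fun A => Metric.ediam A ^ d) (by simp [hd])

lemma hcont_le (d : ℝ) (hd : 0 < d) (A : Set ℝ) : hcont d hd A ≤ Metric.ediam A ^ d :=
  OuterMeasure.ofFunction_le _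

lemma dimH_le_of_hcont_eq_zero {d : ℝ} (hd : 0 < d) {E : Set ℝ} (h : hcont d hd E = 0) :
    dimH E ≤ ENNReal.ofReal d := by
  have hz : μH[d] E = 0 := by
    rw [Measure.hausdorffMeasure_apply]
    refine le_antisymm (iSup₂_le fun r hr => ?_) (zero_le)
    refine le_of_forall_pos_le_add fun ε hε => ?_
    rw [zero_add]
    have hpos : 0 < min ε (r ^ d) := by
      refine lt_min hε ?_
      by_cases hr' : r = ⊤
      · simp [hr', hd]
      · exact ENNReal.rpow_pos hr hr'
    have hlt : hcont d hd E < min ε (r ^ d) := by rw [h]; exact hpos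
    rw [hcont, OuterMeasure.ofFunction_apply] at hlt
    simp only [iInf_lt_iff] at hlt
    obtain ⟨t, ht, hsum⟩ := hlt
    refine iInf_le_of_le t (iInf_le_of_le ht (iInf_le_of_le (fun n => ?_) ?_))
    · have h1 := (ENNReal.le_tsum n).trans (hsum.le.trans (min_le_right _ _))
      exact (ENNReal.rpow_le_rpow_iff hd).1 h1
    · refine le_trans (ENNReal.tsum_le_tsum fun n => iSup_le fun _ => le_rfl)
        (hsum.le.trans (min_le_left _ _))
  refine dimH_le_of_hausdorffMeasure_ne_top (s := E) (d := d.toNNReal) ?_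
  rw [Real.coe_toNNReal _ hd.le, hz]; exact ENNReal.zero_ne_top

/-- Streams all of whose consecutive blocks of length `n` belong to a finite set of words. -/
def KS (B : Finset (List ℕ)) (n : ℕ) : Set (ℕ → ℕ) := {f | ∀ j, pre (shf (j * n) f) n ∈ B}

lemma shf_mem_KS {B : Finset (List ℕ)} {n : ℕ} {f : ℕ → ℕ} (hf : f ∈ KS B n) :
    shf n f ∈ KS B n := fun j => by
  rw [shf_shf]; simpa [Nat.succ_mul, Nat.add_comm] using hf (j + 1)

lemma pre_mem_of_mem_KS {B : Finset (List ℕ)} {n : ℕ} {f : ℕ → ℕ} (hf : f ∈ KS B n) :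
    pre f n ∈ B := by simpa using hf 0

lemma ediam_phi_le (m : ℝ) (u : List ℕ) {E : Set ℝ} (hE : E ⊆ Icc 0 1) :
    Metric.ediam ((fun x => m + phi u x) '' E) ≤ ENNReal.ofReal (1 / qd u ^ 2) := by
  refine Metric.ediam_le ?_
  rintro _ ⟨x, hx, rfl⟩ _ ⟨y, hy, rfl⟩
  rw [edist_dist, Real.dist_eq, add_sub_add_left_eq_sub]
  refine ENNReal.ofReal_le_ofReal ((abs_phi_sub_le _ (hE hx).1 (hE hy).1).trans ?_)
  have := qd_pos u
  have h1 := hE hx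
  have h2 := hE hy
  gcongr
  rw [abs_le]; constructor <;> linarith [h1.1, h1.2, h2.1, h2.2]

lemma one_div_sq_rpow {q : ℝ} (hq : 0 < q) (s : ℝ) : (1 / q ^ 2) ^ s = q ^ (-2 * s) := by
  rw [one_div, ← Real.rpow_natCast, ← Real.rpow_neg hq.le, ← Real.rpow_mul hq.le]
  norm_num

lemma hcont_phi_le {B : Finset (List ℕ)} {n : ℕ} {s : ℝ} (hs : 0 < s) (m : ℝ) (k : ℕ)
    (u : List ℕ) :
    hcont s hs ((fun x => m + phi u x) '' (cf '' KS B n)) ≤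
      ENNReal.ofReal (qd u ^ (-2 * s) * (∑ w ∈ B, qd w ^ (-2 * s)) ^ k) := by
  induction k generalizing u with
  | zero =>
    refine (hcont_le _ _ _).trans ?_
    have hE : cf '' KS B n ⊆ Icc 0 1 := by rintro _ ⟨f, -, rfl⟩; exact cf_mem f
    refine (ENNReal.rpow_le_rpow (ediam_phi_le m u hE) hs.le).trans ?_
    have := qd_pos u
    rw [ENNReal.ofReal_rpow_of_nonneg (by positivity) hs.le, one_div_sq_rpow this]
    simp
  | succ k ih =>
    have hsub : (fun x => m + phi u x) '' (cf '' KS B n) ⊆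
        ⋃ b ∈ B, (fun x => m + phi (u ++ b) x) '' (cf '' KS B n) := by
      rintro _ ⟨_, ⟨f, hf, rfl⟩, rfl⟩
      refine mem_iUnion₂.2 ⟨_, pre_mem_of_mem_KS hf, _, ⟨_, shf_mem_KS hf, rfl⟩, ?_⟩
      simp only [phi_append, ← cf_eq_phi]
    have hpos : ∀ w, 0 ≤ qd w ^ (-2 * s) := fun w => (Real.rpow_pos_of_pos (qd_pos w) _).le
    have hZ : 0 ≤ (∑ w ∈ B, qd w ^ (-2 * s)) ^ k :=
      pow_nonneg (Finset.sum_nonneg fun w _ => hpos w) k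
    refine (measure_mono hsub).trans ((measure_biUnion_finset_le _ _).trans ?_)
    refine (Finset.sum_le_sum fun b _ => ih (u ++ b)).trans ?_
    rw [← ENNReal.ofReal_sum_of_nonneg fun b _ => mul_nonneg (hpos _) hZ]
    refine ENNReal.ofReal_le_ofReal ?_
    rw [← Finset.sum_mul, pow_succ', ← mul_assoc, Finset.mul_sum]
    refine mul_le_mul_of_nonneg_right (Finset.sum_le_sum fun b _ => ?_) hZ
    rw [← Real.mul_rpow (qd_pos u).le (qd_pos b).le]
    exact Real.rpow_le_rpow_of_nonpos (mul_pos (qd_pos u) (qd_pos b)) (qd_mul_le u b) (by linarith)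

lemma eq_zero_of_le_geometric {x : ℝ≥0∞} {c z : ℝ} (hz : 0 ≤ z) (hz1 : z < 1)
    (h : ∀ k : ℕ, x ≤ ENNReal.ofReal (c * z ^ k)) : x = 0 := by
  have h1 : Tendsto (fun k : ℕ => ENNReal.ofReal (c * z ^ k)) atTop (𝓝 (ENNReal.ofReal (c * 0))) :=
    ENNReal.tendsto_ofReal ((tendsto_pow_atTop_nhds_zero_of_lt_one hz hz1).const_mul c)
  simpa using ge_of_tendsto' h1 h

lemma dimH_phi_le {B : Finset (List ℕ)} {n : ℕ} {s : ℝ} (hs : 0 < s) (m : ℝ) (u : List ℕ)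
    (hB : ∑ w ∈ B, qd w ^ (-2 * s) < 1) :
    dimH ((fun x => m + phi u x) '' (cf '' KS B n)) ≤ ENNReal.ofReal s :=
  dimH_le_of_hcont_eq_zero hs <| eq_zero_of_le_geometric
    (Finset.sum_nonneg fun w _ => (Real.rpow_pos_of_pos (qd_pos w) _).le) hB
    fun k => hcont_phi_le hs m k u

/-- Sums of two continued fractions with prescribed beginnings. -/
def VS (B B' : Finset (List ℕ)) (n : ℕ) (m : ℝ) (u v : List ℕ) : Set ℝ :=
  {z | ∃ f ∈ KS B n, ∃ g ∈ KS B' n, z = m + phi u (cf f) + phi v (cf g)}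

lemma VS_subset_left (B B' : Finset (List ℕ)) (n : ℕ) (m : ℝ) (u v : List ℕ) :
    VS B B' n m u v ⊆ ⋃ b ∈ B, VS B B' n m (u ++ b) v := by
  rintro _ ⟨f, hf, g, hg, rfl⟩
  refine mem_iUnion₂.2 ⟨_, pre_mem_of_mem_KS hf, _, shf_mem_KS hf, g, hg, ?_⟩
  simp only [phi_append, ← cf_eq_phi]

lemma VS_subset_right (B B' : Finset (List ℕ)) (n : ℕ) (m : ℝ) (u v : List ℕ) :
    VS B B' n m u v ⊆ ⋃ b ∈ B', VS B B' n m u (v ++ b) := by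
  rintro _ ⟨f, hf, g, hg, rfl⟩
  refine mem_iUnion₂.2 ⟨_, pre_mem_of_mem_KS hg, f, hf, _, shf_mem_KS hg, ?_⟩
  simp only [phi_append, ← cf_eq_phi]

lemma hcont_VS_le {B B' : Finset (List ℕ)} {n : ℕ} {s C Z : ℝ} (hs : 0 < 2 * s) (m : ℝ)
    (hB : ∀ b ∈ B, 2 * qd b ≤ C) (hB' : ∀ b ∈ B', 2 * qd b ≤ C)
    (hZ : ∑ w ∈ B, qd w ^ (-2 * s) ≤ Z) (hZ' : ∑ w ∈ B', qd w ^ (-2 * s) ≤ Z) (hZ0 : 0 ≤ Z)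
    (k : ℕ) (u v : List ℕ) (huv : qd u ≤ C * qd v) (hvu : qd v ≤ C * qd u) :
    hcont (2 * s) hs (VS B B' n m u v) ≤
      ENNReal.ofReal ((2 * C) ^ (2 * s) * (qd u ^ (-2 * s) * qd v ^ (-2 * s)) * Z ^ k) := by
  have hpos : ∀ w, 0 < qd w ^ (-2 * s) := fun w => Real.rpow_pos_of_pos (qd_pos w) _
  have hC : 0 < C := pos_of_mul_pos_left ((qd_pos u).trans_le huv) (qd_pos v).le
  have hC2 : 0 ≤ (2 * C) ^ (2 * s) := Real.rpow_nonneg (by positivity) _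
  have hext : ∀ u b, qd (u ++ b) ^ (-2 * s) ≤ qd u ^ (-2 * s) * qd b ^ (-2 * s) := fun u b => by
    rw [← Real.mul_rpow (qd_pos u).le (qd_pos b).le]
    exact Real.rpow_le_rpow_of_nonpos (mul_pos (qd_pos u) (qd_pos b)) (qd_mul_le u b) (by linarith)
  induction k generalizing u v with
  | zero =>
    refine (hcont_le _ _ _).trans ?_
    have h1 : Metric.ediam (VS B B' n m u v) ≤ ENNReal.ofReal (2 * C * (1 / (qd u * qd v))) := by
      refine Metric.ediam_le ?_
      rintro _ ⟨f, -, g, -, rfl⟩ _ ⟨f', -, g', -, rfl⟩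
      rw [edist_dist, Real.dist_eq]
      refine ENNReal.ofReal_le_ofReal ?_
      have e : m + phi u (cf f) + phi v (cf g) - (m + phi u (cf f') + phi v (cf g'))
          = (phi u (cf f) - phi u (cf f')) + (phi v (cf g) - phi v (cf g')) := by ring
      have hone : ∀ f f', |cf f - cf f'| ≤ 1 := fun f f' => by
        rw [abs_le]; constructor <;> linarith [(cf_mem f).1, (cf_mem f).2, (cf_mem f').1,
          (cf_mem f').2]
      have hu := qd_pos u
      have hv := qd_pos v
      have h2 : |phi u (cf f) - phi u (cf f')| ≤ C * (1 / (qd u * qd v)) := by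
        refine (abs_phi_sub_le _ (cf_mem f).1 (cf_mem f').1).trans ?_
        rw [mul_one_div, div_le_div_iff₀ (by positivity) (by positivity)]
        nlinarith [hone f f', mul_le_mul_of_nonneg_right hvu hu.le, mul_pos hu hv]
      have h3 : |phi v (cf g) - phi v (cf g')| ≤ C * (1 / (qd u * qd v)) := by
        refine (abs_phi_sub_le _ (cf_mem g).1 (cf_mem g').1).trans ?_
        rw [mul_one_div, div_le_div_iff₀ (by positivity) (by positivity)]
        nlinarith [hone g g', mul_le_mul_of_nonneg_right huv hv.le, mul_pos hu hv]
      rw [e]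
      refine (abs_add_le _ _).trans ?_
      linarith
    refine (ENNReal.rpow_le_rpow h1 hs.le).trans ?_
    have hu := qd_pos u
    have hv := qd_pos v
    rw [ENNReal.ofReal_rpow_of_nonneg (by positivity) hs.le, pow_zero, mul_one,
      Real.mul_rpow (by positivity) (by positivity), ← Real.mul_rpow hu.le hv.le, one_div,
      Real.inv_rpow (by positivity), neg_mul, Real.rpow_neg (by positivity)]
  | succ k ih =>
    have hZk : 0 ≤ Z ^ k := pow_nonneg hZ0 k
    by_cases hle : qd u ≤ qd v
    · refine (measure_mono (VS_subset_left B B' n m u v)).trans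
        ((measure_biUnion_finset_le _ _).trans ?_)
      refine (Finset.sum_le_sum fun b hb => ih (u ++ b) v ?_ ?_).trans ?_
      · have := hB b hb
        nlinarith [qd_append_le u b, qd_pos u, qd_pos v, qd_pos b]
      · nlinarith [qd_le_append_left u b]
      rw [← ENNReal.ofReal_sum_of_nonneg fun b _ =>
        mul_nonneg (mul_nonneg hC2 (mul_pos (hpos _) (hpos _)).le) hZk]
      refine ENNReal.ofReal_le_ofReal ?_
      rw [← Finset.sum_mul, ← Finset.mul_sum, ← Finset.sum_mul, pow_succ',
        mul_assoc _ _ (Z * Z ^ k), mul_assoc _ _ (Z ^ k)]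
      refine mul_le_mul_of_nonneg_left ?_ hC2
      rw [← mul_assoc _ Z (Z ^ k)]
      refine mul_le_mul_of_nonneg_right ?_ hZk
      calc (∑ b ∈ B, qd (u ++ b) ^ (-2 * s)) * qd v ^ (-2 * s)
          ≤ (∑ b ∈ B, qd u ^ (-2 * s) * qd b ^ (-2 * s)) * qd v ^ (-2 * s) :=
            mul_le_mul_of_nonneg_right (Finset.sum_le_sum fun b _ => hext u b) (hpos v).le
        _ = qd u ^ (-2 * s) * qd v ^ (-2 * s) * ∑ b ∈ B, qd b ^ (-2 * s) := by
            rw [← Finset.mul_sum]; ring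
        _ ≤ _ := mul_le_mul_of_nonneg_left hZ (mul_pos (hpos u) (hpos v)).le
    · push Not at hle
      refine (measure_mono (VS_subset_right B B' n m u v)).trans
        ((measure_biUnion_finset_le _ _).trans ?_)
      refine (Finset.sum_le_sum fun b hb => ih u (v ++ b) ?_ ?_).trans ?_
      · nlinarith [qd_le_append_left v b]
      · have := hB' b hb
        nlinarith [qd_append_le v b, qd_pos u, qd_pos v, qd_pos b]
      rw [← ENNReal.ofReal_sum_of_nonneg fun b _ =>
        mul_nonneg (mul_nonneg hC2 (mul_pos (hpos _) (hpos _)).le) hZk]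
      refine ENNReal.ofReal_le_ofReal ?_
      rw [← Finset.sum_mul, ← Finset.mul_sum, ← Finset.mul_sum, pow_succ',
        mul_assoc _ _ (Z * Z ^ k), mul_assoc _ _ (Z ^ k)]
      refine mul_le_mul_of_nonneg_left ?_ hC2
      rw [← mul_assoc _ Z (Z ^ k)]
      refine mul_le_mul_of_nonneg_right ?_ hZk
      calc qd u ^ (-2 * s) * ∑ b ∈ B', qd (v ++ b) ^ (-2 * s)
          ≤ qd u ^ (-2 * s) * ∑ b ∈ B', qd v ^ (-2 * s) * qd b ^ (-2 * s) :=
            mul_le_mul_of_nonneg_left (Finset.sum_le_sum fun b _ => hext v b) (hpos u).le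
        _ = qd u ^ (-2 * s) * qd v ^ (-2 * s) * ∑ b ∈ B', qd b ^ (-2 * s) := by
            rw [← Finset.mul_sum]; ring
        _ ≤ _ := mul_le_mul_of_nonneg_left hZ' (mul_pos (hpos u) (hpos v)).le

lemma rt_mem_KS {t : ℝ} {θ : ℤ → ℕ} (hθ : θ ∈ Sig t) (n : ℕ) (i : ℤ) :
    rt θ i ∈ KS (LangF t n) n := fun j => by
  rw [shf_rt]; exact mem_LangF.2 ⟨θ, hθ, _, rfl⟩

lemma lf_mem_KS {t : ℝ} {θ : ℤ → ℕ} (hθ : θ ∈ Sig t) (n : ℕ) (i : ℤ) :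
    lf θ i ∈ KS ((LangF t n).image List.reverse) n := fun j => by
  rw [shf_lf, pre_lf]
  exact Finset.mem_image_of_mem _ (mem_LangF.2 ⟨θ, hθ, _, rfl⟩)

lemma sum_image_reverse (B : Finset (List ℕ)) (g : List ℕ → ℝ) (hg : ∀ w, g w.reverse = g w) :
    ∑ w ∈ B.image List.reverse, g w = ∑ w ∈ B, g w := by
  rw [Finset.sum_image fun a _ b _ h => List.reverse_injective h]
  exact Finset.sum_congr rfl fun w _ => hg w

/-- Perron values of a subcritical subshift form a set of small dimension. -/
lemma dimH_lam_Sig_le {t s : ℝ} (hs : 0 < s) (h : Subcrit t s) :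
    dimH ((fun θ => lam θ 0) '' Sig t) ≤ ENNReal.ofReal (2 * s) := by
  obtain ⟨n, hn, hZ⟩ := h
  set B := LangF t n with hBdef
  obtain ⟨C, hC⟩ : ∃ C, ∀ b ∈ B, 2 * qd b ≤ C :=
    ⟨∑ b ∈ B, 2 * qd b, fun b hb =>
      Finset.single_le_sum (f := fun b => 2 * qd b) (fun b _ => by have := qd_pos b; positivity) hb⟩
  have hC' : ∀ b ∈ B, 2 * qd b ≤ max C 1 := fun b hb => (hC b hb).trans (le_max_left _ _)
  have hs2 : 0 < 2 * s := by linarith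
  have hsub : (fun θ => lam θ 0) '' Sig t ⊆
      ⋃ a : ℕ, VS B (B.image List.reverse) n (a + 1) [] [] := by
    rintro _ ⟨θ, hθ, rfl⟩
    refine mem_iUnion.2 ⟨θ 0, _, rt_mem_KS hθ n 1, _, lf_mem_KS hθ n 0, ?_⟩
    simp [lam, phi]
  refine (dimH_mono hsub).trans ?_
  rw [dimH_iUnion]
  refine iSup_le fun a => dimH_le_of_hcont_eq_zero hs2 ?_
  refine eq_zero_of_le_geometric (Zs_nonneg t n s) hZ fun k => hcont_VS_le hs2 _ hC' ?_ le_rfl ?_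
    (Zs_nonneg t n s) k [] [] (by simp) (by simp)
  · intro b hb
    obtain ⟨b', hb', rfl⟩ := Finset.mem_image.1 hb
    rw [qd_reverse]; exact hC' b' hb'
  · rw [sum_image_reverse _ _ fun w => by rw [qd_reverse]]

/-- Extension of a stream to a two-sided sequence, constant on the left. -/
def extz (f : ℕ → ℕ) : ℤ → ℕ := fun i => f i.toNat

/-- `1 / (q_n |q_n α - p_n|)` for `α = cf f`. -/
noncomputable def val (f : ℕ → ℕ) (n : ℕ) : ℝ :=
  1 / cf (shf n f) + qe (pre f n) / qd (pre f n)

lemma val_pos (f : ℕ → ℕ) (n : ℕ) : 0 < val f n := by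
  have h1 := cf_pos (shf n f)
  have h2 := qd_pos (pre f n)
  have h3 := qe_nonneg (pre f n)
  unfold val; positivity

lemma one_le_val (f : ℕ → ℕ) (n : ℕ) : 1 ≤ val f n := by
  have h1 := cf_pos (shf n f)
  have h2 := qd_pos (pre f n)
  have h3 := qe_nonneg (pre f n)
  have h4 : 1 ≤ 1 / cf (shf n f) := by rw [le_div_iff₀ h1]; linarith [cf_lt_one (shf n f)]
  have h5 : 0 ≤ qe (pre f n) / qd (pre f n) := by positivity
  unfold val; linarith

lemma qd_mul_abs_sub (f : ℕ → ℕ) (n : ℕ) :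
    qd (pre f n) * |qd (pre f n) * cf f - pd (pre f n)| = 1 / val f n := by
  have h1 := cf_pos (shf n f)
  have h2 := qd_pos (pre f n)
  have h3 := qe_nonneg (pre f n)
  have h4 : 0 < qe (pre f n) * cf (shf n f) + qd (pre f n) := by positivity
  have e : qd (pre f n) * cf f - pd (pre f n) =
      (-1) ^ (pre f n).length * (cf (shf n f) / (qe (pre f n) * cf (shf n f) + qd (pre f n))) := by
    rw [cf_eq_phi f n, phi_eq _ h1.le, ← wmat_det]
    field_simp; ring
  rw [e, abs_mul, abs_pow, abs_neg, abs_one, one_pow, one_mul, abs_of_pos (by positivity), val]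
  field_simp; ring

lemma exists_nat_qd (f : ℕ → ℕ) (n : ℕ) : ∃ p q : ℕ, qd (pre f n) = q ∧ pd (pre f n) = p := by
  obtain ⟨a, b, c, d, -, h2, -, h4⟩ := exists_nat_wmat (pre f n)
  exact ⟨b, d, h4, h2⟩

lemma tendsto_qd (f : ℕ → ℕ) : Tendsto (fun n => qd (pre f n)) atTop atTop := by
  refine tendsto_atTop_mono (fun n => two_pow_le_qd (pre f n)) ?_
  simp only [pre_length]
  exact (tendsto_pow_atTop_atTop_of_one_lt (one_lt_two)).comp
    (tendsto_atTop_atTop.2 fun b => ⟨2 * b, fun n hn => by omega⟩)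

lemma irrational_cf (f : ℕ → ℕ) : Irrational (cf f) := by
  rintro ⟨r, hr⟩
  obtain ⟨n, hn⟩ := ((tendsto_qd f).eventually_gt_atTop (r.den : ℝ)).exists
  have h := qd_mul_abs_sub f n
  obtain ⟨p, q, hq, hp⟩ := exists_nat_qd f n
  rw [hq] at hn
  rw [hq, hp, ← hr] at h
  have hd : (0 : ℝ) < r.den := by exact_mod_cast r.den_pos
  have hq0 : (0 : ℝ) < q := hd.trans hn
  have hv : 0 < 1 / val f n := one_div_pos.2 (val_pos f n)
  have hne : |(q : ℝ) * (r : ℝ) - p| ≠ 0 := by intro h0; rw [h0, mul_zero] at h; linarith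
  have e : |(q : ℝ) * (r : ℝ) - p| * r.den = |((q * r.num - p * r.den : ℤ) : ℝ)| := by
    rw [← abs_of_pos hd, ← abs_mul]
    congr 1
    have : (r : ℝ) * r.den = r.num := by exact_mod_cast Rat.mul_den_eq_num r
    push_cast; rw [sub_mul, mul_assoc, this]
  have h1 : (1 : ℝ) ≤ |(q : ℝ) * (r : ℝ) - p| * r.den := by
    rw [e]
    have hz : (q * r.num - p * r.den : ℤ) ≠ 0 := by
      intro h0
      rw [h0] at e
      simp only [Int.cast_zero, abs_zero, mul_eq_zero] at e
      exact e.elim hne hd.ne'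
    exact_mod_cast Int.one_le_abs hz
  have h2 : 1 / val f n ≤ 1 := by
    rw [div_le_one (val_pos f n)]; exact one_le_val f n
  nlinarith [abs_nonneg ((q : ℝ) * (r : ℝ) - p)]

lemma distNearestInt_pos {x : ℝ} (hx : Irrational x) : 0 < distNearestInt x := by
  rw [distNearestInt, abs_pos, sub_ne_zero]
  exact fun h => hx ⟨round x, by simpa using h.symm⟩

lemma distNearestInt_le (x : ℝ) (p : ℤ) : distNearestInt x ≤ |x - p| := round_le x p

lemma distNearestInt_add_int (x : ℝ) (p : ℤ) : distNearestInt (x + p) = distNearestInt x := by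
  simp [distNearestInt]

lemma lagrangeVal_add_int (α : ℝ) (m : ℤ) : lagrangeVal (m + α) = lagrangeVal α := by
  unfold lagrangeVal
  congr 1
  ext q
  have : (q : ℝ) * (m + α) = q * α + ((q * m : ℤ) : ℝ) := by push_cast; ring
  rw [this, distNearestInt_add_int]

lemma exists_cf_eq {x : ℝ} (hx : Irrational x) (h0 : 0 < x) (h1 : x < 1) : ∃ f, x = cf f := by
  let G : ℝ → ℝ := fun y => Int.fract y⁻¹
  let y : ℕ → ℝ := fun n => G^[n] x
  have hy : ∀ n, Irrational (y n) ∧ 0 < y n ∧ y n < 1 := by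
    intro n
    induction n with
    | zero => exact ⟨hx, h0, h1⟩
    | succ n ih =>
      have e : y (n + 1) = Int.fract (y n)⁻¹ := Function.iterate_succ_apply' G n x
      have hi : Irrational (Int.fract (y n)⁻¹) := by
        rw [Int.fract]; exact (irrational_inv_iff.2 ih.1).sub_intCast _
      rw [e]
      exact ⟨hi, lt_of_le_of_ne (Int.fract_nonneg _) (fun h => hi.ne_zero h.symm),
        Int.fract_lt_one _⟩
  let f : ℕ → ℕ := fun n => ⌊(y n)⁻¹⌋.toNat - 1
  have hf : ∀ n, y n = 1 / ((f n : ℝ) + 1 + y (n + 1)) := by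
    intro n
    have e : y (n + 1) = Int.fract (y n)⁻¹ := Function.iterate_succ_apply' G n x
    have h1 : (1 : ℤ) ≤ ⌊(y n)⁻¹⌋ := by
      rw [Int.le_floor]; push_cast
      exact (one_lt_inv₀ (hy n).2.1).2 (hy n).2.2 |>.le
    have h2 : ((f n : ℤ)) + 1 = ⌊(y n)⁻¹⌋ := by
      simp only [f]; omega
    have h3 : (f n : ℝ) + 1 = ⌊(y n)⁻¹⌋ := by exact_mod_cast h2
    rw [h3, e, Int.floor_add_fract, one_div, inv_inv]
  have hphi : ∀ n, x = phi (pre f n) (y n) := by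
    intro n
    induction n with
    | zero => simp [pre, phi, y]
    | succ n ih =>
      rw [pre_succ, phi_append]
      have : phi [f n] (y (n + 1)) = y n := by rw [hf n]; simp [phi]
      rw [this]; exact ih
  refine ⟨f, ?_⟩
  have hb : ∀ n, |x - cf f| ≤ 1 / qd (pre f n) := by
    intro n
    nth_rewrite 1 [hphi n]
    rw [cf_eq_phi f n]
    refine (abs_phi_sub_le _ (hy n).2.1.le (cf_pos _).le).trans ?_
    have hq := qd_ge_one (pre f n)
    have h3 : |y n - cf (shf n f)| ≤ 1 := by
      rw [abs_le]; constructor <;> linarith [(hy n).2.1, (hy n).2.2, cf_pos (shf n f),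
        cf_lt_one (shf n f)]
    rw [div_le_div_iff₀ (by positivity) (by positivity)]
    nlinarith
  have hlim : Tendsto (fun n => 1 / qd (pre f n)) atTop (𝓝 0) := by
    simpa [one_div, Function.comp_def] using tendsto_inv_atTop_zero.comp (tendsto_qd f)
  have := ge_of_tendsto' hlim hb
  exact sub_eq_zero.1 (abs_eq_zero.1 (le_antisymm this (abs_nonneg _)))

lemma exists_int_add_cf {α : ℝ} (h : Irrational α) : ∃ (m : ℤ) (f : ℕ → ℕ), α = m + cf f := by
  have hi : Irrational (Int.fract α) := by rw [Int.fract]; exact h.sub_intCast _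
  obtain ⟨f, hf⟩ := exists_cf_eq hi (lt_of_le_of_ne (Int.fract_nonneg _) (fun h => hi.ne_zero h.symm))
    (Int.fract_lt_one _)
  exact ⟨⌊α⌋, f, by rw [← hf, Int.floor_add_fract]⟩

lemma lagrange_term_ge (f : ℕ → ℕ) {n q : ℕ} (hq : qd (pre f n) = q) :
    val f n ≤ 1 / (q * distNearestInt (q * cf f)) := by
  obtain ⟨p, q', hq', hp⟩ := exists_nat_qd f n
  have hqpos : (0 : ℝ) < q := hq ▸ qd_pos _
  have h := qd_mul_abs_sub f n
  rw [hq, hp] at h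
  have h1 := distNearestInt_le (q * cf f) p
  have hirr : Irrational (q * cf f) :=
    (irrational_cf f).natCast_mul (by exact_mod_cast hqpos.ne')
  have h2 := distNearestInt_pos hirr
  rw [le_div_iff₀ (by positivity)]
  have h3 : q * distNearestInt (q * cf f) ≤ 1 / val f n := by
    rw [← h]; push_cast at h1; gcongr
  have := mul_le_mul_of_nonneg_left h3 (val_pos f n).le
  rwa [mul_one_div_cancel (val_pos f n).ne'] at this

lemma eventually_val_lt {f : ℕ → ℕ} {t : ℝ} (h : lagrangeVal (cf f) < ENNReal.ofReal t) :
    ∀ᶠ n in atTop, val f n < t := by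
  have h1 := eventually_lt_of_limsup_lt h
  choose p q hq hp using exists_nat_qd f
  have hqt : Tendsto q atTop atTop := by
    have := tendsto_qd f
    simp only [hq] at this
    exact tendsto_natCast_atTop_iff.1 this
  filter_upwards [hqt.eventually h1] with n hn
  have ht : 0 < t := by
    by_contra h0
    rw [ENNReal.ofReal_of_nonpos (not_lt.1 h0)] at h
    exact not_lt_zero h
  exact (lagrange_term_ge f (hq n)).trans_lt ((ENNReal.ofReal_lt_ofReal_iff ht).1 hn)

lemma abs_val_sub_lam (f : ℕ → ℕ) (n : ℕ) : |val f n - lam (extz f) n| ≤ 1 / 4 ^ (n / 2) := by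
  have h1 : rt (extz f) ((n : ℤ) + 1) = shf (n + 1) f := by
    ext; simp only [rt, extz, shf]; congr 1
  have h2 : pre (lf (extz f) n) n = (pre f n).reverse := by
    rw [pre_lf, sub_self]
    congr 1
    exact pre_congr fun j _ => by simp [rt, extz]
  have h3 : 1 / cf (shf n f) = f n + 1 + cf (shf (n + 1) f) := by
    rw [cf_cons, one_div_one_div, shf_shf]; simp [shf, add_comm]
  have h4 : qe (pre f n) / qd (pre f n) = phi (pre f n).reverse 0 := by
    rw [phi_eq _ le_rfl, qd_reverse, pd_reverse]; simp
  have h5 : lam (extz f) n = f n + 1 + cf (shf (n + 1) f) + cf (lf (extz f) n) := by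
    rw [lam, h1]; simp [extz]
  rw [val, h3, h4, h5, add_sub_add_left_eq_sub, cf_eq_phi (lf (extz f) n) n, h2]
  refine (abs_phi_sub_le _ le_rfl (cf_pos _).le).trans ?_
  have hq := two_pow_le_qd (pre f n).reverse
  rw [List.length_reverse, pre_length] at hq
  have h6 : |0 - cf (shf n (lf (extz f) n))| ≤ 1 := by
    rw [zero_sub, abs_neg, abs_of_pos (cf_pos _)]; exact (cf_lt_one _).le
  have h7 : (4 : ℝ) ^ (n / 2) ≤ qd (pre f n).reverse ^ 2 := by
    rw [show (4 : ℝ) = 2 ^ 2 by norm_num, ← pow_mul, mul_comm, pow_mul]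
    gcongr
  gcongr

lemma tendsto_one_div_four_pow : Tendsto (fun n : ℕ => (1 : ℝ) / 4 ^ (n / 2)) atTop (𝓝 0) := by
  have : Tendsto (fun n : ℕ => (4 : ℝ) ^ (n / 2)) atTop atTop :=
    (tendsto_pow_atTop_atTop_of_one_lt (by norm_num)).comp
      (tendsto_atTop_atTop.2 fun b => ⟨2 * b, fun n hn => by omega⟩)
  simpa [one_div, Function.comp_def] using tendsto_inv_atTop_zero.comp this

lemma eventually_lam_le {f : ℕ → ℕ} {t : ℝ} (h : lagrangeVal (cf f) < ENNReal.ofReal t) :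
    ∀ᶠ n : ℕ in atTop, lam (extz f) n ≤ t := by
  obtain ⟨t0, ht0, ht0', h0⟩ := ENNReal.lt_iff_exists_real_btwn.1 h
  have hlt : t0 < t := ENNReal.ofReal_lt_ofReal_iff'.1 h0 |>.1
  filter_upwards [eventually_val_lt ht0', tendsto_one_div_four_pow.eventually_lt_const
    (sub_pos.2 hlt)] with n h1 h2
  have := (abs_le.1 (abs_val_sub_lam f n)).1
  linarith

lemma exists_digit_bound {f : ℕ → ℕ} {t : ℝ} (h : ∀ᶠ n : ℕ in atTop, lam (extz f) n ≤ t) :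
    ∃ T, ∀ i, extz f i < T := by
  obtain ⟨N, hN⟩ := eventually_atTop.1 h
  refine ⟨⌈t⌉₊ + ∑ i ∈ Finset.range N, (f i + 1), fun i => ?_⟩
  simp only [extz]
  by_cases hi : i.toNat < N
  · have := Finset.single_le_sum (f := fun i => f i + 1) (fun _ _ => by omega)
      (Finset.mem_range.2 hi)
    omega
  · have := lt_ceil_of_lam_le (hN _ (not_lt.1 hi))
    simp only [extz, Int.toNat_natCast] at this
    omega

/-- Subcriticality bounds the dimension of `{α | ℓ(α) < t}`. -/
lemma lagrangeDim_le {t s : ℝ} (hs : 0 < s) (h : Subcrit t s) :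
    lagrangeDim t ≤ ENNReal.ofReal s := by
  obtain ⟨k, hk, hZ⟩ := h
  have hsub : {α : ℝ | Irrational α ∧ lagrangeVal α < ENNReal.ofReal t} ⊆
      ⋃ mu : ℤ × List ℕ, (fun x => mu.1 + phi mu.2 x) '' (cf '' KS (LangF t k) k) := by
    rintro α ⟨hα, hl⟩
    obtain ⟨m, f, rfl⟩ := exists_int_add_cf hα
    rw [lagrangeVal_add_int] at hl
    have h1 := eventually_lam_le hl
    obtain ⟨T, hT⟩ := exists_digit_bound h1
    obtain ⟨N, hN⟩ := eventually_atTop.1 (eventually_block_mem hT h1 k)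
    refine mem_iUnion.2 ⟨(m, pre f N), _, ⟨shf N f, fun j => ?_, rfl⟩, ?_⟩
    · convert hN (N + j * k) (by omega) using 1
      rw [shf_shf]
      exact pre_congr fun i _ => by simp only [shf, rt, extz]; congr 1
    · simp only [← cf_eq_phi]
  refine (dimH_mono hsub).trans ?_
  rw [dimH_iUnion]
  exact iSup_le fun mu => dimH_phi_le hs _ _ hZ

lemma convergent_cf (f : ℕ → ℕ) (m : ℤ) (n : ℕ) :
    (((m + cf f).convergent n : ℚ) : ℝ) = m + phi (pre f n) 0 := by
  induction n generalizing f m with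
  | zero =>
    have : ⌊(m : ℝ) + cf f⌋ = m := by
      rw [Int.floor_intCast_add, Int.floor_eq_zero_iff.2 ⟨(cf_pos f).le, cf_lt_one f⟩, add_zero]
    simp [Real.convergent_zero, this, pre, phi]
  | succ n ih =>
    have h0 : ⌊(m : ℝ) + cf f⌋ = m := by
      rw [Int.floor_intCast_add, Int.floor_eq_zero_iff.2 ⟨(cf_pos f).le, cf_lt_one f⟩, add_zero]
    have h1 : Int.fract ((m : ℝ) + cf f) = cf f := by rw [Int.fract, h0]; ring
    have h2 : (cf f)⁻¹ = (((f 0 : ℤ) + 1 : ℤ) : ℝ) + cf (shf 1 f) := by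
      rw [cf_cons f, one_div, inv_inv]; push_cast; ring
    rw [Real.convergent_succ, h0, h1, h2, pre_succ']
    push_cast [ih]
    simp only [phi]
    rw [one_div]
    have := ih (shf 1 f) ((f 0 : ℤ) + 1)
    push_cast at this
    rw [this]

lemma lagrangeVal_le {f : ℕ → ℕ} {c : ℝ} (hc : 2 ≤ c) (h : ∀ᶠ n in atTop, val f n ≤ c) :
    lagrangeVal (cf f) ≤ ENNReal.ofReal c := by
  refine limsup_le_of_le (h := ?_)
  obtain ⟨N, hN⟩ := eventually_atTop.1 h
  -- distance to the first `N` convergents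
  obtain ⟨d, hd, hdist⟩ : ∃ d > 0, ∀ n < N, d ≤ |cf f - phi (pre f n) 0| := by
    clear h hN
    induction N with
    | zero => exact ⟨1, one_pos, fun n hn => absurd hn (by omega)⟩
    | succ N ih =>
      obtain ⟨d, hd, h⟩ := ih
      have hpos : 0 < |cf f - phi (pre f N) 0| := by
        rw [abs_pos, sub_ne_zero]
        intro h0
        have := convergent_cf f 0 N
        simp only [Int.cast_zero, zero_add] at this
        exact irrational_cf f ⟨_, this.trans h0.symm⟩
      refine ⟨min d _, lt_min hd hpos, fun n hn => ?_⟩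
      rcases Nat.lt_succ_iff_lt_or_eq.1 hn with h' | rfl
      · exact (min_le_left _ _).trans (h n h')
      · exact min_le_right _ _
  obtain ⟨Q, hQ⟩ := exists_nat_gt (1 / d)
  filter_upwards [eventually_ge_atTop (Q + 1)] with q hq
  refine ENNReal.ofReal_le_ofReal ?_
  have hq1 : (1 : ℝ) ≤ q := by exact_mod_cast (by omega : 1 ≤ q)
  have hq0 : (0 : ℝ) < q := by linarith
  have hirr : Irrational (q * cf f) := (irrational_cf f).natCast_mul (by omega)
  have hdp := distNearestInt_pos hirr
  by_contra! hlt
  have hlt1 : c * (q * distNearestInt (q * cf f)) < 1 := by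
    rwa [lt_div_iff₀ (by positivity)] at hlt
  set p := round ((q : ℝ) * cf f) with hp
  have hdn : distNearestInt (q * cf f) = |q * cf f - p| := rfl
  set r : ℚ := (p : ℚ) / (q : ℚ) with hr
  have hrR : (r : ℝ) = p / q := by rw [hr]; push_cast; rfl
  have hden : (r.den : ℝ) ≤ q := by
    have : (r.den : ℤ) ∣ q := by
      rw [hr]; exact_mod_cast Rat.den_dvd p q
    exact_mod_cast Int.le_of_dvd (by omega) this
  have hden0 : (0 : ℝ) < r.den := by exact_mod_cast r.den_pos
  have hsub : cf f - r = (q * cf f - p) / q := by rw [hrR]; field_simp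
  have habs : |cf f - r| = distNearestInt (q * cf f) / q := by
    rw [hsub, abs_div, abs_of_pos hq0, hdn]
  have hqd : q * distNearestInt (q * cf f) < 1 / 2 := by nlinarith [mul_pos hq0 hdp]
  have hqq : |cf f - r| * q ^ 2 < 1 / 2 := by rw [habs]; field_simp; linarith
  obtain ⟨n, hn⟩ := Real.exists_rat_eq_convergent (ξ := cf f) (q := r) (by
    rw [lt_div_iff₀ (by positivity)]
    have : |cf f - r| * (r.den : ℝ) ^ 2 ≤ |cf f - r| * q ^ 2 := by gcongr
    linarith)
  have hrphi : (r : ℝ) = phi (pre f n) 0 := by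
    have := convergent_cf f 0 n
    simp only [Int.cast_zero, zero_add] at this
    rw [hn]; exact this
  have hnN : N ≤ n := by
    by_contra! hlt'
    have h1 := hdist n hlt'
    rw [← hrphi] at h1
    have h2 : (Q : ℝ) + 1 ≤ q := by exact_mod_cast hq
    have h3 : 1 < d * q := by
      rw [div_lt_iff₀ hd] at hQ
      nlinarith
    nlinarith [mul_le_mul_of_nonneg_right h1 (by positivity : (0 : ℝ) ≤ q ^ 2)]
  have hv := hN n hnN
  -- the reduced fraction is `pd / qd`
  have hw := qd_mul_abs_sub f n
  obtain ⟨P, K, hK, hP⟩ := exists_nat_qd f n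
  have hdet := wmat_det (pre f n)
  obtain ⟨a, b, c', e, ha, hb, hc', he⟩ := exists_nat_wmat (pre f n)
  have hKe : (K : ℕ) = e := by exact_mod_cast hK.symm.trans he
  have hKpos : (0 : ℝ) < K := hK ▸ qd_pos _
  have hPK : (r : ℝ) = P / K := by
    rw [hrphi, phi_eq _ le_rfl, hK, hP]; simp
  have hcop : IsCoprime (P : ℤ) (K : ℤ) := by
    have hbP : b = P := by exact_mod_cast hb.symm.trans hP
    rw [ha, hb, hc', he] at hdet
    have hz : (a * e - b * c' : ℤ) = (-1) ^ (pre f n).length := by exact_mod_cast hdet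
    rw [hKe, ← hbP]
    rcases neg_one_pow_eq_or ℤ (pre f n).length with h1 | h1 <;> rw [h1] at hz
    · exact ⟨-c', a, by linear_combination hz⟩
    · exact ⟨c', -a, by linear_combination -hz⟩
  have hKdvd : (K : ℤ) ∣ q := by
    have h1 : (P : ℝ) * q = p * K := by
      have := hPK.symm.trans hrR
      field_simp at this
      linarith
    have h2 : (P : ℤ) * q = p * K := by exact_mod_cast h1
    exact hcop.symm.dvd_of_dvd_mul_left ⟨p, by linarith⟩
  have hKq : (K : ℝ) ≤ q := by exact_mod_cast Int.le_of_dvd (by omega) hKdvd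
  have hKv : |cf f - r| * K ^ 2 = 1 / val f n := by
    rw [← hw, hK, hP, hPK, ← abs_of_pos hKpos, abs_of_pos hKpos, sq, ← mul_assoc]
    nth_rewrite 2 [← abs_of_pos hKpos]
    rw [← abs_mul]
    rw [sub_mul, div_mul_cancel₀ _ hKpos.ne', mul_comm, mul_comm (cf f)]
  have h1 : 1 / c ≤ 1 / val f n := one_div_le_one_div_of_le (val_pos f n) hv
  have h2 : |cf f - r| * (K : ℝ) ^ 2 ≤ |cf f - r| * q ^ 2 := by gcongr
  have h3 : |cf f - r| * q ^ 2 = q * distNearestInt (q * cf f) := by rw [habs]; field_simp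
  have h4 : 1 ≤ c * (q * distNearestInt (q * cf f)) := by
    rw [← h3]
    have := h1.trans (hKv.symm.le.trans h2)
    rwa [div_le_iff₀' (by linarith)] at this
  linarith

/-- The value `ℓ(cf f)` is the upper limit of the Perron values, once this is at least `2`. -/
lemma lagrangeVal_eq {f : ℕ → ℕ} {v : ℝ} (hv : 2 ≤ v)
    (h1 : ∀ ε > 0, ∀ᶠ n : ℕ in atTop, lam (extz f) n ≤ v + ε)
    (h2 : ∀ ε > 0, ∃ᶠ n : ℕ in atTop, v - ε ≤ lam (extz f) n) :
    lagrangeVal (cf f) = ENNReal.ofReal v := by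
  apply le_antisymm
  · refine ENNReal.le_of_forall_pos_le_add fun ε hε _ => ?_
    have hε' : (0 : ℝ) < ε := hε
    refine (lagrangeVal_le (c := v + ε) (by linarith) ?_).trans ?_
    · filter_upwards [h1 (ε / 2) (by positivity), tendsto_one_div_four_pow.eventually_lt_const
        (half_pos hε')] with n h3 h4
      have := (abs_le.1 (abs_val_sub_lam f n)).2
      linarith
    · rw [ENNReal.ofReal_add (by linarith) hε'.le, ENNReal.ofReal_coe_nnreal]
  · by_contra! hlt
    obtain ⟨t0, ht0, ht0', h0⟩ := ENNReal.lt_iff_exists_real_btwn.1 hlt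
    have hlt' : t0 < v := ENNReal.ofReal_lt_ofReal_iff'.1 h0 |>.1
    have h3 := eventually_val_lt ht0'
    obtain ⟨n, hn, hn1, hn2⟩ := ((h2 ((v - t0) / 2) (by linarith)).and_eventually (h3.and
      (tendsto_one_div_four_pow.eventually_lt_const (half_pos (sub_pos.2 hlt'))))).exists
    have := (abs_le.1 (abs_val_sub_lam f n)).1
    linarith

/-- The form `(x - ξ y) (x - η y)` has Markov value at most `m`. -/
def RootBound (ξ η m : ℝ) : Prop :=
  ∀ x y : ℤ, (x, y) ≠ (0, 0) → |ξ - η| ≤ m * |(x - ξ * y) * (x - η * y)|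

lemma RootBound.symm {ξ η m : ℝ} (h : RootBound ξ η m) : RootBound η ξ m := fun x y hxy => by
  rw [abs_sub_comm, mul_comm ((x : ℝ) - η * y)]; exact h x y hxy

lemma RootBound.add_int {ξ η m : ℝ} (h : RootBound ξ η m) (k : ℤ) :
    RootBound (ξ + k) (η + k) m := fun x y hxy => by
  have := h (x - k * y) y (by
    rintro h0
    simp only [Prod.mk.injEq] at h0
    obtain ⟨h1, rfl⟩ := h0
    exact hxy (by simpa using h1))
  push_cast at this
  convert this using 2
  · ring
  · congr 1; ring

lemma RootBound.irrational {ξ η m : ℝ} (h : RootBound ξ η m) (hne : ξ ≠ η) : Irrational ξ := by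
  rintro ⟨r, rfl⟩
  have h1 := h r.num r.den (by simp)
  have h2 : (r.num : ℝ) - r * (r.den : ℤ) = 0 := by
    have : (r : ℝ) * r.den = r.num := by exact_mod_cast Rat.mul_den_eq_num r
    push_cast; linarith
  rw [h2, zero_mul, abs_zero, mul_zero] at h1
  exact hne (sub_eq_zero.1 (abs_eq_zero.1 (le_antisymm h1 (abs_nonneg _))))

lemma rootBound_inv_iff {ξ η m : ℝ} {k : ℤ} (hξ : ξ - k ≠ 0) (hη : η - k ≠ 0) :
    RootBound (1 / (ξ - k)) (1 / (η - k)) m ↔ RootBound ξ η m := by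
  have hpos : 0 < |(ξ - k) * (η - k)| := abs_pos.2 (mul_ne_zero hξ hη)
  have key : ∀ x y : ℤ, (|1 / (ξ - k) - 1 / (η - k)| ≤
      m * |(x - 1 / (ξ - k) * y) * (x - 1 / (η - k) * y)|) ↔
      (|ξ - η| ≤ m * |((k * x + y : ℤ) - ξ * x) * ((k * x + y : ℤ) - η * x)|) := by
    intro x y
    have e1 : 1 / (ξ - k) - 1 / (η - k) = -(ξ - η) / ((ξ - k) * (η - k)) := by
      field_simp; ring
    have e2 : (x - 1 / (ξ - k) * y) * (x - 1 / (η - k) * y) =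
        (((k * x + y : ℤ) - ξ * x) * ((k * x + y : ℤ) - η * x)) / ((ξ - k) * (η - k)) := by
      push_cast; field_simp; ring
    rw [e1, e2, abs_div, abs_div, abs_neg, ← mul_div_assoc, div_le_div_iff_of_pos_right hpos]
  constructor
  · intro h x y hxy
    have := (key y (x - k * y)).1 (h _ _ (by
      rintro h0
      simp only [Prod.mk.injEq] at h0
      obtain ⟨rfl, h1⟩ := h0
      exact hxy (by simpa using h1)))
    simpa using this
  · intro h x y hxy
    refine (key x y).2 (h _ _ ?_)
    rintro h0
    simp only [Prod.mk.injEq] at h0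
    obtain ⟨h1, rfl⟩ := h0
    exact hxy (by simpa using h1)

/-- The reduced roots attached to a position of a two-sided sequence. -/
noncomputable def xiAt (θ : ℤ → ℕ) (i : ℤ) : ℝ := θ i + 1 + cf (rt θ (i + 1))

lemma rootBound_step (θ : ℤ → ℕ) (m : ℝ) (i : ℤ) :
    RootBound (xiAt θ (i + 1)) (-cf (lf θ (i + 1))) m ↔ RootBound (xiAt θ i) (-cf (lf θ i)) m := by
  have h1 := cf_pos (rt θ (i + 1))
  have h2 := cf_pos (lf θ i)
  have e1 : xiAt θ (i + 1) = 1 / (xiAt θ i - ((θ i + 1 : ℕ) : ℤ)) := by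
    have : cf (rt θ (i + 1)) = 1 / xiAt θ (i + 1) := by
      rw [cf_cons, shf_rt, xiAt]; simp [rt]
    have e : xiAt θ i - ((θ i + 1 : ℕ) : ℤ) = cf (rt θ (i + 1)) := by
      rw [xiAt]; push_cast; ring
    rw [e, this, one_div_one_div]
  have e2 : -cf (lf θ (i + 1)) = 1 / (-cf (lf θ i) - ((θ i + 1 : ℕ) : ℤ)) := by
    have : cf (lf θ (i + 1)) = 1 / (θ i + 1 + cf (lf θ i)) := by
      rw [cf_cons, shf_lf]; simp [lf]
    have h3 : (-cf (lf θ i) - ((θ i + 1 : ℕ) : ℤ)) = -(θ i + 1 + cf (lf θ i)) := by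
      push_cast; ring
    rw [this, h3, div_neg]
  rw [e1, e2]
  refine rootBound_inv_iff ?_ ?_
  · have e : xiAt θ i - ((θ i + 1 : ℕ) : ℤ) = cf (rt θ (i + 1)) := by
      rw [xiAt]; push_cast; ring
    rw [e]; exact h1.ne'
  · have h3 : (-cf (lf θ i) - ((θ i + 1 : ℕ) : ℤ)) = -(θ i + 1 + cf (lf θ i)) := by
      push_cast; ring
    rw [h3, neg_ne_zero]; positivity

lemma mem_Sig_of_rootBound {θ : ℤ → ℕ} {m : ℝ} (h : RootBound (xiAt θ 0) (-cf (lf θ 0)) m) :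
    θ ∈ Sig m := by
  have hall : ∀ i, RootBound (xiAt θ i) (-cf (lf θ i)) m := by
    intro i
    induction i using Int.induction_on with
    | zero => exact h
    | succ i ih => exact (rootBound_step θ m i).2 ih
    | pred i ih =>
      have := rootBound_step θ m (-(i : ℤ) - 1)
      rw [sub_add_cancel] at this
      exact this.1 ih
  intro i
  have h1 := hall i 1 0 (by simp)
  have e : xiAt θ i - -cf (lf θ i) = lam θ i := by rw [xiAt, lam]; ring
  rw [e] at h1
  simpa using (le_abs_self _).trans h1

lemma exists_theta_of_rootBound {ξ η m : ℝ} (h : RootBound ξ η m) (hξ : 1 < ξ) (hη : -1 < η)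
    (hη0 : η < 0) : ∃ θ ∈ Sig m, lam θ 0 = ξ - η := by
  have hne : ξ ≠ η := by linarith [hξ, hη0] |> fun h : η < ξ => h.ne'
  have hξi := h.irrational hne
  have hηi := h.symm.irrational hne.symm
  obtain ⟨m', f, rfl⟩ := exists_int_add_cf hξi
  obtain ⟨g, hg⟩ := exists_cf_eq (x := -η) hηi.neg (by linarith) (by linarith)
  have hm' : 1 ≤ m' := by
    have := cf_lt_one f
    have h0 : (0 : ℝ) < m' := by linarith
    exact_mod_cast h0
  obtain ⟨a, rfl⟩ : ∃ a : ℕ, m' = a + 1 := ⟨(m' - 1).toNat, by omega⟩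
  let θ : ℤ → ℕ := fun i => if i = 0 then a else if 0 < i then f (i - 1).toNat else g (-1 - i).toNat
  have hr : rt θ (0 + 1) = f := by
    ext j
    simp only [rt, θ]
    rw [if_neg (by omega), if_pos (by omega)]
    congr 1; omega
  have hl : lf θ 0 = g := by
    ext j
    simp only [lf, θ]
    rw [if_neg (by omega), if_neg (by omega)]
    congr 1; omega
  have h0 : θ 0 = a := by simp [θ]
  refine ⟨θ, mem_Sig_of_rootBound ?_, ?_⟩
  · rw [xiAt, hr, hl, h0, ← hg, neg_neg]
    convert h using 1; push_cast; ring
  · rw [lam, hr, hl, h0, ← hg]; push_cast; ring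

/-- Root bounds force a Markov value larger than `2`. -/
lemma two_lt_of_rootBound {y v m : ℝ} (hy : 0 < y) (hy1 : y < 1) (hv : 0 < v) (hm : 0 < m)
    (h : RootBound (v - y) (-y) m) (hvm : m / 2 < v) : 2 < m := by
  by_contra! hm2
  have e : v - y - -y = v := by ring
  have h1 := h 1 0 (by simp)
  have h0 := h 0 1 (by simp)
  have h2 := h (-1) 1 (by simp)
  rw [e, abs_of_pos hv] at h0 h1 h2
  have h1' : v ≤ m := by simpa using h1
  have e0 : ((0 : ℤ) - (v - y) * (1 : ℤ)) * ((0 : ℤ) - -y * (1 : ℤ)) = -((v - y) * y) := by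
    push_cast; ring
  have e2 : ((-1 : ℤ) - (v - y) * (1 : ℤ)) * ((-1 : ℤ) - -y * (1 : ℤ)) =
      (1 + (v - y)) * (1 - y) := by push_cast; ring
  rw [e0, abs_neg] at h0
  rw [e2] at h2
  rcases le_or_gt 0 (v - y) with hξ | hξ
  · rw [abs_of_nonneg (by positivity)] at h0
    have h3 : v ≤ 2 * ((v - y) * y) := h0.trans (by gcongr)
    have h4 : (v - 2 * y) ^ 2 ≤ 0 := by nlinarith
    have h5 : v - 2 * y = 0 := by nlinarith [sq_nonneg (v - 2 * y)]
    nlinarith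
  · have h3 : |(v - y) * y| = (y - v) * y := by
      rw [abs_of_nonpos (by nlinarith)]; ring
    rw [h3] at h0
    rw [abs_of_nonneg (mul_nonneg (by linarith) (by linarith))] at h2
    have h4 : v * v ≤ (m * ((y - v) * y)) * (m * ((1 + (v - y)) * (1 - y))) :=
      mul_le_mul h0 h2 hv.le (hv.le.trans h0)
    have h5 : (y - v) * (1 + (v - y)) ≤ 1 / 4 := by nlinarith [sq_nonneg (y - v - 1 / 2)]
    have h6 : y * (1 - y) ≤ 1 / 4 := by nlinarith [sq_nonneg (y - 1 / 2)]
    have h7 : ((y - v) * (1 + (v - y))) * (y * (1 - y)) ≤ 1 / 4 * (1 / 4) :=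
      mul_le_mul h5 h6 (mul_nonneg hy.le (by linarith)) (by norm_num)
    have h8 : v * v ≤ m * m * (1 / 16) := by
      have e : (m * ((y - v) * y)) * (m * ((1 + (v - y)) * (1 - y))) =
        m * m * (((y - v) * (1 + (v - y))) * (y * (1 - y))) := by ring
      rw [e] at h4
      nlinarith [mul_pos hm hm]
    nlinarith

lemma exists_theta_of_rootBound' {ξ η m m' : ℝ} (h : RootBound ξ η m) (hne : ξ ≠ η)
    (hm : 0 < m) (hm2 : m / 2 ≤ m') (hm3 : 2 < m → 2 ≤ m') (hlt : m' < |ξ - η|) :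
    ∃ θ ∈ Sig m, lam θ 0 = |ξ - η| := by
  wlog hle : η < ξ generalizing ξ η
  · rw [abs_sub_comm] at hlt ⊢
    exact this h.symm hne.symm hlt (lt_of_le_of_ne (not_lt.1 hle) hne)
  have hirr := h.symm.irrational hne.symm
  have hv : 0 < ξ - η := sub_pos.2 hle
  rw [abs_of_pos hv] at hlt ⊢
  -- translate the smaller root into `(-1, 0)`
  set k : ℤ := -⌊η⌋ - 1 with hk
  have hk' : (k : ℝ) = -⌊η⌋ - 1 := by rw [hk]; push_cast; ring
  have h1 : -1 < η + k := by
    have : (⌊η⌋ : ℝ) < η := lt_of_le_of_ne (Int.floor_le η) (fun h => hirr ⟨⌊η⌋, by simpa using h⟩)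
    rw [hk']; linarith
  have h2 : η + k < 0 := by rw [hk']; linarith [Int.lt_floor_add_one η]
  have hb := h.add_int k
  have hb' : RootBound ((ξ - η) - -(η + k)) (- -(η + k)) m := by
    convert hb using 1 <;> ring
  have h3 := two_lt_of_rootBound (by linarith) (by linarith) hv hm hb' (by linarith)
  obtain ⟨θ, hθ, hl⟩ := exists_theta_of_rootBound hb (by linarith [hm3 h3]) h1 h2
  exact ⟨θ, hθ, by rw [hl]; ring⟩

lemma exists_root_bound_of_form {a b c m : ℝ} (hΔ : 0 < b ^ 2 - 4 * a * c)
    (h : ∀ x y : ℤ, (x, y) ≠ (0, 0) →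
      √(b ^ 2 - 4 * a * c) ≤ m * |a * (x : ℝ) ^ 2 + b * x * y + c * (y : ℝ) ^ 2|) :
    ∃ ξ η : ℝ, RootBound ξ η m ∧ |ξ - η| = √(b ^ 2 - 4 * a * c) / |a| ∧ ξ ≠ η := by
  set D := √(b ^ 2 - 4 * a * c) with hD
  have hD0 : 0 < D := Real.sqrt_pos.2 hΔ
  have hD2 : D ^ 2 = b ^ 2 - 4 * a * c := Real.sq_sqrt hΔ.le
  have ha : a ≠ 0 := by
    rintro rfl
    have := h 1 0 (by simp)
    simp at this
    linarith
  have e : (-b + D) / (2 * a) - (-b - D) / (2 * a) = D / a := by field_simp; ring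
  have he : |(-b + D) / (2 * a) - (-b - D) / (2 * a)| = D / |a| := by
    rw [e, abs_div, abs_of_pos hD0]
  have ha' : 0 < |a| := abs_pos.2 ha
  refine ⟨(-b + D) / (2 * a), (-b - D) / (2 * a), fun x y hxy => ?_, he, fun h0 => ?_⟩
  · rw [he, div_le_iff₀ ha']
    refine (h x y hxy).trans_eq ?_
    have e3 : a * (x : ℝ) ^ 2 + b * x * y + c * (y : ℝ) ^ 2 =
        ((x - (-b + D) / (2 * a) * y) * (x - (-b - D) / (2 * a) * y)) * a := by
      field_simp
      linear_combination ((y : ℝ) ^ 2) * hD2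
    rw [e3, abs_mul, mul_assoc]
  · rw [h0, sub_self, eq_comm, div_eq_zero_iff] at e
    exact e.elim hD0.ne' ha

lemma exists_theta_of_form {a b c m m' : ℝ} (hΔ : 0 < b ^ 2 - 4 * a * c) (hm' : 0 < m')
    (h : ∀ x y : ℤ, (x, y) ≠ (0, 0) →
      √(b ^ 2 - 4 * a * c) ≤ m * |a * (x : ℝ) ^ 2 + b * x * y + c * (y : ℝ) ^ 2|)
    (hm : 0 < m) (hm2 : m / 2 ≤ m') (hm3 : 2 < m → 2 ≤ m') {p q : ℤ} (hpq : (p, q) ≠ (0, 0))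
    (hlt : m' * |a * (p : ℝ) ^ 2 + b * p * q + c * (q : ℝ) ^ 2| < √(b ^ 2 - 4 * a * c)) :
    ∃ θ ∈ Sig m, m' < lam θ 0 := by
  -- make the vector primitive
  obtain ⟨p, q, u, v, huv, hlt⟩ : ∃ p q u v : ℤ, p * v - u * q = 1 ∧
      m' * |a * (p : ℝ) ^ 2 + b * p * q + c * (q : ℝ) ^ 2| < √(b ^ 2 - 4 * a * c) := by
    have hg : 0 < Int.gcd p q := Int.gcd_pos_iff.2 (by
      by_contra! h0; exact hpq (by rw [h0.1, h0.2]))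
    obtain ⟨p', q', hcop, hp, hq⟩ := Int.exists_gcd_one hg
    set g := Int.gcd p q
    have hcop' : IsCoprime p' q' := Int.isCoprime_iff_gcd_eq_one.2 hcop
    obtain ⟨r, s, hrs⟩ := hcop'
    refine ⟨p', q', -s, r, by linarith, lt_of_le_of_lt ?_ hlt⟩
    refine mul_le_mul_of_nonneg_left ?_ hm'.le
    have e : a * (p : ℝ) ^ 2 + b * p * q + c * (q : ℝ) ^ 2 =
        (a * (p' : ℝ) ^ 2 + b * p' * q' + c * (q' : ℝ) ^ 2) * (g : ℝ) ^ 2 := by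
      rw [hp, hq]; push_cast; ring
    have hg1 : (1 : ℝ) ≤ (g : ℝ) ^ 2 := by
      have : (1 : ℝ) ≤ g := by exact_mod_cast hg
      nlinarith
    rw [e, abs_mul, abs_of_nonneg (by positivity : (0 : ℝ) ≤ (g : ℝ) ^ 2)]
    exact le_mul_of_one_le_right (abs_nonneg _) hg1
  have hdet : (p * v - u * q : ℝ) = 1 := by exact_mod_cast huv
  -- change basis
  set A := a * (p : ℝ) ^ 2 + b * p * q + c * (q : ℝ) ^ 2 with hA
  set B := 2 * a * p * u + b * (p * v + u * q) + 2 * c * q * v with hB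
  set C := a * (u : ℝ) ^ 2 + b * u * v + c * (v : ℝ) ^ 2 with hC
  have hdisc : B ^ 2 - 4 * A * C = b ^ 2 - 4 * a * c := by
    have : B ^ 2 - 4 * A * C = (b ^ 2 - 4 * a * c) * (p * v - u * q) ^ 2 := by
      rw [hA, hB, hC]; ring
    rw [this, hdet]; ring
  obtain ⟨ξ, η, hb, he, hne⟩ := exists_root_bound_of_form (a := A) (b := B) (c := C) (m := m)
    (by rw [hdisc]; exact hΔ) (by
      intro x y hxy
      rw [hdisc]
      have := h (p * x + u * y) (q * x + v * y) (by
        rintro h0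
        simp only [Prod.mk.injEq] at h0
        obtain ⟨h1, h2⟩ := h0
        have hx : x = 0 := by linear_combination v * h1 - u * h2 - x * huv
        have hy : y = 0 := by linear_combination p * h2 - q * h1 - y * huv
        exact hxy (by rw [hx, hy]))
      refine this.trans_eq ?_
      congr 2
      rw [hA, hB, hC]; push_cast; ring)
  rw [hdisc] at he
  have hA0 : 0 < |A| := by
    rw [abs_pos]
    rintro h0
    rw [h0, abs_zero, div_zero] at he
    exact hne (sub_eq_zero.1 (abs_eq_zero.1 he))
  have hlt' : m' < |ξ - η| := by rw [he, lt_div_iff₀ hA0]; exact hlt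
  obtain ⟨θ, hθ, hl⟩ := exists_theta_of_rootBound' hb hne hm hm2 hm3 hlt'
  exact ⟨θ, hθ, by rw [hl]; exact hlt'⟩

/-- Each Markov value is attained as a Perron value of a sequence of the subshift. -/
lemma markovSpectrum_subset {m : ℝ} (hm : m ∈ MarkovSpectrum) :
    m ∈ (fun θ => lam θ 0) '' Sig m := by
  obtain ⟨a, b, c, hΔ, hfin, hval⟩ := hm
  have hD0 : 0 < √(b ^ 2 - 4 * a * c) := Real.sqrt_pos.2 hΔ
  have hne : ∀ x y : ℤ, (x, y) ≠ (0, 0) →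
      0 < |a * (x : ℝ) ^ 2 + b * x * y + c * (y : ℝ) ^ 2| := by
    intro x y hxy
    rw [abs_pos]
    intro h0
    refine hfin (top_le_iff.1 ?_)
    have : (⊤ : ℝ≥0∞) = ENNReal.ofReal (√(b ^ 2 - 4 * a * c)) /
        ENNReal.ofReal |a * (x : ℝ) ^ 2 + b * x * y + c * (y : ℝ) ^ 2| := by
      rw [h0, abs_zero, ENNReal.ofReal_zero, ENNReal.div_zero]
      simpa using hD0
    rw [this]
    exact le_iSup₂_of_le (x, y) hxy le_rfl
  have hm0 : ENNReal.ofReal m = markovVal a b c := by rw [← hval, ENNReal.ofReal_toReal hfin]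
  have hmnn : 0 ≤ m := hval ▸ ENNReal.toReal_nonneg
  have hle : ∀ x y : ℤ, (x, y) ≠ (0, 0) →
      √(b ^ 2 - 4 * a * c) ≤ m * |a * (x : ℝ) ^ 2 + b * x * y + c * (y : ℝ) ^ 2| := by
    intro x y hxy
    have h1 : ENNReal.ofReal (√(b ^ 2 - 4 * a * c)) /
        ENNReal.ofReal |a * (x : ℝ) ^ 2 + b * x * y + c * (y : ℝ) ^ 2| ≤ ENNReal.ofReal m := by
      rw [hm0]; exact le_iSup₂_of_le (f := fun (pq : ℤ × ℤ) (_ : pq ≠ (0, 0)) =>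
        ENNReal.ofReal (√(b ^ 2 - 4 * a * c)) /
        ENNReal.ofReal |a * (pq.1 : ℝ) ^ 2 + b * pq.1 * pq.2 + c * (pq.2 : ℝ) ^ 2|) (x, y) hxy le_rfl
    rw [← ENNReal.ofReal_div_of_pos (hne x y hxy), ENNReal.ofReal_le_ofReal_iff hmnn,
      div_le_iff₀ (hne x y hxy)] at h1
    exact h1
  have hmpos : 0 < m := by
    have := hle 1 0 (by simp)
    have h2 := hne 1 0 (by simp)
    by_contra! h0
    nlinarith
  have hex : ∀ m', m' < m → ∃ θ ∈ Sig m, m' < lam θ 0 := by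
    intro m'' hm''
    obtain ⟨m', hm'1, hm'2, hm'3, hm'4⟩ : ∃ m', m'' ≤ m' ∧ m' < m ∧ m / 2 ≤ m' ∧
        (2 < m → 2 ≤ m') := by
      by_cases h2 : 2 < m
      · exact ⟨max (max m'' (m / 2)) 2, by simp, by
          simp only [max_lt_iff]; exact ⟨⟨hm'', by linarith⟩, h2⟩, by simp, by simp⟩
      · exact ⟨max m'' (m / 2), by simp, by
          simp only [max_lt_iff]; exact ⟨hm'', by linarith⟩, by simp, fun h => absurd h h2⟩
    have hlt : ENNReal.ofReal m' < markovVal a b c := by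
      rw [← hm0]; exact (ENNReal.ofReal_lt_ofReal_iff hmpos).2 hm'2
    rw [markovVal, lt_iSup_iff] at hlt
    obtain ⟨⟨p, q⟩, hlt⟩ := hlt
    rw [lt_iSup_iff] at hlt
    obtain ⟨hpq, hlt⟩ := hlt
    rw [← ENNReal.ofReal_div_of_pos (hne p q hpq)] at hlt
    have h3 := (ENNReal.ofReal_lt_ofReal_iff'.1 hlt).1
    rw [lt_div_iff₀ (hne p q hpq)] at h3
    obtain ⟨θ, hθ, hl⟩ := exists_theta_of_form hΔ (by linarith) hle hmpos hm'3 hm'4 hpq h3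
    exact ⟨θ, hθ, hm'1.trans_lt hl⟩
  have hcomp : IsCompact ((fun θ => lam θ 0) '' Sig m) :=
    (isCompact_Sig m).image (continuous_lam 0)
  refine hcomp.isClosed.closure_subset (Metric.mem_closure_iff.2 fun ε hε => ?_)
  obtain ⟨θ, hθ, hl⟩ := hex (m - ε) (by linarith)
  refine ⟨_, ⟨θ, hθ, rfl⟩, ?_⟩
  have := hθ 0
  rw [Real.dist_eq, abs_lt]; constructor <;> simp only <;> linarith

/-- Subcriticality bounds the dimension of the Markov spectrum below `t`. -/
lemma dimH_markov_le {t s : ℝ} (hs : 0 < s) (h : Subcrit t s) :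
    dimH (MarkovSpectrum ∩ Iio t) ≤ ENNReal.ofReal (2 * s) := by
  refine (dimH_mono ?_).trans (dimH_lam_Sig_le hs h)
  rintro m ⟨hm, hmt⟩
  obtain ⟨θ, hθ, h⟩ := markovSpectrum_subset hm
  exact ⟨θ, Sig_mono (le_of_lt hmt) hθ, h⟩

lemma continuous_xiAt (i : ℤ) : Continuous fun θ : ℤ → ℕ => xiAt θ i := by
  unfold xiAt
  have h1 : Continuous fun θ : ℤ → ℕ => rt θ (i + 1) :=
    continuous_pi fun j => continuous_apply _
  have h3 : Continuous fun θ : ℤ → ℕ => (θ i : ℝ) :=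
    continuous_of_discreteTopology.comp (continuous_apply i)
  exact (h3.add continuous_const).add (continuous_cf.comp h1)

lemma inv_cf_shf (f : ℕ → ℕ) (n : ℕ) : 1 / cf (shf n f) = xiAt (extz f) n := by
  have h1 : rt (extz f) ((n : ℤ) + 1) = shf (n + 1) f := by
    ext; simp only [rt, extz, shf]; congr 1
  rw [cf_cons, one_div_one_div, shf_shf, xiAt, h1]; simp [shf, extz, add_comm]

lemma xiAt_sub (θ : ℤ → ℕ) (i : ℤ) : xiAt θ i - -cf (lf θ i) = lam θ i := by rw [xiAt, lam]; ring

/-- The value of the quadratic form `y (α y - x)` in the basis of consecutive convergents. -/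
lemma val_mul_form (f : ℕ → ℕ) (n : ℕ) (x y : ℝ) :
    val f n * |(qd (pre f n) * x + qe (pre f n) * y) * ((qd (pre f n) * x + qe (pre f n) * y) * cf f -
      (pd (pre f n) * x + pe (pre f n) * y))| =
    |(x - 1 / cf (shf n f) * y) * (x - -(qe (pre f n) / qd (pre f n)) * y)| := by
  have h1 := cf_pos (shf n f)
  have h2 := qd_pos (pre f n)
  have h3 := qe_nonneg (pre f n)
  have h4 : 0 < qe (pre f n) * cf (shf n f) + qd (pre f n) := by positivity
  set X := cf (shf n f)
  have e : (qd (pre f n) * x + qe (pre f n) * y) * cf f - (pd (pre f n) * x + pe (pre f n) * y) =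
      (-1) ^ (pre f n).length * ((X * x - y) / (qe (pre f n) * X + qd (pre f n))) := by
    rw [cf_eq_phi f n, phi_eq _ h1.le, ← wmat_det]
    field_simp; ring
  rw [e, ← abs_of_pos (val_pos f n), ← abs_mul]
  have hv : val f n = (qe (pre f n) * X + qd (pre f n)) / (X * qd (pre f n)) := by
    rw [val, show cf (shf n f) = X from rfl]; field_simp; ring
  have e2 : val f n * ((qd (pre f n) * x + qe (pre f n) * y) * ((-1) ^ (pre f n).length *
      ((X * x - y) / (qe (pre f n) * X + qd (pre f n))))) = (-1) ^ (pre f n).length *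
      ((x - 1 / X * y) * (x - -(qe (pre f n) / qd (pre f n)) * y)) := by
    rw [hv]; field_simp; ring
  rw [e2, abs_mul, abs_pow, abs_neg, abs_one, one_pow, one_mul]

lemma exists_limit_rootBound {f : ℕ → ℕ} {v : ℝ} (hv : lagrangeVal (cf f) ≤ ENNReal.ofReal v)
    (hv0 : 0 ≤ v) {N : ℕ → ℕ} (hN : Tendsto N atTop atTop) :
    ∃ θ : ℤ → ℕ, ∃ φ : ℕ → ℕ, StrictMono φ ∧ RootBound (xiAt θ 0) (-cf (lf θ 0)) v ∧
      Tendsto (fun k => lam (extz f) (N (φ k) : ℕ)) atTop (𝓝 (lam θ 0)) := by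
  have hlt : ∀ ε > 0, lagrangeVal (cf f) < ENNReal.ofReal (v + ε) := fun ε hε =>
    hv.trans_lt ((ENNReal.ofReal_lt_ofReal_iff (by linarith)).2 (by linarith))
  obtain ⟨T, hT⟩ := exists_digit_bound (eventually_lam_le (hlt 1 one_pos))
  obtain ⟨θ, -, φ, hφ, hlim⟩ := (isCompact_digits T).tendsto_subseq
    (x := fun k => tr (N k : ℕ) (extz f)) fun k i => hT _
  have hNφ : Tendsto (fun k => N (φ k)) atTop atTop := hN.comp hφ.tendsto_atTop
  have hlam : Tendsto (fun k => lam (extz f) (N (φ k) : ℕ)) atTop (𝓝 (lam θ 0)) := by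
    have := ((continuous_lam 0).tendsto θ).comp hlim
    simpa only [Function.comp_def, lam_tr, zero_add] using this
  have hxi : Tendsto (fun k => 1 / cf (shf (N (φ k)) f)) atTop (𝓝 (xiAt θ 0)) := by
    have := ((continuous_xiAt 0).tendsto θ).comp hlim
    simpa only [Function.comp_def, inv_cf_shf, xiAt, rt_tr, tr, zero_add, add_comm (1 : ℤ)] using this
  have herr : Tendsto (fun k => val f (N (φ k)) - lam (extz f) (N (φ k) : ℕ)) atTop (𝓝 0) :=
    squeeze_zero_norm (fun k => abs_val_sub_lam f _) (tendsto_one_div_four_pow.comp hNφ)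
  have hval : Tendsto (fun k => val f (N (φ k))) atTop (𝓝 (lam θ 0)) := by
    simpa using herr.add hlam
  have heta : Tendsto (fun k => -(qe (pre f (N (φ k))) / qd (pre f (N (φ k))))) atTop
      (𝓝 (-cf (lf θ 0))) := by
    have h1 := hxi.sub hval
    have e : xiAt θ 0 - lam θ 0 = -cf (lf θ 0) := by rw [← xiAt_sub]; ring
    rw [e] at h1
    refine h1.congr fun k => ?_
    rw [val]; ring
  refine ⟨θ, φ, hφ, fun x y hxy => ?_, hlam⟩
  rw [xiAt_sub, abs_of_pos (by linarith [lt_lam θ 0, (Nat.cast_nonneg (θ 0) : (0 : ℝ) ≤ θ 0)])]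
  refine le_of_forall_pos_le_add fun ε' hε' => ?_
  set F := |((x : ℝ) - xiAt θ 0 * y) * (x - -cf (lf θ 0) * y)| with hF
  set ε := ε' / (F + 1) with hεdef
  have hF0 : 0 ≤ F := abs_nonneg _
  have hε : 0 < ε := by positivity
  have hform : Tendsto (fun k => |((x : ℝ) - 1 / cf (shf (N (φ k)) f) * y) *
      (x - -(qe (pre f (N (φ k))) / qd (pre f (N (φ k)))) * y)|) atTop (𝓝 F) :=
    ((tendsto_const_nhds.sub (hxi.mul_const _)).mul
      (tendsto_const_nhds.sub (heta.mul_const _))).abs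
  -- the denominators tend to infinity
  have hne : (x : ℝ) - -cf (lf θ 0) * y ≠ 0 := by
    intro h0
    have hy : y ≠ 0 := by
      rintro rfl
      simp only [Int.cast_zero, mul_zero, sub_zero, Int.cast_eq_zero] at h0
      exact hxy (by rw [h0])
    have hy' : (y : ℝ) ≠ 0 := by exact_mod_cast hy
    refine irrational_cf (lf θ 0) ⟨-(x : ℚ) / y, ?_⟩
    push_cast
    rw [div_eq_iff hy']
    linarith
  have hQ : Tendsto (fun k => |qd (pre f (N (φ k))) * x + qe (pre f (N (φ k))) * y|) atTop atTop := by
    have h1 : Tendsto (fun k => |(x : ℝ) - -(qe (pre f (N (φ k))) / qd (pre f (N (φ k)))) * y|) atTop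
        (𝓝 |(x : ℝ) - -cf (lf θ 0) * y|) := (tendsto_const_nhds.sub (heta.mul_const _)).abs
    have h2 := ((tendsto_qd f).comp hNφ).atTop_mul_pos (abs_pos.2 hne) h1
    refine h2.congr fun k => ?_
    have := qd_pos (pre f (N (φ k)))
    simp only [Function.comp_def]
    rw [← abs_of_pos this, ← abs_mul, abs_of_pos this]
    congr 1; field_simp; ring
  have hterm := eventually_lt_of_limsup_lt (hlt ε hε)
  have hev : ∀ᶠ k in atTop, val f (N (φ k)) ≤ (v + ε) *
      |((x : ℝ) - 1 / cf (shf (N (φ k)) f) * y) *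
      (x - -(qe (pre f (N (φ k))) / qd (pre f (N (φ k)))) * y)| := by
    obtain ⟨q0, hq0⟩ := eventually_atTop.1 hterm
    filter_upwards [hQ.eventually_ge_atTop (q0 : ℝ), hQ.eventually_gt_atTop 0] with k hk hk0
    obtain ⟨a, b, c, d, ha, hb, hc, hd⟩ := exists_nat_wmat (pre f (N (φ k)))
    rw [← val_mul_form, ha, hb, hc, hd]
    rw [hc, hd] at hk hk0
    set Q : ℤ := d * x + c * y with hQdef
    set P : ℤ := b * x + a * y with hPdef
    have hQR : (d : ℝ) * x + c * y = Q := by rw [hQdef]; push_cast; ring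
    have hPR : (b : ℝ) * x + a * y = P := by rw [hPdef]; push_cast; ring
    rw [hQR] at hk hk0 ⊢
    rw [hPR]
    have hnat : |(Q : ℝ)| = (Q.natAbs : ℝ) := by rw [Nat.cast_natAbs]; push_cast; rfl
    have h1 := hq0 Q.natAbs (by rw [hnat] at hk; exact_mod_cast hk)
    have h2 := (ENNReal.ofReal_lt_ofReal_iff (by linarith)).1 h1
    rw [← hnat] at h2
    have hirr : Irrational (|(Q : ℝ)| * cf f) := by
      rw [hnat]
      exact (irrational_cf f).natCast_mul (by
        rintro h0; rw [hnat, h0] at hk0; simp at hk0)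
    have hd' := distNearestInt_pos hirr
    have h3 : distNearestInt (|(Q : ℝ)| * cf f) ≤ |Q * cf f - P| := by
      rcases abs_cases (Q : ℝ) with ⟨h, -⟩ | ⟨h, -⟩
      · rw [h]; exact distNearestInt_le _ _
      · rw [h]
        refine (distNearestInt_le _ (-P)).trans_eq ?_
        rw [← abs_neg]; congr 1; push_cast; ring
    rw [div_lt_iff₀ (by positivity)] at h2
    have h4 : 1 ≤ (v + ε) * (|(Q : ℝ)| * |Q * cf f - P|) := by
      refine h2.le.trans ?_
      gcongr
    rw [abs_mul]
    nlinarith [val_pos f (N (φ k))]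
  have h1 := le_of_tendsto_of_tendsto hval (hform.const_mul (v + ε)) hev
  have h2 : ε * F ≤ ε' := by
    rw [hεdef, div_mul_eq_mul_div, div_le_iff₀ (by positivity)]
    nlinarith
  linarith [add_mul v ε F]

lemma lagrangeSpectrum_subset_markovSpectrum : LagrangeSpectrum ⊆ MarkovSpectrum := by
  rintro v ⟨α, hα, hfin, hval⟩
  obtain ⟨m, f, rfl⟩ := exists_int_add_cf hα
  rw [lagrangeVal_add_int] at hfin hval
  have hv0 : 0 ≤ v := hval ▸ ENNReal.toReal_nonneg
  have hv : lagrangeVal (cf f) = ENNReal.ofReal v := by rw [← hval, ENNReal.ofReal_toReal hfin]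
  have hbig : ∀ θ : ℤ → ℕ, RootBound (xiAt θ 0) (-cf (lf θ 0)) v → v / 2 < lam θ 0 → 2 < v := by
    intro θ h hl
    have h1 := lt_lam θ 0
    have h2 : (0 : ℝ) ≤ θ 0 := Nat.cast_nonneg _
    have h3 := h 1 0 (by simp)
    rw [xiAt_sub, abs_of_pos (by linarith)] at h3
    simp only [Int.cast_one, Int.cast_zero, mul_zero, sub_zero, mul_one, abs_one] at h3
    refine two_lt_of_rootBound (cf_pos (lf θ 0)) (cf_lt_one _) (v := lam θ 0) (by linarith)
      (by linarith) ?_ hl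
    convert h using 1
    rw [xiAt, lam]; ring
  have h2v : 2 < v := by
    by_contra! h2
    obtain ⟨θ, φ, -, hb, -⟩ := exists_limit_rootBound hv.le hv0 tendsto_id
    have h1 := lt_lam θ 0
    have h3 : (0 : ℝ) ≤ θ 0 := Nat.cast_nonneg _
    linarith [hbig θ hb (by linarith)]
  have hfreq : ∀ k : ℕ, ∃ n, k ≤ n ∧ v - 1 / ((k : ℝ) + 1) < val f n := by
    intro k
    by_contra! hcon
    have hpos : 0 < 1 / ((k : ℝ) + 1) := by positivity
    have := lagrangeVal_le (f := f) (c := max 2 (v - 1 / ((k : ℝ) + 1))) (le_max_left _ _) (by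
      filter_upwards [eventually_ge_atTop k] with n hn
      exact (hcon n hn).trans (le_max_right _ _))
    rw [hv, ENNReal.ofReal_le_ofReal_iff (by positivity)] at this
    rcases le_max_iff.1 this with h | h <;> linarith
  choose N hNk hNv using hfreq
  have hNt : Tendsto N atTop atTop := tendsto_atTop_mono hNk tendsto_id
  obtain ⟨θ, φ, hφ, hb, hlim⟩ := exists_limit_rootBound hv.le hv0 hNt
  have hlam : v ≤ lam θ 0 := by
    have e : Tendsto (fun k => v - 1 / ((φ k : ℝ) + 1) - 1 / 4 ^ (N (φ k) / 2)) atTop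
        (𝓝 (v - 0 - 0)) :=
      (tendsto_const_nhds.sub (tendsto_one_div_add_atTop_nhds_zero_nat.comp hφ.tendsto_atTop)).sub
        (tendsto_one_div_four_pow.comp (hNt.comp hφ.tendsto_atTop))
    rw [sub_zero, sub_zero] at e
    refine le_of_tendsto_of_tendsto' e hlim fun k => ?_
    have := (abs_le.1 (abs_val_sub_lam f (N (φ k)))).2
    linarith [hNv (φ k)]
  have hle := hb 1 0 (by simp)
  rw [xiAt_sub, abs_of_pos (by linarith)] at hle
  simp only [Int.cast_one, Int.cast_zero, mul_zero, sub_zero, mul_one, abs_one] at hle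
  have heq : lam θ 0 = v := le_antisymm hle hlam
  set ξ := xiAt θ 0
  set η := -cf (lf θ 0)
  have hξη : ξ - η = v := by rw [← heq]; exact xiAt_sub θ 0
  have hdisc : (-(ξ + η)) ^ 2 - 4 * 1 * (ξ * η) = v ^ 2 := by rw [← hξη]; ring
  have hsq : √((-(ξ + η)) ^ 2 - 4 * 1 * (ξ * η)) = v := by
    rw [hdisc, Real.sqrt_sq hv0]
  have hM : markovVal 1 (-(ξ + η)) (ξ * η) = ENNReal.ofReal v := by
    apply le_antisymm
    · refine iSup₂_le fun pq hpq => ?_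
      have h := hb pq.1 pq.2 hpq
      have e : 1 * (pq.1 : ℝ) ^ 2 + -(ξ + η) * pq.1 * pq.2 + ξ * η * (pq.2 : ℝ) ^ 2 =
          (pq.1 - ξ * pq.2) * (pq.1 - η * pq.2) := by ring
      rw [hsq, e]
      rw [hξη, abs_of_nonneg hv0] at h
      have hpos : 0 < |((pq.1 : ℝ) - ξ * pq.2) * (pq.1 - η * pq.2)| := by
        rcases (abs_nonneg (((pq.1 : ℝ) - ξ * pq.2) * (pq.1 - η * pq.2))).eq_or_lt with h0 | h0
        · rw [← h0] at h; linarith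
        · exact h0
      rw [← ENNReal.ofReal_div_of_pos hpos]
      refine ENNReal.ofReal_le_ofReal ?_
      rwa [div_le_iff₀ hpos]
    · refine le_iSup₂_of_le (1, 0) (by simp) ?_
      rw [hsq]; simp
  exact ⟨1, -(ξ + η), ξ * η, by rw [hdisc]; positivity, by rw [hM]; exact ENNReal.ofReal_ne_top,
    by rw [hM, ENNReal.toReal_ofReal hv0]⟩

lemma block_take (θ : ℤ → ℕ) (i : ℤ) (m n : ℕ) :
    (block θ i (m + n)).take m = block θ i m ∧ (block θ i (m + n)).drop m = block θ (i + m) n := by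
  rw [block_add]
  exact ⟨List.take_left' (by simp), List.drop_left' (by simp)⟩

lemma rpow_neg_qd_append_le (u v : List ℕ) {s : ℝ} (hs : 0 ≤ s) :
    qd (u ++ v) ^ (-2 * s) ≤ qd u ^ (-2 * s) * qd v ^ (-2 * s) := by
  rw [← Real.mul_rpow (qd_pos u).le (qd_pos v).le]
  exact Real.rpow_le_rpow_of_nonpos (mul_pos (qd_pos u) (qd_pos v)) (qd_mul_le u v) (by linarith)

lemma Zs_add_le (t : ℝ) (m n : ℕ) {s : ℝ} (hs : 0 ≤ s) :
    Zs t (m + n) s ≤ Zs t m s * Zs t n s := by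
  classical
  unfold Zs
  rw [Finset.sum_mul_sum, ← Finset.sum_product']
  let F : List ℕ → List ℕ × List ℕ := fun w => (w.take m, w.drop m)
  have hF : Function.Injective F := fun w w' h => by
    have h1 := congrArg Prod.fst h
    have h2 := congrArg Prod.snd h
    simp only [F] at h1 h2
    rw [← List.take_append_drop m w, h1, h2, List.take_append_drop]
  calc ∑ w ∈ LangF t (m + n), qd w ^ (-2 * s)
      ≤ ∑ w ∈ LangF t (m + n), (fun p : List ℕ × List ℕ =>
          qd p.1 ^ (-2 * s) * qd p.2 ^ (-2 * s)) (F w) := by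
        refine Finset.sum_le_sum fun w _ => ?_
        have := rpow_neg_qd_append_le (w.take m) (w.drop m) hs
        rwa [List.take_append_drop] at this
    _ = ∑ p ∈ (LangF t (m + n)).image F, qd p.1 ^ (-2 * s) * qd p.2 ^ (-2 * s) := by
        rw [Finset.sum_image fun _ _ _ _ h => hF h]
    _ ≤ _ := by
        refine Finset.sum_le_sum_of_subset_of_nonneg ?_ fun p _ _ => by
          have := qd_pos p.1; have := qd_pos p.2; positivity
        intro p hp
        obtain ⟨w, hw, rfl⟩ := Finset.mem_image.1 hp
        obtain ⟨θ, hθ, i, rfl⟩ := mem_LangF.1 hw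
        rw [Finset.mem_product]
        exact ⟨mem_LangF.2 ⟨θ, hθ, i, (block_take θ i m n).1.symm⟩,
          mem_LangF.2 ⟨θ, hθ, i + m, (block_take θ i m n).2.symm⟩⟩

lemma Zs_mul_le (t : ℝ) (n k : ℕ) {s : ℝ} (hs : 0 ≤ s) : Zs t (n * k) s ≤ Zs t n s ^ k := by
  induction k with
  | zero =>
    have : LangF t (n * 0) ⊆ {[]} := fun w hw => by
      simpa using List.length_eq_zero_iff.1 (LangF_length hw)
    refine (Finset.sum_le_sum_of_subset_of_nonneg this fun w _ _ =>
      (Real.rpow_pos_of_pos (qd_pos w) _).le).trans (by simp)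
  | succ k ih =>
    rw [mul_add, mul_one, pow_succ]
    exact (Zs_add_le t _ _ hs).trans (mul_le_mul_of_nonneg_right ih (Zs_nonneg ..))

lemma cf_binary_le {f : ℕ → ℕ} (hf : ∀ i, f i ≤ 1) : cf f ≤ √3 - 1 := by
  have h3 : √3 ^ 2 = 3 := Real.sq_sqrt (by norm_num)
  have h1 : 1 ≤ √3 := Real.one_le_sqrt.2 (by norm_num)
  have key : ∀ n : ℕ, ∀ f : ℕ → ℕ, (∀ i, f i ≤ 1) → cf f - (√3 - 1) ≤ (1 / 9) ^ n := by
    intro n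
    induction n with
    | zero => intro f _; linarith [cf_lt_one f, pow_zero (1 / 9 : ℝ)]
    | succ n ih =>
      intro f hf
      have hy := ih (shf 2 f) fun i => hf _
      have hy0 := (cf_pos (shf 2 f)).le
      have e1 := cf_cons f
      have e2 := cf_cons (shf 1 f)
      rw [shf_shf] at e2
      have f0 : (0 : ℝ) ≤ f 0 := Nat.cast_nonneg _
      have f1 : ((shf 1 f) 0 : ℝ) ≤ 1 := by exact_mod_cast hf _
      have f1' : (0 : ℝ) ≤ (shf 1 f) 0 := Nat.cast_nonneg _
      norm_num at e2
      set y := cf (shf 2 f)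
      have h4 : 1 / (2 + y) ≤ cf (shf 1 f) := by
        rw [e2, ← one_div]; gcongr; linarith
      have h5 : cf f ≤ 1 / (1 + 1 / (2 + y)) := by
        rw [e1]; gcongr; linarith
      have h6 : 1 / (1 + 1 / (2 + y)) - (√3 - 1) = (y - (√3 - 1)) / ((3 + y) * (2 + √3)) := by
        field_simp
        linear_combination (-(3 + y) * (3 + y)) * h3
      have h7 : (9 : ℝ) ≤ (3 + y) * (2 + √3) := by nlinarith
      have h8 : (y - (√3 - 1)) / ((3 + y) * (2 + √3)) ≤ (1 / 9) ^ n / 9 := by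
        calc _ ≤ (1 / 9) ^ n / ((3 + y) * (2 + √3)) := by gcongr
          _ ≤ _ := by gcongr
      rw [pow_succ]; linarith
  have hl : Tendsto (fun n : ℕ => (1 / 9 : ℝ) ^ n) atTop (𝓝 0) :=
    tendsto_pow_atTop_nhds_zero_of_lt_one (by norm_num) (by norm_num)
  have := ge_of_tendsto' hl fun n => key n f hf
  linarith

lemma binary_mem_Sig {θ : ℤ → ℕ} (hθ : ∀ i, θ i ≤ 1) : θ ∈ Sig √12 := by
  intro i
  have h12 : √12 = 2 * √3 := by
    rw [show (12 : ℝ) = 2 ^ 2 * 3 by norm_num, Real.sqrt_mul (by norm_num), Real.sqrt_sq two_pos.le]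
  have h1 := cf_binary_le (f := rt θ (i + 1)) fun j => hθ _
  have h2 := cf_binary_le (f := lf θ i) fun j => hθ _
  have h3 : (θ i : ℝ) ≤ 1 := by exact_mod_cast hθ i
  rw [lam, h12]; linarith

/-- The words of length `n` over the letters `0` and `1`. -/
def binWords : ℕ → Finset (List ℕ)
  | 0 => {[]}
  | n + 1 => (binWords n).image (List.cons 0) ∪ (binWords n).image (List.cons 1)

lemma sum_binWords_succ (n : ℕ) (F : List ℕ → ℝ) :
    ∑ w ∈ binWords (n + 1), F w = ∑ w ∈ binWords n, (F (0 :: w) + F (1 :: w)) := by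
  rw [binWords, Finset.sum_union, Finset.sum_image, Finset.sum_image, Finset.sum_add_distrib]
  · exact fun _ _ _ _ h => List.cons_injective h
  · exact fun _ _ _ _ h => List.cons_injective h
  · rw [Finset.disjoint_left]
    intro w h1 h2
    obtain ⟨a, -, rfl⟩ := Finset.mem_image.1 h1
    obtain ⟨b, -, hb⟩ := Finset.mem_image.1 h2
    simp at hb

lemma mem_binWords {n : ℕ} {w : List ℕ} (hw : w ∈ binWords n) :
    w.length = n ∧ ∀ a ∈ w, a ≤ 1 := by
  induction n generalizing w with
  | zero => simp [binWords] at hw; simp [hw]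
  | succ n ih =>
    simp only [binWords, Finset.mem_union, Finset.mem_image] at hw
    rcases hw with ⟨v, hv, rfl⟩ | ⟨v, hv, rfl⟩ <;> simp [(ih hv).1] <;> exact (ih hv).2

lemma binWords_subset (n : ℕ) : binWords n ⊆ LangF √12 n := by
  intro w hw
  obtain ⟨hl, h⟩ := mem_binWords hw
  refine mem_LangF.2 ⟨fun i => w.getD i.toNat 0, binary_mem_Sig fun i => ?_, 0, ?_⟩
  · by_cases hi : i.toNat < w.length
    · rw [List.getD_eq_getElem _ _ hi]; exact h _ (List.getElem_mem _)
    · rw [List.getD_eq_default _ _ (by omega)]; omega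
  · refine List.ext_getElem (by simp [hl]) fun j h1 h2 => ?_
    rw [block_getElem]
    simp [h2]

lemma binary_test_le {Q E : ℝ} (hQ : 0 < Q) (h1 : Q ≤ 3 * E) :
    1 / (3 / 2 * Q + E) ≤ 1 / (3 / 2 * (E + Q) + Q) + 1 / (3 / 2 * (E + 2 * Q) + Q) := by
  have hE : 0 < E := by linarith
  rw [div_add_div _ _ (by positivity) (by positivity), div_le_div_iff₀ (by positivity)
    (by positivity)]
  nlinarith [mul_nonneg hQ.le (sub_nonneg.2 h1), mul_pos hQ hE, mul_pos hE hE]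

lemma test_le_sum_binWords (n : ℕ) : ∀ u : List ℕ, qd u ≤ 3 * qe u →
    1 / (3 / 2 * qd u + qe u) ≤
      ∑ w ∈ binWords n, 1 / (3 / 2 * qd (u ++ w) + qe (u ++ w)) := by
  induction n with
  | zero => intro u _; simp [binWords]
  | succ n ih =>
    intro u hu
    have hE := qe_le_qd u
    have hQ := qd_pos u
    have d : ∀ a : ℕ, qd (u ++ [a]) = qe u + (a + 1) * qd u := fun a => by
      rw [qd_append]; simp [qd_cons, pd_cons]; ring
    have e : ∀ a : ℕ, qe (u ++ [a]) = qd u := fun a => by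
      rw [qe_append]; simp [qe_cons, pe_cons]
    have g0 := ih (u ++ [0]) (by rw [d, e]; push_cast; linarith)
    have g1 := ih (u ++ [1]) (by rw [d, e]; push_cast; linarith)
    rw [sum_binWords_succ, Finset.sum_add_distrib]
    simp only [List.append_assoc, List.singleton_append] at g0 g1
    refine le_trans ?_ (add_le_add g0 g1)
    rw [d, d, e, e]
    have := binary_test_le hQ hu
    norm_num at this ⊢
    exact this

lemma not_subcrit_sqrt_twelve : ¬ Subcrit √12 (1 / 2) := by
  rintro ⟨n, hn, hz⟩
  set z := Zs √12 n (1 / 2)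
  have h0 : 0 ≤ z := Zs_nonneg ..
  have key : ∀ k : ℕ, (2 / 5 : ℝ) ≤ z ^ k := by
    intro k
    refine le_trans ?_ (Zs_mul_le _ n k (by norm_num))
    have h1 := test_le_sum_binWords (n * k) [0] (by simp [qd_cons, qe_cons])
    have e1 : (1 : ℝ) / (3 / 2 * qd [0] + qe [0]) = 2 / 5 := by simp [qd_cons, qe_cons]; norm_num
    rw [e1] at h1
    refine h1.trans ?_
    unfold Zs
    refine (Finset.sum_le_sum fun w _ => ?_).trans
      (Finset.sum_le_sum_of_subset_of_nonneg (binWords_subset _) fun w _ _ =>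
        (Real.rpow_pos_of_pos (qd_pos w) _).le)
    have h2 : (-2 * (1 / 2) : ℝ) = -1 := by norm_num
    rw [h2, Real.rpow_neg_one, ← one_div]
    have h3 := qd_le_append_right [0] w
    have h4 := qe_nonneg ([0] ++ w)
    have := qd_pos w
    gcongr
    linarith
  have hl := tendsto_pow_atTop_nhds_zero_of_lt_one h0 hz
  have := ge_of_tendsto' hl key
  norm_num at this

/-- Sequences of well separated pairs of letters `1` placed according to `c`. -/
def pairSeq (ℓ : ℕ) (c : ℤ → ℕ) : ℤ → ℕ := fun i => if i % ℓ < 2 then c (i / ℓ) else 0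

lemma pairSeq_apply {ℓ : ℕ} (c : ℤ → ℕ) (q : ℤ) {r : ℤ} (h0 : 0 ≤ r) (h1 : r < ℓ) :
    pairSeq ℓ c (ℓ * q + r) = if r < 2 then c q else 0 := by
  have e1 : (ℓ * q + r) % ℓ = r := by
    rw [add_comm, Int.add_mul_emod_self_left, Int.emod_eq_of_lt h0 h1]
  have e2 : (ℓ * q + r) / ℓ = q := by
    rw [add_comm, Int.add_mul_ediv_left _ _ (by omega), Int.ediv_eq_zero_of_lt h0 h1, zero_add]
  rw [pairSeq, e1, e2]

/-- The sequence with exactly two letters `1`, at the places `0` and `1`. -/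
def pairOne : ℤ → ℕ := fun i => if i = 0 ∨ i = 1 then 1 else 0

lemma lam_pairOne : lam pairOne 0 = 3 ∧ lam pairOne 1 = 3 := by
  set g := cf fun _ => 0 with hg
  have e0 : g = 1 / (1 + g) := by
    have := cf_cons fun _ => 0
    have h2 : shf 1 (fun _ => 0) = fun _ => 0 := rfl
    rw [h2, ← hg] at this
    simpa using this
  have hp : 0 < g := cf_pos _
  have e1 : g * g + g = 1 := by
    have : g * (1 + g) = 1 := by nth_rewrite 1 [e0]; field_simp
    linarith
  have r2 : rt pairOne 2 = fun _ => 0 := by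
    funext j; simp only [rt, pairOne]; rw [if_neg (by omega)]
  have l0 : lf pairOne 0 = fun _ => 0 := by
    funext j; simp only [lf, pairOne]; rw [if_neg (by omega)]
  have r1 : cf (rt pairOne 1) = 1 / (2 + g) := by
    rw [cf_cons]
    have : shf 1 (rt pairOne 1) = fun _ => 0 := by
      funext j; simp only [shf, rt, pairOne]; rw [if_neg (by push_cast; omega)]
    rw [this, ← hg]; simp [rt, pairOne]; norm_num
  have l1 : cf (lf pairOne 1) = 1 / (2 + g) := by
    rw [cf_cons]
    have : shf 1 (lf pairOne 1) = fun _ => 0 := by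
      funext j; simp only [shf, lf, pairOne]; rw [if_neg (by push_cast; omega)]
    rw [this, ← hg]; simp [lf, pairOne]; norm_num
  have e2 : 1 / (2 + g) = 1 - g := by
    rw [div_eq_iff (by positivity)]; linarith
  constructor
  · rw [lam, zero_add, r1, l0, ← hg, e2]; simp [pairOne]; ring
  · rw [lam, show (1 : ℤ) + 1 = 2 by norm_num, l1, r2, ← hg, e2]; simp [pairOne]; ring

lemma pairSeq_mem_Sig (N : ℕ) {c : ℤ → ℕ} (hc : ∀ i, c i ≤ 1) :
    pairSeq (N + 2) c ∈ Sig (3 + 2 / 4 ^ (N / 2)) := by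
  intro i
  have hpos : (0 : ℝ) < 2 / 4 ^ (N / 2) := by positivity
  obtain ⟨q, r, rfl, h0, h1⟩ : ∃ q r : ℤ, i = ((N + 2 : ℕ) : ℤ) * q + r ∧ 0 ≤ r ∧
      r < ((N + 2 : ℕ) : ℤ) :=
    ⟨i / ((N + 2 : ℕ) : ℤ), i % ((N + 2 : ℕ) : ℤ), (Int.mul_ediv_add_emod _ _).symm,
      Int.emod_nonneg _ (by omega), Int.emod_lt_of_pos _ (by omega)⟩
  have hv := pairSeq_apply c q h0 h1
  by_cases hz : pairSeq (N + 2) c (((N + 2 : ℕ) : ℤ) * q + r) = 0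
  · have := lam_lt (pairSeq (N + 2) c) (((N + 2 : ℕ) : ℤ) * q + r)
    rw [hz] at this
    push_cast at this; push_cast; linarith
  have hr : r < 2 := by by_contra h; rw [if_neg h] at hv; exact hz hv
  rw [if_pos hr] at hv
  have hcq : c q = 1 := by have := hc q; omega
  have hm : ∀ j : ℤ, |j| ≤ N → pairSeq (N + 2) c (((N + 2 : ℕ) : ℤ) * q + r + j) =
      pairOne (r + j) := by
    intro j hj
    rw [abs_le] at hj
    by_cases hneg : r + j < 0
    · have := pairSeq_apply (ℓ := N + 2) c (q - 1) (r := r + j + (N + 2 : ℕ)) (by omega) (by omega)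
      rw [show ((N + 2 : ℕ) : ℤ) * q + r + j = ((N + 2 : ℕ) : ℤ) * (q - 1) + (r + j + (N + 2 : ℕ)) by
        ring, this, if_neg (by omega), pairOne, if_neg (by omega)]
    · have := pairSeq_apply (ℓ := N + 2) c q (r := r + j) (by omega) (by omega)
      rw [add_assoc, this, hcq, pairOne]
      congr 1
      exact propext ⟨by omega, by omega⟩
  have hle := abs_lam_sub_le (θ := pairSeq (N + 2) c) (θ' := pairOne)
    (i := ((N + 2 : ℕ) : ℤ) * q + r) (i' := r) hm
  have hr' : lam pairOne r = 3 := by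
    rcases (by omega : r = 0 ∨ r = 1) with rfl | rfl
    exacts [lam_pairOne.1, lam_pairOne.2]
  rw [hr'] at hle
  linarith [(abs_le.1 hle).2]

lemma exists_not_subcrit {t : ℝ} (ht : 3 < t) : ∃ s, 0 < s ∧ ¬ Subcrit t s := by
  classical
  obtain ⟨M, hM⟩ : ∃ M : ℕ, (1 / 4 : ℝ) ^ M < (t - 3) / 2 :=
    exists_pow_lt_of_lt_one (by linarith) (by norm_num)
  set N := 2 * M with hN
  have hN2 : N / 2 = M := by omega
  set ℓ := N + 2 with hl
  have hlt : (3 : ℝ) + 2 / 4 ^ (N / 2) ≤ t := by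
    rw [hN2]
    rw [one_div, inv_pow, ← one_div] at hM
    have : (2 : ℝ) / 4 ^ M = 2 * (1 / 4 ^ M) := by ring
    linarith
  have hℓ : (0 : ℝ) < ℓ := by rw [hl]; positivity
  refine ⟨1 / (4 * ℓ), by positivity, ?_⟩
  set s : ℝ := 1 / (4 * ℓ) with hs
  have hs0 : 0 < s := by positivity
  have key : ∀ n : ℕ, 1 ≤ Zs t (ℓ * n) s := by
    intro n
    let C : (Fin n → Fin 2) → ℤ → ℕ := fun g i =>
      if h : i.toNat < n then (g ⟨i.toNat, h⟩ : ℕ) else 0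
    have hC : ∀ g i, C g i ≤ 1 := fun g i => by
      simp only [C]; split_ifs
      · omega
      · omega
    let F : (Fin n → Fin 2) → List ℕ := fun g => block (pairSeq ℓ (C g)) 0 (ℓ * n)
    have hF : Function.Injective F := by
      intro g g' h
      funext j
      have h1 := block_eq_iff.1 h (ℓ * j) (by
        have := j.2
        exact Nat.mul_lt_mul_of_pos_left this (by omega))
      have h2 : ∀ g, pairSeq ℓ (C g) (0 + ((ℓ * j : ℕ) : ℤ)) = g j := fun g => by
        have := pairSeq_apply (ℓ := ℓ) (C g) (j : ℤ) (r := 0) le_rfl (by omega)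
        rw [show (0 : ℤ) + ((ℓ * j : ℕ) : ℤ) = ℓ * (j : ℤ) + 0 by push_cast; ring, this]
        simp [C]
      rw [h2, h2] at h1
      exact Fin.ext h1
    have hsub : Finset.univ.image F ⊆ LangF t (ℓ * n) := by
      intro w hw
      obtain ⟨g, -, rfl⟩ := Finset.mem_image.1 hw
      exact mem_LangF.2 ⟨_, Sig_mono hlt (pairSeq_mem_Sig N (hC g)), 0, rfl⟩
    have hq : ∀ g, ((3 : ℝ) ^ (ℓ * n)) ^ (-2 * s) ≤ qd (F g) ^ (-2 * s) := by
      intro g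
      refine Real.rpow_le_rpow_of_nonpos (qd_pos _) ?_ (by linarith)
      have := qd_le_pow (T := 2) (F g) (by
        intro a ha
        obtain ⟨j, -, rfl⟩ := mem_block.1 ha
        have : pairSeq ℓ (C g) (0 + j) ≤ 1 := by
          unfold pairSeq; split_ifs
          · exact hC _ _
          · omega
        omega)
      rw [show (F g).length = ℓ * n by simp [F]] at this
      norm_num at this ⊢
      exact this
    have e : ((3 : ℝ) ^ (ℓ * n)) ^ (-2 * s) = (3 : ℝ) ^ (-(n : ℝ) / 2) := by
      rw [← Real.rpow_natCast, ← Real.rpow_mul (by norm_num)]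
      congr 1
      rw [hs]; push_cast; field_simp; norm_num
    have h2 : (1 : ℝ) ≤ 2 ^ n * 3 ^ (-(n : ℝ) / 2) := by
      have h4 : (3 : ℝ) ^ ((n : ℝ) / 2) ≤ 4 ^ ((n : ℝ) / 2) :=
        Real.rpow_le_rpow (by norm_num) (by norm_num) (by positivity)
      have h5 : (4 : ℝ) ^ ((n : ℝ) / 2) = 2 ^ n := by
        rw [show (4 : ℝ) = 2 ^ (2 : ℝ) by norm_num, ← Real.rpow_mul (by norm_num),
          ← Real.rpow_natCast]
        congr 1; ring
      rw [neg_div, Real.rpow_neg (by norm_num), ← div_eq_mul_inv, one_le_div (by positivity)]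
      linarith
    calc (1 : ℝ) ≤ 2 ^ n * 3 ^ (-(n : ℝ) / 2) := h2
      _ = ∑ _g : Fin n → Fin 2, ((3 : ℝ) ^ (ℓ * n)) ^ (-2 * s) := by
          rw [Finset.sum_const, e]; simp
      _ ≤ ∑ g : Fin n → Fin 2, qd (F g) ^ (-2 * s) := Finset.sum_le_sum fun g _ => hq g
      _ = ∑ w ∈ Finset.univ.image F, qd w ^ (-2 * s) := by
          rw [Finset.sum_image fun _ _ _ _ h => hF h]
      _ ≤ _ := Finset.sum_le_sum_of_subset_of_nonneg hsub fun w _ _ =>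
          (Real.rpow_pos_of_pos (qd_pos w) _).le
  rintro ⟨n, hn, hz⟩
  have h1 := Zs_mul_le t n ℓ hs0.le
  rw [mul_comm] at h1
  have h2 : Zs t n s ^ ℓ < 1 := pow_lt_one₀ (Zs_nonneg ..) hz (by omega)
  linarith [key n]

lemma sum_union_le {α : Type*} [DecidableEq α] {f : α → ℝ} (h : ∀ a, 0 ≤ f a) (s t : Finset α) :
    ∑ a ∈ s ∪ t, f a ≤ ∑ a ∈ s, f a + ∑ a ∈ t, f a := by
  rw [← Finset.sum_union_inter]
  have := Finset.sum_nonneg (s := s ∩ t) fun a _ => h a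
  linarith

lemma sum_biUnion_le_sum {α ι : Type*} [DecidableEq α] {f : α → ℝ} (h : ∀ a, 0 ≤ f a)
    (s : Finset ι) (t : ι → Finset α) :
    ∑ a ∈ s.biUnion t, f a ≤ ∑ i ∈ s, ∑ a ∈ t i, f a := by
  classical
  induction s using Finset.induction_on with
  | empty => simp
  | insert i s hi ih =>
    rw [Finset.biUnion_insert, Finset.sum_insert hi]
    exact (sum_union_le h _ _).trans (by linarith)

section Cuts
variable {β : Type*}

/-- The multiplicative extension of a weight on letters to words. -/
noncomputable def lw (ω : β → ℝ) (w : List β) : ℝ := (w.map ω).prod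

@[simp] lemma lw_nil (ω : β → ℝ) : lw ω [] = 1 := by simp [lw]
@[simp] lemma lw_cons (ω : β → ℝ) (b : β) (w : List β) : lw ω (b :: w) = ω b * lw ω w := by
  simp [lw]
lemma lw_append (ω : β → ℝ) (u v : List β) : lw ω (u ++ v) = lw ω u * lw ω v := by simp [lw]

lemma lw_nonneg {ω : β → ℝ} (h : ∀ b, 0 ≤ ω b) (w : List β) : 0 ≤ lw ω w :=
  List.prod_nonneg fun a ha => by obtain ⟨b, -, rfl⟩ := List.mem_map.1 ha; exact h b

/-- At the cut `(x, y)` of the word `x ++ y`, the next letter can be replaced by letters with both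
smaller and larger keys. -/
def RGood (key : β → ℝ) (A : Set (List β)) (x y : List β) : Prop :=
  ∃ b y', y = b :: y' ∧ (∃ a z, x ++ a :: z ∈ A ∧ key a < key b) ∧
    ∃ c z, x ++ c :: z ∈ A ∧ key b < key c

open Classical in
/-- The number of cuts of `w` which are not good. -/
noncomputable def nbad (key : β → ℝ) (A : Set (List β)) (w : List β) : ℕ :=
  ∑ j ∈ Finset.range w.length, if RGood key A (w.take j) (w.drop j) then 0 else 1

open Classical in
lemma nbad_cons (key : β → ℝ) (A : Set (List β)) (b : β) (w : List β) :
    nbad key A (b :: w) = nbad key {v | b :: v ∈ A} w +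
      if RGood key A [] (b :: w) then 0 else 1 := by
  unfold nbad
  rw [List.length_cons, Finset.sum_range_succ']
  congr 1

lemma sum_lw_pow_nbad_le [DecidableEq β] {key ω : β → ℝ} {𝓑 : Finset β}
    (hkey : Set.InjOn key 𝓑) (h0 : ∀ b, 0 ≤ ω b) (h1 : ∀ b, ω b ≤ 1) (hZ : 1 ≤ ∑ b ∈ 𝓑, ω b) :
    ∀ (k : ℕ) (A : Finset (List β)), (∀ w ∈ A, w.length = k ∧ ∀ b ∈ w, b ∈ 𝓑) →
      ∑ w ∈ A, lw ω w * (∑ b ∈ 𝓑, ω b) ^ nbad key (A : Set (List β)) w ≤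
        (3 * ∑ b ∈ 𝓑, ω b) ^ k := by
  classical
  set Z := ∑ b ∈ 𝓑, ω b with hZdef
  have hZ0 : 0 ≤ Z := by linarith
  intro k
  induction k with
  | zero =>
    intro A hA
    have hsub : A ⊆ {[]} := fun w hw => by
      simpa using List.length_eq_zero_iff.1 (hA w hw).1
    refine (Finset.sum_le_sum_of_subset_of_nonneg hsub fun w _ _ =>
      mul_nonneg (lw_nonneg h0 w) (pow_nonneg hZ0 _)).trans ?_
    simp [nbad]
  | succ k ih =>
    intro A hA
    let Ab : β → Finset (List β) := fun b => (A.image List.tail).filter fun v => b :: v ∈ A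
    have mem_Ab : ∀ b v, v ∈ Ab b ↔ b :: v ∈ A := fun b v => by
      simp only [Ab, Finset.mem_filter, Finset.mem_image, and_iff_right_iff_imp]
      exact fun h => ⟨_, h, rfl⟩
    have hcoe : ∀ b, {v | b :: v ∈ (A : Set (List β))} = (Ab b : Set (List β)) := fun b => by
      ext v; simp [mem_Ab]
    have hsplit : A = 𝓑.biUnion fun b => (Ab b).image (List.cons b) := by
      ext w
      simp only [Finset.mem_biUnion, Finset.mem_image, mem_Ab]
      constructor
      · intro hw
        obtain ⟨hl, hb⟩ := hA w hw
        match w, hl with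
        | b :: v, _ => exact ⟨b, hb b (by simp), v, hw, rfl⟩
      · rintro ⟨b, -, v, hv, rfl⟩; exact hv
    let P : β → Prop := fun b => RGood key A [] (b :: [])
    have hP : ∀ b v, RGood key A [] (b :: v) ↔ P b := fun b v => by
      simp [RGood, P]
    let E1 := 𝓑.filter fun b => (Ab b).Nonempty ∧ ∀ a z, a :: z ∈ A → key b ≤ key a
    let E2 := 𝓑.filter fun b => (Ab b).Nonempty ∧ ∀ a z, a :: z ∈ A → key a ≤ key b
    have c1 : E1.card ≤ 1 := by
      refine Finset.card_le_one.2 fun b hb c hc => ?_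
      simp only [E1, Finset.mem_filter] at hb hc
      obtain ⟨hb, ⟨v, hv⟩, hb'⟩ := hb
      obtain ⟨hc, ⟨u, hu⟩, hc'⟩ := hc
      exact hkey hb hc (le_antisymm (hb' _ _ ((mem_Ab _ _).1 hu)) (hc' _ _ ((mem_Ab _ _).1 hv)))
    have c2 : E2.card ≤ 1 := by
      refine Finset.card_le_one.2 fun b hb c hc => ?_
      simp only [E2, Finset.mem_filter] at hb hc
      obtain ⟨hb, ⟨v, hv⟩, hb'⟩ := hb
      obtain ⟨hc, ⟨u, hu⟩, hc'⟩ := hc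
      exact hkey hb hc (le_antisymm (hc' _ _ ((mem_Ab _ _).1 hv)) (hb' _ _ ((mem_Ab _ _).1 hu)))
    have inner : ∀ b ∈ 𝓑, ∑ w ∈ (Ab b).image (List.cons b), lw ω w * Z ^ nbad key A w ≤
        (3 * Z) ^ k * (ω b + ((if b ∈ E1 then Z else 0) + if b ∈ E2 then Z else 0)) := by
      intro b hb
      rw [Finset.sum_image fun _ _ _ _ h => List.cons_injective h]
      have e1 : ∀ v ∈ Ab b, lw ω (b :: v) * Z ^ nbad key A (b :: v) =
          (ω b * Z ^ (if P b then 0 else 1)) * (lw ω v * Z ^ nbad key (Ab b) v) := by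
        intro v _
        rw [nbad_cons, hcoe, pow_add, lw_cons]
        simp only [hP]; ring
      rw [Finset.sum_congr rfl e1, ← Finset.mul_sum, mul_comm]
      rcases (Ab b).eq_empty_or_nonempty with hne | hne
      · rw [hne]; simp only [Finset.sum_empty, zero_mul]
        refine mul_nonneg (by positivity) (add_nonneg (h0 b) ?_)
        split_ifs <;> linarith
      have h3 : ω b * Z ^ (if P b then 0 else 1) ≤
          ω b + ((if b ∈ E1 then Z else 0) + if b ∈ E2 then Z else 0) := by
        by_cases hp : P b
        · rw [if_pos hp, pow_zero, mul_one]
          have : 0 ≤ (if b ∈ E1 then Z else 0) + if b ∈ E2 then Z else 0 := by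
            split_ifs <;> linarith
          linarith
        · rw [if_neg hp, pow_one]
          have hE : b ∈ E1 ∨ b ∈ E2 := by
            by_contra! hcon
            refine hp ?_
            simp only [E1, E2, Finset.mem_filter, hb, hne, true_and, not_forall, not_le] at hcon
            obtain ⟨⟨a, z, hz, ha⟩, ⟨c, y, hy, hc⟩⟩ := hcon
            exact ⟨b, [], rfl, ⟨a, z, by simpa using hz, ha⟩, ⟨c, y, by simpa using hy, hc⟩⟩
          have hωZ : ω b * Z ≤ Z := mul_le_of_le_one_left hZ0 (h1 b)
          have := h0 b
          rcases hE with hE | hE <;> rw [if_pos hE] <;> split_ifs <;> linarith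
      refine mul_le_mul (ih (Ab b) fun v hv => ?_) h3 (mul_nonneg (h0 b) (pow_nonneg hZ0 _))
        (by positivity)
      have := hA _ ((mem_Ab b v).1 hv)
      simp only [List.length_cons, Nat.add_right_cancel_iff, List.mem_cons, forall_eq_or_imp] at this
      exact ⟨this.1, this.2.2⟩
    calc ∑ w ∈ A, lw ω w * Z ^ nbad key A w
        = ∑ b ∈ 𝓑, ∑ w ∈ (Ab b).image (List.cons b), lw ω w * Z ^ nbad key A w := by
          conv_lhs => arg 1; rw [hsplit]
          refine Finset.sum_biUnion fun b _ c _ hbc => ?_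
          rw [Function.onFun, Finset.disjoint_left]
          intro w h1 h2
          obtain ⟨u, -, rfl⟩ := Finset.mem_image.1 h1
          obtain ⟨v, -, hv⟩ := Finset.mem_image.1 h2
          simp only [List.cons.injEq] at hv
          exact hbc hv.1.symm
      _ ≤ ∑ b ∈ 𝓑, (3 * Z) ^ k * (ω b + ((if b ∈ E1 then Z else 0) + if b ∈ E2 then Z else 0)) :=
          Finset.sum_le_sum inner
      _ = (3 * Z) ^ k * (Z + (E1.card * Z + E2.card * Z)) := by
          rw [← Finset.mul_sum, Finset.sum_add_distrib, Finset.sum_add_distrib, ← hZdef,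
            Finset.sum_ite_mem, Finset.sum_ite_mem, Finset.inter_eq_right.2 (Finset.filter_subset ..),
            Finset.inter_eq_right.2 (Finset.filter_subset ..)]
          simp only [Finset.sum_const, nsmul_eq_mul]
          rfl
      _ ≤ (3 * Z) ^ k * (Z + (1 * Z + 1 * Z)) := by
          have d1 : (E1.card : ℝ) ≤ 1 := by exact_mod_cast c1
          have d2 : (E2.card : ℝ) ≤ 1 := by exact_mod_cast c2
          gcongr
      _ = (3 * Z) ^ (k + 1) := by rw [pow_succ]; ring

/-- Words which are concatenations of at most `d` single letters and at most `r` nonempty words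
from the class `P`. -/
inductive Parse (P : List β → Prop) : ℕ → ℕ → List β → Prop
  | nil (r d : ℕ) : Parse P r d []
  | single {r d : ℕ} (b : β) {w : List β} : Parse P r d w → Parse P r (d + 1) (b :: w)
  | jump {r d : ℕ} {v w : List β} : v ≠ [] → P v → Parse P r d w → Parse P (r + 1) d (v ++ w)

lemma sum_lw_le_mul [DecidableEq β] {ω : β → ℝ} (h0 : ∀ b, 0 ≤ ω b) (l : ℕ)
    (A U V : Finset (List β)) (h : ∀ w ∈ A, w.take l ∈ U ∧ w.drop l ∈ V) :
    ∑ w ∈ A, lw ω w ≤ (∑ u ∈ U, lw ω u) * ∑ v ∈ V, lw ω v := by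
  rw [Finset.sum_mul_sum, ← Finset.sum_product']
  let F : List β → List β × List β := fun w => (w.take l, w.drop l)
  have hF : Function.Injective F := fun w w' h => by
    have h1 := congrArg Prod.fst h
    have h2 := congrArg Prod.snd h
    simp only [F] at h1 h2
    rw [← List.take_append_drop l w, h1, h2, List.take_append_drop]
  calc ∑ w ∈ A, lw ω w = ∑ w ∈ A, (fun p : List β × List β => lw ω p.1 * lw ω p.2) (F w) := by
        refine Finset.sum_congr rfl fun w _ => ?_
        simp only [F]
        rw [← lw_append, List.take_append_drop]
    _ = ∑ p ∈ A.image F, lw ω p.1 * lw ω p.2 := by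
        rw [Finset.sum_image fun _ _ _ _ h => hF h]
    _ ≤ _ := by
        refine Finset.sum_le_sum_of_subset_of_nonneg ?_ fun p _ _ =>
          mul_nonneg (lw_nonneg h0 _) (lw_nonneg h0 _)
        intro p hp
        obtain ⟨w, hw, rfl⟩ := Finset.mem_image.1 hp
        exact Finset.mem_product.2 (h w hw)

lemma sum_lw_parse_le [DecidableEq β] {ω : β → ℝ} {𝓑 : Finset β} (h0 : ∀ b, 0 ≤ ω b)
    {P : List β → Prop} {m k : ℕ} (hZ : 1 ≤ ∑ b ∈ 𝓑, ω b) (hm : 1 ≤ m)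
    (hP : ∀ V : Finset (List β), ∀ l, (∀ v ∈ V, P v ∧ v.length = l) → ∑ v ∈ V, lw ω v ≤ m) :
    ∀ (N r d : ℕ), r + d = N → ∀ i ≤ k, ∀ A : Finset (List β),
      (∀ w ∈ A, w.length = i ∧ (∀ b ∈ w, b ∈ 𝓑) ∧ Parse P r d w) →
      ∑ w ∈ A, lw ω w ≤ (2 * ∑ b ∈ 𝓑, ω b) ^ d * (2 * m * k + 1) ^ r := by
  classical
  set Z := ∑ b ∈ 𝓑, ω b with hZdef
  have hm' : (1 : ℝ) ≤ m := by exact_mod_cast hm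
  intro N
  induction N with
  | zero =>
    intro r d hrd i _ A hA
    obtain ⟨rfl, rfl⟩ : r = 0 ∧ d = 0 := by omega
    have hsub : A ⊆ {[]} := fun w hw => by
      have := (hA w hw).2.2
      cases this; simp
    refine (Finset.sum_le_sum_of_subset_of_nonneg hsub fun w _ _ => lw_nonneg h0 w).trans ?_
    simp
  | succ N ih =>
    intro r d hrd i hi A hA
    have hone : (1 : ℝ) ≤ (2 * Z) ^ d * (2 * m * k + 1) ^ r := by
      refine one_le_mul_of_one_le_of_one_le (one_le_pow₀ (by linarith)) (one_le_pow₀ ?_)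
      have : (0 : ℝ) ≤ 2 * m * k := by positivity
      linarith
    rcases Nat.eq_zero_or_pos i with rfl | hipos
    · have hsub : A ⊆ {[]} := fun w hw => by
        simpa using List.length_eq_zero_iff.1 (hA w hw).1
      refine (Finset.sum_le_sum_of_subset_of_nonneg hsub fun w _ _ => lw_nonneg h0 w).trans ?_
      simpa using hone
    let A1 := A.filter fun w => 1 ≤ d ∧ Parse P r (d - 1) (w.drop 1)
    let A2 : ℕ → Finset (List β) := fun l =>
      A.filter fun w => 1 ≤ r ∧ P (w.take l) ∧ Parse P (r - 1) d (w.drop l)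
    have hsub : A ⊆ A1 ∪ (Finset.Icc 1 i).biUnion A2 := by
      intro w hw
      obtain ⟨hl, -, hp⟩ := hA w hw
      simp only [Finset.mem_union, Finset.mem_biUnion, Finset.mem_Icc, A1, A2, Finset.mem_filter, hw,
        true_and]
      cases hp with
      | nil => simp at hl; omega
      | single b h => left; exact ⟨by omega, by simpa using h⟩
      | @jump r d v u hv hv' h =>
        right
        refine ⟨v.length, ⟨List.length_pos_iff.2 hv, ?_⟩, by omega, ?_, ?_⟩
        · rw [List.length_append] at hl; omega
        · simpa using hv'
        · simpa using h
    have b1 : ∑ w ∈ A1, lw ω w ≤ (2 * Z) ^ d * (2 * m * k + 1) ^ r / 2 := by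
      rcases Nat.eq_zero_or_pos d with rfl | hd
      · have : A1 = ∅ := by simp [A1]
        rw [this]; simp only [Finset.sum_empty]; linarith
      have h2 := sum_lw_le_mul h0 1 A1 (𝓑.image fun b => [b]) (A1.image (List.drop 1)) (by
        intro w hw
        have hw' := (Finset.mem_filter.1 hw).1
        refine ⟨?_, Finset.mem_image_of_mem _ hw⟩
        obtain ⟨hl, hb, -⟩ := hA w hw'
        match w, hl with
        | [], hl => simp at hl; omega
        | b :: v, _ => simpa using hb b (by simp))
      rw [Finset.sum_image fun _ _ _ _ h => by simpa using h] at h2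
      simp only [lw_cons, lw_nil, mul_one] at h2
      refine h2.trans ?_
      have h3 := ih r (d - 1) (by omega) (i - 1) (by omega) (A1.image (List.drop 1)) (by
        intro w hw
        obtain ⟨v, hv, rfl⟩ := Finset.mem_image.1 hw
        obtain ⟨hv, -, hp⟩ := Finset.mem_filter.1 hv
        obtain ⟨hl, hb, -⟩ := hA v hv
        exact ⟨by simp [hl], fun b hbm => hb b (List.mem_of_mem_drop hbm), hp⟩)
      calc Z * ∑ v ∈ A1.image (List.drop 1), lw ω v
          ≤ Z * ((2 * Z) ^ (d - 1) * (2 * m * k + 1) ^ r) := by gcongr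
        _ = (2 * Z) ^ d * (2 * m * k + 1) ^ r / 2 := by
          obtain ⟨e, rfl⟩ : ∃ e, d = e + 1 := ⟨d - 1, by omega⟩
          rw [Nat.add_sub_cancel, pow_succ]; ring
    have b2 : ∀ l ∈ Finset.Icc 1 i, ∑ w ∈ A2 l, lw ω w ≤
        m * ((2 * Z) ^ d * (if 1 ≤ r then (2 * m * k + 1 : ℝ) ^ (r - 1) else 0)) := by
      intro l hl
      rw [Finset.mem_Icc] at hl
      by_cases hr : 1 ≤ r
      · rw [if_pos hr]
        refine (sum_lw_le_mul h0 l (A2 l) ((A2 l).image (List.take l)) ((A2 l).image (List.drop l))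
          fun w hw => ⟨Finset.mem_image_of_mem _ hw, Finset.mem_image_of_mem _ hw⟩).trans ?_
        refine mul_le_mul (hP _ l ?_) (ih (r - 1) d (by omega) (i - l) (by omega) _ ?_)
          (Finset.sum_nonneg fun w _ => lw_nonneg h0 w) (by positivity)
        · intro w hw
          obtain ⟨v, hv, rfl⟩ := Finset.mem_image.1 hw
          obtain ⟨hv, -, hp, -⟩ := Finset.mem_filter.1 hv
          exact ⟨hp, by simp [(hA v hv).1, hl.2]⟩
        · intro w hw
          obtain ⟨v, hv, rfl⟩ := Finset.mem_image.1 hw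
          obtain ⟨hv, -, -, hp⟩ := Finset.mem_filter.1 hv
          obtain ⟨hl, hb, -⟩ := hA v hv
          exact ⟨by simp [hl], fun b hbm => hb b (List.mem_of_mem_drop hbm), hp⟩
      · have : A2 l = ∅ := by simp [A2, hr]
        simp [this, hr]
    have b3 : ∑ l ∈ Finset.Icc 1 i, ∑ w ∈ A2 l, lw ω w ≤ (2 * Z) ^ d * (2 * m * k + 1) ^ r / 2 := by
      refine (Finset.sum_le_sum b2).trans ?_
      rw [Finset.sum_const, Nat.card_Icc, nsmul_eq_mul, Nat.add_sub_cancel]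
      by_cases hr : 1 ≤ r
      · rw [if_pos hr]
        obtain ⟨e, rfl⟩ : ∃ e, r = e + 1 := ⟨r - 1, by omega⟩
        rw [Nat.add_sub_cancel, pow_succ]
        have hik : (i : ℝ) ≤ k := by exact_mod_cast hi
        have hX : (0 : ℝ) ≤ (2 * Z) ^ d * (2 * m * k + 1) ^ e := by positivity
        have : (i : ℝ) * m ≤ (2 * m * k + 1) / 2 := by nlinarith
        calc (i : ℝ) * (m * ((2 * Z) ^ d * (2 * m * k + 1) ^ e))
            = (i * m) * ((2 * Z) ^ d * (2 * m * k + 1) ^ e) := by ring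
          _ ≤ (2 * m * k + 1) / 2 * ((2 * Z) ^ d * (2 * m * k + 1) ^ e) := by gcongr
          _ = _ := by ring
      · rw [if_neg hr]; simp only [mul_zero]; linarith
    calc ∑ w ∈ A, lw ω w ≤ ∑ w ∈ A1 ∪ (Finset.Icc 1 i).biUnion A2, lw ω w :=
          Finset.sum_le_sum_of_subset_of_nonneg hsub fun w _ _ => lw_nonneg h0 w
      _ ≤ ∑ w ∈ A1, lw ω w + ∑ w ∈ (Finset.Icc 1 i).biUnion A2, lw ω w :=
          sum_union_le (lw_nonneg h0) _ _
      _ ≤ ∑ w ∈ A1, lw ω w + ∑ l ∈ Finset.Icc 1 i, ∑ w ∈ A2 l, lw ω w := by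
          gcongr
          exact sum_biUnion_le_sum (lw_nonneg h0) _ _
      _ ≤ _ := by linarith
end Cuts

section Pieces
variable {β : Type*}

/-- The mirror image of `RGood`. -/
def LGood (rkey : β → ℝ) (A : Set (List β)) (x y : List β) : Prop :=
  RGood rkey {w | w.reverse ∈ A} y.reverse x.reverse

lemma LGood.exists {rkey : β → ℝ} {A : Set (List β)} {x y : List β} (h : LGood rkey A x y) :
    ∃ b x', x = x' ++ [b] ∧ (∃ a z, z ++ a :: y ∈ A ∧ rkey a < rkey b) ∧
      ∃ c z, z ++ c :: y ∈ A ∧ rkey b < rkey c := by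
  obtain ⟨b, x', hx, ⟨a, z, hz, ha⟩, ⟨c, z', hz', hc⟩⟩ := h
  refine ⟨b, x'.reverse, ?_, ⟨a, z.reverse, ?_, ha⟩, ⟨c, z'.reverse, ?_, hc⟩⟩
  · rw [← List.reverse_reverse x, hx, List.reverse_cons]
  · simpa using hz
  · simpa using hz'

/-- A cut which is good on both sides and whose neighbouring letters are prescribed by `τ`. -/
structure GCut (key rkey : β → ℝ) (A : Set (List β)) (τ : β × β × β × β) (x y : List β) :
    Prop where
  mem : x ++ y ∈ A
  right : RGood key A x y
  left : LGood rkey A x y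
  suffix : [τ.1, τ.2.1] <:+ x
  pref : [τ.2.2.1, τ.2.2.2] <+: y

/-- The word between two good cuts of the same type. -/
def Piece (key rkey : β → ℝ) (A : Set (List β)) (τ : β × β × β × β) (v : List β) : Prop :=
  ∃ x y, GCut key rkey A τ x (v ++ y) ∧ GCut key rkey A τ (x ++ v) y

lemma Parse.mono {P : List β → Prop} {r d : ℕ} {w : List β} (h : Parse P r d w) :
    ∀ {r' d' : ℕ}, r ≤ r' → d ≤ d' → Parse P r' d' w := by
  induction h with
  | nil => intros; exact Parse.nil _ _
  | single b _ ih =>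
    intro r' d' hr hd
    obtain ⟨e, rfl⟩ : ∃ e, d' = e + 1 := ⟨d' - 1, by omega⟩
    exact Parse.single b (ih hr (by omega))
  | jump hv hp _ ih =>
    intro r' d' hr hd
    obtain ⟨e, rfl⟩ : ∃ e, r' = e + 1 := ⟨r' - 1, by omega⟩
    exact Parse.jump hv hp (ih (by omega) hd)

open Classical in
/-- The number of cuts inside `y`, in the word `x ++ y`, which are not good of any type. -/
noncomputable def ncut (key rkey : β → ℝ) (A : Set (List β)) : List β → List β → ℕ
  | _, [] => 0
  | x, b :: y => (if ∃ τ, GCut key rkey A τ x (b :: y) then 0 else 1) + ncut key rkey A (x ++ [b]) y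

lemma ncut_append_le (key rkey : β → ℝ) (A : Set (List β)) (x v y : List β) :
    ncut key rkey A (x ++ v) y ≤ ncut key rkey A x (v ++ y) := by
  induction v generalizing x with
  | nil => simp
  | cons b v ih =>
    have := ih (x ++ [b])
    simp only [List.append_assoc, List.singleton_append] at this
    rw [List.cons_append, ncut]
    omega

lemma parse_of_cuts [DecidableEq β] {key rkey : β → ℝ} {A : Set (List β)} :
    ∀ (n : ℕ) (x y : List β) (S : Finset (β × β × β × β)), y.length = n →
      (∀ x₁ y₁ τ, y = x₁ ++ y₁ → GCut key rkey A τ (x ++ x₁) y₁ → τ ∈ S) →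
      Parse (fun v => ∃ τ, Piece key rkey A τ v) S.card (ncut key rkey A x y + S.card) y := by
  intro n
  induction n using Nat.strong_induction_on with
  | _ n ih =>
  intro x y S hn hS
  match y, hn with
  | [], _ => exact Parse.nil _ _
  | b :: y₀, hn =>
    by_cases hg : ∃ τ, GCut key rkey A τ x (b :: y₀)
    · obtain ⟨τ, hτ⟩ := hg
      have hτS : τ ∈ S := hS [] (b :: y₀) τ rfl (by simpa using hτ)
      let Q : ℕ → Prop := fun i => ∃ v y₁, b :: y₀ = v ++ y₁ ∧ GCut key rkey A τ (x ++ v) y₁ ∧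
        v.length = i
      classical
      have hQ0 : Q 0 := ⟨[], b :: y₀, rfl, by simpa using hτ, rfl⟩
      obtain ⟨v, y₁, hvy, hcut, hlen⟩ := Nat.findGreatest_spec (P := Q) (Nat.zero_le n) hQ0
      have hmax : ∀ v' y', b :: y₀ = v' ++ y' → GCut key rkey A τ (x ++ v') y' →
          v'.length ≤ v.length := by
        intro v' y' h1 h2
        rw [hlen]
        refine Nat.le_findGreatest ?_ ⟨v', y', h1, h2, rfl⟩
        rw [← hn, h1, List.length_append]; omega
      obtain ⟨z, hz⟩ := hcut.pref
      set c := τ.2.2.1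
      set y₂ := τ.2.2.2 :: z
      have hy1 : y₁ = c :: y₂ := by rw [← hz]; rfl
      have hlt : y₂.length < n := by
        have e := congrArg List.length hvy
        rw [hn, hy1, List.length_append, List.length_cons] at e
        omega
      have h := ih y₂.length hlt (x ++ v ++ [c]) y₂ (S.erase τ) rfl (by
        intro x₁ y' σ h1 h2
        rw [Finset.mem_erase]
        constructor
        · rintro rfl
          have := hmax (v ++ c :: x₁) y' (by rw [hvy, hy1, h1]; simp) (by simpa using h2)
          simp at this
        · exact hS (v ++ c :: x₁) y' σ (by rw [hvy, hy1, h1]; simp) (by simpa using h2))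
      have hcard : S.card = (S.erase τ).card + 1 := (Finset.card_erase_add_one hτS).symm
      have hle : ncut key rkey A (x ++ v ++ [c]) y₂ ≤ ncut key rkey A x (b :: y₀) := by
        have := ncut_append_le key rkey A x (v ++ [c]) y₂
        rw [hvy, hy1]
        simpa using this
      have h' := Parse.single c h
      rw [hvy, hy1, hcard]
      rw [hvy, hy1] at hle
      rcases eq_or_ne v [] with rfl | hv
      · exact h'.mono (by omega) (by omega)
      · refine Parse.jump hv ⟨τ, x, y₁, ?_, hcut⟩ (h'.mono le_rfl (by omega))
        rw [← hvy]; exact hτ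
    · have h := ih y₀.length (by rw [← hn]; simp) (x ++ [b]) y₀ S rfl (by
        intro x₁ y₁ τ h1 h2
        exact hS (b :: x₁) y₁ τ (by rw [h1]; rfl) (by simpa using h2))
      rw [ncut, if_neg hg]
      exact (Parse.single b h).mono le_rfl (by omega)

open Classical in
lemma ncut_eq_sum (key rkey : β → ℝ) (A : Set (List β)) (x y : List β) :
    ncut key rkey A x y = ∑ j ∈ Finset.range y.length,
      if ∃ τ, GCut key rkey A τ (x ++ y.take j) (y.drop j) then 0 else 1 := by
  induction y generalizing x with
  | nil => simp [ncut]
  | cons b y ih =>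
    rw [ncut, ih, List.length_cons, Finset.sum_range_succ', add_comm]
    simp

lemma ncut_le (key rkey : β → ℝ) {A : Set (List β)} {w : List β} (hw : w ∈ A) :
    ncut key rkey A [] w ≤ nbad key A w + nbad rkey {w | w.reverse ∈ A} w.reverse + 4 := by
  classical
  rw [ncut_eq_sum]
  set n := w.length with hn
  have hpt : ∀ j ∈ Finset.range n,
      (if ∃ τ, GCut key rkey A τ ([] ++ w.take j) (w.drop j) then 0 else 1) ≤
      (if RGood key A (w.take j) (w.drop j) then 0 else 1) +
      (if LGood rkey A (w.take j) (w.drop j) then 0 else 1) +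
      ((if j < 2 then 1 else 0) + (if n - 1 - j < 1 then 1 else 0)) := by
    intro j hj
    rw [Finset.mem_range] at hj
    by_cases h1 : RGood key A (w.take j) (w.drop j)
    swap
    · rw [if_neg h1]; split_ifs <;> omega
    by_cases h2 : LGood rkey A (w.take j) (w.drop j)
    swap
    · rw [if_neg h2]; split_ifs <;> omega
    by_cases h3 : j < 2
    · rw [if_pos h3]; split_ifs <;> omega
    by_cases h4 : n - 1 - j < 1
    · rw [if_pos h4]; split_ifs <;> omega
    have e1 : w.take j = w.take (j - 2) ++ [w[j - 2], w[j - 1]] := by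
      have a1 := List.take_succ_eq_append_getElem (l := w) (i := j - 2) (by omega)
      have a2 := List.take_succ_eq_append_getElem (l := w) (i := j - 1) (by omega)
      rw [show j - 2 + 1 = j - 1 by omega] at a1
      rw [show j - 1 + 1 = j by omega, a1] at a2
      rw [a2, List.append_assoc]; rfl
    have e2 : w.drop j = [w[j], w[j + 1]] ++ w.drop (j + 2) := by
      rw [List.drop_eq_getElem_cons hj, List.drop_eq_getElem_cons (i := j + 1) (by omega)]
      rfl
    have hg : GCut key rkey A (w[j - 2], w[j - 1], w[j], w[j + 1]) ([] ++ w.take j) (w.drop j) := by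
      rw [List.nil_append]
      refine ⟨by rwa [List.take_append_drop], h1, h2, ?_, ?_⟩
      · rw [e1]; exact List.suffix_append _ _
      · rw [e2]; exact List.prefix_append _ _
    rw [if_pos ⟨_, hg⟩]
    exact Nat.zero_le _
  refine (Finset.sum_le_sum hpt).trans ?_
  rw [Finset.sum_add_distrib, Finset.sum_add_distrib, Finset.sum_add_distrib]
  have f1 : ∑ j ∈ Finset.range n, (if j < 2 then 1 else 0) ≤ 2 := by
    rw [← Finset.sum_filter, Finset.sum_const, smul_eq_mul, mul_one]
    refine (Finset.card_le_card (t := Finset.range 2) fun j hj => ?_).trans (by simp)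
    simp only [Finset.mem_filter, Finset.mem_range] at hj ⊢; omega
  have f2 : ∑ j ∈ Finset.range n, (if n - 1 - j < 1 then 1 else 0) ≤ 1 := by
    rw [Finset.sum_range_reflect (fun j => if j < 1 then 1 else 0) n, ← Finset.sum_filter,
      Finset.sum_const, smul_eq_mul, mul_one]
    refine (Finset.card_le_card (t := Finset.range 1) fun j hj => ?_).trans (by simp)
    simp only [Finset.mem_filter, Finset.mem_range] at hj ⊢; omega
  have f3 : ∑ j ∈ Finset.range n, (if LGood rkey A (w.take j) (w.drop j) then 0 else 1) ≤
      nbad rkey {w | w.reverse ∈ A} w.reverse + 1 := by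
    unfold nbad
    rw [List.length_reverse, ← hn]
    rcases Nat.eq_zero_or_pos n with h0 | h0
    · rw [h0]; simp
    obtain ⟨m, hm⟩ : ∃ m, n = m + 1 := ⟨n - 1, by omega⟩
    set f : ℕ → ℕ := fun i => if RGood rkey {w | w.reverse ∈ A} (w.reverse.take i)
      (w.reverse.drop i) then 0 else 1 with hf
    have hLf : ∀ j, (if LGood rkey A (w.take j) (w.drop j) then 0 else 1) = f (n - j) := by
      intro j
      simp only [hf, LGood]
      congr 3
      · rw [List.take_reverse]
        by_cases hj : j ≤ n
        · rw [show w.length - (n - j) = j by omega]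
        · rw [List.drop_eq_nil_of_le (by omega), List.drop_eq_nil_of_le (by omega)]
      · rw [List.drop_reverse]
        by_cases hj : j ≤ n
        · rw [show w.length - (n - j) = j by omega]
        · rw [List.take_of_length_le (by omega), List.take_of_length_le (by omega)]
    have hf1 : ∀ i, f i ≤ 1 := fun i => by simp only [hf]; split_ifs <;> omega
    simp only [hLf]
    rw [hm, Finset.sum_range_succ', Finset.sum_range_succ' f]
    have : ∑ k ∈ Finset.range m, f (m + 1 - (k + 1)) = ∑ k ∈ Finset.range m, f (k + 1) := by
      rw [← Finset.sum_range_reflect]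
      refine Finset.sum_congr rfl fun k hk => ?_
      rw [Finset.mem_range] at hk
      congr 1; omega
    rw [this]
    have := hf1 (m + 1 - 0)
    omega
  have f4 : ∑ j ∈ Finset.range n, (if RGood key A (w.take j) (w.drop j) then 0 else 1) =
      nbad key A w := rfl
  omega

lemma lw_reverse (ω : β → ℝ) (w : List β) : lw ω w.reverse = lw ω w := by
  simp [lw, List.map_reverse, List.prod_reverse]

/-- The class of pieces between cuts of some type carries large weight. -/
lemma exists_heavy_pieces [DecidableEq β] {key rkey ω : β → ℝ} {𝓑 : Finset β}
    (hkey : Set.InjOn key 𝓑) (hrkey : Set.InjOn rkey 𝓑) (h0 : ∀ b, 0 ≤ ω b) (h1 : ∀ b, ω b ≤ 1)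
    (hZ : 12 ^ 16 ≤ ∑ b ∈ 𝓑, ω b) (A : ℕ → Finset (List β))
    (hA : ∀ K, ∀ w ∈ A K, w.length = 16 * K ∧ ∀ b ∈ w, b ∈ 𝓑)
    (hW : ∀ K, (∑ b ∈ 𝓑, ω b) ^ (15 * K) ≤ ∑ w ∈ A K, lw ω w) :
    ∃ K τ l, ∃ V : Finset (List β), (∀ v ∈ V, Piece key rkey (A K) τ v ∧ v.length = l) ∧
      1 < ∑ v ∈ V, lw ω v := by
  classical
  by_contra! hcon
  set Z := ∑ b ∈ 𝓑, ω b with hZdef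
  have hZ1 : 1 ≤ Z := by linarith [show (1 : ℝ) ≤ 12 ^ 16 by norm_num]
  have hZ2 : 2 ≤ Z := by linarith [show (2 : ℝ) ≤ 12 ^ 16 by norm_num]
  have hZ0 : 0 < Z := by linarith
  set T := 𝓑 ×ˢ 𝓑 ×ˢ 𝓑 ×ˢ 𝓑 with hT
  set m := T.card with hm
  have hne : 𝓑.Nonempty := by
    rw [Finset.nonempty_iff_ne_empty]
    rintro rfl
    simp [hZdef] at hZ1
    linarith
  have hm1 : 1 ≤ m := by
    obtain ⟨b, hb⟩ := hne
    exact Finset.card_pos.2 ⟨(b, b, b, b), by simp [hT, hb]⟩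
  have htype : ∀ K τ x y, GCut key rkey (A K) τ x y → τ ∈ T := by
    intro K τ x y h
    have hb := (hA K _ h.mem).2
    have hx := h.suffix.subset
    have hy := h.pref.subset
    simp only [hT, Finset.mem_product]
    refine ⟨hb _ ?_, hb _ ?_, hb _ ?_, hb _ ?_⟩ <;> rw [List.mem_append]
    · exact Or.inl (hx (by simp))
    · exact Or.inl (hx (by simp))
    · exact Or.inr (hy (by simp))
    · exact Or.inr (hy (by simp))
  have hP : ∀ K, ∀ V : Finset (List β), ∀ l,
      (∀ v ∈ V, (∃ τ, Piece key rkey (A K) τ v) ∧ v.length = l) → ∑ v ∈ V, lw ω v ≤ m := by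
    intro K V l hV
    have hsub : V ⊆ T.biUnion fun τ => V.filter fun v => Piece key rkey (A K) τ v := by
      intro v hv
      obtain ⟨⟨τ, hτ⟩, -⟩ := hV v hv
      have hτT : τ ∈ T := by
        obtain ⟨x, y, h, -⟩ := hτ
        exact htype K τ _ _ h
      exact Finset.mem_biUnion.2 ⟨τ, hτT, Finset.mem_filter.2 ⟨hv, hτ⟩⟩
    calc ∑ v ∈ V, lw ω v ≤ ∑ v ∈ T.biUnion fun τ => V.filter fun v => Piece key rkey (A K) τ v,
          lw ω v := Finset.sum_le_sum_of_subset_of_nonneg hsub fun w _ _ => lw_nonneg h0 w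
      _ ≤ ∑ τ ∈ T, ∑ v ∈ V.filter fun v => Piece key rkey (A K) τ v, lw ω v :=
          sum_biUnion_le_sum (lw_nonneg h0) _ _
      _ ≤ ∑ _τ ∈ T, (1 : ℝ) := by
          refine Finset.sum_le_sum fun τ _ => hcon K τ l _ fun v hv => ?_
          obtain ⟨hv, hτ⟩ := Finset.mem_filter.1 hv
          exact ⟨hτ, (hV v hv).2⟩
      _ = m := by simp [hm]
  have main : ∀ K, Z ^ (15 * K) ≤ 2 * (3 ^ (16 * K) * Z ^ (14 * K)) +
      (2 * Z) ^ (4 * K + 4 + m) * (2 * m * (16 * K : ℕ) + 1) ^ m := by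
    intro K
    set Good := (A K).filter fun w => Parse (fun v => ∃ τ, Piece key rkey (A K) τ v) m
      (4 * K + 4 + m) w
    set Bad1 := (A K).filter fun w => 2 * K ≤ nbad key (A K) w
    set Bad2 := (A K).filter fun w => 2 * K ≤ nbad rkey {w | w.reverse ∈ (A K : Set (List β))}
      w.reverse
    have hsub : A K ⊆ (Bad1 ∪ Bad2) ∪ Good := by
      intro w hw
      by_contra hcon
      simp only [Finset.mem_union, Finset.mem_filter, hw, true_and, not_or, not_le, Good, Bad1,
        Bad2] at hcon
      obtain ⟨⟨c1, c2⟩, c3⟩ := hcon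
      refine c3 ((parse_of_cuts w.length [] w T rfl ?_).mono le_rfl ?_)
      · intro x₁ y₁ τ _ h2
        exact htype K τ _ _ h2
      · have := ncut_le key rkey (A := (A K : Set (List β))) hw
        omega
    have g : ∑ w ∈ Good, lw ω w ≤ (2 * Z) ^ (4 * K + 4 + m) * (2 * m * (16 * K : ℕ) + 1) ^ m := by
      refine sum_lw_parse_le (𝓑 := 𝓑) h0 hZ1 hm1 (hP K) _ m _ rfl (16 * K) le_rfl Good
        fun w hw => ?_
      obtain ⟨hw, hp⟩ := Finset.mem_filter.1 hw
      exact ⟨(hA K w hw).1, (hA K w hw).2, hp⟩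
    have cheb : ∀ (B : Finset (List β)) (N : List β → ℕ), (∀ w ∈ B, 2 * K ≤ N w) →
        ∑ w ∈ B, lw ω w * Z ^ N w ≤ (3 * Z) ^ (16 * K) →
        ∑ w ∈ B, lw ω w ≤ 3 ^ (16 * K) * Z ^ (14 * K) := by
      intro B N hN hle
      have h2 : Z ^ (2 * K) * ∑ w ∈ B, lw ω w ≤ (3 * Z) ^ (16 * K) := by
        refine le_trans ?_ hle
        rw [Finset.mul_sum]
        refine Finset.sum_le_sum fun w hw => ?_
        rw [mul_comm]
        exact mul_le_mul_of_nonneg_left (pow_le_pow_right₀ hZ1 (hN w hw)) (lw_nonneg h0 w)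
      have h3 : (3 * Z) ^ (16 * K) = Z ^ (2 * K) * (3 ^ (16 * K) * Z ^ (14 * K)) := by
        rw [mul_pow, show 16 * K = 2 * K + 14 * K by ring, pow_add Z]; ring
      rw [h3] at h2
      exact le_of_mul_le_mul_left h2 (by positivity)
    have b1 : ∑ w ∈ Bad1, lw ω w ≤ 3 ^ (16 * K) * Z ^ (14 * K) := by
      refine cheb Bad1 (nbad key (A K)) (fun w hw => (Finset.mem_filter.1 hw).2) ?_
      refine le_trans ?_ (sum_lw_pow_nbad_le hkey h0 h1 hZ1 (16 * K) (A K) (hA K))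
      exact Finset.sum_le_sum_of_subset_of_nonneg (Finset.filter_subset _ _)
        fun w _ _ => mul_nonneg (lw_nonneg h0 w) (by positivity)
    have b2 : ∑ w ∈ Bad2, lw ω w ≤ 3 ^ (16 * K) * Z ^ (14 * K) := by
      refine cheb Bad2 (fun w => nbad rkey {w | w.reverse ∈ (A K : Set (List β))} w.reverse)
        (fun w hw => (Finset.mem_filter.1 hw).2) ?_
      have h2 := sum_lw_pow_nbad_le hrkey h0 h1 hZ1 (16 * K) ((A K).image List.reverse) (by
        intro w hw
        obtain ⟨v, hv, rfl⟩ := Finset.mem_image.1 hw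
        exact ⟨by simp [(hA K v hv).1], fun b hb => (hA K v hv).2 b (List.mem_reverse.1 hb)⟩)
      have hset : (((A K).image List.reverse : Finset (List β)) : Set (List β)) =
          {w | w.reverse ∈ (A K : Set (List β))} := by
        ext w
        simp only [Finset.coe_image, Set.mem_image, Finset.mem_coe, Set.mem_ofPred_eq]
        constructor
        · rintro ⟨v, hv, rfl⟩; simpa using hv
        · intro h; exact ⟨_, h, by simp⟩
      rw [hset, Finset.sum_image fun _ _ _ _ h => List.reverse_injective h] at h2
      simp only [lw_reverse] at h2
      refine le_trans ?_ h2
      exact Finset.sum_le_sum_of_subset_of_nonneg (Finset.filter_subset _ _)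
        fun w _ _ => mul_nonneg (lw_nonneg h0 w) (by positivity)
    calc Z ^ (15 * K) ≤ ∑ w ∈ A K, lw ω w := hW K
      _ ≤ ∑ w ∈ (Bad1 ∪ Bad2) ∪ Good, lw ω w :=
          Finset.sum_le_sum_of_subset_of_nonneg hsub fun w _ _ => lw_nonneg h0 w
      _ ≤ (∑ w ∈ Bad1, lw ω w + ∑ w ∈ Bad2, lw ω w) + ∑ w ∈ Good, lw ω w :=
          (sum_union_le (lw_nonneg h0) _ _).trans (by
            gcongr; exact sum_union_le (lw_nonneg h0) _ _)
      _ ≤ _ := by linarith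
  set C : ℝ := 4 * (2 * Z) ^ (4 + m) * (33 * m) ^ m with hC
  have hCpos : 0 < C := by positivity
  obtain ⟨K, hK1, hK⟩ : ∃ K : ℕ, 1 ≤ K ∧ C * ((K : ℝ) ^ m * (1 / 2) ^ K) < 1 := by
    have h := (tendsto_pow_const_mul_const_pow_of_abs_lt_one m
      (r := (1 / 2 : ℝ)) (by rw [abs_of_pos] <;> norm_num)).const_mul C
    rw [mul_zero] at h
    exact ((eventually_ge_atTop 1).and (h.eventually_lt_const one_pos)).exists
  have hK1' : (1 : ℝ) ≤ K := by exact_mod_cast hK1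
  have hm1' : (1 : ℝ) ≤ m := by exact_mod_cast hm1
  have e1 : 2 * ((3 : ℝ) ^ (16 * K) * Z ^ (14 * K)) ≤ Z ^ (15 * K) / 2 := by
    have h4 : (4 : ℝ) * 3 ^ (16 * K) ≤ Z ^ K := by
      calc (4 : ℝ) * 3 ^ (16 * K) ≤ 4 ^ (16 * K) * 3 ^ (16 * K) := by
            gcongr
            exact le_self_pow₀ (by norm_num) (by omega)
        _ = (12 ^ 16) ^ K := by rw [← mul_pow, ← pow_mul]; norm_num
        _ ≤ Z ^ K := by gcongr
    have h5 : Z ^ (15 * K) = Z ^ K * Z ^ (14 * K) := by rw [← pow_add]; congr 1; ring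
    rw [h5]
    have : (0 : ℝ) < Z ^ (14 * K) := by positivity
    nlinarith
  have e2 : (2 * Z) ^ (4 * K + 4 + m) * (2 * m * (16 * K : ℕ) + 1) ^ m < Z ^ (15 * K) / 2 := by
    have h5 : ((2 : ℝ) * m * (16 * K : ℕ) + 1) ^ m ≤ (33 * m) ^ m * K ^ m := by
      rw [← mul_pow]
      refine pow_le_pow_left₀ (by positivity) ?_ _
      push_cast; nlinarith
    have h6 : (2 * Z) ^ (4 * K) ≤ Z ^ (8 * K) := by
      rw [show 8 * K = 2 * (4 * K) by ring, pow_mul Z]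
      refine pow_le_pow_left₀ (by positivity) (by nlinarith) _
    have h7 : 4 * ((2 * Z) ^ (4 + m) * ((33 * m) ^ m * K ^ m)) < 2 ^ K := by
      have e : C * ((K : ℝ) ^ m * (1 / 2) ^ K) =
          4 * ((2 * Z) ^ (4 + m) * ((33 * m) ^ m * K ^ m)) / 2 ^ K := by
        rw [hC, one_div, inv_pow]; ring
      rw [e, div_lt_one (by positivity)] at hK
      exact hK
    have h8 : (2 : ℝ) ^ K ≤ Z ^ (7 * K) :=
      (pow_le_pow_left₀ (by norm_num) hZ2 K).trans (pow_le_pow_right₀ hZ1 (by omega))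
    have hpz : 0 < Z ^ (8 * K) := by positivity
    calc (2 * Z) ^ (4 * K + 4 + m) * (2 * m * (16 * K : ℕ) + 1) ^ m
        ≤ (2 * Z) ^ (4 * K + 4 + m) * ((33 * m) ^ m * K ^ m) := by gcongr
      _ = (2 * Z) ^ (4 * K) * ((2 * Z) ^ (4 + m) * ((33 * m) ^ m * K ^ m)) := by
          rw [add_assoc, pow_add]; ring
      _ ≤ Z ^ (8 * K) * ((2 * Z) ^ (4 + m) * ((33 * m) ^ m * K ^ m)) := by gcongr
      _ < Z ^ (8 * K) * (Z ^ (7 * K) / 2) := by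
          have h9 : 0 < (2 * Z) ^ (4 + m) * ((33 * m) ^ m * (K : ℝ) ^ m) := by positivity
          gcongr
          linarith
      _ = Z ^ (15 * K) / 2 := by
          rw [show 15 * K = 8 * K + 7 * K by ring, pow_add]; ring
  linarith [main K]
end Pieces

lemma phi_key_lt (r : List ℕ) {a b c : ℝ} (ha : 0 ≤ a) (hab : a < b) (hbc : b < c) :
    phi r b < phi r a ∨ phi r b < phi r c := by
  have h1 := phi_sub r (ha.trans hab.le) ha
  have h2 := phi_sub r (ha.trans hab.le) (ha.trans (hab.trans hbc).le)
  have d1 := den_pos r ha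
  have d2 := den_pos r (ha.trans hab.le)
  have d3 := den_pos r (ha.trans (hab.trans hbc).le)
  rcases neg_one_pow_eq_or ℝ r.length with h | h <;> rw [h] at h1 h2
  · right
    have : 1 * (b - c) / ((qe r * b + qd r) * (qe r * c + qd r)) < 0 :=
      div_neg_of_neg_of_pos (by linarith) (by positivity)
    linarith
  · left
    have : -1 * (b - a) / ((qe r * b + qd r) * (qe r * a + qd r)) < 0 :=
      div_neg_of_neg_of_pos (by linarith) (by positivity)
    linarith

/-- The word `U ++ d :: U'` occurs in `θ` with the letter `d` at the place `i`. -/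
def Occ (θ : ℤ → ℕ) (i : ℤ) (U : List ℕ) (d : ℕ) (U' : List ℕ) : Prop :=
  θ i = d ∧ pre (rt θ (i + 1)) U'.length = U' ∧ pre (lf θ i) U.length = U.reverse

lemma occ_of_block {θ : ℤ → ℕ} {p : ℤ} {n : ℕ} {U U' : List ℕ} {d : ℕ}
    (h : block θ p n = U ++ d :: U') : Occ θ (p + U.length) U d U' := by
  have hn : n = U.length + (1 + U'.length) := by
    have := congrArg List.length h
    simp at this; omega
  rw [hn, block_add, block_add] at h
  obtain ⟨h1, h2⟩ := List.append_inj h (by simp)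
  have h3 : block θ (p + U.length) 1 = [θ (p + U.length)] := by
    simp [block, pre_succ, pre_zero, rt]
  rw [h3, List.singleton_append, List.cons.injEq] at h2
  refine ⟨h2.1, by simpa [block] using h2.2, ?_⟩
  rw [pre_lf, add_sub_cancel_right, h1]

lemma pre_split {f : ℕ → ℕ} {u v : List ℕ} (h : pre f (u ++ v).length = u ++ v) :
    pre f u.length = u := by
  rw [List.length_append, pre_add] at h
  exact (List.append_inj h (by simp)).1

lemma Occ.shrink {θ : ℤ → ℕ} {i : ℤ} {X U U' Y : List ℕ} {d : ℕ}
    (h : Occ θ i (X ++ U) d (U' ++ Y)) : Occ θ i U d U' := by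
  refine ⟨h.1, pre_split h.2.1, ?_⟩
  have := h.2.2
  rw [← List.length_reverse, List.reverse_append] at this
  have := pre_split this
  rwa [List.length_reverse] at this

lemma Occ.lam_eq {θ : ℤ → ℕ} {i : ℤ} {U U' : List ℕ} {d : ℕ} (h : Occ θ i U d U') :
    lam θ i = d + 1 + cf (rt θ (i + 1)) + cf (lf θ i) := by rw [lam, h.1]

lemma cf_glue_one {T : ℕ} {f f₁ g g₁ : ℕ → ℕ} (hf : ∀ j, f j < T) (hf₁ : ∀ j, f₁ j < T)
    {u u₁ : List ℕ} (hl : u.length = u₁.length) (e : pre f u.length = u)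
    (e₁ : pre f₁ u₁.length = u₁) (hk : wkey u < wkey u₁) {p : List ℕ} (eg : pre g p.length = p)
    (eg₁ : pre g₁ p.length = p) :
    cf f + cf g ≤ cf f₁ + cf g₁ - sepC T / qd u ^ 2 + 1 / qd p ^ 2 := by
  have mem : ∀ {f : ℕ → ℕ} {u : List ℕ}, (∀ j, f j < T) → pre f u.length = u → ∀ z ∈ u, z < T := by
    intro f u hf e z hz
    rw [← e] at hz
    obtain ⟨j, -, rfl⟩ := mem_pre.1 hz
    exact hf j
  have h1 := word_sep_of_key_lt hl (mem hf e) (mem hf₁ e₁) hk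
    (cf_mem_tailIcc (f := shf u.length f) fun j => hf _)
    (cf_mem_tailIcc (f := shf u₁.length f₁) fun j => hf₁ _)
  have c1 := cf_eq_phi f u.length
  have c2 := cf_eq_phi f₁ u₁.length
  rw [e] at c1
  rw [e₁] at c2
  rw [← c1, ← c2] at h1
  have h2 := abs_cf_sub_le (f := g) (g := g₁) (n := p.length) (by rw [eg, eg₁])
  rw [eg] at h2
  linarith [(abs_le.1 h2).2]

lemma wkey_append (u v : List ℕ) : wkey (u ++ v) = phi u (wkey v) := phi_append u v _

lemma wkey_nonneg (u : List ℕ) : 0 ≤ wkey u := phi_nonneg u (by norm_num)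

lemma cf_glue {T : ℕ} {f f₁ f₂ g g₁ g₂ : ℕ → ℕ} (hf : ∀ j, f j < T) (hf₁ : ∀ j, f₁ j < T)
    (hf₂ : ∀ j, f₂ j < T) {r a b c p : List ℕ} (ha : a.length = b.length)
    (hc : c.length = b.length) (hab : wkey a < wkey b) (hbc : wkey b < wkey c)
    (e : pre f (r ++ b).length = r ++ b) (e₁ : pre f₁ (r ++ a).length = r ++ a)
    (e₂ : pre f₂ (r ++ c).length = r ++ c) (eg : pre g p.length = p)
    (eg₁ : pre g₁ p.length = p) (eg₂ : pre g₂ p.length = p) {B : ℝ}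
    (h₁ : cf f₁ + cf g₁ ≤ B) (h₂ : cf f₂ + cf g₂ ≤ B) :
    cf f + cf g ≤ B - sepC T / qd (r ++ b) ^ 2 + 1 / qd p ^ 2 := by
  rcases phi_key_lt r (wkey_nonneg a) hab hbc with h | h <;> rw [← wkey_append, ← wkey_append] at h
  · have := cf_glue_one hf hf₁ (by simp [ha]) e e₁ h eg eg₁
    linarith
  · have := cf_glue_one hf hf₂ (by simp [hc]) e e₂ h eg eg₂
    linarith

lemma flatten_inj_of_length {n : ℕ} : ∀ {u v : List (List ℕ)}, (∀ b ∈ u, b.length = n) →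
    (∀ b ∈ v, b.length = n) → u.length = v.length → u.flatten = v.flatten → u = v
  | [], [], _, _, _, _ => rfl
  | [], _ :: _, _, _, h, _ => by simp at h
  | _ :: _, [], _, _, h, _ => by simp at h
  | a :: u, b :: v, hu, hv, hl, h => by
    rw [List.flatten_cons, List.flatten_cons] at h
    obtain ⟨h1, h2⟩ := List.append_inj h (by rw [hu a (by simp), hv b (by simp)])
    rw [h1, flatten_inj_of_length (fun c hc => hu c (by simp [hc])) (fun c hc => hv c (by simp [hc]))
      (by simpa using hl) h2]

lemma flatten_length {n : ℕ} {u : List (List ℕ)} (hu : ∀ b ∈ u, b.length = n) :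
    u.flatten.length = u.length * n := by
  induction u with
  | nil => simp
  | cons a u ih =>
    rw [List.flatten_cons, List.length_append, ih fun b hb => hu b (by simp [hb]), hu a (by simp),
      List.length_cons]
    ring

/-- The weight of a block. -/
noncomputable def wt (s : ℝ) (b : List ℕ) : ℝ := (2 * qd b) ^ (-2 * s)

lemma wt_pos (s : ℝ) (b : List ℕ) : 0 < wt s b :=
  Real.rpow_pos_of_pos (mul_pos two_pos (qd_pos b)) _

lemma wt_le_one {s : ℝ} (hs : 0 ≤ s) (b : List ℕ) : wt s b ≤ 1 :=
  Real.rpow_le_one_of_one_le_of_nonpos (by linarith [qd_ge_one b]) (by linarith)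

lemma wt_mul_le {s : ℝ} (hs : 0 ≤ s) (u v : List ℕ) : wt s u * wt s v ≤ wt s (u ++ v) := by
  have hu := qd_pos u
  have hv := qd_pos v
  rw [wt, wt, wt, ← Real.mul_rpow (by positivity) (by positivity)]
  exact Real.rpow_le_rpow_of_nonpos (mul_pos two_pos (qd_pos _))
    (by linarith [qd_append_le u v]) (by linarith)

lemma lw_wt_le {s : ℝ} (hs : 0 ≤ s) {v : List (List ℕ)} (hv : v ≠ []) :
    lw (wt s) v ≤ wt s v.flatten := by
  induction v with
  | nil => exact (hv rfl).elim
  | cons b v ih =>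
    rcases eq_or_ne v [] with rfl | h
    · simp
    · rw [lw_cons, List.flatten_cons]
      exact (mul_le_mul_of_nonneg_left (ih h) (wt_pos s b).le).trans (wt_mul_le hs _ _)

/-- Comparison of the Perron value of a glued sequence with those of the two sequences in which the
block after the window is replaced by a smaller or a larger one. -/
lemma lam_glue_right {T : ℕ} {t : ℝ} {θ θ₁ θ₂ : ℤ → ℕ} {i i₁ i₂ : ℤ} (hT : ∀ j, θ j < T)
    (hT₁ : ∀ j, θ₁ j < T) (hT₂ : ∀ j, θ₂ j < T) {p r a b c : List ℕ} {d : ℕ}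
    (ha : a.length = b.length) (hc : c.length = b.length) (hab : wkey a < wkey b)
    (hbc : wkey b < wkey c) (h : Occ θ i p d (r ++ b)) (h₁ : Occ θ₁ i₁ p d (r ++ a))
    (h₂ : Occ θ₂ i₂ p d (r ++ c)) (ht₁ : lam θ₁ i₁ ≤ t) (ht₂ : lam θ₂ i₂ ≤ t) :
    lam θ i ≤ t - sepC T / qd (r ++ b) ^ 2 + 1 / qd p ^ 2 := by
  rw [h₁.lam_eq] at ht₁
  rw [h₂.lam_eq] at ht₂
  have key := cf_glue (f := rt θ (i + 1)) (f₁ := rt θ₁ (i₁ + 1)) (f₂ := rt θ₂ (i₂ + 1))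
    (g := lf θ i) (g₁ := lf θ₁ i₁) (g₂ := lf θ₂ i₂) (fun j => hT _) (fun j => hT₁ _)
    (fun j => hT₂ _) ha hc hab hbc h.2.1 h₁.2.1 h₂.2.1 (p := p.reverse) (by simpa using h.2.2)
    (by simpa using h₁.2.2) (by simpa using h₂.2.2) (B := t - d - 1) (by linarith) (by linarith)
  rw [qd_reverse] at key
  rw [h.lam_eq]
  linarith

lemma lam_glue_left {T : ℕ} {t : ℝ} {θ θ₁ θ₂ : ℤ → ℕ} {i i₁ i₂ : ℤ} (hT : ∀ j, θ j < T)
    (hT₁ : ∀ j, θ₁ j < T) (hT₂ : ∀ j, θ₂ j < T) {p r a b c : List ℕ} {d : ℕ}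
    (ha : a.length = b.length) (hc : c.length = b.length) (hab : wkey a.reverse < wkey b.reverse)
    (hbc : wkey b.reverse < wkey c.reverse) (h : Occ θ i (b ++ r) d p)
    (h₁ : Occ θ₁ i₁ (a ++ r) d p) (h₂ : Occ θ₂ i₂ (c ++ r) d p) (ht₁ : lam θ₁ i₁ ≤ t)
    (ht₂ : lam θ₂ i₂ ≤ t) :
    lam θ i ≤ t - sepC T / qd (b ++ r) ^ 2 + 1 / qd p ^ 2 := by
  rw [h₁.lam_eq] at ht₁
  rw [h₂.lam_eq] at ht₂
  have conv : ∀ {x : List ℕ} {f : ℕ → ℕ}, pre f (x ++ r).length = (x ++ r).reverse →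
      pre f (r.reverse ++ x.reverse).length = r.reverse ++ x.reverse := by
    intro x f h
    rw [← List.reverse_append, List.length_reverse, h]
  have key := cf_glue (g := rt θ (i + 1)) (g₁ := rt θ₁ (i₁ + 1)) (g₂ := rt θ₂ (i₂ + 1))
    (f := lf θ i) (f₁ := lf θ₁ i₁) (f₂ := lf θ₂ i₂) (fun j => hT _) (fun j => hT₁ _)
    (fun j => hT₂ _) (a := a.reverse) (b := b.reverse) (c := c.reverse) (r := r.reverse) (p := p)
    (by simpa) (by simpa) hab hbc (conv h.2.2) (conv h₁.2.2) (conv h₂.2.2) h.2.1 h₁.2.1 h₂.2.1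
    (B := t - d - 1) (by linarith) (by linarith)
  rw [← List.reverse_append, qd_reverse] at key
  rw [h.lam_eq]
  linarith

lemma glue_bound {T : ℕ} {A B q Q D : ℝ} (hA : 0 < A) (hB : 0 < B) (hAD : A ≤ D)
    (hAB : A ≤ B) (hq : 0 < q) (hqs : 2 ≤ sepC T * q ^ 2) (hQ : q * B ≤ Q) :
    1 / Q ^ 2 - sepC T / A ^ 2 ≤ -(sepC T / (2 * D ^ 2)) := by
  have hs := sepC_pos T
  have h1 : 1 / Q ^ 2 ≤ 1 / (q * B) ^ 2 := by gcongr
  have h2 : 1 / (q * B) ^ 2 ≤ 1 / (q * A) ^ 2 := by gcongr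
  have h3 : 1 / (q * A) ^ 2 ≤ sepC T / (2 * A ^ 2) := by
    rw [div_le_div_iff₀ (by positivity) (by positivity)]
    nlinarith [pow_pos hA 2]
  have h4 : sepC T / (2 * D ^ 2) ≤ sepC T / (2 * A ^ 2) := by gcongr
  have h5 : sepC T / A ^ 2 = 2 * (sepC T / (2 * A ^ 2)) := by field_simp
  linarith

/-- The word is a factor of a sequence with digits less than `T` and Perron values at most `t`. -/
def Fac (T : ℕ) (t : ℝ) (u : List ℕ) : Prop :=
  ∃ θ : ℤ → ℕ, (∀ i, θ i < T) ∧ (∀ i, lam θ i ≤ t) ∧ ∃ p m, block θ p m = u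

lemma Fac.occ {T : ℕ} {t : ℝ} {X Y U U' : List ℕ} {d : ℕ} (h : Fac T t (X ++ (U ++ d :: U') ++ Y)) :
    ∃ θ : ℤ → ℕ, (∀ i, θ i < T) ∧ ∃ i, lam θ i ≤ t ∧ Occ θ i U d U' := by
  obtain ⟨θ, h1, h2, p, m, h⟩ := h
  refine ⟨θ, h1, _, h2 _, Occ.shrink (X := X) (Y := Y) (occ_of_block (p := p) (n := m) ?_)⟩
  simpa using h

lemma exists_split_at {W : List ℕ} {o : ℕ} (h : o < W.length) :
    ∃ W₁ d W₂, W = W₁ ++ d :: W₂ ∧ W₁.length = o := by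
  refine ⟨W.take o, W[o], W.drop (o + 1), ?_, by simp; omega⟩
  simp

lemma sum_le_one_of_forall_eq {β : Type*} {V : Finset (List β)} {ω : List β → ℝ} {v₀ : List β}
    (h : ∀ v ∈ V, v = v₀) (h1 : ω v₀ ≤ 1) : ∑ v ∈ V, ω v ≤ 1 := by
  have : V ⊆ {v₀} := fun v hv => by simpa using h v hv
  rcases Finset.subset_singleton_iff.1 this with rfl | rfl
  · simp
  · simpa using h1

lemma Piece.length_ge {β : Type*} {key rkey : β → ℝ} {A : Set (List β)} {τ : β × β × β × β}
    {ω : β → ℝ} (h1 : ∀ b, ω b ≤ 1) {l : ℕ} {V : Finset (List β)}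
    (hV : ∀ v ∈ V, Piece key rkey A τ v ∧ v.length = l) (hw : 1 < ∑ v ∈ V, lw ω v) : 2 ≤ l := by
  by_contra! hl
  have hl : l = 0 ∨ l = 1 := by omega
  rcases hl with rfl | rfl
  · have := sum_le_one_of_forall_eq (V := V) (ω := lw ω) (v₀ := [])
      (fun v hv => List.eq_nil_of_length_eq_zero (hV v hv).2) (by simp)
    linarith
  · have := sum_le_one_of_forall_eq (V := V) (ω := lw ω) (v₀ := [τ.2.2.1]) ?_
      (by simpa using h1 _)
    · linarith
    intro v hv
    obtain ⟨⟨x, y, h, -⟩, hl⟩ := hV v hv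
    obtain ⟨b, rfl⟩ := List.length_eq_one_iff.1 hl
    obtain ⟨z, hz⟩ := h.pref
    simp at hz
    simp [hz.1]

theorem main_step {T n : ℕ} {𝓑 : Finset (List ℕ)} (hlen : ∀ b ∈ 𝓑, b.length = n)
    (hT : ∀ b ∈ 𝓑, ∀ a ∈ b, a < T) (hQ : ∀ b ∈ 𝓑, 2 ≤ sepC T * qd b ^ 2) {s t : ℝ} (hs : 0 ≤ s)
    (A : ℕ → Finset (List (List ℕ)))
    (hA : ∀ K, ∀ w ∈ A K, w.length = 16 * K ∧ (∀ b ∈ w, b ∈ 𝓑) ∧ Fac T t w.flatten)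
    (hZ : 12 ^ 16 ≤ ∑ b ∈ 𝓑, wt s b)
    (hW : ∀ K, (∑ b ∈ 𝓑, wt s b) ^ (15 * K) ≤ ∑ w ∈ A K, lw (wt s) w) :
    ∃ l, 1 ≤ l ∧ ∃ V : Finset (List ℕ),
      (∀ v ∈ V, ∃ w : List (List ℕ), (∀ b ∈ w, b ∈ 𝓑) ∧ w.length = l ∧ w.flatten = v) ∧
      1 < ∑ v ∈ V, wt s v ∧
      ∃ δ > 0, ∀ θ : ℤ → ℕ, (∀ i, θ i < T) → (∀ j : ℤ, block θ ((l * n : ℕ) * j) (l * n) ∈ V) →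
        ∀ i, lam θ i ≤ t - δ := by
  classical
  have hkey : InjOn wkey (𝓑 : Set (List ℕ)) := fun u hu v hv h =>
    wkey_injOn (hlen u hu) (hlen v hv) (hT u hu) (hT v hv) h
  have hrkey : InjOn (fun b : List ℕ => wkey b.reverse) (𝓑 : Set (List ℕ)) := fun u hu v hv h =>
    List.reverse_injective (wkey_injOn (T := T) (by simpa using hlen u hu)
      (by simpa using hlen v hv) (by simpa using hT u hu) (by simpa using hT v hv) h)
  obtain ⟨K, τ, l, V, hV, hVw⟩ := exists_heavy_pieces hkey hrkey (fun b => (wt_pos s b).le)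
    (wt_le_one hs) hZ A (fun K w hw => ⟨(hA K w hw).1, (hA K w hw).2.1⟩) hW
  have hl := Piece.length_ge (wt_le_one hs) hV hVw
  have hlet : ∀ v ∈ V, ∀ b ∈ v, b ∈ 𝓑 := by
    intro v hv b hb
    obtain ⟨⟨x, y, h, -⟩, -⟩ := hV v hv
    exact (hA K _ h.mem).2.1 b (by simp [hb])
  have hflen : ∀ v ∈ V, v.flatten.length = l * n := fun v hv => by
    rw [flatten_length fun b hb => hlen b (hlet v hv b hb), (hV v hv).2]
  refine ⟨l, by omega, V.image List.flatten, ?_, ?_, sepC T / (2 * ((T + 1 : ℝ) ^ (l * n + n)) ^ 2),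
    by have := sepC_pos T; positivity, ?_⟩
  · intro v hv
    obtain ⟨w, hw, rfl⟩ := Finset.mem_image.1 hv
    exact ⟨w, hlet w hw, (hV w hw).2, rfl⟩
  · rw [Finset.sum_image]
    · refine hVw.trans_le (Finset.sum_le_sum fun v hv => lw_wt_le hs ?_)
      rintro rfl
      have := (hV _ hv).2
      simp at this
      omega
    · intro u hu v hv h
      exact flatten_inj_of_length (fun b hb => hlen b (hlet u hu b hb))
        (fun b hb => hlen b (hlet v hv b hb)) ((hV u hu).2.trans (hV v hv).2.symm) h
  intro θ hθT hθ i
  set N := l * n with hN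
  have hNpos : 0 < N := by
    rcases Nat.eq_zero_or_pos n with h0 | h0
    · exfalso
      have h1 : ∀ b ∈ 𝓑, b = [] := fun b hb => List.eq_nil_of_length_eq_zero (by rw [hlen b hb, h0])
      have := sum_le_one_of_forall_eq (V := 𝓑) (ω := wt s) h1 (wt_le_one hs _)
      norm_num at hZ
      linarith
    · positivity
  obtain ⟨o, j, ho, hi⟩ : ∃ o : ℕ, ∃ j : ℤ, o < N ∧ i = N * j + o := by
    refine ⟨(i % N).toNat, i / N, ?_, ?_⟩
    · have := Int.emod_lt_of_pos i (by exact_mod_cast hNpos : (0 : ℤ) < N)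
      have := Int.emod_nonneg i (by exact_mod_cast hNpos.ne' : (N : ℤ) ≠ 0)
      omega
    · have := Int.emod_nonneg i (by exact_mod_cast hNpos.ne' : (N : ℤ) ≠ 0)
      rw [Int.toNat_of_nonneg this, Int.mul_ediv_add_emod]
  obtain ⟨v₀, hv₀, e₀⟩ := Finset.mem_image.1 (hθ (j - 1))
  obtain ⟨v, hv, e⟩ := Finset.mem_image.1 (hθ j)
  obtain ⟨v₁, hv₁, e₁⟩ := Finset.mem_image.1 (hθ (j + 1))
  obtain ⟨W₁, d, W₂, hW, hW₁⟩ := exists_split_at (W := v.flatten) (o := o) (by rw [hflen v hv]; omega)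
  obtain ⟨X, hX⟩ : [τ.1, τ.2.1] <:+ v₀ := by
    obtain ⟨⟨x, y, -, h⟩, h'⟩ := hV v₀ hv₀
    exact List.suffix_of_suffix_length_le h.suffix (List.suffix_append x v₀) (by simp; omega)
  obtain ⟨Y, hY⟩ : [τ.2.2.1, τ.2.2.2] <+: v₁ := by
    obtain ⟨⟨x, y, h, -⟩, h'⟩ := hV v₁ hv₁
    exact List.prefix_of_prefix_length_le h.pref (List.prefix_append v₁ y) (by simp; omega)
  have hτ₁ : τ.1 ∈ 𝓑 := hlet v₀ hv₀ _ (by simp [← hX])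
  have hτ₂ : τ.2.1 ∈ 𝓑 := hlet v₀ hv₀ _ (by simp [← hX])
  have hτ₃ : τ.2.2.1 ∈ 𝓑 := hlet v₁ hv₁ _ (by simp [← hY])
  have hτ₄ : τ.2.2.2 ∈ 𝓑 := hlet v₁ hv₁ _ (by simp [← hY])
  obtain ⟨τ₁, τ₂, τ₃, τ₄⟩ := τ
  simp only at hX hY hτ₁ hτ₂ hτ₃ hτ₄
  have hocc : Occ θ i (τ₁ ++ τ₂ ++ W₁) d (W₂ ++ τ₃ ++ τ₄) := by
    have hb : block θ (N * (j - 1)) (N + N + N) =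
        (v₀.flatten ++ W₁) ++ d :: (W₂ ++ v₁.flatten) := by
      rw [block_add, block_add, ← e₀]
      rw [show (N * (j - 1) + (N + N : ℕ) : ℤ) = N * (j + 1) by push_cast; ring,
        show (N * (j - 1) + (N : ℕ) : ℤ) = N * j by ring, ← e, ← e₁, hW]
      simp
    have := occ_of_block hb
    rw [List.length_append, hflen v₀ hv₀, hW₁,
      show (N * (j - 1) + (N + o : ℕ) : ℤ) = i by rw [hi]; push_cast; ring] at this
    refine Occ.shrink (X := X.flatten) (Y := Y.flatten) ?_
    rw [← hX, ← hY] at this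
    simpa using this
  have hdig : ∀ a ∈ W₁ ++ W₂, a < T := by
    intro a ha
    have : a ∈ v.flatten := by rw [hW]; simp at ha ⊢; tauto
    obtain ⟨b, hb, hab⟩ := List.mem_flatten.1 this
    exact hT b (hlet v hv b hb) a hab
  have hWlen : W₁.length + W₂.length + 1 = N := by
    rw [← hflen v hv, hW]; simp; ring
  have hD : ∀ u : List ℕ, (∀ a ∈ u, a < T) → u.length ≤ N + n → qd u ≤ (T + 1 : ℝ) ^ (N + n) :=
    fun u hu hl => (qd_le_pow u hu).trans (pow_le_pow_right₀ (by linarith [T.cast_nonneg (α := ℝ)]) hl)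
  have hDr : qd (W₂ ++ τ₃) ≤ (T + 1 : ℝ) ^ (N + n) := by
    refine hD _ ?_ (by rw [List.length_append, hlen _ hτ₃]; omega)
    intro a ha
    rcases List.mem_append.1 ha with h | h
    · exact hdig a (by simp [h])
    · exact hT _ hτ₃ a h
  have hDl : qd (τ₂ ++ W₁) ≤ (T + 1 : ℝ) ^ (N + n) := by
    refine hD _ ?_ (by rw [List.length_append, hlen _ hτ₂]; omega)
    intro a ha
    rcases List.mem_append.1 ha with h | h
    · exact hT _ hτ₂ a h
    · exact hdig a (by simp [h])
  obtain ⟨⟨x, y, hcl, hcr⟩, -⟩ := hV v hv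
  rcases le_total (qd (W₂ ++ τ₃)) (qd (τ₂ ++ W₁)) with hle | hle
  · obtain ⟨b, y', rfl, ⟨a, z, haz, hab⟩, ⟨c, z', hcz, hbc⟩⟩ := hcr.right
    obtain rfl : τ₃ = b := by
      obtain ⟨q, hq⟩ := hcr.pref
      simp at hq
      exact hq.1
    obtain ⟨x', rfl⟩ := hcl.suffix
    have hfa : ∀ {a z}, x' ++ [τ₁, τ₂] ++ v ++ a :: z ∈ A K →
        a ∈ 𝓑 ∧ ∃ θ : ℤ → ℕ, (∀ i, θ i < T) ∧ ∃ i, lam θ i ≤ t ∧ Occ θ i (τ₁ ++ τ₂ ++ W₁) d (W₂ ++ a) := by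
      intro a z h
      refine ⟨(hA K _ h).2.1 a (by simp), Fac.occ (X := x'.flatten) (Y := z.flatten) ?_⟩
      have := (hA K _ h).2.2
      simpa [hW] using this
    obtain ⟨ha, θ₁, hθ₁, i₁, hl₁, ho₁⟩ := hfa (by simpa using haz)
    obtain ⟨hc, θ₂, hθ₂, i₂, hl₂, ho₂⟩ := hfa (by simpa using hcz)
    have := lam_glue_right hθT hθ₁ hθ₂ ((hlen a ha).trans (hlen _ hτ₃).symm)
      ((hlen c hc).trans (hlen _ hτ₃).symm) hab hbc (Occ.shrink (X := []) (by simpa using hocc))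
      ho₁ ho₂ hl₁ hl₂
    have h2 := glue_bound (qd_pos _) (qd_pos _) hDr hle (qd_pos τ₁) (hQ _ hτ₁)
      (Q := qd (τ₁ ++ τ₂ ++ W₁)) (by rw [List.append_assoc]; exact qd_mul_le _ _)
    linarith
  · obtain ⟨b, y', rfl, ⟨a, z, haz, hab⟩, ⟨c, z', hcz, hbc⟩⟩ := hcl.left.exists
    obtain rfl : τ₂ = b := by
      obtain ⟨q, hq⟩ := hcl.suffix
      rw [show [τ₁, τ₂] = [τ₁] ++ [τ₂] from rfl, ← List.append_assoc] at hq
      simpa using (List.append_inj' hq rfl).2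
    obtain ⟨y₁, rfl⟩ := hcr.pref
    have hfa : ∀ {a z}, z ++ a :: (v ++ ([τ₃, τ₄] ++ y₁)) ∈ A K →
        a ∈ 𝓑 ∧ ∃ θ : ℤ → ℕ, (∀ i, θ i < T) ∧ ∃ i, lam θ i ≤ t ∧ Occ θ i (a ++ W₁) d (W₂ ++ τ₃ ++ τ₄) := by
      intro a z h
      refine ⟨(hA K _ h).2.1 a (by simp), Fac.occ (X := z.flatten) (Y := y₁.flatten) ?_⟩
      have := (hA K _ h).2.2
      simpa [hW] using this
    obtain ⟨ha, θ₁, hθ₁, i₁, hl₁, ho₁⟩ := hfa (by simpa using haz)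
    obtain ⟨hc, θ₂, hθ₂, i₂, hl₂, ho₂⟩ := hfa (by simpa using hcz)
    have := lam_glue_left hθT hθ₁ hθ₂ ((hlen a ha).trans (hlen _ hτ₂).symm)
      ((hlen c hc).trans (hlen _ hτ₂).symm) hab hbc
      (Occ.shrink (X := τ₁) (Y := []) (by simpa using hocc)) ho₁ ho₂ hl₁ hl₂
    have h2 := glue_bound (qd_pos _) (qd_pos _) hDl hle (qd_pos τ₄) (hQ _ hτ₄)
      (Q := qd (W₂ ++ τ₃ ++ τ₄)) (by rw [mul_comm]; exact qd_mul_le _ _)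
    linarith

/-- A lower bound for the Hausdorff dimension of a set containing the image of a regular tree. -/
theorem le_dimH_of_tree {M : ℕ} (hM : 1 < M) {E : Set ℝ} (f : (ℕ → Fin M) → ℝ) {c r : ℝ}
    (hc : 0 < c) (hr : 0 < r) (hfE : ∀ ω, f ω ∈ E)
    (hsep : ∀ ω ω' n, (∀ i < n, ω i = ω' i) → ω n ≠ ω' n → c * r ^ n ≤ |f ω - f ω'|)
    {d : ℝ} (hd : 0 < d) (hMr : 1 ≤ M * r ^ d) : ENNReal.ofReal d ≤ dimH E := by
  have hfirst : ∀ {ω ω' : ℕ → Fin M}, ω ≠ ω' → ∃ n, (∀ i < n, ω i = ω' i) ∧ ω n ≠ ω' n := by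
    classical
    intro ω ω' h
    have h' : ∃ n, ω n ≠ ω' n := by
      by_contra! h'
      exact h (funext h')
    exact ⟨Nat.find h', fun i hi => by simpa using Nat.find_min h' hi, Nat.find_spec h'⟩
  have hinj : Function.Injective f := by
    intro ω ω' h
    by_contra hne
    obtain ⟨n, h1, h2⟩ := hfirst hne
    have := hsep ω ω' n h1 h2
    rw [h, sub_self, abs_zero] at this
    have : 0 < c * r ^ n := by positivity
    linarith
  have : Nonempty (Fin M) := ⟨⟨0, by omega⟩⟩
  set g : ℝ → ℝ := fun x => Real.ofDigits (Function.invFun f x) with hg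
  have hgf : ∀ ω, g (f ω) = Real.ofDigits ω := fun ω => by
    rw [hg]
    simp only [Function.leftInverse_invFun hinj ω]
  have hM0 : (0 : ℝ) < M := by exact_mod_cast (by omega : 0 < M)
  have hcd : 0 < c ^ (-d) := Real.rpow_pos_of_pos hc _
  have hold : HolderOnWith (c ^ (-d)).toNNReal d.toNNReal g (range f) := by
    rintro _ ⟨ω, rfl⟩ _ ⟨ω', rfl⟩
    rcases eq_or_ne ω ω' with rfl | hne
    · simp
    obtain ⟨n, h1, h2⟩ := hfirst hne
    rw [edist_dist, edist_dist, Real.dist_eq, Real.dist_eq, hgf, hgf]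
    have h3 : |Real.ofDigits ω - Real.ofDigits ω'| ≤ c ^ (-d) * |f ω - f ω'| ^ d := by
      refine (Real.abs_ofDigits_sub_ofDigits_le h1).trans ?_
      have h4 : (c * r ^ n) ^ d ≤ |f ω - f ω'| ^ d :=
        Real.rpow_le_rpow (by positivity) (hsep ω ω' n h1 h2) hd.le
      have h5 : ((M : ℝ) ^ n)⁻¹ ≤ (r ^ n) ^ d := by
        rw [inv_le_iff_one_le_mul₀ (by positivity), ← Real.rpow_natCast r n, ← Real.rpow_mul hr.le,
          mul_comm (n : ℝ), Real.rpow_mul hr.le, Real.rpow_natCast, mul_comm, ← mul_pow]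
        exact one_le_pow₀ hMr
      calc ((M : ℝ) ^ n)⁻¹ ≤ (r ^ n) ^ d := h5
        _ = c ^ (-d) * (c * r ^ n) ^ d := by
          rw [Real.mul_rpow hc.le (by positivity), ← mul_assoc, ← Real.rpow_add hc]
          simp
        _ ≤ _ := by gcongr
    calc ENNReal.ofReal |Real.ofDigits ω - Real.ofDigits ω'|
        ≤ ENNReal.ofReal (c ^ (-d) * |f ω - f ω'| ^ d) := ENNReal.ofReal_le_ofReal h3
      _ = _ := by
        rw [ENNReal.ofReal_mul hcd.le, Real.coe_toNNReal d hd.le,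
          ENNReal.ofReal_rpow_of_nonneg (abs_nonneg _) hd.le]
        rfl
  have h1 := hold.dimH_image_le (by simpa using hd)
  have h2 : Icc (0 : ℝ) 1 ⊆ g '' range f := by
    intro x hx
    obtain ⟨ω, -, rfl⟩ := Real.ofDigits_SurjOn hM hx
    exact ⟨f ω, ⟨ω, rfl⟩, hgf ω⟩
  have h3 : (1 : ℝ≥0∞) ≤ dimH (range f) / ENNReal.ofReal d := by
    refine le_trans ?_ h1
    have h4 : dimH (Icc (0 : ℝ) 1) = 1 := by
      rw [Real.dimH_of_nonempty_interior (by rw [interior_Icc]; exact ⟨1 / 2, by norm_num⟩)]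
      simp
    rw [← h4]
    exact dimH_mono h2
  rw [ENNReal.le_div_iff_mul_le (by simp [hd]) (by simp), one_mul] at h3
  exact h3.trans (dimH_mono (range_subset_iff.2 hfE))

/-- The denominator of `u` seen from the slope `k`. -/
noncomputable def gg (k : ℝ) (u : List ℕ) : ℝ := qd u + k * pd u

lemma gg_pos {k : ℝ} (hk : 0 ≤ k) (u : List ℕ) : 0 < gg k u := by
  have := qd_pos u
  have := pd_nonneg u
  unfold gg; positivity

lemma qd_le_gg {k : ℝ} (hk : 0 ≤ k) (u : List ℕ) : qd u ≤ gg k u := by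
  have := mul_nonneg hk (pd_nonneg u)
  unfold gg; linarith

lemma gg_le {k : ℝ} (hk : k ≤ 1) (u : List ℕ) : gg k u ≤ 2 * qd u := by
  have := mul_le_mul_of_nonneg_right hk (pd_nonneg u)
  have := pd_le_qd u
  unfold gg; linarith

lemma phi_reverse_eq {k : ℝ} (hk : 0 ≤ k) (u : List ℕ) :
    phi u.reverse k = (qe u + k * pe u) / gg k u := by
  rw [phi_eq _ hk, pe_reverse, pd_reverse, qe_reverse, qd_reverse, gg]
  congr 1 <;> ring

lemma gg_append {k : ℝ} (hk : 0 ≤ k) (u v : List ℕ) :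
    gg k (u ++ v) = gg k u * gg (phi u.reverse k) v := by
  have := (gg_pos hk u).ne'
  have h : gg k u * gg (phi u.reverse k) v = gg k u * qd v + (qe u + k * pe u) * pd v := by
    rw [phi_reverse_eq hk, show gg ((qe u + k * pe u) / gg k u) v =
      qd v + (qe u + k * pe u) / gg k u * pd v from rfl]
    field_simp
  rw [h, gg, gg, qd_append, pd_append]
  ring

lemma abs_log_gg_sub_le {k k' : ℝ} (hk : 0 ≤ k) (hk' : 0 ≤ k') (u : List ℕ) :
    |Real.log (gg k u) - Real.log (gg k' u)| ≤ |k - k'| := by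
  have key : ∀ {k k' : ℝ}, 0 ≤ k → 0 ≤ k' →
      Real.log (gg k u) - Real.log (gg k' u) ≤ |k - k'| := by
    intro k k' hk hk'
    have h1 := gg_pos hk u
    have h2 := gg_pos hk' u
    rw [← Real.log_div h1.ne' h2.ne']
    refine (Real.log_le_sub_one_of_pos (by positivity)).trans ?_
    rw [div_sub_one h2.ne', div_le_iff₀ h2]
    have h3 : pd u ≤ gg k' u := (pd_le_qd u).trans (qd_le_gg hk' u)
    have h4 : gg k u - gg k' u = (k - k') * pd u := by unfold gg; ring
    rw [h4]
    calc (k - k') * pd u ≤ |k - k'| * pd u :=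
          mul_le_mul_of_nonneg_right (le_abs_self _) (pd_nonneg u)
      _ ≤ _ := mul_le_mul_of_nonneg_left h3 (abs_nonneg _)
  rw [abs_le]
  have := key hk hk'
  have h := key hk' hk
  rw [abs_sub_comm] at h
  constructor <;> linarith

lemma exists_phi_fixed {T : ℕ} {a : List ℕ} (ha : a ≠ []) (hT : ∀ z ∈ a, z < T) :
    ∃ x ∈ tailIcc T, phi a x = x := by
  have hn : 0 < a.length := List.length_pos_iff.2 ha
  set f : ℕ → ℕ := fun i => a.getD (i % a.length) 0 with hf
  have hpre : pre f a.length = a := by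
    refine List.ext_getElem (by simp) fun i h1 h2 => ?_
    simp [pre, hf, Nat.mod_eq_of_lt h2, h2]
  have hshf : shf a.length f = f := by
    funext j
    simp [shf, hf]
  have hfT : ∀ j, f j < T := by
    intro j
    have := Nat.mod_lt j hn
    simp only [hf]
    rw [List.getD_eq_getElem _ _ this]
    exact hT _ (List.getElem_mem _)
  refine ⟨cf f, cf_mem_tailIcc hfT, ?_⟩
  have := cf_eq_phi f a.length
  rw [hpre, hshf] at this
  exact this.symm

/-- The word `a` and the fixed points `x`, `k` of `a` and of its mirror image. -/
structure Axis (a : List ℕ) (k x : ℝ) : Prop where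
  even : Even a.length
  ne : a ≠ []
  hk : k ∈ Icc (0 : ℝ) 1
  hx : x ∈ Icc (0 : ℝ) 1
  fixk : phi a.reverse k = k
  fixx : phi a x = x

lemma Axis.reverse {a : List ℕ} {k x : ℝ} (h : Axis a k x) : Axis a.reverse x k :=
  ⟨by simpa using h.even, by simpa using h.ne, h.hx, h.hk, by simpa using h.fixx, h.fixk⟩

lemma Axis.one_lt {a : List ℕ} {k x : ℝ} (h : Axis a k x) : 1 < gg k a := by
  have h1 := two_pow_le_qd a
  have h2 := qd_le_gg h.hk.1 a
  have h3 : 1 ≤ a.length / 2 := by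
    have := List.length_pos_iff.2 h.ne
    obtain ⟨c, hc⟩ := h.even
    omega
  have h4 : (2 : ℝ) ^ 1 ≤ 2 ^ (a.length / 2) := pow_le_pow_right₀ (by norm_num) h3
  linarith

lemma Axis.det {a : List ℕ} {k x : ℝ} (h : Axis a k x) : pe a * qd a - pd a * qe a = 1 := by
  rw [wmat_det, h.even.neg_one_pow]

lemma Axis.eqk {a : List ℕ} {k x : ℝ} (h : Axis a k x) : k * pe a + qe a = gg k a * k := by
  have h1 := h.fixk
  rw [phi_reverse_eq h.hk.1, div_eq_iff (gg_pos h.hk.1 a).ne'] at h1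
  linarith

lemma Axis.gg_eq {a : List ℕ} {k x : ℝ} (h : Axis a k x) : qe a * x + qd a = gg k a := by
  have h1 := h.reverse.eqk
  have h2 := h.eqk
  simp only [pe_reverse, qe_reverse, gg, qd_reverse, pd_reverse] at h1 h2 ⊢
  have h3 : 0 < k * x + 1 := by nlinarith [h.hk.1, h.hx.1, mul_nonneg h.hk.1 h.hx.1]
  have : (qe a * x + qd a - (qd a + k * pd a)) * (k * x + 1) = 0 := by linear_combination x * h2 - k * h1
  rcases mul_eq_zero.1 this with h | h <;> linarith

lemma Axis.eqx {a : List ℕ} {k x : ℝ} (h : Axis a k x) : pe a * x + pd a = gg k a * x := by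
  have h1 := h.reverse.eqk
  rw [← h.gg_eq]
  simp only [pe_reverse, qe_reverse, gg, qd_reverse, pd_reverse] at h1
  linarith

/-- The `M`-th power of the word `a`. -/
def pw (a : List ℕ) (M : ℕ) : List ℕ := (List.replicate M a).flatten

lemma pw_succ (a : List ℕ) (M : ℕ) : pw a (M + 1) = a ++ pw a M := by
  simp [pw, List.replicate_succ]

lemma pw_length (a : List ℕ) (M : ℕ) : (pw a M).length = M * a.length := by simp [pw]

lemma pw_reverse (a : List ℕ) (M : ℕ) : (pw a M).reverse = pw a.reverse M := by
  simp [pw, List.reverse_flatten]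

lemma phi_pw {a : List ℕ} {x : ℝ} (h : phi a x = x) (M : ℕ) : phi (pw a M) x = x := by
  induction M with
  | zero => simp [pw, phi]
  | succ M ih => rw [pw_succ, phi_append, ih, h]

lemma Axis.bilin {a : List ℕ} {k x : ℝ} (h : Axis a k x) (ξ υ : ℝ) (M : ℕ) : ∀ α β : ℝ,
    (α * (pe (pw a M) * ξ + pd (pw a M) * υ) + β * (qe (pw a M) * ξ + qd (pw a M) * υ)) *
      (k * x + 1) = (α * x + β) * (k * ξ + υ) * gg k a ^ M +
        (α - k * β) * (ξ - x * υ) * (gg k a)⁻¹ ^ M := by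
  have hl := (gg_pos h.hk.1 a).ne'
  induction M with
  | zero => intro α β; simp [pw]; ring
  | succ M ih =>
    intro α β
    have := ih (α * pe a + β * qe a) (α * pd a + β * qd a)
    rw [pw_succ, pe_append, pd_append, qe_append, qd_append]
    have e1 : (α * pe a + β * qe a) * x + (α * pd a + β * qd a) = gg k a * (α * x + β) := by
      linear_combination α * h.eqx + β * h.gg_eq
    have e2 : (α * pe a + β * qe a) - k * (α * pd a + β * qd a) = (gg k a)⁻¹ * (α - k * β) := by
      have hg : gg k a = qd a + k * pd a := rfl
      have e3 : gg k a * (pe a - k * pd a) = 1 := by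
        linear_combination h.det + pd a * h.eqk + pe a * hg
      have e4 : gg k a * (qe a - k * qd a) = -k := by
        linear_combination qe a * hg + qd a * h.eqk - k * h.det
      field_simp
      linear_combination α * e3 + β * e4
    rw [e1, e2] at this
    rw [pow_succ, pow_succ]
    linear_combination this

/-- Concatenations of blocks of `B`. -/
def Conc (B : Set (List ℕ)) (w : List ℕ) : Prop := ∃ l : List (List ℕ), (∀ b ∈ l, b ∈ B) ∧ l.flatten = w

lemma Conc.nil (B : Set (List ℕ)) : Conc B [] := ⟨[], by simp, rfl⟩

lemma Conc.append {B : Set (List ℕ)} {u v : List ℕ} (hu : Conc B u) (hv : Conc B v) :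
    Conc B (u ++ v) := by
  obtain ⟨l, hl, rfl⟩ := hu
  obtain ⟨m, hm, rfl⟩ := hv
  refine ⟨l ++ m, ?_, by simp⟩
  intro b hb
  rcases List.mem_append.1 hb with h | h
  exacts [hl b h, hm b h]

lemma conc_pw {B : Set (List ℕ)} {a : List ℕ} (ha : a ∈ B) (M : ℕ) : Conc B (pw a M) :=
  ⟨List.replicate M a, by simp +contextual [List.mem_replicate, ha], rfl⟩

lemma conc_of_mem {B : Set (List ℕ)} {a : List ℕ} (ha : a ∈ B) : Conc B a :=
  ⟨[a], by simpa using ha, by simp⟩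

/-- The logarithmic changes of scale that can be realised, up to arbitrarily small errors, while
returning to the slopes `k` and `x`. -/
def Ret (B : Set (List ℕ)) (k x : ℝ) : Set ℝ :=
  {τ | ∀ ε > 0, ∃ u v, Conc B u ∧ Conc B v.reverse ∧ |phi u.reverse k - k| < ε ∧
    |phi v.reverse x - x| < ε ∧ |2 * Real.log (gg k u) - 2 * Real.log (gg x v) - τ| < ε}

lemma abs_phi_sub_le' (w : List ℕ) {x y : ℝ} (hx : 0 ≤ x) (hy : 0 ≤ y) :
    |phi w x - phi w y| ≤ |x - y| := by
  refine (abs_phi_sub_le w hx hy).trans (div_le_self (abs_nonneg _) ?_)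
  nlinarith [qd_ge_one w]

lemma log_gg_append {k : ℝ} (hk : 0 ≤ k) (u v : List ℕ) :
    Real.log (gg k (u ++ v)) = Real.log (gg k u) + Real.log (gg (phi u.reverse k) v) := by
  rw [gg_append hk, Real.log_mul (gg_pos hk u).ne' (gg_pos (phi_nonneg _ hk) v).ne']

lemma abs_phi_append_sub_le {k κ κ' : ℝ} (hk : 0 ≤ k) (hκ : 0 ≤ κ) (u v : List ℕ) :
    |phi (u ++ v).reverse k - κ'| ≤ |phi u.reverse k - κ| + |phi v.reverse κ - κ'| := by
  rw [List.reverse_append, phi_append]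
  exact (abs_sub_le _ (phi v.reverse κ) _).trans
    (add_le_add_left (abs_phi_sub_le' _ (phi_nonneg _ hk) hκ) _)

lemma abs_log_gg_append_sub_le {k κ : ℝ} (hk : 0 ≤ k) (hκ : 0 ≤ κ) (u v : List ℕ) :
    |Real.log (gg k (u ++ v)) - (Real.log (gg k u) + Real.log (gg κ v))| ≤
      |phi u.reverse k - κ| := by
  rw [log_gg_append hk, add_sub_add_left_eq_sub]
  exact abs_log_gg_sub_le (phi_nonneg _ hk) hκ v

lemma Ret.add {B : Set (List ℕ)} {k x τ τ' : ℝ} (hk : 0 ≤ k) (hx : 0 ≤ x)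
    (h : τ ∈ Ret B k x) (h' : τ' ∈ Ret B k x) : τ + τ' ∈ Ret B k x := by
  intro ε hε
  obtain ⟨u, v, hu, hv, h1, h2, h3⟩ := h (ε / 6) (by positivity)
  obtain ⟨u', v', hu', hv', h1', h2', h3'⟩ := h' (ε / 6) (by positivity)
  refine ⟨u ++ u', v ++ v', hu.append hu', by simpa using hv'.append hv, ?_, ?_, ?_⟩
  · have := abs_phi_append_sub_le (κ' := k) hk hk u u'
    linarith
  · have := abs_phi_append_sub_le (κ' := x) hx hx v v'
    linarith
  · have e1 := abs_log_gg_append_sub_le hk hk u u'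
    have e2 := abs_log_gg_append_sub_le hx hx v v'
    rw [abs_lt] at h3 h3' ⊢
    rw [abs_le] at e1 e2
    constructor <;> linarith [e1.1, e1.2, e2.1, e2.2]

lemma Ret.zero {B : Set (List ℕ)} {k x : ℝ} : (0 : ℝ) ∈ Ret B k x := fun ε hε =>
  ⟨[], [], Conc.nil B, Conc.nil B, by simpa [phi] using hε, by simpa [phi] using hε,
    by simpa [gg] using hε⟩

lemma Ret.nsmul {B : Set (List ℕ)} {k x τ : ℝ} (hk : 0 ≤ k) (hx : 0 ≤ x)
    (h : τ ∈ Ret B k x) (n : ℕ) : n * τ ∈ Ret B k x := by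
  induction n with
  | zero => simpa using Ret.zero
  | succ n ih => rw [Nat.cast_succ, add_one_mul]; exact Ret.add hk hx ih h

lemma Ret.eq_univ {B : Set (List ℕ)} {k x : ℝ} (hk : 0 ≤ k) (hx : 0 ≤ x)
    (h : ∀ ε > 0, ∃ τ, 0 < τ ∧ τ < ε ∧ τ ∈ Ret B k x ∧ -τ ∈ Ret B k x) (σ : ℝ) :
    σ ∈ Ret B k x := by
  intro ε hε
  obtain ⟨τ, h0, h1, h2, h3⟩ := h (ε / 2) (by positivity)
  obtain ⟨z, hz, hz'⟩ : ∃ z ∈ Ret B k x, |z - σ| < ε / 2 := by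
    rcases le_total 0 σ with hσ | hσ
    · refine ⟨⌊σ / τ⌋₊ * τ, Ret.nsmul hk hx h2 _, ?_⟩
      have e1 := (le_div_iff₀ h0).1 (Nat.floor_le (div_nonneg hσ h0.le))
      have e2 := (div_lt_iff₀ h0).1 (Nat.lt_floor_add_one (σ / τ))
      rw [abs_lt]; constructor <;> linarith
    · refine ⟨⌊-σ / τ⌋₊ * -τ, Ret.nsmul hk hx h3 _, ?_⟩
      have hσ' : 0 ≤ -σ := by linarith
      have e1 := (le_div_iff₀ h0).1 (Nat.floor_le (div_nonneg hσ' h0.le))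
      have e2 := (div_lt_iff₀ h0).1 (Nat.lt_floor_add_one (-σ / τ))
      rw [abs_lt]; constructor <;> linarith
  obtain ⟨u, v, hu, hv, e1, e2, e3⟩ := hz (ε / 2) (by positivity)
  refine ⟨u, v, hu, hv, by linarith, by linarith, ?_⟩
  rw [abs_lt] at *
  constructor <;> linarith [e3.1, e3.2, hz'.1, hz'.2]

/-- The bilinear form attached to a word by its action between two fixed points. -/
noncomputable def jj (k x : ℝ) (w : List ℕ) : ℝ := (k * pe w + qe w) * x + (k * pd w + qd w)

lemma jj_pos {k x : ℝ} (hk : 0 ≤ k) (hx : 0 ≤ x) (w : List ℕ) : 0 < jj k x w := by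
  have := qd_pos w
  have := pd_nonneg w
  have := pe_nonneg w
  have := qe_nonneg w
  unfold jj; positivity

lemma jj_reverse (k x : ℝ) (w : List ℕ) : jj x k w.reverse = jj k x w := by
  simp only [jj, pe_reverse, qe_reverse, qd_reverse, pd_reverse]; ring

lemma Axis.prod_pos {a : List ℕ} {k x : ℝ} (h : Axis a k x) : 0 < k * x + 1 := by
  have := mul_nonneg h.hk.1 h.hx.1
  linarith

lemma Axis.tendsto_inv_pow {a : List ℕ} {k x : ℝ} (h : Axis a k x) :
    Tendsto (fun M => (gg k a)⁻¹ ^ M) atTop (𝓝 0) :=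
  tendsto_pow_atTop_nhds_zero_of_lt_one (inv_nonneg.2 (gg_pos h.hk.1 a).le) (inv_lt_one_of_one_lt₀ h.one_lt)

lemma Axis.tendsto_log {a : List ℕ} {k x : ℝ} (h : Axis a k x) (W : List ℕ) :
    Tendsto (fun M => Real.log (gg k (W ++ pw a M)) - M * Real.log (gg k a)) atTop
      (𝓝 (Real.log (jj k x W / (k * x + 1)))) := by
  have hl := gg_pos h.hk.1 a
  have hp := h.prod_pos
  have hJ := jj_pos h.hk.1 h.hx.1 W
  have h1 : ∀ M, gg k (W ++ pw a M) / gg k a ^ M = (jj k x W + ((k * pe W + qe W) -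
      k * (k * pd W + qd W)) * (-x) * ((gg k a)⁻¹ ^ M * (gg k a)⁻¹ ^ M)) / (k * x + 1) := by
    intro M
    have := h.bilin 0 1 M (k * pe W + qe W) (k * pd W + qd W)
    rw [div_eq_div_iff (by positivity) hp.ne', show gg k (W ++ pw a M) * (k * x + 1) =
      ((k * pe W + qe W) * (pe (pw a M) * 0 + pd (pw a M) * 1) + (k * pd W + qd W) *
        (qe (pw a M) * 0 + qd (pw a M) * 1)) * (k * x + 1) by
        rw [gg, qd_append, pd_append]; ring, this, jj]
    have e : (gg k a)⁻¹ ^ M * gg k a ^ M = 1 := by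
      rw [← mul_pow, inv_mul_cancel₀ hl.ne', one_pow]
    linear_combination -((k * pe W + qe W) -
      k * (k * pd W + qd W)) * (-x) * (gg k a)⁻¹ ^ M * e
  have h2 : Tendsto (fun M => gg k (W ++ pw a M) / gg k a ^ M) atTop
      (𝓝 (jj k x W / (k * x + 1))) := by
    simp_rw [h1]
    have := (((h.tendsto_inv_pow.mul h.tendsto_inv_pow).const_mul (((k * pe W + qe W) -
      k * (k * pd W + qd W)) * (-x))).const_add (jj k x W)).div_const (k * x + 1)
    simpa using this
  have h3 := h2.log (by positivity)
  refine h3.congr fun M => ?_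
  rw [Real.log_div (gg_pos h.hk.1 _).ne' (by positivity), Real.log_pow]

lemma abs_phi_pw_sub_le {a : List ℕ} (he : Even a.length) (hne : a ≠ []) (M : ℕ) {y z : ℝ}
    (hy : y ∈ Icc (0 : ℝ) 1) (hz : z ∈ Icc (0 : ℝ) 1) :
    |phi (pw a M) y - phi (pw a M) z| ≤ (1 / 2) ^ M := by
  have h1 := two_pow_le_qd (pw a M)
  have h2 : M ≤ (pw a M).length / 2 := by
    have := List.length_pos_iff.2 hne
    obtain ⟨c, hc⟩ := he
    have hc1 : 1 ≤ c := by omega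
    rw [pw_length, hc, ← two_mul, mul_left_comm, Nat.mul_div_cancel_left _ two_pos]
    exact Nat.le_mul_of_pos_right _ hc1
  have h3 : (2 : ℝ) ^ M ≤ qd (pw a M) := (pow_le_pow_right₀ (by norm_num) h2).trans h1
  have h4 := qd_ge_one (pw a M)
  refine (abs_phi_sub_le _ hy.1 hz.1).trans ?_
  have h5 : |y - z| ≤ 1 := by rw [abs_le]; constructor <;> linarith [hy.1, hy.2, hz.1, hz.2]
  rw [one_div, inv_pow, ← one_div]
  gcongr
  nlinarith

lemma Axis.tendsto_phi {a : List ℕ} {k x : ℝ} (h : Axis a k x) (W : List ℕ) :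
    Tendsto (fun M => phi (W ++ pw a M).reverse k) atTop (𝓝 k) := by
  rw [tendsto_iff_norm_sub_tendsto_zero]
  refine squeeze_zero (fun _ => norm_nonneg _) (fun M => ?_)
    (tendsto_pow_atTop_nhds_zero_of_lt_one (r := (1 / 2 : ℝ)) (by norm_num) (by norm_num))
  rw [List.reverse_append, phi_append, pw_reverse, Real.norm_eq_abs]
  nth_rw 2 [← phi_pw h.fixk M]
  exact abs_phi_pw_sub_le h.reverse.even h.reverse.ne M (phi_mem W.reverse h.hk) h.hk

lemma Axis.mem_ret {B : Set (List ℕ)} {a : List ℕ} {k x : ℝ} (h : Axis a k x) (ha : a ∈ B)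
    {W W' : List ℕ} (hW : Conc B W) (hW' : Conc B W') (i j : ℕ) :
    2 * Real.log (gg k a ^ i * jj k x W) - 2 * Real.log (gg k a ^ j * jj k x W') ∈ Ret B k x := by
  intro ε hε
  have hl := gg_pos h.hk.1 a
  have hl' : gg x a.reverse = gg k a := by
    rw [← h.gg_eq, gg, qd_reverse, pd_reverse]; ring
  have t1 := (h.tendsto_phi W).comp (tendsto_add_atTop_nat i)
  have t2 := (h.reverse.tendsto_phi W'.reverse).comp (tendsto_add_atTop_nat j)
  have t3 := (h.tendsto_log W).comp (tendsto_add_atTop_nat i)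
  have t4 := (h.reverse.tendsto_log W'.reverse).comp (tendsto_add_atTop_nat j)
  have t5 := (t3.const_mul 2).sub (t4.const_mul 2)
  rw [jj_reverse, mul_comm x k] at t5
  obtain ⟨M, ⟨m1, m2⟩, m3⟩ := (((Metric.tendsto_nhds.1 t1 ε hε).and
    (Metric.tendsto_nhds.1 t2 ε hε)).and (Metric.tendsto_nhds.1 t5 ε hε)).exists
  refine ⟨W ++ pw a (M + i), W'.reverse ++ pw a.reverse (M + j), hW.append (conc_pw ha _), ?_,
    m1, m2, ?_⟩
  · simpa [pw_reverse] using (conc_pw ha (M + j)).append hW'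
  · rw [Real.dist_eq] at m3
    convert m3 using 2
    have hJ := jj_pos h.hk.1 h.hx.1 W
    have hJ' := jj_pos h.hk.1 h.hx.1 W'
    have hp := h.prod_pos
    simp only [Function.comp]
    rw [hl', Real.log_mul (by positivity) hJ.ne', Real.log_mul (by positivity) hJ'.ne',
      Real.log_div hJ.ne' hp.ne', Real.log_div hJ'.ne' hp.ne', Real.log_pow, Real.log_pow]
    push_cast
    ring

lemma Axis.jj_eq {a : List ℕ} {k x : ℝ} (h : Axis a k x) (b : List ℕ) (M : ℕ) :
    jj k x (b ++ pw a M ++ b) * (k * x + 1) = jj k x b ^ 2 * gg k a ^ M +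
      ((k * pe b + qe b) - k * (k * pd b + qd b)) * ((pe b * x + pd b) - x * (qe b * x + qd b)) *
        (gg k a)⁻¹ ^ M := by
  have := h.bilin (pe b * x + pd b) (qe b * x + qd b) M (k * pe b + qe b) (k * pd b + qd b)
  rw [jj, jj]
  simp only [pe_append, qe_append, pd_append, qd_append]
  linear_combination this

lemma phi_ne_of_ne {T : ℕ} {a b : List ℕ} (hl : a.length = b.length) (hne : a ≠ b)
    (ha : ∀ z ∈ a, z < T) (hb : ∀ z ∈ b, z < T) {x : ℝ} (hx : x ∈ tailIcc T) (h : phi a x = x) :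
    phi b x ≠ x := by
  intro h'
  have hT := sepC_pos T
  have q1 := qd_pos a
  have h1 : 0 < sepC T / qd a ^ 2 := by positivity
  rcases word_sep hl hne ha hb with h2 | h2
  all_goals
    have := h2 x hx x hx
    rw [h, h'] at this
    linarith

lemma exists_axis {T : ℕ} {a b : List ℕ} (hl : a.length = b.length) (hne : a ≠ b)
    (ha : ∀ z ∈ a, z < T) (hb : ∀ z ∈ b, z < T) (he : Even a.length) :
    ∃ k x, Axis a k x ∧ phi b x ≠ x ∧ phi b.reverse k ≠ k := by
  have h0 : a ≠ [] := by
    rintro rfl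
    exact hne (List.length_eq_zero_iff.1 hl.symm).symm
  obtain ⟨x, hx, hx'⟩ := exists_phi_fixed h0 ha
  obtain ⟨k, hk, hk'⟩ := exists_phi_fixed (a := a.reverse) (T := T) (by simpa using h0)
    (by simpa using ha)
  refine ⟨k, x, ⟨he, h0, tailIcc_subset T hk, tailIcc_subset T hx, hk', hx'⟩,
    phi_ne_of_ne hl hne ha hb hx hx', phi_ne_of_ne (T := T) (a := a.reverse) (by simpa using hl)
      (by simpa using hne) (by simpa using ha) (by simpa using hb) hk hk'⟩

lemma Axis.mem_ret_univ {B : Set (List ℕ)} {a b : List ℕ} {k x : ℝ} (h : Axis a k x) (ha : a ∈ B)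
    (hb : b ∈ B) (hbx : phi b x ≠ x) (hbk : phi b.reverse k ≠ k) (σ : ℝ) : σ ∈ Ret B k x := by
  refine Ret.eq_univ h.hk.1 h.hx.1 (fun ε hε => ?_) σ
  set L := gg k a with hL
  have hl := gg_pos h.hk.1 a
  have hl1 := h.one_lt
  have hp := h.prod_pos
  set E : ℕ → ℝ := fun n => jj k x (b ++ pw a n ++ b) with hE
  have hE0 : ∀ n, 0 < E n := fun n => jj_pos h.hk.1 h.hx.1 _
  have hConc : ∀ n, Conc B (b ++ pw a n ++ b) := fun n =>
    ((conc_of_mem hb).append (conc_pw ha n)).append (conc_of_mem hb)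
  set P := jj k x b ^ 2
  set Q := ((k * pe b + qe b) - k * (k * pd b + qd b)) * ((pe b * x + pd b) - x * (qe b * x + qd b))
    with hQ
  have hP : 0 < P := by have := jj_pos h.hk.1 h.hx.1 b; positivity
  have hQ0 : Q ≠ 0 := by
    refine mul_ne_zero ?_ ?_
    · intro h0
      refine hbk ?_
      rw [phi_reverse_eq h.hk.1, div_eq_iff (gg_pos h.hk.1 b).ne', gg]
      linarith
    · intro h0
      refine hbx ?_
      rw [phi_eq _ h.hx.1, div_eq_iff (den_pos b h.hx.1).ne']
      linarith
  have hEe : ∀ n, E n * (k * x + 1) = P * L ^ n + Q * L⁻¹ ^ n := fun n => h.jj_eq b n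
  set τ : ℕ → ℝ := fun n => 2 * Real.log (L ^ 1 * E n) - 2 * Real.log (L ^ 0 * E (n + 1)) with hτ
  have h1 : ∀ n, τ n ∈ Ret B k x := fun n => h.mem_ret ha (hConc n) (hConc (n + 1)) 1 0
  have h2 : ∀ n, -τ n ∈ Ret B k x := fun n => by
    have := h.mem_ret ha (hConc (n + 1)) (hConc n) 0 1
    rwa [← neg_sub] at this
  have h3 : ∀ n, τ n ≠ 0 := by
    intro n h0
    have e1 : Real.log (L ^ 1 * E n) = Real.log (L ^ 0 * E (n + 1)) := by
      simp only [hτ] at h0; linarith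
    have e2 := Real.log_injOn_pos (mem_Ioi.2 (mul_pos (by positivity) (hE0 n)))
      (mem_Ioi.2 (mul_pos (by positivity) (hE0 (n + 1)))) e1
    have e3 : Q * L⁻¹ ^ n * (L - L⁻¹) = 0 := by
      have := hEe n
      have := hEe (n + 1)
      rw [pow_succ, pow_succ] at this
      linear_combination (k * x + 1) * e2 - L * hEe n + this
    have e4 : L⁻¹ < L := (inv_lt_one_of_one_lt₀ hl1).trans hl1
    have : Q * L⁻¹ ^ n * (L - L⁻¹) ≠ 0 :=
      mul_ne_zero (mul_ne_zero hQ0 (by positivity)) (by linarith)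
    exact this e3
  have h4 : Tendsto τ atTop (𝓝 0) := by
    have r1 : ∀ n, τ n = 2 * (Real.log (P + Q * (L⁻¹ ^ n * L⁻¹ ^ n)) -
        Real.log (P + Q * (L⁻¹ ^ (n + 1) * L⁻¹ ^ (n + 1)))) := by
      have r2 : ∀ n, Real.log (E n) + Real.log (k * x + 1) =
          Real.log (P + Q * (L⁻¹ ^ n * L⁻¹ ^ n)) + n * Real.log L := by
        intro n
        have : P + Q * (L⁻¹ ^ n * L⁻¹ ^ n) = E n * (k * x + 1) / L ^ n := by
          rw [hEe, inv_pow]; have : L ^ n ≠ 0 := (pow_pos hl n).ne'; field_simp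
        rw [this, Real.log_div (mul_pos (hE0 n) hp).ne' (by positivity),
          Real.log_mul (hE0 n).ne' hp.ne', Real.log_pow]
        ring
      intro n
      have a1 := r2 n
      have a2 := r2 (n + 1)
      push_cast at a2
      simp only [hτ, pow_one, pow_zero, one_mul]
      rw [Real.log_mul hl.ne' (hE0 n).ne']
      linarith
    have t0 := h.tendsto_inv_pow
    have t1 : Tendsto (fun n => Real.log (P + Q * (L⁻¹ ^ n * L⁻¹ ^ n))) atTop (𝓝 (Real.log P)) := by
      refine Tendsto.log ?_ hP.ne'
      simpa using ((t0.mul t0).const_mul Q).const_add P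
    have := (t1.sub (t1.comp (tendsto_add_atTop_nat 1))).const_mul 2
    rw [sub_self, mul_zero] at this
    exact this.congr fun n => (r1 n).symm
  obtain ⟨n, hn⟩ := (Metric.tendsto_nhds.1 h4 ε hε).exists
  rw [Real.dist_eq, sub_zero] at hn
  rcases lt_or_gt_of_ne (h3 n) with hneg | hpos
  · exact ⟨-τ n, by linarith, by rw [abs_of_neg hneg] at hn; exact hn, h2 n, by simpa using h1 n⟩
  · exact ⟨τ n, hpos, by rwa [abs_of_pos hpos] at hn, h1 n, h2 n⟩

/-- Every bounded change of scale can be compensated by a pair of words of bounded size. -/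
theorem exists_correction {T : ℕ} {B : Set (List ℕ)} {a b : List ℕ} (ha : a ∈ B) (hb : b ∈ B)
    (hl : a.length = b.length) (hne : a ≠ b) (haT : ∀ z ∈ a, z < T) (hbT : ∀ z ∈ b, z < T)
    (he : Even a.length) :
    ∃ kS ∈ Icc (0 : ℝ) 1, ∃ lS ∈ Icc (0 : ℝ) 1, ∀ η > 0, ∀ S : ℝ, ∃ C : ℝ,
      ∀ k ∈ Icc (0 : ℝ) 1, ∀ l ∈ Icc (0 : ℝ) 1, ∀ σ : ℝ, |σ| ≤ S →
        ∃ u v, Conc B u ∧ Conc B v.reverse ∧ qd u ≤ C ∧ qd v ≤ C ∧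
          |phi u.reverse k - kS| ≤ η ∧ |phi v.reverse l - lS| ≤ η ∧
          |σ + 2 * Real.log (gg k u) - 2 * Real.log (gg l v)| ≤ η := by
  obtain ⟨kS, lS, h, hbx, hbk⟩ := exists_axis hl hne haT hbT he
  refine ⟨kS, h.hk, lS, h.hx, fun η hη S => ?_⟩
  obtain ⟨m, hm⟩ := exists_pow_lt_of_lt_one (show 0 < η / 16 by positivity)
    (show (1 / 2 : ℝ) < 1 by norm_num)
  set u0 := pw a m
  have hu0 : u0.reverse = pw a.reverse m := pw_reverse a m
  have hk0 : ∀ k ∈ Icc (0 : ℝ) 1, |phi u0.reverse k - kS| < η / 16 := fun k hk => by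
    rw [hu0]
    have := abs_phi_pw_sub_le h.reverse.even h.reverse.ne m hk h.hk
    rw [phi_pw h.fixk m] at this
    exact this.trans_lt hm
  have hl0 : ∀ l ∈ Icc (0 : ℝ) 1, |phi u0 l - lS| < η / 16 := fun l hl => by
    have := abs_phi_pw_sub_le h.even h.ne m hl h.hx
    rw [phi_pw h.fixx m] at this
    exact this.trans_lt hm
  have key : ∀ j : ℤ, ∃ u v, Conc B u ∧ Conc B v.reverse ∧ |phi u.reverse kS - kS| < η / 16 ∧
      |phi v.reverse lS - lS| < η / 16 ∧
      |2 * Real.log (gg kS u) - 2 * Real.log (gg lS v) - j * (η / 8)| < η / 16 := fun j =>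
    h.mem_ret_univ ha hb hbx hbk (j * (η / 8)) _ (by positivity)
  choose U V hU hV h1 h2 h3 using key
  have hlog2 : 0 < Real.log 2 := Real.log_pos (by norm_num)
  set N : ℤ := ⌈(S + 2 * Real.log 2) / (η / 8)⌉ + 1
  obtain ⟨C, hC⟩ := ((Finset.Icc (-N) N).image fun j => qd (u0 ++ U j) + qd (u0.reverse ++ V j)).exists_le
  refine ⟨C, fun k hk l hl σ hσ => ?_⟩
  set σ1 := σ + 2 * Real.log (gg k u0) - 2 * Real.log (gg l u0.reverse) with hσ1
  have g1 : Real.log (qd u0) ≤ Real.log (gg k u0) := Real.log_le_log (qd_pos _) (qd_le_gg hk.1 _)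
  have g2 : Real.log (gg k u0) ≤ Real.log 2 + Real.log (qd u0) := by
    rw [← Real.log_mul two_ne_zero (qd_pos u0).ne']
    exact Real.log_le_log (gg_pos hk.1 _) (gg_le hk.2 _)
  have g3 : Real.log (qd u0) ≤ Real.log (gg l u0.reverse) := by
    rw [← qd_reverse]; exact Real.log_le_log (qd_pos _) (qd_le_gg hl.1 _)
  have g4 : Real.log (gg l u0.reverse) ≤ Real.log 2 + Real.log (qd u0) := by
    rw [← Real.log_mul two_ne_zero (qd_pos u0).ne', ← qd_reverse u0]
    exact Real.log_le_log (gg_pos hl.1 _) (gg_le hl.2 _)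
  have hσ1' : |σ1| ≤ S + 2 * Real.log 2 := by
    rw [abs_le] at hσ ⊢
    constructor <;> linarith [hσ.1, hσ.2]
  set j : ℤ := ⌊-σ1 / (η / 8)⌋
  have hη8 : 0 < η / 8 := by positivity
  have j1 : j * (η / 8) ≤ -σ1 := (le_div_iff₀ hη8).1 (Int.floor_le _)
  have j2 : -σ1 < (j + 1) * (η / 8) := (div_lt_iff₀ hη8).1 (Int.lt_floor_add_one _)
  have hjN : j ∈ Finset.Icc (-N) N := by
    have n1 : S + 2 * Real.log 2 ≤ (N - 1) * (η / 8) := by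
      rw [← div_le_iff₀ hη8]
      have := Int.le_ceil ((S + 2 * Real.log 2) / (η / 8))
      push_cast [N]
      linarith
    rw [abs_le] at hσ1'
    rw [Finset.mem_Icc]
    constructor
    · have : (-N : ℝ) < j + 1 := by
        by_contra! hcon
        nlinarith [mul_le_mul_of_nonneg_right hcon hη8.le, hσ1'.2]
      exact Int.lt_add_one_iff.1 (by exact_mod_cast this)
    · have : (j : ℝ) ≤ N := by
        by_contra! hcon
        nlinarith [mul_le_mul_of_nonneg_right hcon.le hη8.le, hσ1'.1]
      exact_mod_cast this
  have hq := hC _ (Finset.mem_image_of_mem _ hjN)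
  have p1 := hk0 k hk
  have p2 : |phi u0.reverse.reverse l - lS| < η / 16 := by simpa using hl0 l hl
  refine ⟨u0 ++ U j, u0.reverse ++ V j, (conc_pw ha m).append (hU j), ?_, ?_, ?_, ?_, ?_, ?_⟩
  · simpa using (hV j).append (conc_pw ha m)
  · linarith [qd_pos (u0.reverse ++ V j)]
  · linarith [qd_pos (u0 ++ U j)]
  · have := abs_phi_append_sub_le (κ' := kS) hk.1 h.hk.1 u0 (U j)
    linarith [h1 j]
  · have := abs_phi_append_sub_le (κ' := lS) hl.1 h.hx.1 u0.reverse (V j)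
    linarith [h2 j]
  · have e1 := abs_log_gg_append_sub_le hk.1 h.hk.1 u0 (U j)
    have e2 := abs_log_gg_append_sub_le hl.1 h.hx.1 u0.reverse (V j)
    have h3j := h3 j
    rw [abs_le] at e1 e2 ⊢
    rw [abs_lt] at h3j
    constructor <;> linarith [e1.1, e1.2, e2.1, e2.2, h3j.1, h3j.2]

/-- The longest common prefix of two words. -/
def lcp : List ℕ → List ℕ → List ℕ
  | a :: u, b :: v => if a = b then a :: lcp u v else []
  | _, _ => []

lemma lcp_append (c : List ℕ) {a b : ℕ} (hab : a ≠ b) (u v : List ℕ) :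
    lcp (c ++ a :: u) (c ++ b :: v) = c := by
  induction c with
  | nil => simp [lcp, hab]
  | cons z c ih => simp [lcp, ih]

lemma lcp_self (c : List ℕ) : lcp c c = c := by
  induction c with
  | nil => rfl
  | cons z c ih => simp [lcp, ih]

lemma lcp_isPrefix_left : ∀ u v : List ℕ, lcp u v <+: u
  | a :: u, b :: v => by
    by_cases h : a = b
    · simpa [lcp, h] using lcp_isPrefix_left u v
    · simp [lcp, h]
  | [], _ => by simp [lcp]
  | _ :: _, [] => by simp [lcp]

lemma lcp_isPrefix_right : ∀ u v : List ℕ, lcp u v <+: v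
  | a :: u, b :: v => by
    by_cases h : a = b
    · subst h; simpa [lcp] using lcp_isPrefix_right u v
    · simp [lcp, h]
  | [], _ => by simp [lcp]
  | _ :: _, [] => by simp [lcp]

lemma qd_lcp_le (u v : List ℕ) : qd (lcp u v) ≤ qd u := by
  obtain ⟨t, ht⟩ := lcp_isPrefix_left u v
  nth_rw 2 [← ht]
  exact qd_le_append_left _ _

lemma lcp_sep {T : ℕ} {u v : List ℕ} (hl : u.length = v.length) (hne : u ≠ v)
    (hu : ∀ z ∈ u, z < T) (hv : ∀ z ∈ v, z < T) {x y : ℝ} (hx : x ∈ tailIcc T)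
    (hy : y ∈ tailIcc T) : sepC T / qd (lcp u v) ^ 2 ≤ |phi u x - phi v y| := by
  obtain ⟨c, a, b, u', v', rfl, rfl, hab⟩ := exists_common_split hl hne
  rw [lcp_append c hab]
  have key : ∀ z w : ℝ, sepC T / qd c ^ 2 ≤ (-1) ^ c.length * (z - w) →
      sepC T / qd c ^ 2 ≤ |z - w| := fun z w h => by
    refine h.trans ((le_abs_self _).trans (le_of_eq ?_))
    rw [abs_mul, abs_pow, abs_neg, abs_one, one_pow, one_mul]
  rcases lt_or_gt_of_ne hab with h | h
  · exact key _ _ (word_sep_aux hu hv h hx hy)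
  · rw [abs_sub_comm]
    exact key _ _ (word_sep_aux hv hu h hy hx)

/-- The projective change of coordinate seen from the slope `k`. -/
noncomputable def psi (k x : ℝ) : ℝ := x / (1 + k * x)

/-- A projected sum of two coordinates. -/
noncomputable def PP (k l r x y : ℝ) : ℝ := psi k x + r * psi l y

lemma psi_sub {k x y : ℝ} (hk : 0 ≤ k) (hx : 0 ≤ x) (hy : 0 ≤ y) :
    psi k x - psi k y = (x - y) / ((1 + k * x) * (1 + k * y)) := by
  have h1 : (1 + k * x) ≠ 0 := by positivity
  have h2 : (1 + k * y) ≠ 0 := by positivity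
  unfold psi
  field_simp
  ring

lemma abs_psi_sub_le {k x y : ℝ} (hk : 0 ≤ k) (hx : 0 ≤ x) (hy : 0 ≤ y) :
    |psi k x - psi k y| ≤ |x - y| := by
  rw [psi_sub hk hx hy, abs_div]
  refine div_le_self (abs_nonneg _) ?_
  have h1 := mul_nonneg hk hx
  have h2 := mul_nonneg hk hy
  rw [abs_of_pos (by positivity)]
  nlinarith [mul_nonneg h1 h2]

lemma le_abs_psi_sub {k x y : ℝ} (hk : k ∈ Icc (0 : ℝ) 1) (hx : x ∈ Icc (0 : ℝ) 1)
    (hy : y ∈ Icc (0 : ℝ) 1) : |x - y| / 4 ≤ |psi k x - psi k y| := by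
  rw [psi_sub hk.1 hx.1 hy.1, abs_div]
  have h1 := mul_nonneg hk.1 hx.1
  have h2 := mul_nonneg hk.1 hy.1
  have h3 : k * x ≤ 1 := mul_le_one₀ hk.2 hx.1 hx.2
  have h4 : k * y ≤ 1 := mul_le_one₀ hk.2 hy.1 hy.2
  have h5 : 0 < (1 + k * x) * (1 + k * y) := by positivity
  rw [abs_of_pos h5]
  refine div_le_div_of_nonneg_left (abs_nonneg _) h5 ?_
  nlinarith

lemma abs_psi_le {k x : ℝ} (hk : 0 ≤ k) (hx : x ∈ Icc (0 : ℝ) 1) : |psi k x| ≤ 1 := by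
  have := abs_psi_sub_le hk hx.1 le_rfl
  have h0 : psi k 0 = 0 := by simp [psi]
  rw [h0, sub_zero, sub_zero, abs_of_nonneg hx.1] at this
  exact this.trans hx.2

lemma abs_psi_sub_left_le {k k' x : ℝ} (hk : 0 ≤ k) (hk' : 0 ≤ k') (hx : x ∈ Icc (0 : ℝ) 1) :
    |psi k x - psi k' x| ≤ |k - k'| := by
  have hx0 := hx.1
  have h1 : 0 < 1 + k * x := by positivity
  have h2 : 0 < 1 + k' * x := by positivity
  have h3 : psi k x - psi k' x = x ^ 2 / ((1 + k * x) * (1 + k' * x)) * (k' - k) := by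
    unfold psi; field_simp; ring
  rw [h3, abs_mul, abs_sub_comm k' k]
  refine mul_le_of_le_one_left (abs_nonneg _) ?_
  rw [abs_of_nonneg (by positivity)]
  have h4 := mul_nonneg hk hx0
  have h5 := mul_nonneg hk' hx0
  refine div_le_one_of_le₀ ?_ (by positivity)
  nlinarith [hx.2, mul_nonneg h4 h5]

lemma psi_phi {k z : ℝ} (hk : 0 ≤ k) (hz : 0 ≤ z) {u : List ℕ} (hu : Even u.length) :
    psi k (phi u z) = pd u / gg k u + psi (phi u.reverse k) z / gg k u ^ 2 := by
  have hg := gg_pos hk u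
  have hd := den_pos u hz
  have hdet : pe u * qd u - pd u * qe u = 1 := by rw [wmat_det, hu.neg_one_pow]
  have hpe := pe_nonneg u
  have hqe := qe_nonneg u
  have hpd := pd_nonneg u
  have hqd := qd_pos u
  rw [phi_reverse_eq hk, phi_eq _ hz, psi, psi]
  have e1 : (0 : ℝ) < qe u * z + qd u + k * (pe u * z + pd u) := by positivity
  have e2 : (0 : ℝ) < gg k u + (qe u + k * pe u) * z := by positivity
  have e3 : qe u * z + qd u + k * (pe u * z + pd u) = gg k u + (qe u + k * pe u) * z := by
    unfold gg; ring
  have l1 : (pe u * z + pd u) / (qe u * z + qd u) / (1 + k * ((pe u * z + pd u) / (qe u * z + qd u)))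
      = (pe u * z + pd u) / (gg k u + (qe u + k * pe u) * z) := by
    rw [← e3]; field_simp
  have l2 : z / (1 + (qe u + k * pe u) / gg k u * z) =
      gg k u * z / (gg k u + (qe u + k * pe u) * z) := by
    field_simp
  rw [l1, l2]
  have hgg : gg k u = qd u + k * pd u := rfl
  have e4 : (pe u * z + pd u) * gg k u = pd u * (gg k u + (qe u + k * pe u) * z) + z := by
    rw [hgg]; linear_combination z * hdet
  field_simp
  linear_combination e4

/-- The evolution of the projection along a pair of words of even length. -/
lemma PP_phi_sub {k l r : ℝ} (hk : 0 ≤ k) (hl : 0 ≤ l) {u v : List ℕ} (hu : Even u.length)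
    (hv : Even v.length) {x y x' y' : ℝ} (hx : 0 ≤ x) (hy : 0 ≤ y) (hx' : 0 ≤ x') (hy' : 0 ≤ y') :
    PP k l r (phi u x) (phi v y) - PP k l r (phi u x') (phi v y') =
      (PP (phi u.reverse k) (phi v.reverse l) (r * (gg k u / gg l v) ^ 2) x y -
        PP (phi u.reverse k) (phi v.reverse l) (r * (gg k u / gg l v) ^ 2) x' y') / gg k u ^ 2 := by
  have h1 := (gg_pos hk u).ne'
  have h2 := (gg_pos hl v).ne'
  unfold PP
  rw [psi_phi hk hx hu, psi_phi hk hx' hu, psi_phi hl hy hv, psi_phi hl hy' hv]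
  field_simp
  ring

lemma abs_PP_sub_le {k l r x y x' y' : ℝ} (hk : 0 ≤ k) (hl : 0 ≤ l) (hx : 0 ≤ x) (hy : 0 ≤ y)
    (hx' : 0 ≤ x') (hy' : 0 ≤ y') :
    |PP k l r x y - PP k l r x' y'| ≤ |x - x'| + |r| * |y - y'| := by
  have h : PP k l r x y - PP k l r x' y' = (psi k x - psi k x') + r * (psi l y - psi l y') := by
    unfold PP; ring
  rw [h]
  refine (abs_add_le _ _).trans (add_le_add (abs_psi_sub_le hk hx hx') ?_)
  rw [abs_mul]
  exact mul_le_mul_of_nonneg_left (abs_psi_sub_le hl hy hy') (abs_nonneg _)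

lemma abs_PP_sub_state_le {k l r k' l' r' x y : ℝ} (hk : 0 ≤ k) (hl : 0 ≤ l) (hk' : 0 ≤ k')
    (hl' : 0 ≤ l') (hx : x ∈ Icc (0 : ℝ) 1) (hy : y ∈ Icc (0 : ℝ) 1) :
    |PP k' l' r' x y - PP k l r x y| ≤ |k' - k| + |r| * |l' - l| + |r' - r| := by
  have h : PP k' l' r' x y - PP k l r x y =
      (psi k' x - psi k x) + r * (psi l' y - psi l y) + (r' - r) * psi l' y := by
    unfold PP; ring
  rw [h]
  refine (abs_add_le _ _).trans (add_le_add ((abs_add_le _ _).trans (add_le_add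
    (abs_psi_sub_left_le hk' hk hx) ?_)) ?_)
  · rw [abs_mul]
    exact mul_le_mul_of_nonneg_left (abs_psi_sub_left_le hl' hl hy) (abs_nonneg _)
  · rw [abs_mul]
    exact mul_le_of_le_one_right (abs_nonneg _) (abs_psi_le hl' hy)

/-- Points of a progression in a short interval. -/
lemma card_progression_le (H : ℕ) {α β δ : ℝ} (hβ : 0 < β) (hδ : 0 ≤ δ) :
    (((Finset.range H).filter fun i : ℕ => |α + i * β| ≤ δ).card : ℝ) ≤ 2 * δ / β + 1 := by
  set S := (Finset.range H).filter fun i : ℕ => |α + i * β| ≤ δ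
  rcases S.eq_empty_or_nonempty with h | h
  · rw [h]; simp; positivity
  have hmem : ∀ i ∈ S, |α + i * β| ≤ δ := fun i hi => (Finset.mem_filter.1 hi).2
  set a := S.min' h
  set b := S.max' h
  have hsub : S ⊆ Finset.Icc a b := fun i hi => Finset.mem_Icc.2 ⟨S.min'_le i hi, S.le_max' i hi⟩
  have hab : a ≤ b := S.min'_le_max' h
  have hcard := Finset.card_le_card hsub
  rw [Nat.card_Icc] at hcard
  have h1 := abs_le.1 (hmem a (S.min'_mem h))
  have h2 := abs_le.1 (hmem b (S.max'_mem h))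
  have h3 : ((b : ℝ) - a) * β ≤ 2 * δ := by linarith [h1.1, h2.2]
  have h4 : (b : ℝ) - a ≤ 2 * δ / β := by rwa [le_div_iff₀ hβ]
  have h5 : (S.card : ℝ) ≤ b + 1 - a := by
    have : S.card + a ≤ b + 1 := by omega
    have : (S.card : ℝ) + a ≤ b + 1 := by exact_mod_cast this
    linarith
  linarith

/-- The proportion of scales for which a combination of two differences is small. -/
lemma card_small_le {H : ℕ} (hH : 0 < H) {α β δ : ℝ} (hδ : 0 ≤ δ) :
    (α ≠ 0 → (((Finset.range H).filter fun i : ℕ => |α + (1 + i / H) * β| ≤ δ).card : ℝ) ≤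
      8 * δ * H / |α| + 1) ∧
    (β ≠ 0 → (((Finset.range H).filter fun i : ℕ => |α + (1 + i / H) * β| ≤ δ).card : ℝ) ≤
      8 * δ * H / |β| + 1) := by
  have hH' : (0 : ℝ) < H := by exact_mod_cast hH
  set S := (Finset.range H).filter fun i : ℕ => |α + (1 + i / H) * β| ≤ δ with hS
  have hle : (S.card : ℝ) ≤ H := by
    have := Finset.card_filter_le (Finset.range H) fun i : ℕ => |α + (1 + i / H) * β| ≤ δ
    rw [Finset.card_range] at this
    exact_mod_cast this
  by_cases hc : |α| ≤ 4 * |β|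
  · have hmain : β ≠ 0 → (S.card : ℝ) ≤ 2 * δ * H / |β| + 1 := by
      intro hβ
      have hβ' := abs_pos.2 hβ
      have h1 : S = (Finset.range H).filter fun i : ℕ =>
          |SignType.sign β * (α + β) + i * (|β| / H)| ≤ δ := by
        rw [hS]
        refine Finset.filter_congr fun i _ => ?_
        have : (SignType.sign β : ℝ) * (α + β) + i * (|β| / H) =
            SignType.sign β * (α + (1 + i / H) * β) := by
          rw [← sign_mul_self β]; ring
        rw [this, abs_mul]
        have : |(SignType.sign β : ℝ)| = 1 := by
          rcases lt_or_gt_of_ne hβ with h | h <;> simp [h]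
        rw [this, one_mul]
      rw [h1]
      refine (card_progression_le H (by positivity) hδ).trans (le_of_eq ?_)
      field_simp
    refine ⟨fun hα => ?_, fun hβ => ?_⟩
    · have hα' := abs_pos.2 hα
      have hβ' : 0 < |β| := by linarith
      refine (hmain (abs_pos.1 hβ')).trans (add_le_add_left ?_ _)
      rw [div_le_div_iff₀ hβ' hα']
      have := mul_le_mul_of_nonneg_left hc (show 0 ≤ 2 * δ * H by positivity)
      linarith
    · refine (hmain hβ).trans (add_le_add_left ?_ _)
      have hβ' := abs_pos.2 hβ
      gcongr; norm_num
  · push Not at hc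
    have hα' : 0 < |α| := by linarith [abs_nonneg β]
    rcases S.eq_empty_or_nonempty with h | ⟨i, hi⟩
    · rw [h]
      constructor <;> intro _ <;> simp <;> positivity
    · obtain ⟨hi1, hi2⟩ := Finset.mem_filter.1 hi
      have hi3 : (i : ℝ) / H ≤ 1 := by
        rw [div_le_one hH']; exact_mod_cast (Finset.mem_range.1 hi1).le
      have hi4 : 0 ≤ (i : ℝ) / H := by positivity
      have h1 : |α| ≤ δ + 2 * |β| := by
        have h2 : α = (α + (1 + i / H) * β) - (1 + i / H) * β := by ring
        have h3 : |(1 + i / H) * β| ≤ 2 * |β| := by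
          rw [abs_mul, abs_of_nonneg (by linarith)]
          exact mul_le_mul_of_nonneg_right (by linarith) (abs_nonneg _)
        calc |α| = |(α + (1 + i / H) * β) - (1 + i / H) * β| := by rw [← h2]
          _ ≤ _ := abs_sub _ _
          _ ≤ _ := add_le_add hi2 h3
      have h4 : |α| ≤ 2 * δ := by linarith
      have h5 : ∀ γ : ℝ, 0 < γ → γ ≤ |α| → (S.card : ℝ) ≤ 8 * δ * H / γ + 1 := by
        intro γ h0 hγ
        have : (H : ℝ) ≤ 8 * δ * H / γ := by
          rw [le_div_iff₀ h0]; nlinarith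
        linarith
      refine ⟨fun _ => h5 _ hα' le_rfl, fun hβ => h5 _ (abs_pos.2 hβ) (by linarith [abs_nonneg β])⟩

lemma sum_mul_log_le {ι : Type*} {I : Finset ι} {p X : ι → ℝ} (hp : ∀ i ∈ I, 0 ≤ p i)
    (h1 : ∑ i ∈ I, p i = 1) (hX : ∀ i ∈ I, 0 < X i) :
    ∑ i ∈ I, p i * Real.log (X i) ≤ Real.log (∑ i ∈ I, p i * X i) := by
  simpa using strictConcaveOn_log_Ioi.concaveOn.le_map_sum hp h1 hX

/-- A weighted selection of well separated bins. -/
lemma exists_selection {ι : Type*} [DecidableEq ι] {I : Finset ι} {p W : ι → ℝ} (bin : ι → ℤ)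
    (hp : ∀ i ∈ I, 0 < p i) (h1 : ∑ i ∈ I, p i = 1) (hW : ∀ i ∈ I, 0 < W i) :
    ∃ J ⊆ I, (∀ c ∈ J, ∀ d ∈ J, c ≠ d → bin c + 2 ≤ bin d ∨ bin d + 2 ≤ bin c) ∧ J.Nonempty ∧
      -Real.log 2 + ∑ i ∈ I, p i * Real.log (W i) -
        Real.log (∑ c ∈ I, ∑ d ∈ I with bin d = bin c, p c * p d) ≤ Real.log (∑ i ∈ J, W i) := by
  classical
  set P : ι → ℝ := fun c => ∑ d ∈ I with bin d = bin c, p d with hP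
  have hI : I.Nonempty := by
    rw [Finset.nonempty_iff_ne_empty]; rintro rfl; simp at h1
  have hPpos : ∀ c ∈ I, 0 < P c := fun c hc =>
    Finset.sum_pos (fun d hd => hp d (Finset.mem_filter.1 hd).1) ⟨c, by simp [hc]⟩
  have hsel : ∀ z ∈ I.image bin, ∃ c ∈ I, bin c = z ∧ ∀ d ∈ I, bin d = z → W d ≤ W c := by
    intro z hz
    obtain ⟨c0, hc0, h0⟩ := Finset.mem_image.1 hz
    obtain ⟨c, hc, hmax⟩ := Finset.exists_max_image (I.filter fun d => bin d = z) W
      ⟨c0, by simp [hc0, h0]⟩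
    rw [Finset.mem_filter] at hc
    exact ⟨c, hc.1, hc.2, fun d hd hdz => hmax d (by simp [hd, hdz])⟩
  have : Nonempty ι := ⟨hI.choose⟩
  choose! sel s1 s2 s3 using hsel
  set Z := I.image bin
  have hsum : ∑ c ∈ I, p c * (W c / P c) ≤ ∑ z ∈ Z, W (sel z) := by
    rw [← Finset.sum_fiberwise_of_maps_to (g := bin) (t := Z) fun i hi => Finset.mem_image_of_mem _ hi]
    refine Finset.sum_le_sum fun z hz => ?_
    have hPz : ∀ c ∈ I.filter (fun c => bin c = z), P c = P (sel z) := fun c hc => by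
      simp only [hP, (Finset.mem_filter.1 hc).2, s2 z hz]
    calc ∑ c ∈ I with bin c = z, p c * (W c / P c)
        ≤ ∑ c ∈ I with bin c = z, p c * (W (sel z) / P (sel z)) := by
          refine Finset.sum_le_sum fun c hc => ?_
          rw [hPz c hc]
          obtain ⟨hc1, hc2⟩ := Finset.mem_filter.1 hc
          have := hPpos _ (s1 z hz)
          have := (hp c hc1).le
          gcongr
          exact s3 z hz c hc1 hc2
      _ = W (sel z) := by
          rw [← Finset.sum_mul]
          have : ∑ c ∈ I with bin c = z, p c = P (sel z) := by simp only [hP, s2 z hz]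
          rw [this, mul_div_cancel₀ _ (hPpos _ (s1 z hz)).ne']
  have hinj : ∀ z ∈ Z, ∀ z' ∈ Z, sel z = sel z' → z = z' := fun z hz z' hz' h => by
    rw [← s2 z hz, ← s2 z' hz', h]
  obtain ⟨r, hr⟩ : ∃ r : ℤ, ∑ z ∈ Z, W (sel z) ≤ 2 * ∑ z ∈ Z with z % 2 = r, W (sel z) := by
    have := Finset.sum_filter_add_sum_filter_not Z (fun z => z % 2 = 0) fun z => W (sel z)
    have e : (Z.filter fun z => ¬z % 2 = 0) = Z.filter fun z => z % 2 = 1 :=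
      Finset.filter_congr fun z _ => by omega
    rw [e] at this
    rcases le_total (∑ z ∈ Z with z % 2 = 0, W (sel z)) (∑ z ∈ Z with z % 2 = 1, W (sel z)) with h | h
    · exact ⟨1, by linarith⟩
    · exact ⟨0, by linarith⟩
  have hpos : 0 < ∑ c ∈ I, p c * (W c / P c) :=
    Finset.sum_pos (fun c hc => mul_pos (hp c hc) (div_pos (hW c hc) (hPpos c hc))) hI
  refine ⟨(Z.filter fun z => z % 2 = r).image sel, ?_, ?_, ?_, ?_⟩
  · intro c hc
    obtain ⟨z, hz, rfl⟩ := Finset.mem_image.1 hc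
    exact s1 z (Finset.mem_filter.1 hz).1
  · intro c hc d hd hcd
    obtain ⟨z, hz, rfl⟩ := Finset.mem_image.1 hc
    obtain ⟨z', hz', rfl⟩ := Finset.mem_image.1 hd
    rw [Finset.mem_filter] at hz hz'
    rw [s2 z hz.1, s2 z' hz'.1]
    have : z ≠ z' := fun h => hcd (by rw [h])
    omega
  · rw [Finset.image_nonempty, Finset.nonempty_iff_ne_empty]
    intro h
    rw [h, Finset.sum_empty] at hr
    linarith
  · rw [Finset.sum_image fun z hz z' hz' h =>
      hinj z (Finset.mem_filter.1 hz).1 z' (Finset.mem_filter.1 hz').1 h]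
    have j1 := sum_mul_log_le (fun i hi => (hp i hi).le) h1 fun i hi =>
      div_pos (hW i hi) (hPpos i hi)
    have j2 := sum_mul_log_le (fun i hi => (hp i hi).le) h1 hPpos
    have j3 : ∑ i ∈ I, p i * Real.log (W i / P i) =
        ∑ i ∈ I, p i * Real.log (W i) - ∑ i ∈ I, p i * Real.log (P i) := by
      rw [← Finset.sum_sub_distrib]
      refine Finset.sum_congr rfl fun i hi => ?_
      rw [Real.log_div (hW i hi).ne' (hPpos i hi).ne', mul_sub]
    have j4 : ∑ c ∈ I, ∑ d ∈ I with bin d = bin c, p c * p d = ∑ i ∈ I, p i * P i :=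
      Finset.sum_congr rfl fun c _ => by rw [hP, Finset.mul_sum]
    have j5 := Real.log_le_log hpos (hsum.trans hr)
    have j6 : 0 < ∑ z ∈ Z with z % 2 = r, W (sel z) := by linarith
    rw [Real.log_mul two_ne_zero j6.ne'] at j5
    rw [j4]
    linarith

lemma Conc.forall_lt {B : Set (List ℕ)} {T : ℕ} (hB : ∀ b ∈ B, ∀ z ∈ b, z < T) {u : List ℕ}
    (hu : Conc B u) : ∀ z ∈ u, z < T := by
  obtain ⟨l, hl, rfl⟩ := hu
  intro z hz
  obtain ⟨b, hb, hzb⟩ := List.mem_flatten.1 hz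
  exact hB b (hl b hb) z hzb

lemma Conc.even_length {B : Set (List ℕ)} (hB : ∀ b ∈ B, Even b.length) {u : List ℕ}
    (hu : Conc B u) : Even u.length := by
  obtain ⟨l, hl, rfl⟩ := hu
  induction l with
  | nil => simp
  | cons b l ih =>
    simp only [List.flatten_cons, List.length_append]
    exact (hB b (hl b (by simp))).add (ih fun c hc => hl c (by simp [hc]))

lemma pw_succ' (a : List ℕ) (M : ℕ) : pw a (M + 1) = pw a M ++ a := by
  induction M with
  | zero => simp [pw]
  | succ M ih => rw [pw_succ, ih, ← List.append_assoc, ← pw_succ, ih]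

lemma exists_padding {a w : List ℕ} (ha : a ≠ []) (he : Even a.length) {X C : ℝ} (hw : qd w ≤ X)
    (hC : 2 * qd a ≤ C) : ∃ i, X ≤ qd (w ++ pw a i) ∧ qd (w ++ pw a i) ≤ C * X := by
  have hex : ∃ i, X ≤ qd (w ++ pw a i) := by
    obtain ⟨i, hi⟩ := pow_unbounded_of_one_lt X (one_lt_two (α := ℝ))
    refine ⟨i, hi.le.trans (le_trans ?_ (qd_le_append_right w _))⟩
    refine le_trans (pow_le_pow_right₀ one_le_two ?_) (two_pow_le_qd (pw a i))
    rw [pw_length]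
    have : 2 ≤ a.length := by
      have := List.length_pos_iff.2 ha
      rcases he with ⟨m, hm⟩
      omega
    have := Nat.mul_le_mul_left i this
    omega
  classical
  have h1 := Nat.find_spec hex
  refine ⟨Nat.find hex, h1, ?_⟩
  have hqa := qd_ge_one a
  have hX : 0 ≤ X := (qd_pos w).le.trans hw
  rcases h : Nat.find hex with _ | i
  · simp only [pw, List.replicate_zero, List.flatten_nil, List.append_nil]
    nlinarith
  · have h2 := Nat.find_min hex (m := i) (by omega)
    push Not at h2
    rw [pw_succ', ← List.append_assoc]
    refine (qd_append_le _ _).trans ?_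
    calc 2 * (qd (w ++ pw a i) * qd a) = 2 * qd a * qd (w ++ pw a i) := by ring
      _ ≤ C * X := mul_le_mul hC h2.le (qd_pos _).le (by linarith)

/-- A family of words of comparable denominators carrying a probability weight whose energy is at
most `Γ`. -/
structure Side (T : ℕ) (B : Set (List ℕ)) (C Q Γ : ℝ) (V : Finset (List ℕ)) (p : List ℕ → ℝ) :
    Prop where
  even : ∀ b ∈ B, Even b.length
  lt : ∀ b ∈ B, ∀ z ∈ b, z < T
  conc : ∀ a ∈ V, Conc B a
  len : ∀ a ∈ V, ∀ a' ∈ V, a.length = a'.length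
  le : ∀ a ∈ V, qd a ≤ Q
  ge : ∀ a ∈ V, Q ≤ 2 * qd a
  pos : ∀ a ∈ V, 0 < p a
  sum : ∑ a ∈ V, p a = 1
  energy : ∑ a ∈ V, ∑ a' ∈ V, p a * p a' * qd (lcp a a') ≤ Γ
  pad : ∃ a ∈ B, a ≠ [] ∧ 2 * qd a ≤ C

/-- Concatenations whose denominator is comparable to `R ^ j`. -/
def Nd (B : Set (List ℕ)) (C R : ℝ) (j : ℕ) (u : List ℕ) : Prop :=
  Conc B u ∧ R ^ j ≤ qd u ∧ qd u ≤ C * R ^ j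

section
variable {T : ℕ} {B : Set (List ℕ)} {C Q Γ : ℝ} {V : Finset (List ℕ)} {p : List ℕ → ℝ}

lemma Side.two_le (h : Side T B C Q Γ V p) : 2 ≤ C := by
  obtain ⟨a, -, -, ha⟩ := h.pad
  linarith [qd_ge_one a]

lemma Side.nonempty (h : Side T B C Q Γ V p) : V.Nonempty := by
  rw [Finset.nonempty_iff_ne_empty]; rintro rfl
  simpa using h.sum

lemma Side.one_le (h : Side T B C Q Γ V p) : 1 ≤ Q := by
  obtain ⟨a, ha⟩ := h.nonempty
  exact (qd_ge_one a).trans (h.le a ha)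

lemma Side.exists_child (h : Side T B C Q Γ V p) {j : ℕ} {u : List ℕ}
    (hu : Nd B C (2 * C * Q) j u) : ∃ e : List ℕ → List ℕ, ∀ a ∈ V,
      Conc B (e a) ∧ Nd B C (2 * C * Q) (j + 1) (u ++ (a ++ e a)) ∧
        Q ≤ qd (a ++ e a) := by
  obtain ⟨a0, h0, hne, hC⟩ := h.pad
  have hQ := h.one_le
  have hC2 := h.two_le
  have key : ∀ a ∈ V, ∃ i, (2 * C * Q) ^ (j + 1) ≤ qd (u ++ a ++ pw a0 i) ∧
      qd (u ++ a ++ pw a0 i) ≤ C * (2 * C * Q) ^ (j + 1) := fun a ha => by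
    refine exists_padding hne (h.even a0 h0) ?_ hC
    refine (qd_append_le _ _).trans ?_
    calc 2 * (qd u * qd a) ≤ 2 * (C * (2 * C * Q) ^ j * Q) := by
          have := mul_le_mul hu.2.2 (h.le a ha) (qd_pos a).le (by positivity)
          linarith
      _ = _ := by ring
  choose! i hi using key
  refine ⟨fun a => pw a0 (i a), fun a ha => ⟨conc_pw h0 _, ⟨?_, ?_, ?_⟩, ?_⟩⟩
  · exact hu.1.append ((h.conc a ha).append (conc_pw h0 _))
  · rw [← List.append_assoc]; exact (hi a ha).1
  · rw [← List.append_assoc]; exact (hi a ha).2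
  · have h1 := (hi a ha).1
    rw [List.append_assoc] at h1
    have h2 := h1.trans (qd_append_le _ _)
    have h3 : (2 * C * Q) ^ (j + 1) ≤ 2 * (C * (2 * C * Q) ^ j * qd (a ++ pw a0 (i a))) :=
      h2.trans (by
        have := mul_le_mul_of_nonneg_right hu.2.2 (qd_pos (a ++ pw a0 (i a))).le
        linarith)
    have h4 : 0 < 2 * C * (2 * C * Q) ^ j := by positivity
    refine le_of_mul_le_mul_left ?_ h4
    calc _ = (2 * C * Q) ^ (j + 1) := by ring
      _ ≤ _ := h3
      _ = _ := by ring

end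

section
variable {T : ℕ} {B : Set (List ℕ)} {C Q Γ : ℝ} {V : Finset (List ℕ)} {p : List ℕ → ℝ}

lemma Side.T_pos (h : Side T B C Q Γ V p) : 0 < T := by
  obtain ⟨a, ha, hne, -⟩ := h.pad
  obtain ⟨z, hz⟩ := List.exists_mem_of_ne_nil a hne
  exact (Nat.zero_le z).trans_lt (h.lt a ha z hz)

lemma sepC_le (T : ℕ) : sepC T ≤ 1 / 4 := by
  unfold sepC
  refine div_le_div_of_nonneg_left (by norm_num) (by norm_num) ?_
  have : (1 : ℝ) ≤ ((T : ℝ) + 1) ^ 3 := one_le_pow₀ (by linarith [(Nat.cast_nonneg T : (0 : ℝ) ≤ T)])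
  linarith

lemma Side.psi_sep (h : Side T B C Q Γ V p) {e : List ℕ → List ℕ} (he : ∀ a ∈ V, Conc B (e a))
    {a a' : List ℕ} (ha : a ∈ V) (ha' : a' ∈ V) (hne : a ≠ a') {k : ℝ} (hk : k ∈ Icc (0 : ℝ) 1) :
    sepC T / (4 * qd (lcp a a') ^ 2) ≤
      |psi k (phi (a ++ e a) (1 / 2)) - psi k (phi (a' ++ e a') (1 / 2))| := by
  have hh : (1 / 2 : ℝ) ∈ Icc (0 : ℝ) 1 := by norm_num
  have hm : ∀ w, Conc B w → phi w (1 / 2) ∈ tailIcc T := fun w hw =>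
    phi_mem_tailIcc (hw.forall_lt h.lt) (half_mem_tailIcc h.T_pos)
  refine le_trans ?_ (le_abs_psi_sub hk (phi_mem _ hh) (phi_mem _ hh))
  rw [phi_append, phi_append]
  have := lcp_sep (h.len a ha a' ha') hne ((h.conc a ha).forall_lt h.lt)
    ((h.conc a' ha').forall_lt h.lt) (hm _ (he a ha)) (hm _ (he a' ha'))
  calc _ = sepC T / qd (lcp a a') ^ 2 / 4 := by rw [div_div]; ring_nf
    _ ≤ _ := by gcongr

lemma Side.le_qd_lcp_self (h : Side T B C Q Γ V p) {a : List ℕ} (ha : a ∈ V) :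
    Q ≤ 2 * qd (lcp a a) := by
  rw [lcp_self]; exact h.ge a ha

lemma Side.qd_lcp_le (h : Side T B C Q Γ V p) {a a' : List ℕ} (ha : a ∈ V) :
    qd (lcp a a') ≤ Q := (_root_.qd_lcp_le a a').trans (h.le a ha)

end

/-- The constant governing the proportion of scales with a near coincidence. -/
noncomputable def colC (T : ℕ) (C : ℝ) : ℝ := 18000 * C ^ 4 / sepC T

lemma card_coincidence_le {T : ℕ} {B B' : Set (List ℕ)} {C Q Γ Γ' : ℝ} {V V' : Finset (List ℕ)}
    {p p' : List ℕ → ℝ} (h : Side T B C Q Γ V p) (h' : Side T B' C Q Γ' V' p')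
    {e f : List ℕ → List ℕ} (he : ∀ a ∈ V, Conc B (e a)) (hf : ∀ a ∈ V', Conc B' (f a))
    {k l r ρ : ℝ} (hk : k ∈ Icc (0 : ℝ) 1) (hl : l ∈ Icc (0 : ℝ) 1) (hr : |r| = 1)
    (hρ : 1 ≤ 4 * C ^ 2 * ρ) {H : ℕ} (hH : Q ^ 2 ≤ H) {a a' b b' : List ℕ} (ha : a ∈ V)
    (ha' : a' ∈ V) (hb : b ∈ V') (hb' : b' ∈ V') :
    (((Finset.range H).filter fun i : ℕ =>
      |PP k l (r * (1 + i / H) * ρ) (phi (a ++ e a) (1 / 2)) (phi (b ++ f b) (1 / 2)) -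
        PP k l (r * (1 + i / H) * ρ) (phi (a' ++ e a') (1 / 2)) (phi (b' ++ f b') (1 / 2))| ≤
        69 * C ^ 2 / Q ^ 2).card : ℝ) ≤
      H * (colC T C / Q ^ 2 * (qd (lcp a a') * qd (lcp b b'))) := by
  have hQ := h.one_le
  have hC := h.two_le
  have hs := sepC_pos T
  have hs' := sepC_le T
  have hH0 : (0 : ℝ) < H := by nlinarith
  have hH1 : 0 < H := by exact_mod_cast hH0
  have hC4 : 1 ≤ C ^ 4 := one_le_pow₀ (by linarith)
  have hC24 : C ^ 2 ≤ C ^ 4 := pow_le_pow_right₀ (by linarith) (by norm_num)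
  have hρ0 : 0 < ρ := by
    by_contra hcon
    push Not at hcon
    nlinarith [mul_nonneg (show 0 ≤ 4 * C ^ 2 by positivity) (neg_nonneg.2 hcon)]
  set α := psi k (phi (a ++ e a) (1 / 2)) - psi k (phi (a' ++ e a') (1 / 2)) with hα
  set β := r * ρ * (psi l (phi (b ++ f b) (1 / 2)) - psi l (phi (b' ++ f b') (1 / 2))) with hβ
  set g := qd (lcp a a') with hg
  set g' := qd (lcp b b') with hg'
  have hg1 : 1 ≤ g := qd_ge_one _
  have hg1' : 1 ≤ g' := qd_ge_one _
  set δ := 69 * C ^ 2 / Q ^ 2 with hδ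
  have hδ0 : 0 ≤ δ := by positivity
  have hset : ((Finset.range H).filter fun i : ℕ =>
      |PP k l (r * (1 + i / H) * ρ) (phi (a ++ e a) (1 / 2)) (phi (b ++ f b) (1 / 2)) -
        PP k l (r * (1 + i / H) * ρ) (phi (a' ++ e a') (1 / 2)) (phi (b' ++ f b') (1 / 2))| ≤ δ) =
      (Finset.range H).filter fun i : ℕ => |α + (1 + i / H) * β| ≤ δ := by
    refine Finset.filter_congr fun i _ => ?_
    have : PP k l (r * (1 + i / H) * ρ) (phi (a ++ e a) (1 / 2)) (phi (b ++ f b) (1 / 2)) -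
        PP k l (r * (1 + i / H) * ρ) (phi (a' ++ e a') (1 / 2)) (phi (b' ++ f b') (1 / 2)) =
        α + (1 + i / H) * β := by
      rw [hα, hβ]; unfold PP; ring
    rw [this]
  rw [hset]
  obtain ⟨c1, c2⟩ := card_small_le hH1 (α := α) (β := β) hδ0
  set N : ℝ := (((Finset.range H).filter fun i : ℕ => |α + (1 + i / H) * β| ≤ δ).card : ℝ)
  have hNH : N ≤ H := by
    have := Finset.card_filter_le (Finset.range H) fun i : ℕ => |α + (1 + i / H) * β| ≤ δ
    rw [Finset.card_range] at this
    exact Nat.cast_le.2 this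
  have gen : ∀ γ G : ℝ, 1 ≤ G → sepC T / (16 * C ^ 2 * G ^ 2) ≤ |γ| →
      8 * δ * H / |γ| + 1 ≤ H * (9000 * C ^ 4 / sepC T / Q ^ 2 * G ^ 2) := by
    intro γ G hG hγ
    have hG2 : 1 ≤ G ^ 2 := one_le_pow₀ hG
    have e1 : 8 * δ * H / |γ| ≤ 8 * δ * H / (sepC T / (16 * C ^ 2 * G ^ 2)) :=
      div_le_div_of_nonneg_left (by positivity) (by positivity) hγ
    have e2 : 8 * δ * H / (sepC T / (16 * C ^ 2 * G ^ 2)) =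
        H * (8832 * C ^ 4 / sepC T / Q ^ 2 * G ^ 2) := by
      rw [hδ]; field_simp; ring
    have e3 : (1 : ℝ) ≤ H * (168 * C ^ 4 / sepC T / Q ^ 2 * G ^ 2) := by
      have e4 : 1 ≤ 168 * C ^ 4 / sepC T := by rw [le_div_iff₀ hs]; linarith
      calc (1 : ℝ) ≤ H / Q ^ 2 := by rwa [le_div_iff₀ (by positivity), one_mul]
        _ ≤ H / Q ^ 2 * (168 * C ^ 4 / sepC T * G ^ 2) :=
          le_mul_of_one_le_right (by positivity) (one_le_mul_of_one_le_of_one_le e4 hG2)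
        _ = _ := by ring
    calc _ ≤ H * (8832 * C ^ 4 / sepC T / Q ^ 2 * G ^ 2) +
          H * (168 * C ^ 4 / sepC T / Q ^ 2 * G ^ 2) := by linarith
      _ = _ := by ring
  have fin : ∀ X : ℝ, X ≤ 2 * (g * g') → H * (9000 * C ^ 4 / sepC T / Q ^ 2 * X) ≤
      H * (colC T C / Q ^ 2 * (g * g')) := by
    intro X hX
    calc H * (9000 * C ^ 4 / sepC T / Q ^ 2 * X) ≤
        H * (9000 * C ^ 4 / sepC T / Q ^ 2 * (2 * (g * g'))) := by gcongr
      _ = _ := by unfold colC; ring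
  have hA : a ≠ a' → N ≤ H * (9000 * C ^ 4 / sepC T / Q ^ 2 * g ^ 2) := fun hne => by
    have hsep := h.psi_sep he ha ha' hne hk
    have h0 : 0 < |α| := lt_of_lt_of_le (by positivity) hsep
    refine (c1 (abs_pos.1 h0)).trans (gen α g hg1 (le_trans ?_ hsep))
    refine div_le_div_of_nonneg_left hs.le (by positivity) ?_
    have : 1 ≤ C ^ 2 := one_le_pow₀ (by linarith)
    have hg2 : 0 < g ^ 2 := by positivity
    rw [← hg]
    nlinarith
  have hB : b ≠ b' → N ≤ H * (9000 * C ^ 4 / sepC T / Q ^ 2 * g' ^ 2) := fun hne => by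
    have hsep := h'.psi_sep hf hb hb' hne hl
    have hβ' : sepC T / (16 * C ^ 2 * g' ^ 2) ≤ |β| := by
      rw [hβ, abs_mul, abs_mul, hr, one_mul, abs_of_pos hρ0]
      calc sepC T / (16 * C ^ 2 * g' ^ 2) ≤ (4 * C ^ 2 * ρ) * (sepC T / (16 * C ^ 2 * g' ^ 2)) :=
            le_mul_of_one_le_left (by positivity) hρ
        _ = ρ * (sepC T / (4 * g' ^ 2)) := by field_simp; ring
        _ ≤ _ := mul_le_mul_of_nonneg_left hsep hρ0.le
    have h0 : 0 < |β| := lt_of_lt_of_le (by positivity) hβ'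
    exact (c2 (abs_pos.1 h0)).trans (gen β g' hg1' hβ')
  have hgg : 0 < g * g' := by positivity
  by_cases h1 : a = a'
  · have q1 : Q ≤ 2 * g := by rw [hg, ← h1]; exact h.le_qd_lcp_self ha
    by_cases h2 : b = b'
    · have q2 : Q ≤ 2 * g' := by rw [hg', ← h2]; exact h'.le_qd_lcp_self hb
      refine hNH.trans (le_mul_of_one_le_right hH0.le ?_)
      have q3 : Q ^ 2 ≤ 4 * (g * g') := by nlinarith
      have q4 : 4 ≤ colC T C := by unfold colC; rw [le_div_iff₀ hs]; linarith
      rw [div_mul_eq_mul_div, le_div_iff₀ (by positivity)]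
      nlinarith
    · refine (hB h2).trans (fin _ ?_)
      have : g' ≤ Q := h'.qd_lcp_le hb
      nlinarith
  · by_cases h2 : b = b'
    · have q2 : Q ≤ 2 * g' := by rw [hg', ← h2]; exact h'.le_qd_lcp_self hb
      refine (hA h1).trans (fin _ ?_)
      have : g ≤ Q := h.qd_lcp_le ha
      nlinarith
    · rcases le_total g g' with h3 | h3
      · exact (hA h1).trans (fin _ (by nlinarith))
      · exact (hB h2).trans (fin _ (by nlinarith))

/-- Robust separation of the cylinders of a family of pairs of words under projections. -/
def SepFam (k l r η c : ℝ) (F : Finset (List ℕ × List ℕ)) : Prop :=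
  ∀ k' ∈ Icc (0 : ℝ) 1, ∀ l' ∈ Icc (0 : ℝ) 1, ∀ τ : ℝ, |k' - k| ≤ η → |l' - l| ≤ η → |τ| ≤ η →
    ∀ A ∈ F, ∀ A' ∈ F, A ≠ A' → ∀ x ∈ Icc (0 : ℝ) 1, ∀ y ∈ Icc (0 : ℝ) 1, ∀ x' ∈ Icc (0 : ℝ) 1,
      ∀ y' ∈ Icc (0 : ℝ) 1, c ≤ |PP k' l' (r * Real.exp τ) (phi A.1 x) (phi A.2 y) -
        PP k' l' (r * Real.exp τ) (phi A'.1 x') (phi A'.2 y')|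

lemma gg_ratio_bounds {C X k l : ℝ} {u v : List ℕ} (hX : 0 < X) (hk : k ∈ Icc (0 : ℝ) 1)
    (hl : l ∈ Icc (0 : ℝ) 1) (hu : X ≤ qd u) (hu' : qd u ≤ C * X) (hv : X ≤ qd v)
    (hv' : qd v ≤ C * X) :
    1 ≤ 4 * C ^ 2 * (gg k u / gg l v) ^ 2 ∧ (gg k u / gg l v) ^ 2 ≤ 4 * C ^ 2 := by
  have hgu := gg_pos hk.1 u
  have hgv := gg_pos hl.1 v
  have h1 := qd_le_gg hk.1 u
  have h2 := qd_le_gg hl.1 v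
  have h3 := gg_le hk.2 u
  have h4 := gg_le hl.2 v
  have hC : 0 < C := by
    by_contra hcon
    push Not at hcon
    nlinarith [mul_nonneg (neg_nonneg.2 hcon) hX.le]
  have h5 : gg k u / gg l v ≤ 2 * C := by
    rw [div_le_iff₀ hgv]
    nlinarith
  have h6 : 1 ≤ 2 * C * (gg k u / gg l v) := by
    rw [mul_div_assoc', le_div_iff₀ hgv]
    nlinarith
  have h7 : 0 ≤ gg k u / gg l v := by positivity
  constructor
  · calc (1 : ℝ) ≤ (2 * C * (gg k u / gg l v)) ^ 2 := one_le_pow₀ h6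
      _ = _ := by ring
  · calc (gg k u / gg l v) ^ 2 ≤ (2 * C) ^ 2 := pow_le_pow_left₀ h7 h5 2
      _ = _ := by ring

lemma abs_ratio_sub_le {C k l k' l' r τ η ρ : ℝ} {u v : List ℕ} (hk : 0 ≤ k) (hl : 0 ≤ l)
    (hk' : 0 ≤ k') (hl' : 0 ≤ l') (hr : |r| ≤ 2) (hη : 5 * η ≤ 1) (h1 : |k' - k| ≤ η)
    (h2 : |l' - l| ≤ η) (h3 : |τ| ≤ η) (hρ : (gg k u / gg l v) ^ 2 = ρ) (hρC : ρ ≤ 4 * C ^ 2) :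
    |r * Real.exp τ * (gg k' u / gg l' v) ^ 2 - r * ρ| ≤ 80 * C ^ 2 * η := by
  have g1 := gg_pos hk u
  have g2 := gg_pos hl v
  have g3 := gg_pos hk' u
  have g4 := gg_pos hl' v
  set θ := τ + 2 * (Real.log (gg k' u) - Real.log (gg k u)) -
    2 * (Real.log (gg l' v) - Real.log (gg l v)) with hθ
  have e1 := (abs_le.1 ((abs_log_gg_sub_le hk' hk u).trans h1))
  have e2 := (abs_le.1 ((abs_log_gg_sub_le hl' hl v).trans h2))
  have e3 := abs_le.1 h3
  have hθ5 : |θ| ≤ 5 * η := by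
    rw [abs_le]; constructor <;> linarith [e1.1, e1.2, e2.1, e2.2, e3.1, e3.2]
  have e4 : (gg k' u / gg l' v) ^ 2 * Real.exp τ = ρ * Real.exp θ := by
    have : θ = τ + (2 * Real.log (gg k' u) - 2 * Real.log (gg k u)) -
        (2 * Real.log (gg l' v) - 2 * Real.log (gg l v)) := by rw [hθ]; ring
    have hlog : ∀ x : ℝ, 0 < x → Real.exp (2 * Real.log x) = x ^ 2 := fun x hx => by
      rw [two_mul, Real.exp_add, Real.exp_log hx, sq]
    rw [this, Real.exp_sub, Real.exp_add, Real.exp_sub, Real.exp_sub, hlog _ g1, hlog _ g2,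
      hlog _ g3, hlog _ g4, ← hρ]
    field_simp
  have e5 : r * Real.exp τ * (gg k' u / gg l' v) ^ 2 - r * ρ = r * ρ * (Real.exp θ - 1) := by
    linear_combination r * e4
  have hρ0 : 0 ≤ ρ := by rw [← hρ]; positivity
  rw [e5, abs_mul, abs_mul, abs_of_nonneg hρ0]
  have e6 := Real.abs_exp_sub_one_le (hθ5.trans hη)
  have hη0 : 0 ≤ η := (abs_nonneg _).trans h3
  calc |r| * ρ * |Real.exp θ - 1| ≤ 2 * (4 * C ^ 2) * (2 * (5 * η)) := by
        gcongr
        linarith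
    _ = _ := by ring

lemma abs_PP_sub_center_le {C Q η K L K' L' R R' x y : ℝ} {a b : List ℕ} (hC : 1 ≤ C) (hQ : 0 < Q)
    (hK : 0 ≤ K) (hL : 0 ≤ L) (hK' : 0 ≤ K') (hL' : 0 ≤ L') (h1 : |K' - K| ≤ η)
    (h2 : |L' - L| ≤ η) (hR : |R| ≤ 8 * C ^ 2) (hRR : |R' - R| ≤ 80 * C ^ 2 * η)
    (hη : 90 * Q ^ 2 * η ≤ 1) (ha : Q ≤ qd a) (hb : Q ≤ qd b) (hx : x ∈ Icc (0 : ℝ) 1)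
    (hy : y ∈ Icc (0 : ℝ) 1) :
    |PP K' L' R' (phi a x) (phi b y) - PP K L R (phi a (1 / 2)) (phi b (1 / 2))| ≤
      10 * C ^ 2 / Q ^ 2 := by
  have hh : (1 / 2 : ℝ) ∈ Icc (0 : ℝ) 1 := by norm_num
  have hη0 : 0 ≤ η := (abs_nonneg _).trans h1
  have hd : ∀ w : List ℕ, Q ≤ qd w → ∀ z ∈ Icc (0 : ℝ) 1, |phi w z - phi w (1 / 2)| ≤ 1 / Q ^ 2 := by
    intro w hw z hz
    refine (abs_phi_sub_le w hz.1 hh.1).trans ?_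
    gcongr
    rw [abs_le]; constructor <;> linarith [hz.1, hz.2]
  have e1 := abs_PP_sub_state_le (r := R) (r' := R') hK hL hK' hL' (phi_mem a hx) (phi_mem b hy)
  have e2 := abs_PP_sub_le (r := R) hK hL (phi_nonneg a hx.1) (phi_nonneg b hy.1)
    (phi_nonneg a hh.1) (phi_nonneg b hh.1)
  have e3 := hd a ha x hx
  have e4 := hd b hb y hy
  have hC2 : 1 ≤ C ^ 2 := one_le_pow₀ hC
  have e5 : |R| * |L' - L| ≤ 8 * C ^ 2 * η := by gcongr
  have e6 : |R| * |phi b y - phi b (1 / 2)| ≤ 8 * C ^ 2 * (1 / Q ^ 2) := by gcongr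
  have e7 : 90 * η ≤ 1 / Q ^ 2 := by rw [le_div_iff₀ (by positivity)]; linarith
  have e8 : 0 < 1 / Q ^ 2 := by positivity
  have e9 : 10 * C ^ 2 / Q ^ 2 = 10 * C ^ 2 * (1 / Q ^ 2) := by ring
  rw [e9]
  have tri := abs_sub_le (PP K' L' R' (phi a x) (phi b y)) (PP K L R (phi a x) (phi b y))
    (PP K L R (phi a (1 / 2)) (phi b (1 / 2)))
  nlinarith [mul_nonneg (sub_nonneg.2 hC2) e8.le, mul_nonneg (sub_nonneg.2 hC2) hη0,
    mul_le_mul_of_nonneg_left e7 (sq_nonneg C)]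

lemma robust_sep {C Q η k l k' l' r τ : ℝ} {j : ℕ} {u v a b a' b' : List ℕ} (hC : 2 ≤ C)
    (hQ : 1 ≤ Q) (hk : k ∈ Icc (0 : ℝ) 1) (hl : l ∈ Icc (0 : ℝ) 1) (hk' : k' ∈ Icc (0 : ℝ) 1)
    (hl' : l' ∈ Icc (0 : ℝ) 1) (hr : |r| ≤ 2) (h1 : |k' - k| ≤ η) (h2 : |l' - l| ≤ η)
    (h3 : |τ| ≤ η) (hη : 90 * Q ^ 2 * η ≤ 1) (hu : (2 * C * Q) ^ j ≤ qd u)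
    (hu' : qd u ≤ C * (2 * C * Q) ^ j) (hv : (2 * C * Q) ^ j ≤ qd v)
    (hv' : qd v ≤ C * (2 * C * Q) ^ j) (hue : Even u.length) (hve : Even v.length)
    (ha : Q ≤ qd a) (hb : Q ≤ qd b) (ha' : Q ≤ qd a') (hb' : Q ≤ qd b')
    (hsep : 69 * C ^ 2 / Q ^ 2 ≤ |PP (phi u.reverse k) (phi v.reverse l)
        (r * (gg k u / gg l v) ^ 2) (phi a (1 / 2)) (phi b (1 / 2)) -
      PP (phi u.reverse k) (phi v.reverse l)
        (r * (gg k u / gg l v) ^ 2) (phi a' (1 / 2)) (phi b' (1 / 2))|)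
    {x y x' y' : ℝ} (hx : x ∈ Icc (0 : ℝ) 1) (hy : y ∈ Icc (0 : ℝ) 1) (hx' : x' ∈ Icc (0 : ℝ) 1)
    (hy' : y' ∈ Icc (0 : ℝ) 1) :
    1 / (2 * C * Q) ^ (2 * (j + 1)) ≤
      |PP k' l' (r * Real.exp τ) (phi (u ++ a) x) (phi (v ++ b) y) -
        PP k' l' (r * Real.exp τ) (phi (u ++ a') x') (phi (v ++ b') y')| := by
  have hX : 0 < (2 * C * Q) ^ j := by positivity
  obtain ⟨-, hρC⟩ := gg_ratio_bounds hX hk hl hu hu' hv hv'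
  have hη0 : 0 ≤ η := (abs_nonneg _).trans h1
  have hη5 : 5 * η ≤ 1 := by nlinarith [mul_nonneg hη0 (by nlinarith : 0 ≤ Q ^ 2 - 1)]
  have hRR := abs_ratio_sub_le hk.1 hl.1 hk'.1 hl'.1 hr hη5 h1 h2 h3 rfl hρC
  have hR : |r * (gg k u / gg l v) ^ 2| ≤ 8 * C ^ 2 := by
    rw [abs_mul, abs_of_nonneg (sq_nonneg (gg k u / gg l v))]
    nlinarith [mul_le_mul hr hρC (sq_nonneg _) two_pos.le]
  have hK : |phi u.reverse k' - phi u.reverse k| ≤ η := (abs_phi_sub_le' _ hk'.1 hk.1).trans h1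
  have hL : |phi v.reverse l' - phi v.reverse l| ≤ η := (abs_phi_sub_le' _ hl'.1 hl.1).trans h2
  have c1 := abs_PP_sub_center_le (by linarith) (by linarith) (phi_nonneg _ hk.1)
    (phi_nonneg _ hl.1) (phi_nonneg _ hk'.1) (phi_nonneg _ hl'.1) hK hL hR hRR hη ha hb hx hy
  have c2 := abs_PP_sub_center_le (by linarith) (by linarith) (phi_nonneg _ hk.1)
    (phi_nonneg _ hl.1) (phi_nonneg _ hk'.1) (phi_nonneg _ hl'.1) hK hL hR hRR hη ha' hb' hx' hy'
  rw [phi_append, phi_append, phi_append, phi_append, PP_phi_sub hk'.1 hl'.1 hue hve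
    (phi_nonneg _ hx.1) (phi_nonneg _ hy.1) (phi_nonneg _ hx'.1) (phi_nonneg _ hy'.1)]
  have hg := gg_pos hk'.1 u
  rw [abs_div, abs_of_pos (show 0 < gg k' u ^ 2 by positivity), le_div_iff₀ (by positivity)]
  have hgu : gg k' u ≤ 2 * (C * (2 * C * Q) ^ j) := (gg_le hk'.2 u).trans (by linarith)
  have e1 : 1 / (2 * C * Q) ^ (2 * (j + 1)) * gg k' u ^ 2 ≤
      1 / (2 * C * Q) ^ (2 * (j + 1)) * (2 * (C * (2 * C * Q) ^ j)) ^ 2 := by gcongr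
  have e2 : 1 / (2 * C * Q) ^ (2 * (j + 1)) * (2 * (C * (2 * C * Q) ^ j)) ^ 2 = 1 / Q ^ 2 := by
    have : (2 * C * Q) ^ (2 * (j + 1)) = ((2 * C * Q) ^ j) ^ 2 * (2 * C * Q) ^ 2 := by ring
    rw [this]
    field_simp
  have e3 : 1 / Q ^ 2 ≤ 49 * C ^ 2 / Q ^ 2 := by gcongr; nlinarith
  have e4 : 49 * C ^ 2 / Q ^ 2 = 69 * C ^ 2 / Q ^ 2 - 10 * C ^ 2 / Q ^ 2 - 10 * C ^ 2 / Q ^ 2 := by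
    ring
  rw [e2] at e1
  have quad : ∀ p q P P' E S : ℝ, |P - p| ≤ E → |P' - q| ≤ E → S ≤ |p - q| →
      S - E - E ≤ |P - P'| := fun p q P P' E S i1 i2 i3 => by
    have t1 := abs_sub_le p P q
    have t2 := abs_sub_le P P' q
    rw [abs_sub_comm p P] at t1
    linarith
  exact (e1.trans e3).trans (e4.le.trans (quad _ _ _ _ _ _ c1 c2 hsep))

lemma abs_sub_le_of_floor_eq {x y δ : ℝ} (hδ : 0 < δ) (h : ⌊x / δ⌋ = ⌊y / δ⌋) : |x - y| ≤ δ := by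
  have := (Int.abs_sub_lt_one_of_floor_eq_floor h).le
  rwa [← sub_div, abs_div, abs_of_pos hδ, div_le_one hδ] at this

lemma le_abs_sub_of_floor {x y δ : ℝ} (hδ : 0 < δ)
    (h : ⌊x / δ⌋ + 2 ≤ ⌊y / δ⌋ ∨ ⌊y / δ⌋ + 2 ≤ ⌊x / δ⌋) : δ ≤ |x - y| := by
  have key : ∀ x y : ℝ, ⌊x / δ⌋ + 2 ≤ ⌊y / δ⌋ → δ ≤ |x - y| := fun x y h => by
    have h1 := Int.lt_floor_add_one (x / δ)
    have h2 := Int.floor_le (y / δ)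
    have h3 : ((⌊x / δ⌋ : ℤ) : ℝ) + 2 ≤ (⌊y / δ⌋ : ℤ) := by exact_mod_cast h
    have h4 : 1 ≤ (y - x) / δ := by rw [sub_div]; linarith
    rw [le_div_iff₀ hδ, one_mul] at h4
    rw [abs_sub_comm]
    exact h4.trans (le_abs_self _)
  rcases h with h | h
  · exact key x y h
  · rw [abs_sub_comm]; exact key y x h

section
variable {T : ℕ} {B B' : Set (List ℕ)} {C Q Γ Γ' : ℝ} {V V' : Finset (List ℕ)}
    {p p' : List ℕ → ℝ}

lemma Side.one_le_energy (h : Side T B C Q Γ V p) : 1 ≤ Γ := by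
  refine le_trans ?_ h.energy
  calc (1 : ℝ) = ∑ a ∈ V, ∑ a' ∈ V, p a * p a' * 1 := by
        simp only [mul_one]
        rw [← Finset.sum_mul_sum, h.sum, one_mul]
    _ ≤ _ := Finset.sum_le_sum fun a ha => Finset.sum_le_sum fun a' ha' =>
        mul_le_mul_of_nonneg_left (qd_ge_one _) (mul_pos (h.pos a ha) (h.pos a' ha')).le

/-- The average over the scales of the probability of a near coincidence. -/
lemma sum_coincidence_le (h : Side T B C Q Γ V p) (h' : Side T B' C Q Γ' V' p')
    {e f : List ℕ → List ℕ} (he : ∀ a ∈ V, Conc B (e a)) (hf : ∀ a ∈ V', Conc B' (f a))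
    {k l r ρ : ℝ} (hk : k ∈ Icc (0 : ℝ) 1) (hl : l ∈ Icc (0 : ℝ) 1) (hr : |r| = 1)
    (hρ : 1 ≤ 4 * C ^ 2 * ρ) {H : ℕ} (hH : Q ^ 2 ≤ H) (bin : ℕ → List ℕ × List ℕ → ℤ)
    (hbin : ∀ i c d, bin i d = bin i c →
      |PP k l (r * (1 + i / H) * ρ) (phi (c.1 ++ e c.1) (1 / 2)) (phi (c.2 ++ f c.2) (1 / 2)) -
        PP k l (r * (1 + i / H) * ρ) (phi (d.1 ++ e d.1) (1 / 2)) (phi (d.2 ++ f d.2) (1 / 2))| ≤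
        69 * C ^ 2 / Q ^ 2) :
    ∑ i ∈ Finset.range H, ∑ c ∈ V ×ˢ V', ∑ d ∈ V ×ˢ V' with bin i d = bin i c,
      (p c.1 * p' c.2) * (p d.1 * p' d.2) ≤ H * (colC T C / Q ^ 2 * (Γ * Γ')) := by
  have hQ := h.one_le
  have hc0 : 0 ≤ colC T C := by
    unfold colC; have := sepC_pos T; positivity
  have hpos : ∀ c ∈ V ×ˢ V', 0 < p c.1 * p' c.2 := fun c hc => by
    rw [Finset.mem_product] at hc
    exact mul_pos (h.pos _ hc.1) (h'.pos _ hc.2)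
  have hE : ∑ c ∈ V ×ˢ V', ∑ d ∈ V ×ˢ V', (p c.1 * p' c.2) * (p d.1 * p' d.2) *
      (qd (lcp c.1 d.1) * qd (lcp c.2 d.2)) =
      (∑ a ∈ V, ∑ a' ∈ V, p a * p a' * qd (lcp a a')) *
        ∑ b ∈ V', ∑ b' ∈ V', p' b * p' b' * qd (lcp b b') := by
    simp only [Finset.sum_product]
    rw [Finset.sum_mul_sum]
    refine Finset.sum_congr rfl fun a _ => Finset.sum_congr rfl fun b _ => ?_
    rw [Finset.sum_mul_sum]
    refine Finset.sum_congr rfl fun a' _ => Finset.sum_congr rfl fun b' _ => ?_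
    ring
  calc _ = ∑ c ∈ V ×ˢ V', ∑ d ∈ V ×ˢ V', (p c.1 * p' c.2) * (p d.1 * p' d.2) *
        (((Finset.range H).filter fun i => bin i d = bin i c).card : ℝ) := by
        rw [Finset.sum_comm]
        refine Finset.sum_congr rfl fun c _ => ?_
        simp only [Finset.sum_filter]
        rw [Finset.sum_comm]
        refine Finset.sum_congr rfl fun d _ => ?_
        rw [Finset.card_filter, Nat.cast_sum, Finset.mul_sum]
        exact Finset.sum_congr rfl fun i _ => by split_ifs <;> simp
    _ ≤ ∑ c ∈ V ×ˢ V', ∑ d ∈ V ×ˢ V', (p c.1 * p' c.2) * (p d.1 * p' d.2) *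
        (H * (colC T C / Q ^ 2 * (qd (lcp c.1 d.1) * qd (lcp c.2 d.2)))) := by
        refine Finset.sum_le_sum fun c hc => Finset.sum_le_sum fun d hd => ?_
        refine mul_le_mul_of_nonneg_left ?_ (mul_pos (hpos c hc) (hpos d hd)).le
        rw [Finset.mem_product] at hc hd
        refine le_trans ?_ (card_coincidence_le h h' he hf hk hl hr hρ hH hc.1 hd.1 hc.2 hd.2)
        refine Nat.cast_le.2 (Finset.card_le_card fun i hi => ?_)
        rw [Finset.mem_filter] at hi ⊢
        exact ⟨hi.1, hbin i c d hi.2⟩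
    _ = H * (colC T C / Q ^ 2 * ∑ c ∈ V ×ˢ V', ∑ d ∈ V ×ˢ V',
        (p c.1 * p' c.2) * (p d.1 * p' d.2) * (qd (lcp c.1 d.1) * qd (lcp c.2 d.2))) := by
        simp only [Finset.mul_sum]
        exact Finset.sum_congr rfl fun c _ => Finset.sum_congr rfl fun d _ => by ring
    _ ≤ _ := by
        rw [hE]
        have := h.one_le_energy
        have := h.energy
        have := h'.energy
        have hn : ∀ (V : Finset (List ℕ)) (p : List ℕ → ℝ), (∀ a ∈ V, 0 < p a) →
            0 ≤ ∑ b ∈ V, ∑ b' ∈ V, p b * p b' * qd (lcp b b') := fun V p hp =>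
          Finset.sum_nonneg fun b hb => Finset.sum_nonneg fun b' hb' =>
            mul_nonneg (mul_pos (hp b hb) (hp b' hb')).le (qd_pos _).le
        have := hn V' p' h'.pos
        gcongr

/-- The gain in the logarithm of the number of separated cylinders at each step. -/
noncomputable def gain (T : ℕ) (C Q G : ℝ) : ℝ := -Real.log 2 - Real.log (colC T C / Q ^ 2 * G)

lemma tree_families (h : Side T B C Q Γ V p) (h' : Side T B' C Q Γ' V' p') {k l r : ℝ}
    (hk : k ∈ Icc (0 : ℝ) 1) (hl : l ∈ Icc (0 : ℝ) 1) (hr : |r| = 1) {H : ℕ} (hH : Q ^ 2 ≤ H) :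
    ∀ n j u v, Nd B C (2 * C * Q) j u → Nd B' C (2 * C * Q) j v →
      ∃ F : ℕ → Finset (List ℕ × List ℕ), (∀ i < H, (F i).Nonempty ∧
        (∀ A ∈ F i, u <+: A.1 ∧ v <+: A.2 ∧ Nd B C (2 * C * Q) (j + n) A.1 ∧
          Nd B' C (2 * C * Q) (j + n) A.2) ∧
        SepFam k l (r * (1 + i / H)) (1 / (90 * Q ^ 2)) (1 / (2 * C * Q) ^ (2 * (j + n))) (F i)) ∧
      H * (n * gain T C Q (Γ * Γ')) ≤ ∑ i ∈ Finset.range H, Real.log (F i).card := by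
  classical
  have hQ := h.one_le
  have hC := h.two_le
  have hX : 1 ≤ 2 * C * Q := by nlinarith
  have hH0 : (0 : ℝ) < H := by nlinarith
  have hH1 : 0 < H := by exact_mod_cast hH0
  intro n
  induction n with
  | zero =>
    intro j u v hu hv
    refine ⟨fun _ => {(u, v)}, fun i _ => ⟨⟨(u, v), by simp⟩, fun A hA => ?_, ?_⟩, by simp⟩
    · rw [Finset.mem_singleton] at hA
      subst hA
      exact ⟨List.prefix_rfl, List.prefix_rfl, hu, hv⟩
    · intro k' _ l' _ τ _ _ _ A hA A' hA' hne
      rw [Finset.mem_singleton] at hA hA'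
      exact absurd (hA.trans hA'.symm) hne
  | succ n ih =>
    intro j u v hu hv
    obtain ⟨e, he⟩ := h.exists_child hu
    obtain ⟨f, hf⟩ := h'.exists_child hv
    have hch : ∀ c ∈ V ×ˢ V', _ := fun c hc =>
      ih (j + 1) (u ++ (c.1 ++ e c.1)) (v ++ (c.2 ++ f c.2))
        (he c.1 (Finset.mem_product.1 hc).1).2.1 (hf c.2 (Finset.mem_product.1 hc).2).2.1
    choose! G hG1 hG2 using hch
    set K := phi u.reverse k with hK
    set L := phi v.reverse l with hL
    set ρ := (gg k u / gg l v) ^ 2 with hρ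
    have hKm : K ∈ Icc (0 : ℝ) 1 := phi_mem _ hk
    have hLm : L ∈ Icc (0 : ℝ) 1 := phi_mem _ hl
    have hρ1 := (gg_ratio_bounds (by positivity) hk hl hu.2.1 hu.2.2 hv.2.1 hv.2.2).1
    set δ := 69 * C ^ 2 / Q ^ 2 with hδ
    have hδ0 : 0 < δ := by positivity
    set pos : ℕ → List ℕ × List ℕ → ℝ := fun i c =>
      PP K L (r * (1 + i / H) * ρ) (phi (c.1 ++ e c.1) (1 / 2)) (phi (c.2 ++ f c.2) (1 / 2)) with hpos
    set bin : ℕ → List ℕ × List ℕ → ℤ := fun i c => ⌊pos i c / δ⌋ with hbin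
    set P : List ℕ × List ℕ → ℝ := fun c => p c.1 * p' c.2 with hP
    have hPpos : ∀ c ∈ V ×ˢ V', 0 < P c := fun c hc => by
      rw [Finset.mem_product] at hc
      exact mul_pos (h.pos _ hc.1) (h'.pos _ hc.2)
    have hPsum : ∑ c ∈ V ×ˢ V', P c = 1 := by
      rw [Finset.sum_product, ← Finset.sum_mul_sum, h.sum, h'.sum, one_mul]
    have hsel : ∀ i < H, _ := fun i hi => exists_selection (bin i) hPpos hPsum
      (W := fun c => ((G c i).card : ℝ)) fun c hc =>
        Nat.cast_pos.2 (Finset.card_pos.2 (hG1 c hc i hi).1)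
    choose! J hJI hJsep hJne hJlog using hsel
    have hsepJ : ∀ i < H, ∀ c ∈ J i, ∀ d ∈ J i, c ≠ d → ∀ A ∈ G c i, ∀ A' ∈ G d i,
        ∀ k' ∈ Icc (0 : ℝ) 1, ∀ l' ∈ Icc (0 : ℝ) 1, ∀ τ : ℝ, |k' - k| ≤ 1 / (90 * Q ^ 2) →
        |l' - l| ≤ 1 / (90 * Q ^ 2) → |τ| ≤ 1 / (90 * Q ^ 2) →
        ∀ x ∈ Icc (0 : ℝ) 1, ∀ y ∈ Icc (0 : ℝ) 1, ∀ x' ∈ Icc (0 : ℝ) 1, ∀ y' ∈ Icc (0 : ℝ) 1,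
        1 / (2 * C * Q) ^ (2 * (j + 1)) ≤
          |PP k' l' (r * (1 + i / H) * Real.exp τ) (phi A.1 x) (phi A.2 y) -
            PP k' l' (r * (1 + i / H) * Real.exp τ) (phi A'.1 x') (phi A'.2 y')| := by
      intro i hi c hc d hd hcd A hA A' hA' k' hk' l' hl' τ h1 h2 h3 x hx y hy x' hx' y' hy'
      have hc' := Finset.mem_product.1 (hJI i hi hc)
      have hd' := Finset.mem_product.1 (hJI i hi hd)
      obtain ⟨⟨s1, e1⟩, ⟨s2, e2⟩, -, -⟩ := (hG1 c (hJI i hi hc) i hi).2.1 A hA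
      obtain ⟨⟨s3, e3⟩, ⟨s4, e4⟩, -, -⟩ := (hG1 d (hJI i hi hd) i hi).2.1 A' hA'
      rw [← e1, ← e2, ← e3, ← e4, phi_append _ s1, phi_append _ s2, phi_append _ s3,
        phi_append _ s4]
      refine robust_sep hC hQ hk hl hk' hl' ?_ h1 h2 h3 (le_of_eq (by field_simp)) hu.2.1 hu.2.2
        hv.2.1 hv.2.2 (hu.1.even_length h.even) (hv.1.even_length h'.even) (he c.1 hc'.1).2.2
        (hf c.2 hc'.2).2.2 (he d.1 hd'.1).2.2 (hf d.2 hd'.2).2.2 ?_ (phi_mem _ hx) (phi_mem _ hy)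
        (phi_mem _ hx') (phi_mem _ hy')
      · have : (i : ℝ) / H ≤ 1 := by
          rw [div_le_one hH0]; exact_mod_cast hi.le
        have h0 : 0 ≤ (i : ℝ) / H := by positivity
        rw [abs_mul, hr, one_mul, abs_of_nonneg (by linarith)]
        linarith
      · exact le_abs_sub_of_floor hδ0 (hJsep i hi c hc d hd hcd)
    have hdisj : ∀ i < H, (J i : Set (List ℕ × List ℕ)).PairwiseDisjoint fun c => G c i := by
      intro i hi c hc d hd hcd
      rw [Function.onFun, Finset.disjoint_left]
      intro A hA hA'
      have h0 : (0 : ℝ) ∈ Icc (0 : ℝ) 1 := by simp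
      have hη : (0 : ℝ) ≤ 1 / (90 * Q ^ 2) := by positivity
      have := hsepJ i hi c hc d hd hcd A hA A hA' k hk l hl 0 (by simpa using hη)
        (by simpa using hη) (by simpa using hη) 0 h0 0 h0 0 h0 0 h0
      rw [sub_self, abs_zero] at this
      exact absurd this (not_le.2 (by positivity))
    refine ⟨fun i => (J i).biUnion fun c => G c i, fun i hi => ⟨?_, ?_, ?_⟩, ?_⟩
    · obtain ⟨c, hc⟩ := hJne i hi
      obtain ⟨A, hA⟩ := (hG1 c (hJI i hi hc) i hi).1
      exact ⟨A, Finset.mem_biUnion.2 ⟨c, hc, hA⟩⟩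
    · intro A hA
      obtain ⟨c, hc, hA⟩ := Finset.mem_biUnion.1 hA
      obtain ⟨e1, e2, e3, e4⟩ := (hG1 c (hJI i hi hc) i hi).2.1 A hA
      rw [show j + (n + 1) = j + 1 + n by ring]
      exact ⟨(List.prefix_append _ _).trans e1, (List.prefix_append _ _).trans e2, e3, e4⟩
    · intro k' hk' l' hl' τ h1 h2 h3 A hA A' hA' hne x hx y hy x' hx' y' hy'
      obtain ⟨c, hc, hA⟩ := Finset.mem_biUnion.1 hA
      obtain ⟨d, hd, hA'⟩ := Finset.mem_biUnion.1 hA'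
      by_cases hcd : c = d
      · subst hcd
        rw [show j + (n + 1) = j + 1 + n by ring]
        exact (hG1 c (hJI i hi hc) i hi).2.2 k' hk' l' hl' τ h1 h2 h3 A hA A' hA' hne x hx y hy
          x' hx' y' hy'
      · refine le_trans ?_ (hsepJ i hi c hc d hd hcd A hA A' hA' k' hk' l' hl' τ h1 h2 h3 x hx y hy
          x' hx' y' hy')
        exact one_div_le_one_div_of_le (by positivity) (pow_le_pow_right₀ hX (by omega))
    · set Col : ℕ → ℝ := fun i => ∑ c ∈ V ×ˢ V', ∑ d ∈ V ×ˢ V' with bin i d = bin i c, P c * P d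
        with hCol
      have hcol : ∑ i ∈ Finset.range H, Col i ≤ H * (colC T C / Q ^ 2 * (Γ * Γ')) :=
        sum_coincidence_le h h' (fun a ha => (he a ha).1) (fun a ha => (hf a ha).1) hKm hLm hr hρ1 hH
          bin fun i c d hcd => abs_sub_le_of_floor_eq hδ0 hcd.symm
      have hCpos : ∀ i ∈ Finset.range H, 0 < Col i := fun i hi => by
        obtain ⟨c, hc⟩ : (V ×ˢ V').Nonempty := (hJne i (Finset.mem_range.1 hi)).mono
          (hJI i (Finset.mem_range.1 hi))
        refine Finset.sum_pos (fun c hc => Finset.sum_pos (fun d hd => ?_) ⟨c, by simpa using hc⟩)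
          ⟨c, hc⟩
        exact mul_pos (hPpos c hc) (hPpos d (Finset.mem_filter.1 hd).1)
      have hjen : ∑ i ∈ Finset.range H, Real.log (Col i) ≤
          H * Real.log (colC T C / Q ^ 2 * (Γ * Γ')) := by
        have hw : ∑ i ∈ Finset.range H, (1 / H : ℝ) = 1 := by
          rw [Finset.sum_const, Finset.card_range, nsmul_eq_mul]; field_simp
        have := sum_mul_log_le (p := fun _ : ℕ => (1 / H : ℝ)) (fun i _ => by positivity) hw hCpos
        rw [← Finset.mul_sum, ← Finset.mul_sum, div_mul_eq_mul_div, div_mul_eq_mul_div, one_mul,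
          one_mul, div_le_iff₀ hH0] at this
        refine this.trans ?_
        rw [mul_comm]
        refine mul_le_mul_of_nonneg_left (Real.log_le_log ?_ ?_) hH0.le
        · exact div_pos (Finset.sum_pos hCpos ⟨0, Finset.mem_range.2 hH1⟩) hH0
        · rw [div_le_iff₀ hH0]; linarith
      have hcard : ∀ i ∈ Finset.range H, -Real.log 2 + ∑ c ∈ V ×ˢ V', P c *
          Real.log (G c i).card - Real.log (Col i) ≤
          Real.log ((J i).biUnion fun c => G c i).card := fun i hi => by
        have hi' := Finset.mem_range.1 hi
        rw [Finset.card_biUnion (hdisj i hi'), Nat.cast_sum]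
        exact hJlog i hi'
      refine le_trans ?_ (Finset.sum_le_sum hcard)
      rw [Finset.sum_sub_distrib, Finset.sum_add_distrib, Finset.sum_const, Finset.card_range,
        nsmul_eq_mul, Finset.sum_comm]
      have hih : H * (n * gain T C Q (Γ * Γ')) ≤ ∑ c ∈ V ×ˢ V', ∑ i ∈ Finset.range H,
          P c * Real.log (G c i).card := by
        calc _ = ∑ c ∈ V ×ˢ V', P c * (H * (n * gain T C Q (Γ * Γ'))) := by
              rw [← Finset.sum_mul, hPsum, one_mul]
          _ ≤ _ := Finset.sum_le_sum fun c hc => by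
              rw [← Finset.mul_sum]
              exact mul_le_mul_of_nonneg_left (hG2 c hc) (hPpos c hc).le
      have hgain : H * ((n + 1 : ℕ) * gain T C Q (Γ * Γ')) = H * (n * gain T C Q (Γ * Γ')) +
          H * -Real.log 2 - H * Real.log (colC T C / Q ^ 2 * (Γ * Γ')) := by
        push_cast; unfold gain; ring
      rw [hgain]
      linarith

end

/-- A rich family of pairs of words whose projections are robustly separated. -/
lemma exists_family {T : ℕ} {B B' : Set (List ℕ)} {C Q Γ Γ' : ℝ} {V V' : Finset (List ℕ)}
    {p p' : List ℕ → ℝ} (h : Side T B C Q Γ V p) (h' : Side T B' C Q Γ' V' p') {k l r : ℝ}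
    (hk : k ∈ Icc (0 : ℝ) 1) (hl : l ∈ Icc (0 : ℝ) 1) (hr : |r| = 1) (n : ℕ) :
    ∃ z ∈ Icc (1 : ℝ) 2, ∃ F : Finset (List ℕ × List ℕ), F.Nonempty ∧
      (∀ A ∈ F, Nd B C (2 * C * Q) n A.1 ∧ Nd B' C (2 * C * Q) n A.2) ∧
      SepFam k l (r * z) (1 / (90 * Q ^ 2)) (1 / (2 * C * Q) ^ (2 * n)) F ∧
      n * gain T C Q (Γ * Γ') ≤ Real.log F.card := by
  obtain ⟨H, hH⟩ := exists_nat_ge (Q ^ 2)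
  have hQ := h.one_le
  have hC := h.two_le
  have hH0 : (0 : ℝ) < H := by nlinarith
  have h0 : ∀ B : Set (List ℕ), Nd B C (2 * C * Q) 0 [] := fun B =>
    ⟨Conc.nil B, by simp, by simp; linarith⟩
  obtain ⟨F, hF, hsum⟩ := tree_families h h' hk hl hr hH n 0 [] [] (h0 B) (h0 B')
  obtain ⟨i, hi, hlog⟩ : ∃ i ∈ Finset.range H, n * gain T C Q (Γ * Γ') ≤ Real.log (F i).card := by
    by_contra hcon
    push Not at hcon
    have := Finset.sum_lt_sum_of_nonempty (s := Finset.range H)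
      ⟨0, Finset.mem_range.2 (by exact_mod_cast hH0)⟩ hcon
    rw [Finset.sum_const, Finset.card_range, nsmul_eq_mul] at this
    linarith
  have hi' := Finset.mem_range.1 hi
  obtain ⟨f1, f2, f3⟩ := hF i hi'
  rw [zero_add] at f3
  refine ⟨1 + i / H, ⟨?_, ?_⟩, F i, f1, fun A hA => ?_, f3, hlog⟩
  · have : 0 ≤ (i : ℝ) / H := by positivity
    linarith
  · have : (i : ℝ) / H ≤ 1 := by rw [div_le_one hH0]; exact_mod_cast hi'.le
    linarith
  · obtain ⟨-, -, e1, e2⟩ := f2 A hA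
    rw [zero_add] at e1 e2
    exact ⟨e1, e2⟩

/-- The lists of `m` elements of `B`. -/
def pows (B : Finset (List ℕ)) : ℕ → Finset (List (List ℕ))
  | 0 => {[]}
  | m + 1 => (B ×ˢ pows B m).image fun x => x.1 :: x.2

lemma mem_pows {B : Finset (List ℕ)} : ∀ {m : ℕ} {l : List (List ℕ)},
    l ∈ pows B m ↔ l.length = m ∧ ∀ b ∈ l, b ∈ B
  | 0, l => by simp only [pows, Finset.mem_singleton, List.length_eq_zero_iff]; grind
  | m + 1, l => by
    simp only [pows, Finset.mem_image, Finset.mem_product, Prod.exists, mem_pows]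
    constructor
    · rintro ⟨b, l', ⟨hb, h1, h2⟩, rfl⟩
      grind
    · rintro ⟨h1, h2⟩
      cases l with
      | nil => simp at h1
      | cons b l => exact ⟨b, l, ⟨h2 b (by simp), by simpa using h1,
          fun c hc => h2 c (by simp [hc])⟩, rfl⟩

lemma sum_pows (B : Finset (List ℕ)) (ω : List ℕ → ℝ) :
    ∀ m, ∑ l ∈ pows B m, lw ω l = (∑ b ∈ B, ω b) ^ m
  | 0 => by simp [pows]
  | m + 1 => by
    rw [pows, Finset.sum_image (by rintro ⟨a, x⟩ - ⟨b, y⟩ -; simp), Finset.sum_product]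
    simp_rw [lw_cons, ← Finset.mul_sum, ← Finset.sum_mul, sum_pows B ω m]
    ring

lemma lw_le_rpow_qd {ω : List ℕ → ℝ} {s : ℝ} (hs : 0 ≤ s) (h0 : ∀ b, 0 ≤ ω b)
    (hω : ∀ b, ω b ≤ wt s b) (l : List (List ℕ)) : lw ω l ≤ qd l.flatten ^ (-2 * s) := by
  have h1 : lw ω l ≤ lw (wt s) l := by
    induction l with
    | nil => simp
    | cons b l ih =>
      simp only [lw_cons]
      exact mul_le_mul (hω b) ih (lw_nonneg h0 _) (wt_pos s b).le
  refine h1.trans ?_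
  rcases eq_or_ne l [] with rfl | hl
  · simp
  · refine (lw_wt_le hs hl).trans ?_
    exact Real.rpow_le_rpow_of_nonpos (qd_pos _) (by linarith [qd_pos l.flatten]) (by linarith)

lemma exists_lcp_flatten {n0 : ℕ} {qm : ℝ} : ∀ {l l' : List (List ℕ)},
    (∀ b ∈ l, b.length = n0 ∧ qd b ≤ qm) → (∀ b ∈ l', b.length = n0) → 1 ≤ qm →
    ∃ t ≤ l.length, l.take t = l'.take t ∧
      ∃ e, lcp l.flatten l'.flatten = (l.take t).flatten ++ e ∧ qd e ≤ qm
  | [], l', _, _, h => ⟨0, by simp, by simp, [], by simp [lcp], by simpa using h⟩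
  | b :: l, [], _, _, h => ⟨0, by simp, by simp, [], by simp [lcp], by simpa using h⟩
  | b :: l, b' :: l', hl, hl', h => by
    by_cases hb : b = b'
    · subst hb
      obtain ⟨t, ht, h1, e, h2, h3⟩ := exists_lcp_flatten (l := l) (l' := l')
        (fun c hc => hl c (by simp [hc])) (fun c hc => hl' c (by simp [hc])) h
      refine ⟨t + 1, by simpa using ht, by simpa using h1, e, ?_, h3⟩
      have : ∀ c u v : List ℕ, lcp (c ++ u) (c ++ v) = c ++ lcp u v := fun c u v => by
        induction c with
        | nil => rfl
        | cons z c ih => simp [lcp, ih]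
      simp [this, h2]
    · refine ⟨0, by simp, by simp, lcp (b :: l).flatten (b' :: l').flatten, by simp, ?_⟩
      have h1 := lcp_isPrefix_left (b :: l).flatten (b' :: l').flatten
      have h2 := lcp_isPrefix_right (b :: l).flatten (b' :: l').flatten
      set e := lcp (b :: l).flatten (b' :: l').flatten
      rw [List.flatten_cons] at h1 h2
      have hbl := hl b (by simp)
      have hbl' := hl' b' (by simp)
      rcases le_total e.length n0 with he | he
      · have h3 : e <+: b := List.prefix_of_prefix_length_le h1 (List.prefix_append b _)
          (by rw [hbl.1]; exact he)
        obtain ⟨x, hx⟩ := h3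
        refine le_trans ?_ hbl.2
        rw [← hx]; exact qd_le_append_left _ _
      · refine absurd ?_ hb
        have h3 : b <+: e := List.prefix_of_prefix_length_le (List.prefix_append b _) h1 (by omega)
        have h4 : b' <+: e := List.prefix_of_prefix_length_le (List.prefix_append b' _) h2 (by omega)
        exact (List.prefix_of_prefix_length_le h3 h4 (by omega)).eq_of_length (by omega)

section
variable {T n0 : ℕ} {B : Finset (List ℕ)} {ω : List ℕ → ℝ} {s qm : ℝ}

lemma sum_take_eq_le (h0 : ∀ b, 0 ≤ ω b) (hsum : ∑ b ∈ B, ω b = 1) {m t : ℕ}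
    {A : Finset (List (List ℕ))} (hA : A ⊆ pows B m) (c : List (List ℕ)) :
    ∑ l' ∈ A with c = l'.take t, lw ω l' ≤ lw ω c := by
  have := sum_lw_le_mul h0 t (A.filter fun l' => c = l'.take t) {c} (pows B (m - t)) (by
    intro w hw
    obtain ⟨hw, h1⟩ := Finset.mem_filter.1 hw
    obtain ⟨h2, h3⟩ := mem_pows.1 (hA hw)
    exact ⟨by simp [← h1], mem_pows.2 ⟨by simp [h2], fun b hb => h3 b (List.mem_of_mem_drop hb)⟩⟩)
  simpa [sum_pows, hsum] using this

lemma sum_lcp_le (hs : 0 ≤ s) (hs2 : s ≤ 1 / 2) (h0 : ∀ b, 0 ≤ ω b) (hω : ∀ b, ω b ≤ wt s b)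
    (hsum : ∑ b ∈ B, ω b = 1) (hB : ∀ b ∈ B, b.length = n0 ∧ qd b ≤ qm) (hqm : 1 ≤ qm) {m : ℕ}
    {A : Finset (List (List ℕ))} (hA : A ⊆ pows B m) (hA0 : A.Nonempty) {Q : ℝ} (hQ : ∀ l ∈ A, qd l.flatten ≤ Q) :
    ∑ l ∈ A, ∑ l' ∈ A, lw ω l * lw ω l' * qd (lcp l.flatten l'.flatten) ≤
      2 * qm * (m + 1) * Q ^ (1 - 2 * s) := by
  have hn : ∀ l, 0 ≤ lw ω l := lw_nonneg h0
  have key : ∀ l ∈ A, ∑ l' ∈ A, lw ω l' * qd (lcp l.flatten l'.flatten) ≤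
      2 * qm * (m + 1) * Q ^ (1 - 2 * s) := by
    intro l hl
    obtain ⟨hl1, hl2⟩ := mem_pows.1 (hA hl)
    calc ∑ l' ∈ A, lw ω l' * qd (lcp l.flatten l'.flatten)
        ≤ ∑ l' ∈ A, ∑ t ∈ Finset.range (m + 1), if l.take t = l'.take t then
            2 * qm * qd (l.take t).flatten * lw ω l' else 0 := by
          refine Finset.sum_le_sum fun l' hl' => ?_
          obtain ⟨hl'1, hl'2⟩ := mem_pows.1 (hA hl')
          obtain ⟨t, ht, h1, e, h2, h3⟩ := exists_lcp_flatten (l := l) (l' := l')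
            (fun b hb => hB b (hl2 b hb)) (fun b hb => (hB b (hl'2 b hb)).1) hqm
          refine le_trans ?_ (Finset.single_le_sum (f := fun t => if l.take t = l'.take t then
            2 * qm * qd (l.take t).flatten * lw ω l' else 0) (fun i _ => ?_)
            (Finset.mem_range.2 (show t < m + 1 by omega)))
          · simp only [h1, if_true]
            rw [h2, mul_comm (lw ω l'), ← h1]
            refine mul_le_mul_of_nonneg_right ((qd_append_le _ _).trans ?_) (hn _)
            nlinarith [qd_pos (l.take t).flatten]
          · split_ifs
            · have := qd_pos (l.take i).flatten
              have := hn l'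
              positivity
            · rfl
      _ = ∑ t ∈ Finset.range (m + 1), 2 * qm * qd (l.take t).flatten *
            ∑ l' ∈ A with l.take t = l'.take t, lw ω l' := by
          rw [Finset.sum_comm]
          refine Finset.sum_congr rfl fun t _ => ?_
          rw [Finset.mul_sum, Finset.sum_filter]
      _ ≤ ∑ t ∈ Finset.range (m + 1), 2 * qm * Q ^ (1 - 2 * s) := by
          refine Finset.sum_le_sum fun t _ => ?_
          have hq := qd_pos (l.take t).flatten
          have h1 : qd (l.take t).flatten ≤ Q := by
            refine le_trans ?_ (hQ l hl)
            nth_rw 2 [← List.take_append_drop t l]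
            rw [List.flatten_append]; exact qd_le_append_left _ _
          calc _ ≤ 2 * qm * qd (l.take t).flatten * qd (l.take t).flatten ^ (-2 * s) := by
                refine mul_le_mul_of_nonneg_left ?_ (by positivity)
                exact (sum_take_eq_le h0 hsum hA _).trans (lw_le_rpow_qd hs h0 hω _)
            _ = 2 * qm * qd (l.take t).flatten ^ (1 - 2 * s) := by
                rw [show 1 - 2 * s = 1 + -2 * s by ring, Real.rpow_add hq, Real.rpow_one]; ring
            _ ≤ _ := by
                refine mul_le_mul_of_nonneg_left ?_ (by positivity)
                exact Real.rpow_le_rpow hq.le h1 (by linarith)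
      _ = _ := by simp; ring
  calc _ = ∑ l ∈ A, lw ω l * ∑ l' ∈ A, lw ω l' * qd (lcp l.flatten l'.flatten) := by
        simp_rw [Finset.mul_sum, mul_assoc]
    _ ≤ ∑ l ∈ A, lw ω l * (2 * qm * (m + 1) * Q ^ (1 - 2 * s)) :=
        Finset.sum_le_sum fun l hl => mul_le_mul_of_nonneg_left (key l hl) (hn l)
    _ = (∑ l ∈ A, lw ω l) * (2 * qm * (m + 1) * Q ^ (1 - 2 * s)) := by rw [Finset.sum_mul]
    _ ≤ 1 * (2 * qm * (m + 1) * Q ^ (1 - 2 * s)) := by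
        obtain ⟨l, hl⟩ := hA0
        have hQ0 : 0 ≤ Q := (qd_pos _).le.trans (hQ l hl)
        refine mul_le_mul_of_nonneg_right ?_ (by positivity)
        refine (Finset.sum_le_sum_of_subset_of_nonneg hA fun l _ _ => hn l).trans ?_
        simp [sum_pows, hsum]
    _ = _ := one_mul _

lemma exists_side (hs : 0 ≤ s) (hs2 : s ≤ 1 / 2) (h0 : ∀ b, 0 < ω b) (hω : ∀ b, ω b ≤ wt s b)
    (hsum : ∑ b ∈ B, ω b = 1) (hB : ∀ b ∈ B, b.length = n0 ∧ qd b ≤ qm) (hqm : 1 ≤ qm)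
    (he : Even n0) (hn0 : n0 ≠ 0) (hT : ∀ b ∈ B, ∀ z ∈ b, z < T) {m : ℕ} {Q N C : ℝ}
    {A : Finset (List (List ℕ))} (hA : A ⊆ pows B m)
    (hQ : ∀ l ∈ A, qd l.flatten ≤ Q ∧ Q ≤ 2 * qd l.flatten) (hN : 0 < N)
    (hAN : 1 / N ≤ ∑ l ∈ A, lw ω l) (hC : ∃ b ∈ B, 2 * qd b ≤ C) :
    ∃ V p, Side T ↑B C Q (2 * qm * (m + 1) * Q ^ (1 - 2 * s) * N ^ 2) V p := by
  classical
  set P := ∑ l ∈ A, lw ω l with hP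
  have hP0 : 0 < P := lt_of_lt_of_le (by positivity) hAN
  have hlen : ∀ l ∈ A, ∀ b ∈ l, b.length = n0 := fun l hl b hb =>
    (hB b ((mem_pows.1 (hA hl)).2 b hb)).1
  have hinj : Set.InjOn List.flatten (A : Set (List (List ℕ))) := fun l hl l' hl' h =>
    flatten_inj_of_length (hlen l hl) (hlen l' hl')
      ((mem_pows.1 (hA hl)).1.trans (mem_pows.1 (hA hl')).1.symm) h
  set p : List ℕ → ℝ := fun v => (∑ l ∈ A with l.flatten = v, lw ω l) / P
  have hp : ∀ l ∈ A, p l.flatten = lw ω l / P := fun l hl => by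
    simp only [p]
    rw [Finset.sum_eq_single_of_mem l (by simp [hl])]
    intro l' hl' hne
    obtain ⟨h1, h2⟩ := Finset.mem_filter.1 hl'
    exact absurd (hinj h1 hl h2) hne
  have hA0 : A.Nonempty := by
    rw [Finset.nonempty_iff_ne_empty]; rintro rfl
    simp [hP] at hP0
  refine ⟨A.image List.flatten, p,
    fun b hb => (hB b hb).1 ▸ he, hT, ?_, ?_, ?_, ?_, ?_, ?_, ?_, ?_⟩
  · intro a ha
    obtain ⟨l, hl, rfl⟩ := Finset.mem_image.1 ha
    exact ⟨l, (mem_pows.1 (hA hl)).2, rfl⟩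
  · intro a ha a' ha'
    obtain ⟨l, hl, rfl⟩ := Finset.mem_image.1 ha
    obtain ⟨l', hl', rfl⟩ := Finset.mem_image.1 ha'
    rw [flatten_length (hlen l hl), flatten_length (hlen l' hl'), (mem_pows.1 (hA hl)).1,
      (mem_pows.1 (hA hl')).1]
  · intro a ha
    obtain ⟨l, hl, rfl⟩ := Finset.mem_image.1 ha
    exact (hQ l hl).1
  · intro a ha
    obtain ⟨l, hl, rfl⟩ := Finset.mem_image.1 ha
    exact (hQ l hl).2
  · intro a ha
    obtain ⟨l, hl, rfl⟩ := Finset.mem_image.1 ha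
    rw [hp l hl]
    refine div_pos ?_ hP0
    exact List.prod_pos fun x hx => by obtain ⟨b, -, rfl⟩ := List.mem_map.1 hx; exact h0 b
  · rw [Finset.sum_image hinj, Finset.sum_congr rfl hp, ← Finset.sum_div]
    exact div_self hP0.ne'
  · have h1 : ∑ a ∈ A.image List.flatten, ∑ a' ∈ A.image List.flatten, p a * p a' * qd (lcp a a') =
        (∑ l ∈ A, ∑ l' ∈ A, lw ω l * lw ω l' * qd (lcp l.flatten l'.flatten)) / P ^ 2 := by
      rw [Finset.sum_image hinj, Finset.sum_div]
      refine Finset.sum_congr rfl fun l hl => ?_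
      rw [Finset.sum_image hinj, Finset.sum_div]
      refine Finset.sum_congr rfl fun l' hl' => ?_
      rw [hp l hl, hp l' hl']
      field_simp
    rw [h1, div_le_iff₀ (by positivity)]
    refine (sum_lcp_le hs hs2 (fun b => (h0 b).le) hω hsum hB hqm hA hA0
      fun l hl => (hQ l hl).1).trans ?_
    have hQ0 : 0 ≤ Q := by
      obtain ⟨l, hl⟩ := hA0
      exact (qd_pos _).le.trans (hQ l hl).1
    have h2 : 1 ≤ N * P := by rwa [div_le_iff₀ hN, mul_comm] at hAN
    have h3 : 1 ≤ N ^ 2 * P ^ 2 := by rw [← mul_pow]; exact one_le_pow₀ h2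
    rw [mul_assoc _ (N ^ 2)]
    exact le_mul_of_one_le_right (by positivity) h3
  · obtain ⟨b, hb, hbC⟩ := hC
    refine ⟨b, hb, ?_, hbC⟩
    rintro rfl
    exact hn0 (by simpa using (hB [] hb).1.symm)
end

lemma sum_pows_reverse (B : Finset (List ℕ)) {ω : List ℕ → ℝ} (hω : ∀ b, ω b.reverse = ω b)
    (m : ℕ) (P : ℝ → Prop) [DecidablePred P] :
    ∑ l ∈ pows (B.image List.reverse) m with P (qd l.flatten), lw ω l =
      ∑ l ∈ pows B m with P (qd l.flatten), lw ω l := by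
  have hf : ∀ l : List (List ℕ), (l.map List.reverse).reverse.flatten = l.flatten.reverse :=
    fun l => by rw [List.reverse_flatten]
  have hinv : ∀ l : List (List ℕ),
      (((l.map List.reverse).reverse).map List.reverse).reverse = l := fun l => by
    simp [← List.map_reverse]
  refine Finset.sum_nbij' (fun l => (l.map List.reverse).reverse)
    (fun l => (l.map List.reverse).reverse) ?_ ?_ (fun l _ => hinv l) (fun l _ => hinv l) ?_
  · intro l hl
    simp only [Finset.mem_filter, mem_pows, hf, qd_reverse] at hl ⊢
    refine ⟨⟨by simpa using hl.1.1, ?_⟩, hl.2⟩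
    intro b hb
    rw [List.mem_reverse, List.mem_map] at hb
    obtain ⟨c, hc, rfl⟩ := hb
    obtain ⟨d, hd, rfl⟩ := Finset.mem_image.1 (hl.1.2 c hc)
    simpa using hd
  · intro l hl
    simp only [Finset.mem_filter, mem_pows, hf, qd_reverse] at hl ⊢
    refine ⟨⟨by simpa using hl.1.1, ?_⟩, hl.2⟩
    intro b hb
    rw [List.mem_reverse, List.mem_map] at hb
    obtain ⟨c, hc, rfl⟩ := hb
    exact Finset.mem_image_of_mem _ (hl.1.2 c hc)
  · intro l _
    simp [lw, Function.comp_def, hω]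

lemma exists_log_le_mul {c : ℝ} (hc : 0 < c) : ∃ D, ∀ m : ℕ, Real.log (m + 1) ≤ c * m + D := by
  refine ⟨c - 1 - Real.log c, fun m => ?_⟩
  have := Real.add_one_le_exp (Real.log (c * (m + 1)))
  rw [Real.exp_log (by positivity), Real.log_mul hc.ne' (by positivity)] at this
  linarith

/-- Two families of words with the same parameters, one built from `B` and one from the reversed
blocks, for which the gain exceeds any prescribed rate below the critical one. -/
lemma exists_sides {T n0 : ℕ} {B : Finset (List ℕ)} {s s' : ℝ} (hB : ∀ b ∈ B, b.length = n0)
    (he : Even n0) (hn0 : n0 ≠ 0) (hT : ∀ b ∈ B, ∀ z ∈ b, z < T) (hs2 : s ≤ 1 / 2)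
    (hZ : 1 ≤ ∑ b ∈ B, wt s b) (hs' : 0 ≤ s') (hss : s' < s) :
    ∃ C Q Γ V p V' p', Side T ↑B C Q Γ V p ∧ Side T ↑(B.image List.reverse) C Q Γ V' p' ∧
      4 * s' * Real.log (2 * C * Q) ≤ gain T C Q (Γ * Γ) := by
  classical
  have hs : 0 ≤ s := hs'.trans hss.le
  set Z := ∑ b ∈ B, wt s b with hZdef
  have hZ0 : 0 < Z := by linarith
  set ω : List ℕ → ℝ := fun b => wt s b / Z
  have h0 : ∀ b, 0 < ω b := fun b => div_pos (wt_pos s b) hZ0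
  have hω : ∀ b, ω b ≤ wt s b := fun b => div_le_self (wt_pos s b).le hZ
  have hωr : ∀ b, ω b.reverse = ω b := fun b => by simp [ω, wt, qd_reverse]
  have hsum : ∑ b ∈ B, ω b = 1 := by
    simp only [ω]; rw [← Finset.sum_div]; exact div_self hZ0.ne'
  obtain ⟨b0, hb0⟩ : B.Nonempty := by
    rw [Finset.nonempty_iff_ne_empty]; intro h
    rw [h] at hsum; simp at hsum
  set C := 2 * qd b0
  set K := (T + 1) * n0 with hK
  obtain ⟨qm, hqm⟩ : ∃ qm : ℝ, qm = 2 ^ K := ⟨_, rfl⟩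
  have hqm1 : 1 ≤ qm := hqm ▸ one_le_pow₀ one_le_two
  have hqb : ∀ b ∈ B, qd b ≤ qm := fun b hb => by
    refine (qd_le_pow b (hT b hb)).trans ?_
    rw [hB b hb, hqm, hK, pow_mul]
    refine pow_le_pow_left₀ (by positivity) ?_ _
    exact_mod_cast (Nat.lt_two_pow_self (n := T + 1)).le
  have hC : 2 ≤ C := by have := qd_ge_one b0; simp only [C]; linarith
  have hcC : 0 < colC T C := by
    unfold colC; have := sepC_pos T; positivity
  obtain ⟨D, hD⟩ := exists_log_le_mul (c := (s - s') * Real.log 2 / 6)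
    (by have := Real.log_pos one_lt_two; have : 0 < s - s' := by linarith
        positivity)
  set E := Real.log 2 + Real.log (colC T C * (4 * qm ^ 2 * (K + 1) ^ 4)) + 6 * D +
    4 * s' * Real.log (2 * C) with hE
  obtain ⟨m, hm⟩ := exists_nat_ge (E / ((s - s') * Real.log 2))
  have hl2 := Real.log_pos one_lt_two
  have hss' : 0 < s - s' := by linarith
  rw [div_le_iff₀ (by positivity)] at hm
  set cls : Finset (List ℕ) → ℕ → Finset (List (List ℕ)) := fun B i =>
    (pows B m).filter fun l => (2 : ℝ) ^ i ≤ qd l.flatten ∧ qd l.flatten < 2 ^ (i + 1) with hcls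
  set N : ℝ := (K + 1) * (m + 1) with hN
  have hN0 : 0 < N := by positivity
  obtain ⟨i, hi⟩ : ∃ i, 1 / N ≤ ∑ l ∈ cls B i, lw ω l := by
    by_contra! hcon
    have hbU : pows B m ⊆ (Finset.range (K * m + 1)).biUnion (cls B) := by
      intro l hl
      obtain ⟨h1, h2⟩ := mem_pows.1 hl
      obtain ⟨i, hi, hi2⟩ := exists_nat_pow_near (qd_ge_one l.flatten) one_lt_two
      refine Finset.mem_biUnion.2 ⟨i, ?_, by simp [hcls, hl, hi, hi2]⟩
      rw [Finset.mem_range, Nat.lt_succ_iff]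
      have h3 : qd l.flatten ≤ 2 ^ (K * m) := by
        refine (qd_le_pow l.flatten (T := T) fun z hz => ?_).trans ?_
        · obtain ⟨b, hb, hzb⟩ := List.mem_flatten.1 hz
          exact hT b (h2 b hb) z hzb
        · rw [flatten_length (n := n0) fun b hb => hB b (h2 b hb), h1, hK,
            show (T + 1) * n0 * m = (T + 1) * (m * n0) by ring, pow_mul (2 : ℝ)]
          refine pow_le_pow_left₀ (by positivity) ?_ _
          exact_mod_cast (Nat.lt_two_pow_self (n := T + 1)).le
      exact (pow_le_pow_iff_right₀ one_lt_two).1 (hi.trans h3)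
    have h1 : (1 : ℝ) ≤ ∑ i ∈ Finset.range (K * m + 1), ∑ l ∈ cls B i, lw ω l := by
      refine le_trans ?_ (sum_biUnion_le_sum (fun l => lw_nonneg (fun b => (h0 b).le) l) _ _)
      refine le_trans ?_ (Finset.sum_le_sum_of_subset_of_nonneg hbU
        fun l _ _ => lw_nonneg (fun b => (h0 b).le) l)
      rw [sum_pows, hsum, one_pow]
    have h2 := h1.trans_lt (Finset.sum_lt_sum_of_nonempty (by simp) fun i _ => hcon i)
    rw [Finset.sum_const, Finset.card_range, nsmul_eq_mul, mul_one_div, one_lt_div hN0] at h2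
    push_cast at h2
    nlinarith
  set Q : ℝ := 2 ^ (i + 1) with hQ
  have hQm : (2 : ℝ) ^ m ≤ Q := by
    have : (cls B i).Nonempty := by
      rw [Finset.nonempty_iff_ne_empty]; intro h
      rw [h, Finset.sum_empty] at hi
      exact absurd hi (not_le.2 (div_pos one_pos hN0))
    obtain ⟨l, hl⟩ := this
    simp only [hcls, Finset.mem_filter, mem_pows] at hl
    refine le_trans ?_ hl.2.2.le
    refine le_trans (pow_le_pow_right₀ one_le_two ?_) (two_pow_le_qd _)
    rw [flatten_length (n := n0) fun b hb => hB b (hl.1.2 b hb), hl.1.1]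
    obtain ⟨e, he⟩ := he
    have : m * 2 ≤ m * n0 := Nat.mul_le_mul_left m (by omega)
    omega
  have hside : ∀ l, (2 : ℝ) ^ i ≤ qd l ∧ qd l < 2 ^ (i + 1) → qd l ≤ Q ∧ Q ≤ 2 * qd l := fun l h =>
    ⟨h.2.le, by rw [hQ, pow_succ]; linarith [h.1]⟩
  obtain ⟨V, p, hV⟩ := exists_side (T := T) (A := cls B i) hs hs2 h0 hω hsum
    (fun b hb => ⟨hB b hb, hqb b hb⟩) hqm1 he hn0 hT (Finset.filter_subset _ _)
    (fun l hl => hside _ (Finset.mem_filter.1 hl).2) hN0 hi ⟨b0, hb0, le_rfl⟩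
  obtain ⟨V', p', hV'⟩ := exists_side (T := T) (A := cls (B.image List.reverse) i) (C := C)
    hs hs2 h0 hω
    (by rw [Finset.sum_image List.reverse_injective.injOn]; simpa only [hωr] using hsum)
    (n0 := n0) (qm := qm) (fun b hb => by
      obtain ⟨c, hc, rfl⟩ := Finset.mem_image.1 hb
      rw [List.length_reverse, qd_reverse]; exact ⟨hB c hc, hqb c hc⟩) hqm1 he hn0
    (fun b hb z hz => by
      obtain ⟨c, hc, rfl⟩ := Finset.mem_image.1 hb
      exact hT c hc z (List.mem_reverse.1 hz)) (Finset.filter_subset _ _)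
    (fun l hl => hside _ (Finset.mem_filter.1 hl).2) hN0
    (by
      refine hi.trans (le_of_eq ?_)
      exact (sum_pows_reverse B hωr m fun q => (2 : ℝ) ^ i ≤ q ∧ q < 2 ^ (i + 1)).symm)
    ⟨b0.reverse, Finset.mem_image_of_mem _ hb0, by rw [qd_reverse]⟩
  refine ⟨C, Q, _, V, p, V', p', hV, hV', ?_⟩
  have hQ0 : 0 < Q := by positivity
  have hlQ : m * Real.log 2 ≤ Real.log Q := by
    rw [← Real.log_pow]; exact Real.log_le_log (by positivity) hQm
  have h1 : colC T C / Q ^ 2 * ((2 * qm * (m + 1) * Q ^ (1 - 2 * s) * N ^ 2) *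
      (2 * qm * (m + 1) * Q ^ (1 - 2 * s) * N ^ 2)) =
      colC T C * (4 * qm ^ 2 * (K + 1) ^ 4) * ((m + 1) ^ 6 * Q ^ (-4 * s)) := by
    have : Q ^ (1 - 2 * s) * Q ^ (1 - 2 * s) = Q ^ 2 * Q ^ (-4 * s) := by
      rw [← Real.rpow_add hQ0, ← Real.rpow_natCast Q 2, ← Real.rpow_add hQ0]
      congr 1; push_cast; ring
    calc _ = colC T C / Q ^ 2 * (4 * qm ^ 2 * (m + 1) ^ 2 * N ^ 4 *
          (Q ^ (1 - 2 * s) * Q ^ (1 - 2 * s))) := by ring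
      _ = _ := by rw [this, hN]; field_simp
  have hqm0 : 0 < qm := by linarith
  have h3 : Real.log (colC T C * (4 * qm ^ 2 * (K + 1) ^ 4) * ((m + 1) ^ 6 * Q ^ (-4 * s))) =
      Real.log (colC T C * (4 * qm ^ 2 * (K + 1) ^ 4)) +
        (6 * Real.log (m + 1) + -4 * s * Real.log Q) := by
    rw [Real.log_mul (x := _ * _) (y := _ * _) (by positivity) (by positivity),
      Real.log_mul (x := _ ^ 6) (by positivity) (by positivity), Real.log_rpow hQ0, Real.log_pow]
    norm_num
  rw [gain, h1, h3, Real.log_mul (x := 2 * C) (by positivity) hQ0.ne']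
  have h2 := hD m
  have h4 := mul_le_mul_of_nonneg_left hlQ hss'.le
  have h5 : 0 ≤ (s - s') * (m * Real.log 2) := by positivity
  linarith

lemma exists_stream {U : ℕ → List ℕ} (hp : ∀ n, U n <+: U (n + 1)) (hl : ∀ n, n ≤ (U n).length) :
    ∃ f : ℕ → ℕ, ∀ n, pre f (U n).length = U n := by
  have hmono : ∀ m n, m ≤ n → U m <+: U n := fun m n h => by
    induction n, h using Nat.le_induction with
    | base => exact List.prefix_rfl
    | succ n _ ih => exact ih.trans (hp n)
  refine ⟨fun i => (U (i + 1)).getD i 0, fun n => List.ext_getElem (by simp) fun i h1 h2 => ?_⟩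
  have h3 : i < (U (i + 1)).length := hl (i + 1)
  simp only [pre, List.getElem_map, List.getElem_range, List.getD_eq_getElem _ _ h3]
  rcases le_total (i + 1) n with h | h
  · exact (hmono _ _ h).getElem h3
  · exact ((hmono _ _ h).getElem h2).symm

lemma mem_KS_of_conc {B : Finset (List ℕ)} {n : ℕ} (hn : n ≠ 0) (hB : ∀ b ∈ B, b.length = n)
    {f : ℕ → ℕ} (h : ∀ N, ∃ m ≥ N, Conc ↑B (pre f m)) : f ∈ KS B n := by
  intro j
  obtain ⟨m, hm, l, hl, hlf⟩ := h ((j + 1) * n)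
  have h1 := flatten_length (n := n) fun b hb => hB b (hl b hb)
  rw [hlf, pre_length] at h1
  have h2 : j < l.length := by
    by_contra! hcon
    have := Nat.mul_le_mul_right n hcon
    have : 0 < n := Nat.pos_of_ne_zero hn
    rw [Nat.add_one_mul] at hm
    omega
  have h3 : l = l.take j ++ (l[j] :: l.drop (j + 1)) := by
    rw [List.getElem_cons_drop, List.take_append_drop]
  have h4 : m = j * n + (n + (m - (j + 1) * n)) := by rw [Nat.add_one_mul] at hm ⊢; omega
  rw [h4, pre_add, pre_add, h3, List.flatten_append, List.flatten_cons] at hlf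
  have h5 := (List.append_inj hlf (by
    rw [flatten_length (n := n) fun b hb => hB b (hl b (List.mem_of_mem_take hb)), pre_length,
      List.length_take, min_eq_left h2.le])).2
  have h6 := (List.append_inj h5 (by rw [pre_length, hB _ (hl _ (List.getElem_mem h2))])).1
  rw [← h6]
  exact hl _ (List.getElem_mem h2)

lemma cf_pre {f : ℕ → ℕ} {u : List ℕ} (h : pre f u.length = u) :
    ∃ x ∈ Icc (0 : ℝ) 1, cf f = phi u x :=
  ⟨_, cf_mem (shf u.length f), by rw [cf_eq_phi f u.length, h]⟩

/-- **Dimension of projected sums of two dynamically defined Cantor sets.** -/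
theorem le_dimH_PP {T n : ℕ} {B : Finset (List ℕ)} {s s' : ℝ} (hB : ∀ b ∈ B, b.length = n)
    (he : Even n) (hn : n ≠ 0) (hT : ∀ b ∈ B, ∀ z ∈ b, z < T) (hs2 : s ≤ 1 / 2)
    (hZ : 1 ≤ ∑ b ∈ B, wt s b) (hs' : 0 < s') (hss : s' < s) {a b : List ℕ} (ha : a ∈ B)
    (hb : b ∈ B) (hne : a ≠ b) {k l r σ : ℝ} (hk : k ∈ Icc (0 : ℝ) 1) (hl : l ∈ Icc (0 : ℝ) 1)
    (hr : |r| = 1) {E : Set ℝ} (hE : ∀ f ∈ KS B n, ∀ g ∈ KS (B.image List.reverse) n,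
      PP k l (r * Real.exp σ) (cf f) (cf g) ∈ E) : ENNReal.ofReal (2 * s') ≤ dimH E := by
  classical
  obtain ⟨C, Q, Γ, V, p, V', p', hV, hV', hgain⟩ := exists_sides (s' := (s' + s) / 2) hB he hn hT
    hs2 hZ (by linarith) (by linarith)
  obtain ⟨kS, hkS, lS, hlS, hcorr⟩ := exists_correction (B := (B : Set (List ℕ))) ha hb
    ((hB a ha).trans (hB b hb).symm) hne (hT a ha) (hT b hb) (by rwa [hB a ha])
  have hQ := hV.one_le
  have hC := hV.two_le
  set R := 2 * C * Q with hRdef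
  have hR : 4 ≤ R := by nlinarith
  have hlR : 0 < Real.log R := Real.log_pos (by linarith)
  have hlC : 0 ≤ Real.log (2 * C) := Real.log_nonneg (by linarith)
  set η := 1 / (90 * Q ^ 2) with hη
  have hη0 : 0 < η := by positivity
  have hη1 : η ≤ 1 := by rw [hη, div_le_one (by positivity)]; nlinarith
  set S := |σ| + 2 + 2 * Real.log (2 * C) with hS
  obtain ⟨K', hK'⟩ := hcorr η hη0 (S + 1)
  set K := max K' 1
  have hK1 : 1 ≤ K := le_max_right _ _
  set D := 4 * K * C
  have hD0 : 0 < D := by positivity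
  obtain ⟨N, hN⟩ := exists_nat_ge (max 1 (2 * s' * Real.log D / ((s - s') * Real.log R)))
  have hss' : 0 < s - s' := by linarith
  have hN1 : (1 : ℝ) ≤ N := (le_max_left _ _).trans hN
  have hN2 := (le_max_right _ _).trans hN
  rw [div_le_iff₀ (by positivity)] at hN2
  obtain ⟨z, hz, F, -, hFN, hFsep, hFcard⟩ := exists_family hV hV' hkS hlS hr N
  have hlz0 : 0 ≤ Real.log z := Real.log_nonneg hz.1
  have hlz1 : Real.log z ≤ 1 := by
    have := Real.log_le_sub_one_of_pos (show 0 < z by linarith [hz.1])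
    linarith [hz.2]
  have hRN : 4 ≤ R ^ N := hR.trans (le_self_pow₀ (by linarith) (by
    rintro rfl; norm_num at hN1))
  have hcard : 2 * (s' + s) * (N * Real.log R) ≤ Real.log F.card := by
    refine le_trans ?_ hFcard
    have := mul_le_mul_of_nonneg_left hgain (show (0 : ℝ) ≤ N by positivity)
    linarith
  have hM : 1 < F.card := by
    by_contra! hcon
    have h1 : Real.log F.card ≤ 0 := Real.log_nonpos (by positivity) (by exact_mod_cast hcon)
    have : 0 < 2 * (s' + s) * (N * Real.log R) := by
      have : 0 < s' + s := by linarith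
      positivity
    linarith
  set e := F.equivFin.symm
  set sg : List ℕ → List ℕ → ℝ := fun u v =>
    σ + 2 * Real.log (gg k u) - 2 * Real.log (gg l v) with hsg
  have h0 : (0 : ℝ) ∈ Icc (0 : ℝ) 1 := by simp
  have hcor : ∀ p : List ℕ × List ℕ, ∃ c : List ℕ × List ℕ, |sg p.1 p.2| ≤ S →
      Conc B c.1 ∧ Conc ↑(B.image List.reverse) c.2 ∧ qd c.1 ≤ K ∧
        |phi (p.1 ++ c.1).reverse k - kS| ≤ η ∧ |phi (p.2 ++ c.2).reverse l - lS| ≤ η ∧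
        |sg (p.1 ++ c.1) (p.2 ++ c.2) - Real.log z| ≤ η := by
    intro p
    by_cases hp : |sg p.1 p.2| ≤ S
    · obtain ⟨u, v, h1, ⟨w, hw, hwv⟩, h3, -, h5, h6, h7⟩ := hK' _ (phi_mem p.1.reverse hk) _
        (phi_mem p.2.reverse hl) (sg p.1 p.2 - Real.log z) (by
          rw [abs_le] at hp ⊢; constructor <;> linarith [hp.1, hp.2])
      refine ⟨(u, v), fun _ => ⟨h1, ⟨(w.map List.reverse).reverse, ?_, ?_⟩, h3.trans (le_max_left _ _), ?_, ?_, ?_⟩⟩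
      · intro b hb
        rw [List.mem_reverse, List.mem_map] at hb
        obtain ⟨c, hc, rfl⟩ := hb
        exact_mod_cast Finset.mem_image_of_mem _ (hw c hc)
      · rw [← List.reverse_flatten, hwv, List.reverse_reverse]
      · rwa [List.reverse_append, phi_append]
      · rwa [List.reverse_append, phi_append]
      · refine le_trans (le_of_eq ?_) h7
        simp only [hsg]
        rw [gg_append hk.1, gg_append hl.1, Real.log_mul (gg_pos hk.1 _).ne'
          (gg_pos (phi_mem _ hk).1 _).ne', Real.log_mul (gg_pos hl.1 _).ne'
          (gg_pos (phi_mem _ hl).1 _).ne']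
        congr 1; ring
    · exact ⟨([], []), fun h => absurd h hp⟩
  choose c hc using hcor
  set step : List ℕ × List ℕ → List ℕ × List ℕ → List ℕ × List ℕ := fun p A =>
    (p.1 ++ (c p).1 ++ A.1, p.2 ++ (c p).2 ++ A.2) with hstep
  set inv : List ℕ × List ℕ → ℕ → Prop := fun p i => Conc B p.1 ∧
    Conc ↑(B.image List.reverse) p.2 ∧ |sg p.1 p.2| ≤ S ∧ qd p.1 ≤ (D * R ^ N) ^ i ∧
      i ≤ p.1.length ∧ i ≤ p.2.length with hinv
  have hnil : ∀ {u : List ℕ}, R ^ N ≤ qd u → 1 ≤ u.length := fun {u} hu => by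
    rw [Nat.one_le_iff_ne_zero, Ne, List.length_eq_zero_iff]; rintro rfl
    simp at hu; linarith
  have hinvs : ∀ p i A, inv p i → A ∈ F → inv (step p A) (i + 1) := by
    rintro p i A ⟨h1, h2, h3, h4, h5, h6⟩ hA
    obtain ⟨c1, c2, c3, c4, c5, c6⟩ := hc p h3
    obtain ⟨⟨f1, f2, f3⟩, g1, g2, g3⟩ := hFN A hA
    refine ⟨(h1.append c1).append f1, (h2.append c2).append g1, ?_, ?_, ?_, ?_⟩
    · have ku := phi_mem (p.1 ++ (c p).1).reverse hk
      have lv := phi_mem (p.2 ++ (c p).2).reverse hl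
      have e1 : sg (step p A).1 (step p A).2 = sg (p.1 ++ (c p).1) (p.2 ++ (c p).2) +
          2 * Real.log (gg (phi (p.1 ++ (c p).1).reverse k) A.1) -
          2 * Real.log (gg (phi (p.2 ++ (c p).2).reverse l) A.2) := by
        simp only [hsg, hstep]
        rw [gg_append hk.1 _ A.1, gg_append hl.1 _ A.2, Real.log_mul (gg_pos hk.1 _).ne'
          (gg_pos ku.1 _).ne', Real.log_mul (gg_pos hl.1 _).ne' (gg_pos lv.1 _).ne']
        ring
      have hlog : ∀ {x : ℝ} {u : List ℕ}, x ∈ Icc (0 : ℝ) 1 → R ^ N ≤ qd u → qd u ≤ C * R ^ N →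
          Real.log (R ^ N) ≤ Real.log (gg x u) ∧
            Real.log (gg x u) ≤ Real.log (2 * C) + Real.log (R ^ N) := fun {x u} hx hu hu' => by
        refine ⟨Real.log_le_log (by linarith) (hu.trans (qd_le_gg hx.1 u)), ?_⟩
        rw [← Real.log_mul (by positivity) (by positivity)]
        exact Real.log_le_log (gg_pos hx.1 u) (by linarith [gg_le hx.2 u])
      have l1 := hlog ku f2 f3
      have l2 := hlog lv g2 g3
      rw [abs_le] at c6
      rw [e1, abs_le]
      have := abs_nonneg σ
      constructor <;> linarith [l1.1, l1.2, l2.1, l2.2, c6.1, c6.2]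
    · calc qd (p.1 ++ (c p).1 ++ A.1) ≤ 2 * (2 * (qd p.1 * qd (c p).1) * qd A.1) := by
            refine (qd_append_le _ _).trans ?_
            have := qd_append_le p.1 (c p).1
            have := qd_pos A.1
            gcongr
        _ ≤ 2 * (2 * ((D * R ^ N) ^ i * K) * (C * R ^ N)) := by
            have := qd_pos A.1
            have := qd_pos p.1
            have := qd_pos (c p).1
            gcongr
        _ = _ := by simp only [D]; ring
    · simp only [hstep, List.length_append]; have := hnil f2; omega
    · simp only [hstep, List.length_append]; have := hnil g2; omega
  set node : (ℕ → Fin F.card) → ℕ → List ℕ × List ℕ := fun ω i =>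
    Nat.rec ([], []) (fun i p => step p (e (ω i))) i with hnode
  have hnode_succ : ∀ ω i, node ω (i + 1) = step (node ω i) (e (ω i)) := fun ω i => rfl
  have hnode_inv : ∀ ω i, inv (node ω i) i := fun ω i => by
    induction i with
    | zero =>
      refine ⟨Conc.nil _, Conc.nil _, ?_, by simp [hnode], by simp, by simp⟩
      simp [hnode, hsg, gg, hS]; linarith
    | succ i ih => rw [hnode_succ]; exact hinvs _ _ _ ih (e (ω i)).2
  have hX : ∀ ω, ∃ f : ℕ → ℕ, ∀ i, pre f (node ω i).1.length = (node ω i).1 := fun ω =>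
    exists_stream (fun i => by rw [hnode_succ]; simp only [hstep, List.append_assoc, List.prefix_append])
      fun i => (hnode_inv ω i).2.2.2.2.1
  have hY : ∀ ω, ∃ f : ℕ → ℕ, ∀ i, pre f (node ω i).2.length = (node ω i).2 := fun ω =>
    exists_stream (fun i => by rw [hnode_succ]; simp only [hstep, List.append_assoc, List.prefix_append])
      fun i => (hnode_inv ω i).2.2.2.2.2
  choose X hX using hX
  choose Y hY using hY
  have hev : ∀ u : List ℕ, Conc B u → Even u.length := fun u hu =>
    hu.even_length fun b hb => by rwa [hB b hb]
  have hev' : ∀ u : List ℕ, Conc ↑(B.image List.reverse) u → Even u.length := fun u hu =>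
    hu.even_length fun b hb => by
      obtain ⟨c, hc, rfl⟩ := Finset.mem_image.1 (Finset.mem_coe.1 hb)
      rwa [List.length_reverse, hB c hc]
  refine le_dimH_of_tree hM (fun ω => PP k l (r * Real.exp σ) (cf (X ω)) (cf (Y ω)))
    (c := 1 / R ^ (2 * N) / (4 * K) ^ 2) (r := 1 / (D * R ^ N) ^ 2) (by positivity)
    (by positivity) ?_ ?_ (by positivity) ?_
  · intro ω
    refine hE _ (mem_KS_of_conc hn hB fun i => ?_) _ (mem_KS_of_conc hn ?_ fun i => ?_)
    · exact ⟨_, (hnode_inv ω i).2.2.2.2.1, by rw [hX]; exact (hnode_inv ω i).1⟩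
    · intro b hb
      obtain ⟨c, hc, rfl⟩ := Finset.mem_image.1 hb
      rw [List.length_reverse, hB c hc]
    · exact ⟨_, (hnode_inv ω i).2.2.2.2.2, by rw [hY]; exact (hnode_inv ω i).2.1⟩
  · intro ω ω' i hi hne
    have hnn : node ω' i = node ω i := by
      clear hne
      induction i with
      | zero => rfl
      | succ i ih => rw [hnode_succ, hnode_succ, ih fun j hj => hi j (by omega), hi i (by omega)]
    obtain ⟨h1, h2, h3, h4, -, -⟩ := hnode_inv ω i
    obtain ⟨c1, c2, c3, c4, c5, c6⟩ := hc _ h3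
    obtain ⟨x, hx, ex⟩ := cf_pre (hX ω (i + 1))
    obtain ⟨y, hy, ey⟩ := cf_pre (hY ω (i + 1))
    obtain ⟨x', hx', ex'⟩ := cf_pre (hX ω' (i + 1))
    obtain ⟨y', hy', ey'⟩ := cf_pre (hY ω' (i + 1))
    rw [hnode_succ] at ex ey ex' ey'
    rw [hnn] at ex' ey'
    simp only [hstep, phi_append _ (e _).1.1, phi_append _ (e _).1.2] at ex ey ex' ey'
    set P := node ω i
    set u := P.1 ++ (c P).1
    set v := P.2 ++ (c P).2
    rw [ex, ey, ex', ey', PP_phi_sub hk.1 hl.1 (hev u (h1.append c1)) (hev' v (h2.append c2))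
      (phi_mem _ hx).1 (phi_mem _ hy).1 (phi_mem _ hx').1 (phi_mem _ hy').1, abs_div,
      abs_of_pos (pow_pos (gg_pos hk.1 u) 2)]
    have hgu := gg_pos hk.1 u
    have hgv := gg_pos hl.1 v
    have hrat : r * Real.exp σ * (gg k u / gg l v) ^ 2 =
        r * z * Real.exp (sg u v - Real.log z) := by
      have hlog : ∀ x : ℝ, 0 < x → Real.exp (2 * Real.log x) = x ^ 2 := fun x hx => by
        rw [two_mul, Real.exp_add, Real.exp_log hx, sq]
      have hz0 : 0 < z := by linarith [hz.1]
      simp only [hsg]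
      rw [Real.exp_sub, Real.exp_log hz0, Real.exp_sub, Real.exp_add, hlog _ hgu, hlog _ hgv]
      field_simp
    rw [hrat, le_div_iff₀ (by positivity)]
    refine le_trans ?_ (hFsep _ (phi_mem _ hk) _ (phi_mem _ hl) _ c4 c5 c6 _ (e (ω i)).2 _
      (e (ω' i)).2 ?_ x hx y hy x' hx' y' hy')
    · have hgle : gg k u ≤ 4 * K * (D * R ^ N) ^ i := by
        refine (gg_le hk.2 u).trans ?_
        have := mul_le_mul h4 c3 (qd_pos _).le (by positivity)
        have := qd_append_le P.1 (c P).1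
        linarith
      calc 1 / R ^ (2 * N) / (4 * K) ^ 2 * (1 / (D * R ^ N) ^ 2) ^ i * gg k u ^ 2
          ≤ 1 / R ^ (2 * N) / (4 * K) ^ 2 * (1 / (D * R ^ N) ^ 2) ^ i *
            (4 * K * (D * R ^ N) ^ i) ^ 2 := by gcongr
        _ = 1 / R ^ (2 * N) := by rw [div_pow, one_pow, ← pow_mul, mul_pow _ (_ ^ i), ← pow_mul, mul_comm i]; field_simp
        _ ≤ _ := le_rfl
    · intro h
      exact hne (e.injective (Subtype.ext h))
  · have hM0 : (0 : ℝ) < F.card := by positivity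
    rw [← Real.log_nonneg_iff (by positivity), Real.log_mul (by positivity) (by positivity),
      Real.log_rpow (by positivity), Real.log_div one_ne_zero (by positivity), Real.log_one,
      Real.log_pow, Real.log_mul (by positivity) (by positivity), Real.log_pow]
    push_cast
    linarith

/-- The sequences whose aligned blocks of length `n` all belong to `V`. -/
def AL (V : Finset (List ℕ)) (n : ℕ) : Set (ℤ → ℕ) := {θ | ∀ j : ℤ, block θ (n * j) n ∈ V}

lemma exists_chunks (θ : ℤ → ℕ) (n : ℕ) : ∀ (k : ℕ) (i : ℤ), ∃ l : List (List ℕ), l.length = k ∧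
    (∀ b ∈ l, ∃ j, block θ j n = b) ∧ l.flatten = block θ i (k * n)
  | 0, _ => ⟨[], by simp [block, pre]⟩
  | k + 1, i => by
    obtain ⟨l, h1, h2, h3⟩ := exists_chunks θ n k (i + n)
    refine ⟨block θ i n :: l, by simp [h1], ?_, ?_⟩
    · rintro b (_ | ⟨_, hb⟩)
      exacts [⟨i, rfl⟩, h2 b hb]
    · rw [List.flatten_cons, h3, ← block_add]; congr 1; ring

lemma exists_log_Zs_growth {t s s' : ℝ} (hs : 0 ≤ s) (h : s < s') (hnt : ¬Subcrit t s') :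
    ∃ L > 0, Tendsto (fun n : ℕ => Real.log (Zs t n s) / n) atTop (𝓝 L) ∧
      ∀ n : ℕ, Real.exp (n * L) ≤ Zs t n s := by
  have h1 : ∀ n : ℕ, 1 ≤ n → (2 : ℝ) ^ (((n : ℝ) - 1) * (s' - s)) ≤ Zs t n s := fun n hn => by
    have h2 : 1 ≤ Zs t n s' := by by_contra! hc; exact hnt ⟨n, hn, hc⟩
    refine (le_mul_of_one_le_right (by positivity) h2).trans ?_
    rw [Zs, Zs, Finset.mul_sum]
    refine Finset.sum_le_sum fun w hw => ?_
    have h3 : (2 : ℝ) ^ (((n : ℝ) - 1) / 2) ≤ qd w := by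
      refine le_trans ?_ (two_pow_le_qd w)
      rw [← Real.rpow_natCast, LangF_length hw]
      refine Real.rpow_le_rpow_of_exponent_le one_le_two ?_
      have : n ≤ 2 * (n / 2) + 1 := by omega
      have : (n : ℝ) ≤ 2 * (n / 2 : ℕ) + 1 := by exact_mod_cast this
      linarith
    calc _ = ((2 : ℝ) ^ (((n : ℝ) - 1) / 2)) ^ (2 * (s' - s)) * qd w ^ (-2 * s') := by
          rw [← Real.rpow_mul two_pos.le]; ring_nf
      _ ≤ qd w ^ (2 * (s' - s)) * qd w ^ (-2 * s') := by
          have := Real.rpow_pos_of_pos (qd_pos w) (-2 * s')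
          gcongr
      _ = _ := by rw [← Real.rpow_add (qd_pos w)]; ring_nf
  have hge : ∀ n, 1 ≤ Zs t n s := fun n => by
    rcases Nat.eq_zero_or_pos n with rfl | hn
    · have h2 := Zs_add_le t 0 1 hs
      have h3 := h1 1 le_rfl
      simp only [Nat.cast_one, sub_self, zero_mul, Real.rpow_zero, zero_add] at h2 h3
      nlinarith
    · refine le_trans (Real.one_le_rpow one_le_two ?_) (h1 n hn)
      have : (1 : ℝ) ≤ n := by exact_mod_cast hn
      exact mul_nonneg (by linarith) (by linarith)
  have hsub : Subadditive fun n => Real.log (Zs t n s) := fun m n => by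
    have := hge m; have := hge n; have := hge (m + n)
    rw [← Real.log_mul (by positivity) (by positivity)]
    exact Real.log_le_log (by positivity) (Zs_add_le t m n hs)
  have hbdd : BddBelow (range fun n : ℕ => Real.log (Zs t n s) / n) :=
    ⟨0, by rintro _ ⟨n, rfl⟩; exact div_nonneg (Real.log_nonneg (hge n)) n.cast_nonneg⟩
  have hlim := hsub.tendsto_lim hbdd
  have h2 := Real.log_pos one_lt_two
  refine ⟨hsub.lim, lt_of_lt_of_le (b := (s' - s) * Real.log 2 / 2) (by
    have : 0 < s' - s := by linarith
    positivity) (ge_of_tendsto hlim ?_), hlim, fun n => ?_⟩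
  · filter_upwards [eventually_ge_atTop 2] with n hn
    have hn' : (2 : ℝ) ≤ n := by exact_mod_cast hn
    have h3 := Real.log_le_log (by positivity) (h1 n (by omega))
    rw [Real.log_rpow two_pos] at h3
    rw [le_div_iff₀ (by linarith)]
    refine le_trans ?_ h3
    nlinarith [mul_pos (show 0 < s' - s by linarith) h2]
  · rcases Nat.eq_zero_or_pos n with rfl | hn
    · simpa using hge 0
    rw [← Real.le_log_iff_exp_le (by linarith [hge n]), mul_comm,
      ← le_div_iff₀ (by exact_mod_cast hn)]
    exact hsub.lim_le_div hbdd hn.ne'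

lemma eventually_sep (T : ℕ) :
    ∀ᶠ n : ℕ in atTop, ∀ w : List ℕ, w.length = n → 2 ≤ sepC T * qd w ^ 2 := by
  have h1 : Tendsto (fun n : ℕ => (2 : ℝ) ^ (n / 2)) atTop atTop :=
    (tendsto_pow_atTop_atTop_of_one_lt one_lt_two).comp
      (Nat.tendsto_div_const_atTop two_ne_zero)
  filter_upwards [h1.eventually_ge_atTop (max 1 (2 / sepC T))] with n hn w hw
  have h2 := hn.trans (hw ▸ two_pow_le_qd w)
  have h3 := (le_max_right _ _).trans h2
  have h4 := (le_max_left _ _).trans h2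
  rw [div_le_iff₀ (sepC_pos T)] at h3
  nlinarith [sepC_pos T]

theorem exists_subsystem {t s s' : ℝ} (hs : 0 < s) (h : s < s') (hnt : ¬Subcrit t s') :
    ∃ T n : ℕ, ∃ V : Finset (List ℕ), n ≠ 0 ∧ (∀ v ∈ V, v.length = n) ∧ (∀ v ∈ V, ∀ a ∈ v, a < T) ∧
      1 < ∑ v ∈ V, wt s v ∧ ∃ δ > 0, ∀ θ ∈ AL V n, (∀ i, θ i < T) → ∀ i, lam θ i ≤ t - δ := by
  classical
  obtain ⟨L, hL, hlim, hge⟩ := exists_log_Zs_growth hs.le h hnt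
  have hwt : ∀ w : List ℕ, wt s w = 4 ^ (-s) * qd w ^ (-2 * s) := fun w => by
    rw [wt, Real.mul_rpow two_pos.le (qd_pos w).le, show -2 * s = 2 * -s by ring,
      Real.rpow_mul two_pos.le]
    norm_num
  have hsum : ∀ n, ∑ w ∈ LangF t n, wt s w = 4 ^ (-s) * Zs t n s := fun n => by
    simp_rw [hwt]; rw [Zs, Finset.mul_sum]
  have hnL : Tendsto (fun n : ℕ => (n : ℝ) * L) atTop atTop :=
    tendsto_natCast_atTop_atTop.atTop_mul_const hL
  obtain ⟨n, hn1, hnQ, hnu, hn3, hn4⟩ := ((eventually_ge_atTop 1).and ((eventually_sep ⌈t⌉₊).and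
    ((hlim.eventually_le_const (show L < 31 / 30 * L by linarith)).and
    (((Real.tendsto_exp_atTop.comp hnL).eventually_ge_atTop (12 ^ 16 * 4 ^ s)).and
    (hnL.eventually_ge_atTop (2 * (s * Real.log 4))))))).exists
  rw [div_le_iff₀ (by positivity)] at hnu
  have hZ0 : 0 < Zs t n s := (Real.exp_pos _).trans_le (hge n)
  have hch : ∀ K : ℕ, ∀ w ∈ LangF t (16 * K * n), ∃ l : List (List ℕ), l.length = 16 * K ∧
      (∀ b ∈ l, b ∈ LangF t n) ∧ l.flatten = w := fun K w hw => by
    obtain ⟨θ, hθ, i, rfl⟩ := mem_LangF.1 hw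
    obtain ⟨l, h1, h2, h3⟩ := exists_chunks θ n (16 * K) i
    exact ⟨l, h1, fun b hb => mem_LangF.2 ⟨θ, hθ, h2 b hb⟩, h3⟩
  choose! c hc1 hc2 hc3 using hch
  have hmain := main_step (T := ⌈t⌉₊) (n := n) (𝓑 := LangF t n)
    (fun b hb => LangF_length hb) (fun b hb => LangF_lt hb) (fun b hb => hnQ b (LangF_length hb))
    (s := s) (t := t) hs.le (fun K => (LangF t (16 * K * n)).image (c K)) ?_ ?_ ?_
  · obtain ⟨l, hl, V, hV, hVs, δ, hδ, hδ'⟩ := hmain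
    refine ⟨⌈t⌉₊, l * n, V, by positivity, fun v hv => ?_, fun v hv => ?_, hVs, δ, hδ,
      fun θ h1 h2 => hδ' θ h2 h1⟩ <;> obtain ⟨w, h1, rfl, rfl⟩ := hV v hv
    · exact flatten_length fun b hb => LangF_length (h1 b hb)
    · intro a ha
      obtain ⟨b, hb, ha⟩ := List.mem_flatten.1 ha
      exact LangF_lt (h1 b hb) a ha
  · intro K w hw
    obtain ⟨v, hv, rfl⟩ := Finset.mem_image.1 hw
    refine ⟨hc1 K v hv, hc2 K v hv, ?_⟩
    rw [hc3 K v hv]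
    obtain ⟨θ, hθ, i, rfl⟩ := mem_LangF.1 hv
    exact ⟨θ, fun i => lt_ceil_of_lam_le (hθ i), hθ, i, _, rfl⟩
  · rw [hsum, Real.rpow_neg (by norm_num), ← div_eq_inv_mul, le_div_iff₀ (by positivity)]
    exact hn3.trans (hge n)
  · intro K
    have hlw : ∀ l : List (List ℕ), (4 : ℝ) ^ (-s * l.length) * qd l.flatten ^ (-2 * s) ≤
        lw (wt s) l := fun l => by
      induction l with
      | nil => simp
      | cons b l ih =>
        rw [lw_cons, hwt, List.flatten_cons, List.length_cons, Nat.cast_succ, mul_add_one,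
          Real.rpow_add (by norm_num)]
        have h1 : qd (b ++ l.flatten) ^ (-2 * s) ≤ qd b ^ (-2 * s) * qd l.flatten ^ (-2 * s) := by
          rw [← Real.mul_rpow (qd_pos b).le (qd_pos _).le]
          exact Real.rpow_le_rpow_of_nonpos (mul_pos (qd_pos b) (qd_pos _)) (qd_mul_le _ _)
            (by linarith)
        have h2 := Real.rpow_pos_of_pos (qd_pos b) (-2 * s)
        calc _ ≤ (4 : ℝ) ^ (-s * l.length) * 4 ^ (-s) *
              (qd b ^ (-2 * s) * qd l.flatten ^ (-2 * s)) := by gcongr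
          _ = (4 : ℝ) ^ (-s) * qd b ^ (-2 * s) *
              (4 ^ (-s * l.length) * qd l.flatten ^ (-2 * s)) := by ring
          _ ≤ _ := by gcongr
    have h1 : (4 : ℝ) ^ (-s * (16 * K : ℕ)) * Zs t (16 * K * n) s ≤
        ∑ w ∈ (LangF t (16 * K * n)).image (c K), lw (wt s) w := by
      rw [Finset.sum_image fun u hu v hv huv => by rw [← hc3 K u hu, ← hc3 K v hv, huv], Zs,
        Finset.mul_sum]
      refine Finset.sum_le_sum fun w hw => ?_
      have := hlw (c K w)
      rwa [hc1 K w hw, hc3 K w hw] at this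
    refine le_trans ?_ h1
    refine le_trans ?_ (mul_le_mul_of_nonneg_left (hge _) (by positivity))
    rw [hsum, ← Real.exp_log hZ0, Real.rpow_def_of_pos (by norm_num),
      Real.rpow_def_of_pos (by norm_num), ← Real.exp_add, ← Real.exp_add, ← Real.exp_nat_mul,
      Real.exp_le_exp]
    push_cast
    have hK : (0 : ℝ) ≤ K := K.cast_nonneg
    nlinarith [mul_le_mul_of_nonneg_left hnu hK, mul_le_mul_of_nonneg_left hn4 hK]

/-- The sequence whose aligned blocks of length `n` are the words `W j`. -/
def bld (n : ℕ) (W : ℤ → List ℕ) : ℤ → ℕ := fun x => (W (x / n)).getD (x % n).toNat 0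

lemma block_bld {n : ℕ} {W : ℤ → List ℕ} {j : ℤ} (h : (W j).length = n) :
    block (bld n W) (n * j) n = W j := by
  refine List.ext_getElem (by simp [h]) fun k h1 h2 => ?_
  have hk : k < n := by simpa using h1
  have h3 : ((n : ℤ) * j + k) / n = j := by
    rw [Int.mul_add_ediv_left _ _ (by omega), Int.ediv_eq_zero_of_lt (by omega) (by omega), add_zero]
  have h4 : ((n : ℤ) * j + k) % n = k := by
    rw [Int.mul_add_emod_self_left, Int.emod_eq_of_lt (by omega) (by omega)]
  rw [block_getElem]
  simp only [bld, h3, h4, Int.toNat_natCast]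
  exact List.getD_eq_getElem _ _ h2

lemma block_eq_flatten_iff {θ : ℤ → ℕ} {n : ℕ} : ∀ {l : List (List ℕ)} {p : ℤ},
    (∀ b ∈ l, b.length = n) → (block θ p (l.length * n) = l.flatten ↔
      ∀ i, (h : i < l.length) → block θ (p + n * i) n = l[i])
  | [], p, _ => by simp [block, pre]
  | b :: l, p, hl => by
    rw [show (b :: l).length * n = n + l.length * n by rw [List.length_cons]; ring, block_add,
      List.flatten_cons]
    have ih := block_eq_flatten_iff (θ := θ) (p := p + n) fun c hc => hl c (List.mem_cons_of_mem _ hc)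
    constructor
    · intro h
      obtain ⟨h1, h2⟩ := List.append_inj h (by simp [hl b List.mem_cons_self])
      rintro (_ | i) hi
      · simpa using h1
      · have := ih.1 h2 i (by simpa using hi)
        rw [List.getElem_cons_succ, ← this]; congr 1; push_cast; ring
    · intro h
      have h1 : block θ p n = b := by have := h 0 (by simp); rwa [Nat.cast_zero, mul_zero, add_zero] at this
      rw [h1, ih.2 fun i hi => ?_]
      rw [← List.getElem_cons_succ b l i (by simpa using hi), ← h (i + 1) (by simpa using hi)]
      congr 1; push_cast; ring

lemma lt_of_mem_AL {V : Finset (List ℕ)} {n T : ℕ} (hn : n ≠ 0) (hT : ∀ v ∈ V, ∀ a ∈ v, a < T)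
    {θ : ℤ → ℕ} (h : θ ∈ AL V n) (i : ℤ) : θ i < T := by
  refine hT _ (h (i / n)) _ (mem_block.2 ⟨(i % n).toNat, ?_, ?_⟩)
  · have := Int.emod_lt_of_pos i (show (0 : ℤ) < n by omega); omega
  · rw [Int.toNat_of_nonneg (Int.emod_nonneg _ (by omega)), Int.mul_ediv_add_emod]

lemma mem_of_block_flatten {θ : ℤ → ℕ} {n l : ℕ} {B : Finset (List ℕ)}
    (hB : ∀ b ∈ B, b.length = n) (hl : 1 ≤ l) {j : ℤ} {w : List (List ℕ)} (hw : ∀ b ∈ w, b ∈ B)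
    (hwl : w.length = l) (h : block θ ((l * n : ℕ) * (j / l)) (l * n) = w.flatten) :
    block θ (n * j) n ∈ B := by
  subst hwl
  have h0 := Int.emod_nonneg j (show (w.length : ℤ) ≠ 0 by omega)
  have h1 := Int.emod_lt_of_pos j (show (0 : ℤ) < w.length by omega)
  have h2 := (block_eq_flatten_iff fun b hb => hB b (hw b hb)).1 h (j % w.length).toNat (by omega)
  have h3 : ((w.length * n : ℕ) : ℤ) * (j / w.length) + n * ((j % w.length).toNat : ℕ) = n * j := by
    rw [Int.toNat_of_nonneg h0]
    nth_rw 3 [← Int.mul_ediv_add_emod j w.length]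
    push_cast; ring
  rw [← h3, h2]
  exact hw _ (List.getElem_mem _)

lemma AL_flatten_subset {n l : ℕ} {B V : Finset (List ℕ)} (hB : ∀ b ∈ B, b.length = n)
    (hl : 1 ≤ l)
    (hV : ∀ v ∈ V, ∃ w : List (List ℕ), (∀ b ∈ w, b ∈ B) ∧ w.length = l ∧ w.flatten = v) :
    AL V (l * n) ⊆ AL B n := fun θ h j => by
  obtain ⟨w, h1, h2, h3⟩ := hV _ (h (j / l))
  exact mem_of_block_flatten hB hl h1 h2 h3.symm

theorem exists_two_level {t s s' : ℝ} (hs : 0 < s) (h : s < s') (hnt : ¬Subcrit t s') :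
    ∃ T n : ℕ, ∃ V : Finset (List ℕ), n ≠ 0 ∧ Even n ∧ (∀ v ∈ V, v.length = n) ∧
      (∀ v ∈ V, ∀ a ∈ v, a < T) ∧ 1 < ∑ v ∈ V, wt s v ∧ ∃ (𝒜 : Set (ℤ → ℕ)) (m : ℝ), m < t ∧
      (∀ θ ∈ 𝒜, (∀ i, θ i < T) ∧ ∀ i, lam θ i ≤ m) ∧
      (∀ ε > 0, ∃ θ ∈ 𝒜, ∃ i, m - ε < lam θ i) ∧
      (∀ θ₀ ∈ 𝒜, ∀ (P : ℤ) (θ : ℤ → ℕ), (∀ j, -P ≤ j → j < P → block θ (n * j) n = block θ₀ (n * j) n) →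
        (∀ j, j < -P ∨ P ≤ j → block θ (n * j) n ∈ V) → θ ∈ 𝒜) ∧
      ∃ δ > 0, ∀ θ ∈ AL V n, ∀ i, lam θ i ≤ m - δ := by
  classical
  obtain ⟨T, n, V, hn, hVl, hVT, hVs, δ, hδ, hV⟩ := exists_subsystem hs h hnt
  have h2k : Tendsto (fun k : ℕ => 2 * k * n) atTop atTop :=
    (tendsto_id.const_mul_atTop' two_pos).atTop_mul_const' (Nat.pos_of_ne_zero hn)
  obtain ⟨k, hk1, hkZ, hkQ⟩ := ((eventually_ge_atTop 1).and
    (((tendsto_pow_atTop_atTop_of_one_lt (one_lt_pow₀ hVs two_ne_zero)).eventually_ge_atTop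
      (12 ^ 16)).and (h2k.eventually (eventually_sep T)))).exists
  rw [← pow_mul] at hkZ
  set r := 2 * k
  set B := (pows V r).image List.flatten with hBdef
  have hBw : ∀ b ∈ B, ∃ w : List (List ℕ), (∀ c ∈ w, c ∈ V) ∧ w.length = r ∧ w.flatten = b :=
    fun b hb => by
      obtain ⟨w, hw, rfl⟩ := Finset.mem_image.1 hb
      exact ⟨w, (mem_pows.1 hw).2, (mem_pows.1 hw).1, rfl⟩
  have hBl : ∀ b ∈ B, b.length = r * n := fun b hb => by
    obtain ⟨w, h1, h2, rfl⟩ := hBw b hb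
    rw [← h2]
    exact flatten_length fun c hc => hVl c (h1 c hc)
  have hBT : ∀ b ∈ B, ∀ a ∈ b, a < T := fun b hb a ha => by
    obtain ⟨w, h1, -, rfl⟩ := hBw b hb
    obtain ⟨c, hc, ha⟩ := List.mem_flatten.1 ha
    exact hVT c (h1 c hc) a ha
  have hr0 : r ≠ 0 := by omega
  have hrn : r * n ≠ 0 := mul_ne_zero hr0 hn
  have hBZ : 12 ^ 16 ≤ ∑ b ∈ B, wt s b := by
    rw [hBdef, Finset.sum_image fun u hu v hv huv => by
      rw [Finset.mem_coe, mem_pows] at hu hv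
      exact flatten_inj_of_length (fun b hb => hVl b (hu.2 b hb)) (fun b hb => hVl b (hv.2 b hb))
        (hu.1.trans hv.1.symm) huv]
    refine hkZ.trans ?_
    rw [← sum_pows]
    refine Finset.sum_le_sum fun l hl => lw_wt_le hs.le ?_
    rintro rfl
    exact hr0 (by simpa using (mem_pows.1 hl).1.symm)
  have hsub := AL_flatten_subset hVl (by omega) hBw
  have hub : ∀ θ ∈ AL B (r * n), ∀ i, lam θ i ≤ t - δ := fun θ hθ =>
    hV θ (hsub hθ) (lt_of_mem_AL hn hVT (hsub hθ))
  obtain ⟨b₀, hb₀⟩ : B.Nonempty := by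
    by_contra! hc
    rw [hc, Finset.sum_empty] at hBZ
    norm_num at hBZ
  have hbld : ∀ W : ℤ → List ℕ, (∀ j, W j ∈ B) → bld (r * n) W ∈ AL B (r * n) := fun W hW j => by
    rw [block_bld (hBl _ (hW j))]; exact hW j
  set S := {x | ∃ θ ∈ AL B (r * n), ∃ i, lam θ i = x}
  have hSb : BddAbove S := ⟨t - δ, by rintro _ ⟨θ, hθ, i, rfl⟩; exact hub θ hθ i⟩
  have hS0 : S.Nonempty := ⟨_, _, hbld (fun _ => b₀) fun _ => hb₀, 0, rfl⟩
  have hle : ∀ θ ∈ AL B (r * n), ∀ i, lam θ i ≤ sSup S := fun θ hθ i => le_csSup hSb ⟨θ, hθ, i, rfl⟩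
  have hm := main_step (T := T) (n := r * n) hBl hBT (fun b hb => hkQ b (hBl b hb)) (t := sSup S)
    hs.le (fun K => pows B (16 * K)) ?_ hBZ fun K => ?_
  · obtain ⟨l, hl, V', hV', hVs', δ', hδ', hlam⟩ := hm
    have hVl' : ∀ v ∈ V', v.length = l * (r * n) := fun v hv => by
      obtain ⟨w, h1, rfl, rfl⟩ := hV' v hv
      exact flatten_length fun b hb => hBl b (h1 b hb)
    have hVT' : ∀ v ∈ V', ∀ a ∈ v, a < T := fun v hv a ha => by
      obtain ⟨w, h1, -, rfl⟩ := hV' v hv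
      obtain ⟨b, hb, ha⟩ := List.mem_flatten.1 ha
      exact hBT b (h1 b hb) a ha
    refine ⟨T, l * (r * n), V', by positivity, ⟨l * (k * n), by ring⟩, hVl', hVT', hVs',
      AL B (r * n), sSup S, ?_, fun θ hθ => ⟨lt_of_mem_AL hrn hBT hθ, hle θ hθ⟩, fun ε hε => ?_,
      fun θ₀ h0 P θ h1 h2 j => ?_, δ', hδ', fun θ hθ => hlam θ ?_ hθ⟩
    · exact (csSup_le hS0 (by rintro _ ⟨θ, hθ, i, rfl⟩; exact hub θ hθ i)).trans_lt (by linarith)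
    · obtain ⟨_, ⟨θ, hθ, i, rfl⟩, hi⟩ := exists_lt_of_lt_csSup hS0 (show sSup S - ε < sSup S by linarith)
      exact ⟨θ, hθ, i, hi⟩
    · by_cases hj : -P ≤ j / l ∧ j / l < P
      · have h3 := h1 _ hj.1 hj.2
        obtain ⟨w, hw1, hw2, hw3⟩ : ∃ w : List (List ℕ), w.length = l ∧
            (∀ b ∈ w, b.length = r * n ∧ ∃ p, block θ₀ ((r * n : ℕ) * p) (r * n) = b) ∧
            w.flatten = block θ₀ ((l * (r * n) : ℕ) * (j / l)) (l * (r * n)) := by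
          refine ⟨(List.range l).map fun i : ℕ => block θ₀ ((r * n : ℕ) * (l * (j / l) + i)) (r * n),
            by simp, fun b hb => ?_, ?_⟩
          · obtain ⟨i, -, rfl⟩ := List.mem_map.1 hb
            exact ⟨by simp, _, rfl⟩
          · have := (block_eq_flatten_iff (θ := θ₀) (n := r * n) (p := (l * (r * n) : ℕ) * (j / l))
              (l := (List.range l).map fun i : ℕ => block θ₀ ((r * n : ℕ) * (l * (j / l) + i)) (r * n))
              (by simp)).2 (fun i hi => by simp; congr 1; ring)
            rw [← this]; simp
        refine mem_of_block_flatten hBl hl (w := w) (fun b hb => ?_) hw1 (by rw [h3, hw3])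
        obtain ⟨-, p, rfl⟩ := hw2 b hb
        exact h0 p
      · obtain ⟨w, hw1, hw2, hw3⟩ := hV' _ (h2 (j / l) (by omega))
        exact mem_of_block_flatten hBl hl hw1 hw2 hw3.symm
    · exact lt_of_mem_AL (by positivity) hVT' hθ
  · intro K w hw
    obtain ⟨h1, h2⟩ := mem_pows.1 hw
    have h3 : ∀ j : ℤ, w.getD j.toNat b₀ ∈ B := fun j => by
      rcases lt_or_ge j.toNat w.length with hj | hj
      · rw [List.getD_eq_getElem _ _ hj]; exact h2 _ (List.getElem_mem _)
      · rw [List.getD_eq_default _ _ hj]; exact hb₀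
    have h4 := hbld (fun j => w.getD j.toNat b₀) h3
    refine ⟨h1, h2, _, lt_of_mem_AL hrn hBT h4, hle _ h4, 0, w.length * (r * n),
      (block_eq_flatten_iff fun b hb => hBl b (h2 b hb)).2 fun i hi => ?_⟩
    rw [zero_add, block_bld (hBl _ (h3 i)), Int.toNat_natCast, List.getD_eq_getElem _ _ hi]
  · rw [sum_pows]
    exact pow_le_pow_right₀ (le_trans (by norm_num) hBZ) (by omega)

lemma exists_lam_local {ε : ℝ} (hε : 0 < ε) : ∃ ρ : ℕ, ∀ (θ θ' : ℤ → ℕ) (i i' : ℤ),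
    (∀ x : ℤ, |x| ≤ ρ → θ (i + x) = θ' (i' + x)) → lam θ i ≤ lam θ' i' + ε := by
  obtain ⟨ρ, h⟩ := (tendsto_one_div_four_pow.eventually_le_const (half_pos hε)).exists
  refine ⟨ρ, fun θ θ' i i' h1 => ?_⟩
  have h2 := (le_abs_self _).trans (abs_lam_sub_le h1)
  rw [← mul_one_div] at h2
  linarith

lemma eq_of_block {n : ℕ} (hn : n ≠ 0) {θ θ' : ℤ → ℕ} {x : ℤ}
    (h : block θ (n * (x / n)) n = block θ' (n * (x / n)) n) : θ x = θ' x := by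
  have h0 := Int.emod_nonneg x (show (n : ℤ) ≠ 0 by omega)
  have h1 := Int.emod_lt_of_pos x (show (0 : ℤ) < n by omega)
  have := block_eq_iff.1 h (x % n).toNat (by omega)
  rwa [Int.toNat_of_nonneg h0, Int.mul_ediv_add_emod] at this

lemma abs_ediv_add_sub_le {n : ℕ} (hn : n ≠ 0) (i x : ℤ) : |(i + x) / n - i / n| ≤ |x| := by
  have hn' : (0 : ℤ) < n := by omega
  have h1 : i / n - |x| ≤ (i + x) / n := by
    rw [Int.le_ediv_iff_mul_le hn', sub_mul]
    nlinarith [Int.ediv_mul_le i hn'.ne', neg_abs_le x, abs_nonneg x]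
  have h2 : (i + x) / n < i / n + |x| + 1 := by
    rw [Int.ediv_lt_iff_lt_mul hn']
    nlinarith [Int.lt_ediv_add_one_mul_self i hn', le_abs_self x, abs_nonneg x]
  rw [abs_le]; constructor <;> linarith

lemma exists_lam_near {V : Finset (List ℕ)} {n : ℕ} {c ε : ℝ} (hn : n ≠ 0)
    (hV : ∀ θ ∈ AL V n, ∀ i, lam θ i ≤ c) (hε : 0 < ε) : ∃ ρ : ℕ, ∀ (θ : ℤ → ℕ) (i : ℤ),
      (∀ j, |j - i / n| ≤ ρ → block θ (n * j) n ∈ V) → lam θ i ≤ c + ε := by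
  obtain ⟨ρ, h⟩ := exists_lam_local hε
  refine ⟨ρ, fun θ i h1 => ?_⟩
  set W : ℤ → List ℕ := fun j => block θ (n * max (i / n - ρ) (min j (i / n + ρ))) n
  have h2 : bld n W ∈ AL V n := fun j => by
    rw [block_bld (by simp [W])]
    exact h1 _ (by rw [abs_le]; omega)
  refine (h θ (bld n W) i i fun x hx => eq_of_block hn ?_).trans (by linarith [hV _ h2 i])
  have h3 := abs_le.1 ((abs_ediv_add_sub_le hn i x).trans hx)
  rw [block_bld (by simp [W])]
  simp only [W]
  congr 2
  omega

/-- Sequences that agree with `θ₀` on the central `2 P` blocks and have blocks in `V` elsewhere. -/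
def Mix (V : Finset (List ℕ)) (n : ℕ) (θ₀ : ℤ → ℕ) (P : ℤ) : Set (ℤ → ℕ) :=
  {θ | (∀ j, -P ≤ j → j < P → block θ (n * j) n = block θ₀ (n * j) n) ∧
    ∀ j, j < -P ∨ P ≤ j → block θ (n * j) n ∈ V}

lemma isClosed_block_mem (p : ℤ) (n : ℕ) (S : Set (List ℕ)) :
    IsClosed {θ : ℤ → ℕ | block θ p n ∈ S} := by
  have h : {θ : ℤ → ℕ | block θ p n ∈ S} =
      (fun (θ : ℤ → ℕ) (k : Fin n) => θ (p + k)) ⁻¹' {g | List.ofFn g ∈ S} := by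
    ext θ
    have : block θ p n = List.ofFn fun k : Fin n => θ (p + k) :=
      List.ext_getElem (by simp) fun k h1 h2 => by rw [block_getElem]; simp
    simp [this]
  rw [h]
  exact (isClosed_discrete _).preimage (by fun_prop)

lemma isClosed_Mix (V : Finset (List ℕ)) (n : ℕ) (θ₀ : ℤ → ℕ) (P : ℤ) :
    IsClosed (Mix V n θ₀ P) := by
  simp only [Mix, ofPred_and, ofPred_forall]
  refine IsClosed.inter ?_ ?_
  · exact isClosed_iInter fun j => isClosed_iInter fun _ => isClosed_iInter fun _ =>
      isClosed_block_mem _ n {_}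
  · exact isClosed_iInter fun j => isClosed_iInter fun _ => isClosed_block_mem _ n V

lemma Mix_nonempty {V : Finset (List ℕ)} {n : ℕ} (hl : ∀ v ∈ V, v.length = n) {v : List ℕ}
    (hv : v ∈ V) (θ₀ : ℤ → ℕ) (P : ℤ) : (Mix V n θ₀ P).Nonempty := by
  classical
  set W : ℤ → List ℕ := fun j => if -P ≤ j ∧ j < P then block θ₀ (n * j) n else v
  have hW : ∀ j, (W j).length = n := fun j => by simp only [W]; split_ifs <;> simp [hl v hv]
  refine ⟨bld n W, fun j h1 h2 => ?_, fun j h1 => ?_⟩ <;> rw [block_bld (hW j)]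
  · exact if_pos ⟨h1, h2⟩
  · simp only [W]; rw [if_neg (by omega)]; exact hv

/-- Some finite central pattern pins down the position of the maximal Perron value. -/
lemma exists_center {T n : ℕ} {V : Finset (List ℕ)} {𝒜 : Set (ℤ → ℕ)} {m δ : ℝ} (hn : n ≠ 0)
    (hl : ∀ v ∈ V, v.length = n) (hV0 : V.Nonempty) (h𝒜 : ∀ θ ∈ 𝒜, (∀ i, θ i < T) ∧ ∀ i, lam θ i ≤ m)
    (hm : ∀ ε > 0, ∃ θ ∈ 𝒜, ∃ i, m - ε < lam θ i) (hmix : ∀ θ₀ ∈ 𝒜, ∀ P, Mix V n θ₀ P ⊆ 𝒜)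
    (hδ : 0 < δ) (hV : ∀ θ ∈ AL V n, ∀ i, lam θ i ≤ m - δ) :
    ∃ (θ₁ : ℤ → ℕ) (M : ℕ) (i₀ : ℤ), |i₀| < M ∧ Mix V n θ₁ M ⊆ 𝒜 ∧
      ∀ θ ∈ Mix V n θ₁ M, m - δ ≤ lam θ i₀ ∧ ∀ i, lam θ i ≤ lam θ i₀ := by
  obtain ⟨θ₀, h0, i₁, hi₁⟩ := hm (δ / 4) (by linarith)
  obtain ⟨ρ₁, hρ₁⟩ := exists_lam_local (show 0 < δ / 4 by linarith)
  obtain ⟨ρ₂, hρ₂⟩ := exists_lam_near hn hV (show 0 < δ / 4 by linarith)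
  have hdiv : ∀ x P : ℤ, |x| ≤ P → -P - 1 ≤ x / n ∧ x / n ≤ P := fun x P hx => by
    have := abs_ediv_add_sub_le hn 0 x
    rw [zero_add, Int.zero_ediv, sub_zero] at this
    have := abs_le.1 (this.trans hx)
    omega
  set P : ℤ := |i₁| + ρ₁ + 1
  set X := Mix V n θ₀ P
  set J := Finset.Icc (-(n * (P + ρ₂ + 1)) : ℤ) (n * (P + ρ₂ + 1))
  have hbig : ∀ θ ∈ X, m - δ / 2 ≤ lam θ i₁ := fun θ hθ => by
    have := hρ₁ θ₀ θ i₁ i₁ fun x hx => (eq_of_block hn ?_).symm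
    · linarith
    have h1 := hdiv (i₁ + x) (P - 1) (by have := abs_add_le i₁ x; omega)
    exact hθ.1 _ (by omega) (by omega)
  have hsmall : ∀ θ ∈ X, ∀ i ∉ J, lam θ i < m - δ / 2 := fun θ hθ i hi => by
    refine (hρ₂ θ i fun j hj => hθ.2 j ?_).trans_lt (by linarith)
    by_contra! hc
    refine hi (Finset.mem_Icc.2 ?_)
    have hj' := abs_le.1 hj
    have hn' : (0 : ℤ) < n := by omega
    have h1 := Int.mul_ediv_add_emod i n
    have h2 := Int.emod_nonneg i hn'.ne'
    have h3 := Int.emod_lt_of_pos i hn'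
    constructor <;> nlinarith
  have hiJ : ∀ θ ∈ X, i₁ ∈ J := fun θ hθ => by
    by_contra hc; linarith [hbig θ hθ, hsmall θ hθ _ hc]
  have hXc : IsCompact X := (isCompact_digits T).of_isClosed_subset (isClosed_Mix _ _ _ _)
    fun θ hθ => (h𝒜 θ (hmix θ₀ h0 P hθ)).1
  obtain ⟨v, hv⟩ := hV0
  have : CompactSpace X := isCompact_iff_compactSpace.1 hXc
  have : Nonempty X := (Mix_nonempty hl hv θ₀ P).to_subtype
  obtain ⟨⟨i₀, hi₀⟩, ⟨θ₁, hθ₁⟩, hinter⟩ := nonempty_interior_of_iUnion_of_closed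
    (f := fun i : J => {θ : X | ∀ j ∈ J, lam θ j ≤ lam θ i}) (fun i => by
      simp only [ofPred_forall]
      exact isClosed_iInter fun j => isClosed_iInter fun _ => isClosed_le
        ((continuous_lam j).comp continuous_subtype_val)
        ((continuous_lam i).comp continuous_subtype_val))
    (eq_univ_of_forall fun θ => by
      obtain ⟨i, hi, hmax⟩ := J.exists_max_image (fun i => lam θ i) ⟨i₁, hiJ θ θ.2⟩
      exact mem_iUnion.2 ⟨⟨i, hi⟩, hmax⟩)
  obtain ⟨U, hU, hUX⟩ := isOpen_induced_iff.1 (isOpen_interior (s := {θ : X | ∀ j ∈ J,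
    lam θ j ≤ lam θ i₀}))
  obtain ⟨I, u, hI, hIU⟩ := isOpen_pi_iff.1 hU θ₁ (by
    have : (⟨θ₁, hθ₁⟩ : X) ∈ Subtype.val ⁻¹' U := hUX ▸ hinter
    exact this)
  set M := P.natAbs + i₀.natAbs + (∑ a ∈ I, a.natAbs) + 1
  have hMX : Mix V n θ₁ M ⊆ X := fun θ hθ => by
    refine ⟨fun j h1 h2 => (hθ.1 j (by omega) (by omega)).trans (hθ₁.1 j h1 h2), fun j hj => ?_⟩
    by_cases h : -(M : ℤ) ≤ j ∧ j < M
    · rw [hθ.1 j h.1 h.2]; exact hθ₁.2 j hj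
    · exact hθ.2 j (by omega)
  refine ⟨θ₁, M, i₀, by rw [Int.abs_eq_natAbs]; omega, hMX.trans (hmix θ₀ h0 P), fun θ hθ => ?_⟩
  have hmem : θ ∈ U := hIU fun a ha => by
    have h1 := Finset.single_le_sum (f := Int.natAbs) (fun _ _ => zero_le) ha
    have h2 := hdiv a (M - 1) (by rw [Int.abs_eq_natAbs]; omega)
    rw [eq_of_block hn (hθ.1 (a / n) (by omega) (by omega))]
    exact (hI a ha).2
  have hmax : ∀ j ∈ J, lam θ j ≤ lam θ i₀ := by
    have h1 : (⟨θ, hMX hθ⟩ : X) ∈ Subtype.val ⁻¹' U := hmem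
    rw [hUX] at h1
    exact interior_subset h1
  have h1 := hbig θ (hMX hθ)
  have h2 := hmax i₁ (hiJ θ (hMX hθ))
  refine ⟨by linarith, fun i => ?_⟩
  by_cases hi : i ∈ J
  · exact hmax i hi
  · linarith [hsmall θ (hMX hθ) i hi]

/-- The integer square root, on integers. -/
def isq (b : ℤ) : ℤ := Nat.sqrt b.toNat

lemma isq_spec {b : ℤ} (hb : 0 ≤ b) : 0 ≤ isq b ∧ isq b * isq b ≤ b ∧ b < (isq b + 1) * (isq b + 1) := by
  obtain ⟨b, rfl⟩ := Int.eq_ofNat_of_zero_le hb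
  simp only [isq, Int.toNat_natCast]
  exact ⟨by simp, by exact_mod_cast Nat.sqrt_le b, by exact_mod_cast Nat.lt_succ_sqrt b⟩

lemma isq_eq {b K : ℤ} (hK : 0 ≤ K) (h1 : K * K ≤ b) (h2 : b < (K + 1) * (K + 1)) : isq b = K := by
  obtain ⟨h3, h4, h5⟩ := isq_spec (b := b) (by nlinarith)
  have : isq b < K + 1 := by by_contra!; nlinarith
  have : K < isq b + 1 := by by_contra!; nlinarith
  omega

/-- The one-sided sequence exhibiting longer and longer central segments of `θ`. -/
def spread (n : ℕ) (θ : ℤ → ℕ) (x : ℕ) : ℕ :=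
  θ (x - n * (isq (x / n) * isq (x / n) + isq (x / n)))

lemma extz_spread {n : ℕ} {θ : ℤ → ℕ} {x : ℤ} (hx : 0 ≤ x) : extz (spread n θ) x =
    θ (x - n * (isq (x / n) * isq (x / n) + isq (x / n))) := by
  rw [extz, spread, Int.toNat_of_nonneg hx]

lemma lam_mem_lagrangeSpectrum {V : Finset (List ℕ)} {n M : ℕ} {c : ℝ} {θ : ℤ → ℕ} {i₀ : ℤ}
    (hn : n ≠ 0) (hV : ∀ θ ∈ AL V n, ∀ i, lam θ i ≤ c)
    (hθ : ∀ j : ℤ, j < -M ∨ M ≤ j → block θ (n * j) n ∈ V) (hmax : ∀ i, lam θ i ≤ lam θ i₀)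
    (hc : c ≤ lam θ i₀) (h2 : 2 ≤ lam θ i₀) : lam θ i₀ ∈ LagrangeSpectrum := by
  have hn' : (0 : ℤ) < n := by omega
  have key := lagrangeVal_eq (f := spread n θ) h2 (fun ε hε => ?_) (fun ε hε => ?_)
  · exact ⟨cf (spread n θ), irrational_cf _, by rw [key]; exact ENNReal.ofReal_ne_top,
      by rw [key, ENNReal.toReal_ofReal (by linarith)]⟩
  · obtain ⟨ρ₁, h1⟩ := exists_lam_local hε
    obtain ⟨ρ₂, h2⟩ := exists_lam_near hn hV hε
    set ρ : ℕ := max ρ₁ ρ₂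
    have hρ₁ : ρ₁ ≤ ρ := le_max_left _ _
    have hρ₂ : ρ₂ ≤ ρ := le_max_right _ _
    set K : ℤ := M + 2 * ρ + 1
    filter_upwards [eventually_ge_atTop (n * (K * K + ρ + ρ).toNat)] with x hx
    set q : ℤ := (x : ℤ) / n
    have hq : K * K + ρ + ρ ≤ q := by
      rw [Int.le_ediv_iff_mul_le hn', mul_comm]
      calc (n : ℤ) * (K * K + ρ + ρ) ≤ n * ((K * K + ρ + ρ).toNat : ℤ) := by
            gcongr; exact Int.self_le_toNat _
        _ ≤ x := by exact_mod_cast hx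
    have hρ0 : (0 : ℤ) ≤ ρ := by positivity
    by_cases hsame : ∀ b, |b - q| ≤ ρ → isq b = isq q
    · refine (h1 _ θ x (x - n * (isq q * isq q + isq q)) fun y hy => ?_).trans
        (by linarith [hmax (x - n * (isq q * isq q + isq q))])
      have hb := abs_ediv_add_sub_le hn x y
      have h3 : 0 ≤ (x : ℤ) + y := by
        have := abs_le.1 hy
        have := Int.mul_ediv_add_emod x n
        have := Int.emod_nonneg x hn'.ne'
        nlinarith
      rw [extz_spread h3, hsame _ (hb.trans (by omega))]
      congr 1; ring
    · refine (h2 _ _ fun b hb => ?_).trans (by linarith)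
      have hbq := abs_le.1 hb
      have hK0 : 0 ≤ K * K := mul_self_nonneg K
      obtain ⟨b', hb', hne⟩ : ∃ b', |b' - q| ≤ ρ ∧ isq b' ≠ isq b := by
        push Not at hsame
        obtain ⟨b', h3, h4⟩ := hsame
        by_cases h5 : isq b = isq q
        · exact ⟨b', h3, h5 ▸ h4⟩
        · exact ⟨q, by simp, fun h => h5 h.symm⟩
      have hbq' := abs_le.1 hb'
      obtain ⟨h3, h4, h5⟩ := isq_spec (b := b) (by omega)
      obtain ⟨h6, h7, h8⟩ := isq_spec (b := b') (by omega)
      have h9 : K ≤ isq b := by by_contra!; nlinarith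
      have h10 : block (extz (spread n θ)) (n * b) n =
          block θ (n * (b - (isq b * isq b + isq b))) n := by
        refine block_eq_iff.2 fun k hk => ?_
        have hd : ((n : ℤ) * b + k) / n = b := by
          rw [Int.mul_add_ediv_left _ _ hn'.ne', Int.ediv_eq_zero_of_lt (by omega) (by omega),
            add_zero]
        rw [extz_spread (add_nonneg (mul_nonneg hn'.le (by omega)) (by omega)), hd]
        congr 1; ring
      rw [h10]
      refine hθ _ ?_
      rcases lt_or_gt_of_ne hne with h | h
      · have := mul_self_le_mul_self (by omega) (show isq b' + 1 ≤ isq b by omega)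
        left; linarith
      · have := mul_self_le_mul_self (by omega) (show isq b + 1 ≤ isq b' by omega)
        right; linarith
  · obtain ⟨ρ, h1⟩ := exists_lam_local hε
    refine frequently_atTop.2 fun a => ?_
    set N : ℤ := |i₀| + ρ + a + 1
    have hi := abs_le.1 (le_refl |i₀|)
    have hN : 1 ≤ N := by have := abs_nonneg i₀; omega
    have h0 : 0 ≤ i₀ + n * (N * N + N) - ρ - a := by nlinarith
    refine ⟨(i₀ + n * (N * N + N)).toNat, by omega, ?_⟩
    have := h1 θ (extz (spread n θ)) i₀ ((i₀ + n * (N * N + N)).toNat : ℕ) fun y hy => ?_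
    · linarith
    have hy' := abs_le.1 hy
    rw [Int.toNat_of_nonneg (by omega), extz_spread (by omega)]
    have hd : (i₀ + n * (N * N + N) + y) / n = (i₀ + y) / n + (N * N + N) := by
      rw [show i₀ + n * (N * N + N) + y = i₀ + y + n * (N * N + N) by ring,
        Int.add_mul_ediv_left _ _ hn'.ne']
    have h3 := abs_ediv_add_sub_le hn 0 (i₀ + y)
    rw [zero_add, Int.zero_ediv, sub_zero] at h3
    have h4 := abs_le.1 (h3.trans (abs_add_le _ _))
    rw [hd, isq_eq (K := N) (by omega) (by nlinarith) (by nlinarith)]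
    congr 1; ring

lemma lt_of_mem_KS {V : Finset (List ℕ)} {n T : ℕ} (hn : n ≠ 0) (hT : ∀ v ∈ V, ∀ z ∈ v, z < T)
    {f : ℕ → ℕ} (hf : f ∈ KS V n) (x : ℕ) : f x < T :=
  hT _ (hf (x / n)) _ (mem_pre.2 ⟨x % n, Nat.mod_lt _ (Nat.pos_of_ne_zero hn), by
    rw [shf, mul_comm, Nat.div_add_mod]⟩)

lemma two_le_colC (T : ℕ) {C : ℝ} (hC : 2 ≤ C) : 2 ≤ colC T C := by
  have h1 : sepC T ≤ 1 := by
    rw [sepC, div_le_one (by positivity)]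
    have : (1 : ℝ) ≤ (T + 1) ^ 3 := one_le_pow₀ (by linarith [Nat.cast_nonneg (α := ℝ) T])
    linarith
  have h2 : (2 : ℝ) ^ 4 ≤ C ^ 4 := by gcongr
  rw [colC, le_div_iff₀ (sepC_pos T)]
  linarith

lemma Side.le_log_card {T : ℕ} {B : Set (List ℕ)} {C Q Γ : ℝ} {V : Finset (List ℕ)}
    {p : List ℕ → ℝ} (h : Side T B C Q Γ V p) : gain T C Q (Γ * Γ) ≤ 2 * Real.log V.card := by
  have hQ := h.one_le
  have hΓ := h.one_le_energy
  have hV : (0 : ℝ) < V.card := by exact_mod_cast h.nonempty.card_pos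
  have h1 : Q / 2 * ∑ a ∈ V, p a ^ 2 ≤ Γ := by
    rw [Finset.mul_sum]
    refine le_trans (Finset.sum_le_sum fun a ha => ?_) h.energy
    refine le_trans ?_ (Finset.single_le_sum (fun b hb => ?_) ha)
    · have : lcp a a = a := by simp [lcp_self]
      rw [this]
      nlinarith [h.ge a ha, sq_nonneg (p a)]
    · exact mul_nonneg (mul_nonneg (h.pos a ha).le (h.pos b hb).le) (qd_pos _).le
  have h2 : (1 : ℝ) ≤ V.card * ∑ a ∈ V, p a ^ 2 := by
    have := sq_sum_le_card_mul_sum_sq (s := V) (f := p)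
    rwa [h.sum, one_pow] at this
  have h3 : Q / (2 * Γ) ≤ V.card := by
    rw [div_le_iff₀ (by positivity)]
    nlinarith
  have h4 := Real.log_le_log (by positivity) h3
  have hc := two_le_colC T h.two_le
  have h5 := Real.log_le_log two_pos hc
  rw [Real.log_div (by positivity) (by positivity), Real.log_mul two_ne_zero (by positivity)] at h4
  rw [gain, Real.log_mul (by positivity) (by positivity), Real.log_div (by positivity) (by positivity),
    Real.log_pow, Real.log_mul (by positivity) (by positivity)]
  push_cast
  linarith

/-- The dimension of the Cantor set of continued fractions spelled with the words of `V`. -/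
theorem le_dimH_KS {T n : ℕ} {V : Finset (List ℕ)} {s σ : ℝ} (hl : ∀ v ∈ V, v.length = n)
    (he : Even n) (hn : n ≠ 0) (hT : ∀ v ∈ V, ∀ z ∈ v, z < T) (hσ : σ ≤ 1 / 2)
    (hZ : 1 ≤ ∑ v ∈ V, wt σ v) (hs : 0 < s) (hss : s < σ) {E : Set ℝ}
    (hE : ∀ f ∈ KS V n, cf f ∈ E) : ENNReal.ofReal s ≤ dimH E := by
  obtain ⟨C, Q, Γ, W, p, -, -, hW, -, hgain⟩ := exists_sides hl he hn hT hσ hZ hs.le hss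
  have hQ := hW.one_le
  have hC := hW.two_le
  have hcard := hgain.trans hW.le_log_card
  have hlog : Real.log (2 * Q) ≤ Real.log (2 * C * Q) :=
    Real.log_le_log (by linarith) (by nlinarith)
  have hlQ : 0 < Real.log (2 * Q) := Real.log_pos (by linarith)
  have hlW : 0 < Real.log W.card := by nlinarith
  have hM : 1 < W.card := by
    by_contra! hcon
    exact absurd hlW (Real.log_nonpos (by positivity) (by exact_mod_cast hcon)).not_gt
  have hpos : ∀ a ∈ W, 1 ≤ a.length := fun a ha => by
    rw [Nat.one_le_iff_ne_zero]
    intro h0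
    obtain ⟨b, hb, hba⟩ := Finset.exists_mem_ne hM a
    have := hW.len b hb a ha
    exact hba (by rw [List.length_eq_zero_iff.1 h0, List.length_eq_zero_iff.1 (this.trans h0)])
  set e := W.equivFin.symm
  set U : (ℕ → Fin W.card) → ℕ → List ℕ := fun ω i => Nat.rec [] (fun i u => u ++ (e (ω i)).1) i with hU
  have hUs : ∀ ω i, U ω (i + 1) = U ω i ++ (e (ω i)).1 := fun ω i => rfl
  have hinv : ∀ ω i, Conc (V : Set (List ℕ)) (U ω i) ∧ qd (U ω i) ≤ (2 * Q) ^ i ∧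
      i ≤ (U ω i).length := fun ω i => by
    induction i with
    | zero => exact ⟨Conc.nil _, by simp [hU], by simp⟩
    | succ i ih =>
      obtain ⟨h1, h2, h3⟩ := ih
      rw [hUs]
      refine ⟨h1.append (hW.conc _ (e (ω i)).2), ?_, ?_⟩
      · have := mul_le_mul h2 (hW.le _ (e (ω i)).2) (qd_pos _).le (by positivity)
        rw [pow_succ]
        linarith [qd_append_le (U ω i) (e (ω i)).1]
      · have := hpos _ (e (ω i)).2
        rw [List.length_append]
        omega
  have hX : ∀ ω, ∃ f : ℕ → ℕ, ∀ i, pre f (U ω i).length = U ω i := fun ω =>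
    exists_stream (fun i => by rw [hUs]; exact List.prefix_append _ _) fun i => (hinv ω i).2.2
  choose X hX using hX
  have hK : ∀ ω, X ω ∈ KS V n := fun ω => mem_KS_of_conc hn hl fun i =>
    ⟨_, (hinv ω i).2.2, by rw [hX]; exact (hinv ω i).1⟩
  have hphi : ∀ ω i, ∃ x ∈ tailIcc T, cf (X ω) = phi (U ω i) (phi (e (ω i)).1 x) := fun ω i =>
    ⟨cf (shf (U ω (i + 1)).length (X ω)), cf_mem_tailIcc fun j => lt_of_mem_KS hn hT (hK ω) _, by
      rw [← phi_append, ← hUs, cf_eq_phi _ (U ω (i + 1)).length, hX ω (i + 1)]⟩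
  refine le_dimH_of_tree hM (fun ω => cf (X ω)) (c := sepC T / Q ^ 2 / 4) (r := 1 / (2 * Q) ^ 2)
    (by have := sepC_pos T; positivity) (by positivity) (fun ω => hE _ (hK ω)) ?_ hs ?_
  · intro ω ω' i hi hne
    have hUU : U ω' i = U ω i := by
      clear hne
      induction i with
      | zero => rfl
      | succ i ih => rw [hUs, hUs, ih fun j hj => hi j (by omega), hi i (by omega)]
    obtain ⟨x, hx, ex⟩ := hphi ω i
    obtain ⟨y, hy, ey⟩ := hphi ω' i
    have hd := fun a (ha : a ∈ W) => (hW.conc a ha).forall_lt hW.lt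
    have hsep := lcp_sep (hW.len _ (e (ω i)).2 _ (e (ω' i)).2)
      (fun h => hne (e.injective (Subtype.ext h))) (hd _ (e (ω i)).2) (hd _ (e (ω' i)).2) hx hy
    have h0 := (qd_lcp_le (e (ω i)).1 (e (ω' i)).1).trans (hW.le _ (e (ω i)).2)
    rw [ex, ey, hUU]
    refine le_trans ?_ (le_abs_phi_sub _ (phi_mem _ (tailIcc_subset T hx))
      (phi_mem _ (tailIcc_subset T hy)))
    have h1 := (hinv ω i).2.1
    have h2 := qd_pos (U ω i)
    have h3 := qd_pos (lcp (e (ω i)).1 (e (ω' i)).1)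
    have h4 := (sepC_pos T).le
    calc sepC T / Q ^ 2 / 4 * (1 / (2 * Q) ^ 2) ^ i
        = sepC T / Q ^ 2 / (4 * ((2 * Q) ^ i) ^ 2) := by
          rw [div_pow, one_pow, ← pow_mul, ← pow_mul, mul_comm i]; field_simp
      _ ≤ sepC T / qd (lcp (e (ω i)).1 (e (ω' i)).1) ^ 2 / (4 * qd (U ω i) ^ 2) := by gcongr
      _ ≤ _ := by gcongr
  · have hM0 : (0 : ℝ) < W.card := by positivity
    rw [← Real.log_nonneg_iff (by positivity), Real.log_mul (by positivity) (by positivity),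
      Real.log_rpow (by positivity), Real.log_div one_ne_zero (by positivity), Real.log_one,
      Real.log_pow]
    push_cast
    nlinarith

lemma phi_eq_psi (w : List ℕ) {x : ℝ} (hx : 0 ≤ x) :
    phi w x = phi w 0 + (-1) ^ w.length / qd w ^ 2 * psi (qe w / qd w) x := by
  have h1 := qd_pos w
  have h2 := den_pos w hx
  have h3 := phi_sub w hx le_rfl
  rw [psi, show 1 + qe w / qd w * x = (qe w * x + qd w) / qd w by field_simp; ring,
    sub_eq_iff_eq_add'.1 h3, mul_zero, zero_add, sub_zero]
  field_simp

lemma two_le_of_AL {V : Finset (List ℕ)} {n : ℕ} {c : ℝ} (hl : ∀ v ∈ V, v.length = n)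
    (hV2 : 1 < V.card) (hV : ∀ θ ∈ AL V n, ∀ i, lam θ i ≤ c) : 2 ≤ c := by
  obtain ⟨v, hv, z, hz, hz0⟩ : ∃ v ∈ V, ∃ z ∈ v, z ≠ 0 := by
    by_contra! h
    obtain ⟨a, ha, b, hb, hab⟩ := Finset.one_lt_card.1 hV2
    have h0 := fun v hv => List.eq_replicate_iff.2 ⟨hl v hv, h v hv⟩
    exact hab ((h0 a ha).trans (h0 b hb).symm)
  have hθ : ∀ j, block (bld n fun _ => v) (n * j) n = v := fun j => block_bld (hl v hv)
  have h1 := hθ 0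
  rw [← h1, mem_block] at hz
  obtain ⟨j, -, rfl⟩ := hz
  have h2 := hV (bld n fun _ => v) (fun j => by rwa [hθ]) (n * 0 + j)
  have h3 := lt_lam (bld n fun _ => v) (n * 0 + j)
  have h4 : (1 : ℝ) ≤ bld n (fun _ => v) (n * 0 + j) := by
    exact_mod_cast Nat.one_le_iff_ne_zero.2 hz0
  linarith

lemma lagrangeVal_lt_of_mem_KS {V : Finset (List ℕ)} {n : ℕ} {c t : ℝ} (hn : n ≠ 0) (hc : 2 ≤ c)
    (hV : ∀ θ ∈ AL V n, ∀ i, lam θ i ≤ c) (hct : c < t) {f : ℕ → ℕ} (hf : f ∈ KS V n) :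
    lagrangeVal (cf f) < ENNReal.ofReal t := by
  obtain ⟨ρ, hρ⟩ := exists_lam_near hn hV (show 0 < (t - c) / 3 by linarith)
  refine (lagrangeVal_le (c := c + 2 * ((t - c) / 3)) (by linarith) ?_).trans_lt
    ((ENNReal.ofReal_lt_ofReal_iff (by linarith)).2 (by linarith))
  filter_upwards [eventually_ge_atTop (n * ρ), tendsto_one_div_four_pow.eventually_lt_const
    (show 0 < (t - c) / 3 by linarith)] with i hi h2
  have h3 := hρ (extz f) i fun j hj => by
    have h4 : (ρ : ℤ) ≤ (i : ℤ) / n := by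
      rw [Int.le_ediv_iff_mul_le (by omega), mul_comm]; exact_mod_cast hi
    obtain ⟨j, rfl⟩ := Int.eq_ofNat_of_zero_le (a := j) (by have := abs_le.1 hj; omega)
    convert hf j using 1
    refine pre_congr fun k _ => ?_
    simp only [rt, extz, shf]
    congr 1
    rw [mul_comm j]
    omega
  have := (abs_le.1 (abs_val_sub_lam f i)).2
  linarith

/-- The sequence with centre `θ` and sides spelled by `f` (right) and `g` (left). -/
def glue (n M : ℕ) (θ : ℤ → ℕ) (f g : ℕ → ℕ) (x : ℤ) : ℕ :=
  if n * M ≤ x then f (x - n * M).toNat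
  else if x < -(n * M) then g (-(n * M) - 1 - x).toNat else θ x

lemma glue_mem_Mix {n M : ℕ} {V : Finset (List ℕ)} {θ : ℤ → ℕ} {f g : ℕ → ℕ} (hf : f ∈ KS V n)
    (hg : g ∈ KS (V.image List.reverse) n) : glue n M θ f g ∈ Mix V n θ M := by
  have hb : ∀ {a b : ℤ} {k : ℕ}, k < n → (a ≤ b → (n : ℤ) * a ≤ n * b) ∧
      (a < b → (n : ℤ) * a + k < n * b) := fun {a b k} hk =>
    ⟨fun h => by gcongr, fun h => by have : (n : ℤ) * (a + 1) ≤ n * b := by gcongr; omega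
                                     rw [mul_add] at this; omega⟩
  refine ⟨fun j h1 h2 => block_eq_iff.2 fun k hk => ?_, fun j hj => ?_⟩
  · have h3 := (hb (a := j) hk).2 h2
    have h4 := (hb hk).1 h1
    rw [mul_neg] at h4
    rw [glue, if_neg (by omega), if_neg (by omega)]
  · rcases hj with hj | hj
    · obtain ⟨i, hi⟩ := Int.eq_ofNat_of_zero_le (a := -M - 1 - j) (by omega)
      obtain ⟨v, hv, hvr⟩ := Finset.mem_image.1 (hg i)
      have h1 : pre (lf (glue n M θ f g) (n * j + n)) n = pre (shf (i * n) g) n :=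
        pre_congr fun k hk => by
          have h5 : (n : ℤ) * j + n - 1 - k = -(n * M) - 1 - (i * n + k : ℕ) := by
            push_cast; rw [← hi]; ring
          have h6 : (n : ℤ) * M ≥ 0 := by positivity
          rw [lf, h5, glue, if_neg (by omega), if_pos (by omega), shf]
          congr 1
          omega
      rw [pre_lf, ← hvr, add_sub_cancel_right] at h1
      rwa [List.reverse_injective h1]
    · obtain ⟨i, hi⟩ := Int.eq_ofNat_of_zero_le (a := j - M) (by omega)
      convert hf i using 1
      refine pre_congr fun k hk => ?_
      have h5 : (n : ℤ) * j + k = n * M + (i * n + k : ℕ) := by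
        push_cast; rw [← hi]; ring
      rw [rt, h5, glue, if_pos (by omega), shf]
      congr 1
      omega

lemma exists_lam_glue {n M : ℕ} {θ : ℤ → ℕ} {i : ℤ} (hn : n ≠ 0) (hi : |i| < M) :
    ∃ A : ℝ, ∃ u v : List ℕ, ∀ f g, lam (glue n M θ f g) i = A + phi u (cf f) + phi v (cf g) := by
  have hM : (M : ℤ) ≤ n * M := le_mul_of_one_le_left (by positivity) (by omega)
  have hi' := abs_lt.1 hi
  obtain ⟨p, hp⟩ := Int.eq_ofNat_of_zero_le (a := n * M - i - 1) (by omega)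
  obtain ⟨q, hq⟩ := Int.eq_ofNat_of_zero_le (a := n * M + i) (by omega)
  refine ⟨θ i + 1, pre (rt θ (i + 1)) p, pre (lf θ i) q, fun f g => ?_⟩
  have hmid : ∀ x, -(n * M : ℤ) ≤ x → x < n * M → glue n M θ f g x = θ x := fun x h1 h2 => by
    rw [glue, if_neg (by omega), if_neg (by omega)]
  have h1 : pre (rt (glue n M θ f g) (i + 1)) p = pre (rt θ (i + 1)) p :=
    pre_congr fun j hj => hmid (i + 1 + j) (by omega) (by omega)
  have h2 : pre (lf (glue n M θ f g) i) q = pre (lf θ i) q :=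
    pre_congr fun j hj => hmid (i - 1 - j) (by omega) (by omega)
  have h3 : shf p (rt (glue n M θ f g) (i + 1)) = f := by
    ext j
    rw [shf, rt, glue, if_pos (by omega)]
    congr 1; omega
  have h4 : shf q (lf (glue n M θ f g) i) = g := by
    ext j
    rw [shf, lf, glue, if_neg (by omega), if_pos (by omega)]
    congr 1; omega
  rw [lam, cf_eq_phi (rt _ _) p, cf_eq_phi (lf _ _) q, hmid i (by omega) (by omega), h1, h2, h3, h4]

/-- **Lower bounds for both dimensions**, strictly below the threshold. -/
theorem exists_le_dimH {t s s' : ℝ} (hs : 0 < s) (h2 : s < 1 / 2) (hss : s < s')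
    (hnt : ¬Subcrit t s') : ∃ t' < t, ENNReal.ofReal s ≤ lagrangeDim t' ∧
      ENNReal.ofReal (2 * s) ≤ dimH (LagrangeSpectrum ∩ Iio t') := by
  obtain ⟨σ, hσ, hσ'⟩ := exists_between (lt_min hss h2)
  obtain ⟨T, n, V, hn, he, hl, hT, hZ, 𝒜, m, hmt, h𝒜, hm, hmix, δ, hδ, hV⟩ :=
    exists_two_level (hs.trans hσ) (hσ'.trans_le (min_le_left _ _)) hnt
  have hσ2 := (hσ'.trans_le (min_le_right _ _)).le
  have hcard : 1 < V.card := by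
    by_contra! hcon
    have h1 := Finset.sum_le_card_nsmul V (wt σ) 1 fun b _ => wt_le_one (by linarith) b
    rw [nsmul_one] at h1
    have : (V.card : ℝ) ≤ 1 := by exact_mod_cast hcon
    linarith
  have hc := two_le_of_AL hl hcard hV
  refine ⟨(m + t) / 2, by linarith, ?_, ?_⟩
  · exact le_dimH_KS hl he hn hT hσ2 hZ.le hs hσ fun f hf =>
      ⟨irrational_cf f, lagrangeVal_lt_of_mem_KS hn hc hV (by linarith) hf⟩
  obtain ⟨a, ha, b, hb, hab⟩ := Finset.one_lt_card.1 hcard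
  obtain ⟨θ, M, i, hi, hM𝒜, hM⟩ := exists_center hn hl ⟨a, ha⟩ h𝒜 hm
    (fun θ₀ h0 P θ hθ => hmix θ₀ h0 P θ hθ.1 hθ.2) hδ hV
  obtain ⟨A, u, v, huv⟩ := exists_lam_glue (θ := θ) hn hi
  have hu := qd_pos u
  have hv := qd_pos v
  have hk : ∀ w, qe w / qd w ∈ Icc (0 : ℝ) 1 := fun w =>
    ⟨div_nonneg (qe_nonneg w) (qd_pos w).le, div_le_one_of_le₀ (qe_le_qd w) (qd_pos w).le⟩
  set c : ℝ := (-1) ^ u.length / qd u ^ 2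
  set F : ℝ → ℝ := fun y => A + phi u 0 + phi v 0 + c * y
  have hc0 : c ≠ 0 := by positivity
  have hF : AntilipschitzWith ‖c‖₊⁻¹ F := AntilipschitzWith.of_le_mul_dist fun x y => by
    rw [Real.dist_eq, Real.dist_eq, show F x - F y = c * (x - y) by simp only [F]; ring, abs_mul]
    simp [abs_pos.2 hc0 |>.ne']
  have key := le_dimH_PP (E := F ⁻¹' (LagrangeSpectrum ∩ Iio ((m + t) / 2)))
    (σ := Real.log (qd u ^ 2 / qd v ^ 2)) (r := (-1) ^ (u.length + v.length)) hl he hn hT hσ2 hZ.le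
    hs hσ ha hb hab (hk u) (hk v) (by simp) fun f hf g hg => ?_
  · exact key.trans ((hF.le_dimH_image _).trans (dimH_mono (image_preimage_subset _ _)))
  · have hmixθ := glue_mem_Mix (M := M) (θ := θ) hf hg
    obtain ⟨h3, h4⟩ := hM _ hmixθ
    have h5 := lam_mem_lagrangeSpectrum hn hV hmixθ.2 h4 h3 (hc.trans h3)
    have h6 := (h𝒜 _ (hM𝒜 hmixθ)).2 i
    have h7 : F (PP (qe u / qd u) (qe v / qd v) ((-1) ^ (u.length + v.length) *
        Real.exp (Real.log (qd u ^ 2 / qd v ^ 2))) (cf f) (cf g)) = lam (glue n M θ f g) i := by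
      rw [huv, phi_eq_psi u (cf_mem f).1, phi_eq_psi v (cf_mem g).1, Real.exp_log (by positivity)]
      have h8 : (-1 : ℝ) ^ u.length * (-1) ^ u.length = 1 := by rw [← mul_pow]; simp
      simp only [F, PP, c, pow_add]
      field_simp
      linear_combination psi (qe v / qd v) (cf g) * (-1) ^ v.length * qd u ^ 2 * h8
    rw [mem_preimage, h7]
    exact ⟨h5, by rw [mem_Iio]; linarith⟩

lemma subcrit_of_le {t y : ℝ} {c : ℝ≥0∞} (hy : y ≤ 1)
    (h : ∀ t' < t, dimH (LagrangeSpectrum ∩ Iio t') ≤ c ∨ 2 * lagrangeDim t' ≤ c)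
    (hc : c < ENNReal.ofReal y) : Subcrit t (y / 2) := by
  by_contra hnt
  obtain ⟨z, -, hcz, hzy⟩ := ENNReal.lt_iff_exists_real_btwn.1 hc
  have hz0 : 0 < z := ENNReal.ofReal_pos.1 (pos_of_gt hcz)
  have hzy' := (ENNReal.ofReal_lt_ofReal_iff'.1 hzy).1
  obtain ⟨t', ht', h1, h2⟩ :=
    exists_le_dimH (half_pos hz0) (by linarith) (by linarith : z / 2 < y / 2) hnt
  rw [mul_div_cancel₀ z two_ne_zero] at h2
  rcases h t' ht' with h3 | h3
  · exact (h2.trans h3).not_gt hcz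
  · have h4 : ENNReal.ofReal z = 2 * ENNReal.ofReal (z / 2) := by
      rw [← ENNReal.ofReal_ofNat 2, ← ENNReal.ofReal_mul two_pos.le,
        mul_div_cancel₀ z two_ne_zero]
    exact (h4.le.trans ((mul_le_mul_right h1 2).trans h3)).not_gt hcz

lemma dimH_real_le_one (s : Set ℝ) : dimH s ≤ 1 :=
  (dimH_mono (subset_univ s)).trans Real.dimH_univ.le

lemma dimH_markov_mono {t t' : ℝ} (h : t ≤ t') :
    dimH (MarkovSpectrum ∩ Iio t) ≤ dimH (MarkovSpectrum ∩ Iio t') :=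
  dimH_mono (inter_subset_inter_right _ (Iio_subset_Iio h))

lemma dimH_lagrange_le (t : ℝ) :
    dimH (LagrangeSpectrum ∩ Iio t) ≤ dimH (MarkovSpectrum ∩ Iio t) :=
  dimH_mono (inter_subset_inter_left _ lagrangeSpectrum_subset_markovSpectrum)

lemma lagrangeDim_mono {t t' : ℝ} (h : t ≤ t') : lagrangeDim t ≤ lagrangeDim t' :=
  dimH_mono fun _ hα => ⟨hα.1, hα.2.trans_le (ENNReal.ofReal_le_ofReal h)⟩

lemma dimH_markov_le_of_forall {t : ℝ} {c : ℝ≥0∞}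
    (h : ∀ t' < t, dimH (LagrangeSpectrum ∩ Iio t') ≤ c ∨ 2 * lagrangeDim t' ≤ c) :
    dimH (MarkovSpectrum ∩ Iio t) ≤ c := by
  by_contra! hlt
  obtain ⟨y, -, hcy, hy⟩ := ENNReal.lt_iff_exists_real_btwn.1 hlt
  have hy1 : y ≤ 1 := ENNReal.ofReal_le_one.1 (hy.le.trans (dimH_real_le_one _))
  have hy0 : 0 < y := ENNReal.ofReal_pos.1 (pos_of_gt hcy)
  have := dimH_markov_le (half_pos hy0) (subcrit_of_le hy1 h hcy)
  rw [mul_div_cancel₀ y two_ne_zero] at this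
  exact this.not_gt hy

lemma dimH_markov_le_dimH_lagrange (t : ℝ) :
    dimH (MarkovSpectrum ∩ Iio t) ≤ dimH (LagrangeSpectrum ∩ Iio t) :=
  dimH_markov_le_of_forall fun _ ht => .inl
    (dimH_mono (inter_subset_inter_right _ (Iio_subset_Iio ht.le)))

lemma subcrit_of_dimH_lt {t y : ℝ} (hy : y ≤ 1)
    (h : dimH (MarkovSpectrum ∩ Iio t) < ENNReal.ofReal y) : Subcrit t (y / 2) :=
  subcrit_of_le hy (fun t' ht => .inl ((dimH_lagrange_le t').trans (dimH_markov_mono ht.le))) h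

lemma min_le_dimH_markov (t : ℝ) :
    min 1 (2 * lagrangeDim t) ≤ dimH (MarkovSpectrum ∩ Iio t) := by
  by_contra! hlt
  obtain ⟨y, hy0, hy, hy'⟩ := ENNReal.lt_iff_exists_real_btwn.1 hlt
  have hy1 := ENNReal.ofReal_le_one.1 (hy'.le.trans (min_le_left _ _))
  have hy0 : 0 < y := ENNReal.ofReal_pos.1 (pos_of_gt hy)
  have h1 := lagrangeDim_le (half_pos hy0) (subcrit_of_dimH_lt hy1 hy)
  refine (hy'.trans_le (min_le_right _ _)).not_ge ((mul_le_mul_right h1 2).trans ?_)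
  rw [← ENNReal.ofReal_ofNat 2, ← ENNReal.ofReal_mul two_pos.le, mul_div_cancel₀ y two_ne_zero]

lemma continuous_dimH_markov : Continuous fun t : ℝ => dimH (MarkovSpectrum ∩ Iio t) := by
  refine continuous_iff_continuousAt.2 fun t => tendsto_order.2 ⟨fun a ha => ?_, fun b hb => ?_⟩
  · obtain ⟨t', ht', h⟩ : ∃ t' < t, a < dimH (MarkovSpectrum ∩ Iio t') := by
      by_contra! hcon
      exact (dimH_markov_le_of_forall fun t' ht' => .inl
        ((dimH_lagrange_le t').trans (hcon t' ht'))).not_gt ha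
    exact (lt_mem_nhds ht').mono fun x hx => h.trans_le (dimH_markov_mono hx.le)
  · obtain ⟨y, -, hy, hyb⟩ := ENNReal.lt_iff_exists_real_btwn.1 hb
    rcases le_or_gt y 1 with hy1 | hy1
    · have hy0 : 0 < y := ENNReal.ofReal_pos.1 (pos_of_gt hy)
      obtain ⟨t', ht', h⟩ := (subcrit_of_dimH_lt hy1 hy).exists_gt
      have h1 := dimH_markov_le (half_pos hy0) h
      rw [mul_div_cancel₀ y two_ne_zero] at h1
      exact (gt_mem_nhds ht').mono fun x hx =>
        ((dimH_markov_mono hx.le).trans h1).trans_lt hyb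
    · exact .of_forall fun x => (dimH_real_le_one _).trans_lt
        ((ENNReal.one_lt_ofReal.2 hy1).trans hyb)

/-- **Moreira (2018)**: for all `t`, `dimH(L ∩ (-∞,t)) = dimH(M ∩ (-∞,t)) = min(1, 2 D(t))`;
moreover `t ↦ dimH(M ∩ (-∞,t))` is continuous, positive for `t > 3`, and equals `1` at
`t = √12`. -/
theorem moreira_dimension_across_spectra :
    (∀ t : ℝ,
      dimH (LagrangeSpectrum ∩ Set.Iio t) = dimH (MarkovSpectrum ∩ Set.Iio t) ∧
      dimH (MarkovSpectrum ∩ Set.Iio t) = min 1 (2 * lagrangeDim t)) ∧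
    Continuous (fun t : ℝ => dimH (MarkovSpectrum ∩ Set.Iio t)) ∧
    (∀ t : ℝ, 3 < t → 0 < dimH (MarkovSpectrum ∩ Set.Iio t)) ∧
    dimH (MarkovSpectrum ∩ Set.Iio (Real.sqrt 12)) = 1 := by
  refine ⟨fun t => ⟨(dimH_lagrange_le t).antisymm (dimH_markov_le_dimH_lagrange t),
    (le_min (dimH_real_le_one _) (dimH_markov_le_of_forall fun t' ht => .inr
      (mul_le_mul_right (lagrangeDim_mono ht.le) 2))).antisymm (min_le_dimH_markov t)⟩,
    continuous_dimH_markov, fun t ht => ?_, (dimH_real_le_one _).antisymm ?_⟩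
  · by_contra! hcon
    obtain ⟨s, hs, hnt⟩ := exists_not_subcrit ht
    refine hnt ((subcrit_of_dimH_lt (min_le_left 1 (2 * s)) (hcon.trans_lt ?_)).mono_right ?_)
    · exact ENNReal.ofReal_pos.2 (by positivity)
    · linarith [min_le_right 1 (2 * s)]
  · by_contra! hcon
    exact not_subcrit_sqrt_twelve (subcrit_of_dimH_lt le_rfl (by rwa [ENNReal.ofReal_one]))
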